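/- Let p = d be an even integer. Then there exist constants c_p ∈ (0,1), c'_p > 0 and C_p > 0 depending only on p, such that for every n ∈ ℕ and every degree-p homogeneous polynomial f : ℝ^n → ℝ with coeff_p(f) = 1 satisfying |⟨f, f_p⟩| ≤ c_p, where f_p(x) := n^{−1/2} Σ_{i=1}^n x_i^p and ⟨Σ a_I x^I, Σ b_I x^I⟩ := Σ_I a_I b_I is the coefficient inner product on degree-p homogeneous polynomials, one has Var_{μ_{n,p}}(f) ≥ c'_p and |∫_{ℝ^n} e^{itf(x)} dμ_{n,p}(x)| ≤ C_p |t|^{−1/p} for every t ≠ 0. -/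

import Mathlib

open MeasureTheory

noncomputable section

/-- Variance of a real function with respect to a measure. -/
def mVar {α : Type*} [MeasurableSpace α] (μ : Measure α) (f : α → ℝ) : ℝ :=
  (∫ x, f x ^ 2 ∂μ) - (∫ x, f x ∂μ) ^ 2

/-- `coeffNorm d f` is `coeff_d(f)`, the ℓ² norm of the coefficients of the degree-`d`
homogeneous part of `f`. -/
def coeffNorm {n : ℕ} (d : ℕ) (f : MvPolynomial (Fin n) ℝ) : ℝ :=
  Real.sqrt (∑ I ∈ f.support.filter (fun I => (I.sum fun _ e => e) = d),
    (MvPolynomial.coeff I f) ^ 2)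

/-- The isotropic radius `R_{n,p}`. -/
def Rnp (n : ℕ) (p : ℝ) : ℝ :=
  Real.sqrt ((((n : ℝ) + 2) / n) * (Real.Gamma (((n : ℝ) + 2) / p) / Real.Gamma ((n : ℝ) / p)) *
    (Real.Gamma (1 / p) / Real.Gamma (3 / p)))

/-- The isotropic `L^p` ball `B_{n,p}` in ℝ^n. -/
def lpBall (n : ℕ) (p : ℝ) : Set (Fin n → ℝ) :=
  {x | ∑ i, |x i| ^ p ≤ Rnp n p ^ p}

/-- `μ_{n,p}`, the uniform probability measure on the isotropic `L^p` ball. -/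
def muNP (n : ℕ) (p : ℝ) : Measure (Fin n → ℝ) :=
  (volume (lpBall n p))⁻¹ • volume.restrict (lpBall n p)

/-- The coefficient inner product on polynomials: `⟨Σ a_I x^I, Σ b_I x^I⟩ = Σ_I a_I b_I`. -/
def coeffInner {n : ℕ} (f g : MvPolynomial (Fin n) ℝ) : ℝ :=
  ∑ I ∈ f.support ∪ g.support, (MvPolynomial.coeff I f) * (MvPolynomial.coeff I g)

/-- The polynomial `f_p(x) = n^{-1/2} Σ_i x_i^p`. -/
def fP (n p : ℕ) : MvPolynomial (Fin n) ℝ :=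
  (Real.sqrt n)⁻¹ • ∑ i : Fin n, (MvPolynomial.X i) ^ p

namespace LpBallDecay

open ProbabilityTheory Set Filter Topology
open scoped ENNReal NNReal

/-- Uniform measure on the unit interval. -/
def unif : Measure ℝ := volume.restrict (Icc (0 : ℝ) 1)

instance : IsProbabilityMeasure unif := ⟨by simp [unif]⟩

lemma continuous_cdf (m : Measure ℝ) [IsProbabilityMeasure m] [NullSingletonClass m] :
    Continuous (cdf m) := by
  rw [continuous_iff_continuousAt]
  intro a
  rw [(monotone_cdf m).continuousAt_iff_leftLim_eq_rightLim, StieltjesFunction.rightLim_eq]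
  have h := (cdf m).measure_singleton a
  rw [measure_cdf, measure_singleton] at h
  have h2 := ENNReal.ofReal_eq_zero.1 h.symm
  have h3 := (monotone_cdf m).leftLim_le (le_refl a)
  linarith

lemma measure_cdf_le_of_mem_Ioo
    (m : Measure ℝ) [IsProbabilityMeasure m] [NullSingletonClass m] {y : ℝ}
    (h0 : 0 < y) (h1 : y < 1) : m {z | cdf m z ≤ y} = ENNReal.ofReal y := by
  have hc := continuous_cdf m
  have hne : {z | cdf m z ≤ y}.Nonempty := by
    obtain ⟨z, hz⟩ := ((tendsto_cdf_atBot m).eventually (eventually_lt_nhds h0)).exists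
    exact ⟨z, hz.le⟩
  obtain ⟨u, hu⟩ := ((tendsto_cdf_atTop m).eventually (eventually_gt_nhds h1)).exists
  have hbd : BddAbove {z | cdf m z ≤ y} := by
    refine ⟨u, fun z hz => ?_⟩
    by_contra! hlt
    have := monotone_cdf m hlt.le
    simp only [mem_ofPred_eq] at hz
    linarith
  have hcl : IsClosed {z | cdf m z ≤ y} := isClosed_le hc continuous_const
  set w := sSup {z | cdf m z ≤ y} with hw
  have hwm : cdf m w ≤ y := hcl.csSup_mem hne hbd
  have heq : {z | cdf m z ≤ y} = Iic w := by
    ext z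
    exact ⟨fun hz => le_csSup hbd hz, fun hz => (monotone_cdf m hz).trans hwm⟩
  have hwy : cdf m w = y := by
    refine le_antisymm hwm ?_
    by_contra! hlt
    have hev : ∀ᶠ z in 𝓝 w, cdf m z < y := hc.continuousAt.eventually (eventually_lt_nhds hlt)
    obtain ⟨z, hz1, hz2⟩ := ((hev.filter_mono nhdsWithin_le_nhds).and
      (self_mem_nhdsWithin (a := w) (s := Ioi w))).exists
    exact absurd (le_csSup hbd (show z ∈ {z | cdf m z ≤ y} from hz1.le)) (not_le.2 hz2)
  rw [heq, ← hwy, ofReal_cdf]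

lemma map_cdf_eq_unif (m : Measure ℝ) [IsProbabilityMeasure m] [NullSingletonClass m] :
    m.map (cdf m) = unif := by
  have hmeas : Measurable (cdf m) := (continuous_cdf m).measurable
  have : IsProbabilityMeasure (m.map (cdf m)) := Measure.isProbabilityMeasure_map hmeas.aemeasurable
  refine Measure.ext_of_Iic _ _ fun y => ?_
  rw [Measure.map_apply hmeas measurableSet_Iic]
  have hset : (cdf m) ⁻¹' Iic y = {z | cdf m z ≤ y} := rfl
  rw [hset, unif, Measure.restrict_apply measurableSet_Iic]
  rcases lt_trichotomy y 0 with hy | hy | hy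
  · have h1 : {z | cdf m z ≤ y} = ∅ := by
      ext z; simp only [mem_ofPred_eq, mem_empty_iff_false, iff_false, not_le]
      exact hy.trans_le (cdf_nonneg m z)
    have h2 : Iic y ∩ Icc (0 : ℝ) 1 = ∅ := by
      ext z; simp only [mem_inter_iff, mem_Iic, mem_Icc, mem_empty_iff_false, iff_false]
      intro h; linarith [h.1, h.2.1]
    rw [h1, h2]; simp
  · subst hy
    have h2 : Iic (0 : ℝ) ∩ Icc (0 : ℝ) 1 ⊆ {0} := by
      intro z hz; simp only [mem_inter_iff, mem_Iic, mem_Icc] at hz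
      exact le_antisymm hz.1 hz.2.1
    rw [measure_mono_null h2 (by simp)]
    refine le_antisymm (ENNReal.le_of_forall_pos_le_add fun ε hε _ => ?_) bot_le
    have hm : 0 < min (ε : ℝ) (1 / 2) := by positivity
    calc m {z | cdf m z ≤ 0} ≤ m {z | cdf m z ≤ min (ε : ℝ) (1 / 2)} :=
          measure_mono fun z hz => le_trans hz hm.le
      _ = ENNReal.ofReal (min (ε : ℝ) (1 / 2)) :=
          measure_cdf_le_of_mem_Ioo m hm ((min_le_right _ _).trans_lt (by norm_num))
      _ ≤ 0 + ε := by
          rw [zero_add]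
          exact (ENNReal.ofReal_le_ofReal (min_le_left _ _)).trans (by simp)
  · rcases lt_or_ge y 1 with h1 | h1
    · rw [measure_cdf_le_of_mem_Ioo m hy h1]
      have h2 : Iic y ∩ Icc (0 : ℝ) 1 = Icc 0 y := by
        ext z; simp only [mem_inter_iff, mem_Iic, mem_Icc]
        constructor
        · rintro ⟨a, b, c⟩; exact ⟨b, a⟩
        · rintro ⟨a, b⟩; exact ⟨b, a, by linarith⟩
      rw [h2]; simp
    · have h2 : Iic y ∩ Icc (0 : ℝ) 1 = Icc 0 1 := by
        ext z; simp only [mem_inter_iff, mem_Iic, mem_Icc]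
        constructor
        · rintro ⟨a, b, c⟩; exact ⟨b, c⟩
        · rintro ⟨a, b⟩; exact ⟨by linarith, a, b⟩
      have h3 : {z | cdf m z ≤ y} = univ := by
        ext z; simp only [mem_ofPred_eq, mem_univ, iff_true]
        exact (cdf_le_one m z).trans h1
      rw [h2, h3]; simp

lemma rpow_one_sub_le (a : ℝ≥0∞) {s : ℝ} (h0 : 0 ≤ s) (h1 : s < 1) :
    a ^ (1 - s) ≤ ENNReal.ofReal (1 - s) * a + ENNReal.ofReal s := by
  induction a with
  | top =>
    rw [ENNReal.mul_top (by simp; linarith)]; simp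
  | coe a =>
    rw [← ENNReal.coe_rpow_of_nonneg _ (by linarith), ENNReal.ofReal, ENNReal.ofReal]
    norm_cast
    have h := NNReal.geom_mean_le_arith_mean2_weighted (Real.toNNReal (1 - s)) (Real.toNNReal s) a 1
      (by rw [← Real.toNNReal_add (by linarith) h0]; simp)
    simpa [Real.coe_toNNReal _ (by linarith : 0 ≤ 1 - s)] using h

instance : NullSingletonClass unif := by unfold unif; infer_instance

lemma ae_unif_mem : ∀ᵐ z ∂unif, z ∈ Icc (0 : ℝ) 1 := ae_restrict_mem measurableSet_Icc

/-- Change of variables along the distribution function of a density on `[0,1]`. -/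
lemma lintegral_cdf_withDensity {k : ℝ → ℝ≥0∞} (hk : Measurable k)
    (hk1 : IsProbabilityMeasure (unif.withDensity k)) {g : ℝ → ℝ≥0∞} (hg : Measurable g) :
    ∫⁻ z, k z * g (cdf (unif.withDensity k) z) ∂unif = ∫⁻ y, g y ∂unif := by
  set m := unif.withDensity k with hm
  have hc : Measurable (cdf m) := (continuous_cdf m).measurable
  conv_rhs => rw [← map_cdf_eq_unif m]
  rw [lintegral_map hg hc]
  exact (lintegral_withDensity_eq_lintegral_mul _ hk (hg.comp hc)).symm

lemma cdf_convex_combination {k : ℝ → ℝ≥0∞} (hk : Measurable k)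
    (hk1 : IsProbabilityMeasure (unif.withDensity k)) {s : ℝ} (h0 : 0 ≤ s) (h1 : s ≤ 1) :
    IsProbabilityMeasure
        (unif.withDensity fun z => ENNReal.ofReal (1 - s) * k z + ENNReal.ofReal s) ∧
    ∀ z ∈ Icc (0 : ℝ) 1,
      cdf (unif.withDensity fun z => ENNReal.ofReal (1 - s) * k z + ENNReal.ofReal s) z
        = (1 - s) * cdf (unif.withDensity k) z + s * z := by
  have happ : ∀ A, MeasurableSet A →
      (unif.withDensity fun z => ENNReal.ofReal (1 - s) * k z + ENNReal.ofReal s) A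
        = ENNReal.ofReal (1 - s) * unif.withDensity k A + ENNReal.ofReal s * unif A := by
    intro A hA
    rw [withDensity_apply _ hA, withDensity_apply _ hA, lintegral_add_right _ measurable_const,
      lintegral_const_mul _ hk]
    simp
  have hprob : IsProbabilityMeasure
      (unif.withDensity fun z => ENNReal.ofReal (1 - s) * k z + ENNReal.ofReal s) := by
    constructor
    rw [happ _ MeasurableSet.univ, measure_univ, measure_univ, mul_one, mul_one,
      ← ENNReal.ofReal_add (by linarith) h0]
    simp
  refine ⟨hprob, fun z hz => ?_⟩
  rw [cdf_eq_real, cdf_eq_real, measureReal_def, happ _ measurableSet_Iic, ENNReal.toReal_add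
    (by finiteness) (by finiteness), ENNReal.toReal_mul, ENNReal.toReal_mul,
    ENNReal.toReal_ofReal (by linarith), ENNReal.toReal_ofReal h0, measureReal_def]
  congr 2
  have h2 : Iic z ∩ Icc (0 : ℝ) 1 = Icc 0 z := by
    ext y; simp only [mem_inter_iff, mem_Iic, mem_Icc]
    constructor
    · rintro ⟨a, b, c⟩; exact ⟨b, a⟩
    · rintro ⟨a, b⟩; exact ⟨b, a, by linarith [hz.2]⟩
  rw [unif, Measure.restrict_apply measurableSet_Iic, h2]
  simp [hz.1]

lemma transport_one_dim {τ : Measure ℝ} [SFinite τ] (hτ : ∀ᵐ s ∂τ, 0 ≤ s ∧ s < 1)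
    {b W : ℝ → ℝ≥0∞} {h : ℝ × ℝ → ℝ≥0∞} (hb : Measurable b) (hb1 : ∀ z, b z ≤ 1)
    (hb0 : ∫⁻ z, b z ∂unif ≠ 0) (hW : Measurable W) (hh : Measurable h)
    (hyp : ∀ x z, b z ≠ 0 → W x ≤ ∫⁻ s, (b z) ^ (-s) * h (s, (1 - s) * x + s * z) ∂τ) :
    ∫⁻ x, W x ∂unif ≤ ∫⁻ s, (∫⁻ z, b z ∂unif) ^ (-s) * ∫⁻ y, h (s, y) ∂unif ∂τ := by
  set β := ∫⁻ z, b z ∂unif with hβ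
  have hβ1 : β ≤ 1 := by
    calc β ≤ ∫⁻ _, 1 ∂unif := lintegral_mono hb1
      _ = 1 := by simp
  have hβt : β ≠ ∞ := ne_top_of_le_ne_top ENNReal.one_ne_top hβ1
  set k : ℝ → ℝ≥0∞ := fun z => b z / β with hkdef
  have hk : Measurable k := hb.div_const _
  have hk1 : IsProbabilityMeasure (unif.withDensity k) := by
    constructor
    rw [withDensity_apply _ MeasurableSet.univ, Measure.restrict_univ]
    simp only [hkdef, div_eq_mul_inv]
    rw [lintegral_mul_const _ hb, ENNReal.mul_inv_cancel hb0 hβt]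
  set Φ := cdf (unif.withDensity k) with hΦ
  have hΦm : Measurable Φ := (continuous_cdf _).measurable
  have hmeas : Measurable fun q : ℝ × ℝ => h (q.2, (1 - q.2) * Φ q.1 + q.2 * q.1) := by
    refine hh.comp (measurable_snd.prodMk ?_)
    exact ((measurable_const.sub measurable_snd).mul (hΦm.comp measurable_fst)).add
      (measurable_snd.mul measurable_fst)
  calc ∫⁻ x, W x ∂unif = ∫⁻ z, k z * W (Φ z) ∂unif := (lintegral_cdf_withDensity hk hk1 hW).symm
    _ ≤ ∫⁻ z, ∫⁻ s, k z * ((b z) ^ (-s) * h (s, (1 - s) * Φ z + s * z)) ∂τ ∂unif := by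
        refine lintegral_mono fun z => ?_
        simp only
        rw [lintegral_const_mul'' _ ?_]
        · by_cases hz : b z = 0
          · simp [hkdef, hz]
          · gcongr
            exact hyp _ _ hz
        · refine AEMeasurable.mul ?_ ?_
          · exact (measurable_const.pow measurable_neg).aemeasurable
          · exact (hmeas.comp (measurable_const.prodMk measurable_id)).aemeasurable
    _ = ∫⁻ s, ∫⁻ z, k z * ((b z) ^ (-s) * h (s, (1 - s) * Φ z + s * z)) ∂unif ∂τ := by
        refine lintegral_lintegral_swap (Measurable.aemeasurable ?_)
        refine (hk.comp measurable_fst).mul (Measurable.mul ?_ hmeas)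
        exact (hb.comp measurable_fst).pow measurable_snd.neg
    _ ≤ ∫⁻ s, β ^ (-s) * ∫⁻ y, h (s, y) ∂unif ∂τ := by
        refine lintegral_mono_ae ?_
        filter_upwards [hτ] with s hs
        obtain ⟨hprob, hcdf⟩ := cdf_convex_combination hk hk1 hs.1 hs.2.le
        rw [← lintegral_cdf_withDensity
            (k := fun z => ENNReal.ofReal (1 - s) * k z + ENNReal.ofReal s)
          (by fun_prop) hprob (g := fun y => h (s, y))
              (hh.comp (measurable_const.prodMk measurable_id)),
          ← lintegral_const_mul' _ _ (by
            simp only [ne_eq, ENNReal.rpow_eq_top_iff, hb0, hβt]; simp)]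
        refine lintegral_mono_ae ?_
        filter_upwards [ae_unif_mem] with z hz
        rw [hcdf z hz]
        by_cases hz0 : b z = 0
        · simp [hkdef, hz0]
        have hzt : b z ≠ ∞ := ne_top_of_le_ne_top ENNReal.one_ne_top (hb1 z)
        have key : k z * (b z) ^ (-s) = β ^ (-s) * (k z) ^ (1 - s) := by
          simp only [hkdef, div_eq_mul_inv]
          rw [ENNReal.mul_rpow_of_ne_top hzt (by simpa using hb0), ENNReal.inv_rpow,
            ENNReal.rpow_sub _ _ hz0 hzt, ENNReal.rpow_sub _ _ hb0 hβt, ENNReal.rpow_one,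
            ENNReal.rpow_one, ENNReal.rpow_neg, ENNReal.rpow_neg]
          rw [ENNReal.div_eq_inv_mul, ENNReal.div_eq_inv_mul (b := β ^ s),
              ENNReal.mul_inv (by right; exact hβt) (by right; exact hb0), inv_inv]
          have hc : (β ^ s)⁻¹ * β ^ s = 1 := ENNReal.inv_mul_cancel
            (by simp [ENNReal.rpow_eq_zero_iff, hb0, hβt])
            (by simp only [ne_eq, ENNReal.rpow_eq_top_iff, hb0, hβt]; simp)
          calc b z * β⁻¹ * (b z ^ s)⁻¹ = 1 * (b z * β⁻¹ * (b z ^ s)⁻¹) := by rw [one_mul]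
            _ = _ := by rw [← hc]; ring
        rw [← mul_assoc, key, mul_assoc]
        gcongr
        exact rpow_one_sub_le _ hs.1 hs.2

lemma lintegral_pi_fin_succ {α : Type*} [MeasurableSpace α] (μ : Measure α) [SigmaFinite μ] {n : ℕ}
    {F : (Fin (n + 1) → α) → ℝ≥0∞} (hF : Measurable F) :
    ∫⁻ x, F x ∂(Measure.pi fun _ => μ)
      = ∫⁻ a, ∫⁻ x, F (Fin.cons a x : Fin (n + 1) → α) ∂(Measure.pi fun _ : Fin n => μ) ∂μ := by
  have h := (measurePreserving_piFinSuccAbove (fun _ : Fin (n + 1) => μ) 0).symm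
  rw [← h.lintegral_comp hF]
  refine (lintegral_prod _ (hF.comp h.measurable).aemeasurable).trans ?_
  simp [MeasurableEquiv.piFinSuccAbove_symm_apply]
  rfl

lemma lintegral_pi_fin_zero {α : Type*} [MeasurableSpace α] (μ : Measure α) [SigmaFinite μ]
    {F : (Fin 0 → α) → ℝ≥0∞} :
    ∫⁻ x, F x ∂(Measure.pi fun _ => μ) = F Fin.elim0 := by
  rw [Measure.pi_of_empty _ Fin.elim0]
  simp

lemma measurable_fin_cons {α : Type*} [MeasurableSpace α] {n : ℕ} :
    Measurable fun q : α × (Fin n → α) => (Fin.cons q.1 q.2 : Fin (n + 1) → α) := by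
  refine measurable_pi_lambda _ fun i => ?_
  refine Fin.cases ?_ (fun j => ?_) i
  · exact measurable_fst
  · exact (measurable_pi_apply j).comp measurable_snd

/-- Uniform measure on the unit cube. -/
def cube (n : ℕ) : Measure (Fin n → ℝ) := Measure.pi fun _ => unif

instance (n : ℕ) : IsProbabilityMeasure (cube n) := by unfold cube; infer_instance

lemma transport_cube {τ : Measure ℝ} [SFinite τ] (hτ : ∀ᵐ s ∂τ, 0 ≤ s ∧ s < 1) (n : ℕ) :
    ∀ {b W : (Fin n → ℝ) → ℝ≥0∞} {h : ℝ × (Fin n → ℝ) → ℝ≥0∞} (_ : Measurable b)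
    (_ : ∀ z, b z ≤ 1)
    (_ : ∫⁻ z, b z ∂(cube n) ≠ 0) (_ : Measurable W) (_ : Measurable h)
    (_ : ∀ x z, b z ≠ 0 → W x ≤ ∫⁻ s, (b z) ^ (-s) * h (s, (1 - s) • x + s • z) ∂τ),
    ∫⁻ x, W x ∂(cube n) ≤ ∫⁻ s, (∫⁻ z, b z ∂(cube n)) ^ (-s) * ∫⁻ y, h (s, y) ∂(cube n) ∂τ := by
  induction n with
  | zero =>
    intro b W h hb hb1 hb0 hW hh hyp
    simp only [cube, lintegral_pi_fin_zero] at hb0 ⊢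
    refine (hyp Fin.elim0 Fin.elim0 hb0).trans (le_of_eq ?_)
    congr! 5
  | succ n ih =>
    intro b W h hb hb1 hb0 hW hh hyp
    have hmc := measurable_fin_cons (α := ℝ) (n := n)
    have hms : ∀ s, Measurable fun y => h (s, y) := fun s => hh.comp (by fun_prop)
    have hsplit : ∀ s, ∫⁻ y, h (s, y) ∂(cube (n + 1))
        = ∫⁻ a, ∫⁻ y, h (s, Fin.cons a y) ∂(cube n) ∂unif :=
      fun s => lintegral_pi_fin_succ unif (hms s)
    have hsb : ∫⁻ y, b y ∂(cube (n + 1)) = ∫⁻ a, ∫⁻ y, b (Fin.cons a y) ∂(cube n) ∂unif :=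
      lintegral_pi_fin_succ unif hb
    have hsW : ∫⁻ y, W y ∂(cube (n + 1)) = ∫⁻ a, ∫⁻ y, W (Fin.cons a y) ∂(cube n) ∂unif :=
      lintegral_pi_fin_succ unif hW
    have hcons : ∀ a : ℝ, Measurable fun y : Fin n → ℝ => (Fin.cons a y : Fin (n + 1) → ℝ) :=
      fun a => hmc.comp (measurable_const.prodMk measurable_id)
    simp only [hsplit, hsW]
    rw [hsb] at hb0 ⊢
    refine transport_one_dim hτ (b := fun a => ∫⁻ y, b (Fin.cons a y) ∂(cube n))
      (W := fun a => ∫⁻ y, W (Fin.cons a y) ∂(cube n))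
      (h := fun q => ∫⁻ y, h (q.1, Fin.cons q.2 y) ∂(cube n)) ?_ ?_ hb0 ?_ ?_ ?_
    · exact (hb.comp hmc).lintegral_prod_right'
    · intro a
      calc ∫⁻ y, b (Fin.cons a y) ∂(cube n) ≤ ∫⁻ _, 1 ∂(cube n) := lintegral_mono fun y => hb1 _
        _ = 1 := by simp
    · exact (hW.comp hmc).lintegral_prod_right'
    · have : Measurable fun q : (ℝ × ℝ) × (Fin n → ℝ) => h (q.1.1, Fin.cons q.1.2 q.2) := by
        refine hh.comp (Measurable.prodMk (by fun_prop) ?_)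
        exact hmc.comp (by fun_prop : Measurable fun q : (ℝ × ℝ) × (Fin n → ℝ) => (q.1.2, q.2))
      exact this.lintegral_prod_right'
    · intro x0 z0 hz0
      refine ih (b := fun y => b (Fin.cons z0 y)) (W := fun y => W (Fin.cons x0 y))
        (h := fun q => h (q.1, Fin.cons ((1 - q.1) * x0 + q.1 * z0) q.2)) (hb.comp (hcons z0))
        (fun _ => hb1 _) hz0 (hW.comp (hcons x0)) ?_ ?_
      · refine hh.comp (Measurable.prodMk (by fun_prop) ?_)
        exact hmc.comp (by fun_prop :
          Measurable fun q : ℝ × (Fin n → ℝ) => ((1 - q.1) * x0 + q.1 * z0, q.2))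
      · intro x z hz
        refine (hyp (Fin.cons x0 x) (Fin.cons z0 z) hz).trans (le_of_eq ?_)
        refine lintegral_congr fun s => ?_
        congr 3
        ext i
        refine Fin.cases ?_ (fun j => ?_) i <;> simp

lemma exists_root_near {q : Polynomial ℝ} {D : ℕ} (hq : q.natDegree ≤ D) {s s0 η : ℝ}
    (hη0 : 0 ≤ η) (hη1 : η ≤ 1) (h : |q.eval s| < η ^ D * |q.eval s0|) :
    ∃ z ∈ (q.map (algebraMap ℝ ℂ)).roots, ‖(s : ℂ) - z‖ < η * ‖(s0 : ℂ) - z‖ := by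
  by_contra! hcon
  set Q := q.map (algebraMap ℝ ℂ) with hQ
  have hsp : Q.Splits := IsAlgClosed.splits Q
  have hval : ∀ t : ℝ, |q.eval t| =
      ‖Q.leadingCoeff‖ * (Q.roots.map fun z => ‖(t : ℂ) - z‖).prod := by
    intro t
    have h1 : (Q.eval (t : ℂ)) = ((q.eval t : ℝ) : ℂ) := by
      rw [hQ, Polynomial.eval_map_algebraMap]
      exact Polynomial.aeval_algebraMap_apply_eq_algebraMap_eval t q
    have h2 := hsp.eval_eq_prod_roots (t : ℂ)
    rw [h1] at h2
    have h3 := congrArg norm h2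
    rw [Complex.norm_real, norm_mul, Real.norm_eq_abs] at h3
    have h4 := Multiset.prod_hom (Q.roots.map fun z => (t : ℂ) - z) (normHom : ℂ →*₀ ℝ)
    rw [Multiset.map_map] at h4
    rw [h3]
    exact congrArg _ h4.symm
  have hcard : Multiset.card Q.roots ≤ D :=
    (Polynomial.card_roots' Q).trans ((Polynomial.natDegree_map_le).trans hq)
  have hind : ∀ M : Multiset ℂ, (∀ z ∈ M, η * ‖(s0 : ℂ) - z‖ ≤ ‖(s : ℂ) - z‖) →
      η ^ (Multiset.card M) * (M.map fun z => ‖(s0 : ℂ) - z‖).prod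
        ≤ (M.map fun z => ‖(s : ℂ) - z‖).prod := by
    intro M
    induction M using Multiset.induction with
    | empty => simp
    | cons a M ih =>
      intro hM
      have h1 := ih fun z hz => hM z (Multiset.mem_cons_of_mem hz)
      have h2 := hM a (Multiset.mem_cons_self a M)
      have h3 : 0 ≤ (M.map fun z => ‖(s0 : ℂ) - z‖).prod :=
        Multiset.prod_nonneg (by simp only [Multiset.mem_map]; rintro _ ⟨z, _, rfl⟩; positivity)
      rw [Multiset.card_cons, Multiset.map_cons, Multiset.map_cons, Multiset.prod_cons,
        Multiset.prod_cons, pow_succ]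
      calc _ = (η * ‖(s0 : ℂ) - a‖) *
          (η ^ (Multiset.card M) * (M.map fun z => ‖(s0 : ℂ) - z‖).prod) := by
            ring
        _ ≤ _ := mul_le_mul h2 h1 (by positivity) (by positivity)
  have h1 := hind Q.roots hcon
  have h2 : η ^ D ≤ η ^ (Multiset.card Q.roots) := pow_le_pow_of_le_one hη0 hη1 hcard
  have h3 : η ^ D * |q.eval s0| ≤ |q.eval s| := by
    calc η ^ D * |q.eval s0| ≤ η ^ (Multiset.card Q.roots) * |q.eval s0| := by gcongr
      _ = ‖Q.leadingCoeff‖ *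
            (η ^ (Multiset.card Q.roots) * (Q.roots.map fun z => ‖(s0 : ℂ) - z‖).prod) := by
          rw [hval s0]; ring
      _ ≤ ‖Q.leadingCoeff‖ * (Q.roots.map fun z => ‖(s : ℂ) - z‖).prod := by gcongr
      _ = _ := (hval s).symm
  linarith

/-- Sublevel sets of a polynomial on an interval are small. -/
lemma volume_sublevel_le {q : Polynomial ℝ} {D : ℕ} (hD : 1 ≤ D) (hq : q.natDegree ≤ D) {L s0 η : ℝ}
    (hL : 0 ≤ L) (hs0 : s0 ∈ Icc 0 L) (hη0 : 0 ≤ η) :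
    volume {s | s ∈ Icc 0 L ∧ |q.eval s| < η ^ D * |q.eval s0|} ≤
        ENNReal.ofReal (4 * D * η * L) := by
  have hD' : (1 : ℝ) ≤ D := by exact_mod_cast hD
  rcases le_or_gt η (1 / 2) with hη | hη
  · set R := (q.map (algebraMap ℝ ℂ)).roots with hR
    have hsub : {s | s ∈ Icc 0 L ∧ |q.eval s| < η ^ D * |q.eval s0|}
        ⊆ ⋃ z ∈ R.toFinset, Icc (z.re - 2 * η * L) (z.re + 2 * η * L) := by
      rintro s ⟨hs, hlt⟩
      obtain ⟨z, hz, hzs⟩ := exists_root_near hq hη0 (by linarith) hlt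
      simp only [mem_iUnion]
      refine ⟨z, Multiset.mem_toFinset.2 hz, ?_⟩
      have h1 : ‖(s0 : ℂ) - z‖ ≤ L + ‖(s : ℂ) - z‖ := by
        calc ‖(s0 : ℂ) - z‖ = ‖((s0 - s : ℝ) : ℂ) + ((s : ℂ) - z)‖ := by congr 1; push_cast; ring
          _ ≤ ‖((s0 - s : ℝ) : ℂ)‖ + ‖(s : ℂ) - z‖ := norm_add_le _ _
          _ ≤ _ := by
            gcongr
            rw [Complex.norm_real, Real.norm_eq_abs, abs_le]
            constructor <;> linarith [hs.1, hs.2, hs0.1, hs0.2]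
      have h0 := norm_nonneg ((s0 : ℂ) - z)
      have h2 : ‖(s0 : ℂ) - z‖ ≤ 2 * L := by nlinarith
      have h3 : |s - z.re| ≤ 2 * η * L := by
        calc |s - z.re| = |((s : ℂ) - z).re| := by simp
          _ ≤ ‖(s : ℂ) - z‖ := Complex.abs_re_le_norm _
          _ ≤ η * (2 * L) := hzs.le.trans (by gcongr)
          _ = _ := by ring
      rw [abs_le] at h3
      exact ⟨by linarith [h3.1], by linarith [h3.2]⟩
    have hcard : (R.toFinset.card : ℝ) ≤ D := by
      exact_mod_cast (Multiset.toFinset_card_le R).trans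
        ((Polynomial.card_roots' _).trans ((Polynomial.natDegree_map_le).trans hq))
    calc _ ≤ volume (⋃ z ∈ R.toFinset, Icc (z.re - 2 * η * L) (z.re + 2 * η * L)) :=
        measure_mono hsub
      _ ≤ ∑ z ∈ R.toFinset, volume (Icc (z.re - 2 * η * L) (z.re + 2 * η * L)) :=
          measure_biUnion_finset_le _ _
      _ = ∑ z ∈ R.toFinset, ENNReal.ofReal (4 * η * L) := by
          refine Finset.sum_congr rfl fun z _ => ?_
          rw [Real.volume_Icc]; congr 1; ring
      _ = ENNReal.ofReal (R.toFinset.card * (4 * η * L)) := by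
          rw [Finset.sum_const, nsmul_eq_mul,
              ENNReal.ofReal_mul (p := (R.toFinset.card : ℝ)) (by positivity),
            ENNReal.ofReal_natCast]
      _ ≤ _ := by
          refine ENNReal.ofReal_le_ofReal ?_
          calc (R.toFinset.card * (4 * η * L) : ℝ) ≤ D * (4 * η * L) := by gcongr
            _ = _ := by ring
  · calc _ ≤ volume (Icc 0 L) := measure_mono fun s hs => hs.1
      _ = ENNReal.ofReal L := by rw [Real.volume_Icc, sub_zero]
      _ ≤ _ := ENNReal.ofReal_le_ofReal (by
          have : 1 ≤ 4 * D * η := by nlinarith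
          nlinarith)

/-- The restriction of `f` to every line is a polynomial of degree at most `D`. -/
def PolyOnLines {n : ℕ} (D : ℕ) (f : (Fin n → ℝ) → ℝ) : Prop :=
  ∀ x z, ∃ q : Polynomial ℝ, q.natDegree ≤ D ∧ ∀ s : ℝ, f ((1 - s) • x + s • z) = q.eval s

lemma PolyOnLines.const_mul {n D : ℕ} {f : (Fin n → ℝ) → ℝ} (hf : PolyOnLines D f) (c : ℝ) :
    PolyOnLines D fun x => c * f x := by
  intro x z
  obtain ⟨q, hq, h⟩ := hf x z
  exact ⟨Polynomial.C c * q, (Polynomial.natDegree_C_mul_le _ _).trans hq, fun s => by simp [h s]⟩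

/-- The function `|f|^{-1/D}`. -/
def invRoot {α : Type*} (D : ℕ) (f : α → ℝ) (x : α) : ℝ≥0∞ :=
  (ENNReal.ofReal |f x|) ^ (-(1 / D : ℝ))

lemma measurable_invRoot {α : Type*} [MeasurableSpace α] {D : ℕ} {f : α → ℝ} (hf : Measurable f) :
    Measurable (invRoot D f) := by
  unfold invRoot
  exact ((ENNReal.measurable_ofReal.comp (by simpa using hf.norm)).pow_const _)

lemma one_le_sublevel_add_superlevel {n D : ℕ} (hD : 1 ≤ D)
    {f : (Fin n → ℝ) → ℝ} (hf : Measurable f)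
    (hpl : PolyOnLines D f) {δ η : ℝ} (hδ0 : 0 < δ) (hδ1 : δ ≤ 1) (hη : 0 < η)
    (hβ : cube n {x | 1 ≤ |f x|} ≠ 0) :
    1 ≤ ∫⁻ x, min (ENNReal.ofReal (4 * D * η) * invRoot D f x)
        (ENNReal.ofReal (4 * D * η / δ)) ∂(cube n)
      + (cube n {x | 1 ≤ |f x|}) ^ (-δ) * cube n {x | η ^ D ≤ |f x|} := by
  set w : (Fin n → ℝ) → ℝ≥0∞ := fun x =>
    min (ENNReal.ofReal (4 * D * η) * invRoot D f x) (ENNReal.ofReal (4 * D * η / δ)) with hw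
  have hwm : Measurable w := ((measurable_invRoot hf).const_mul _).min measurable_const
  set τ : Measure ℝ := (ENNReal.ofReal δ)⁻¹ • volume.restrict (Ioo 0 δ) with hτdef
  have hδne : ENNReal.ofReal δ ≠ 0 := by simpa using hδ0
  have hτprob : IsProbabilityMeasure τ := by
    constructor
    simp only [hτdef, Measure.smul_apply, Measure.restrict_apply_univ, Real.volume_Ioo, sub_zero,
      smul_eq_mul]
    exact ENNReal.inv_mul_cancel hδne ENNReal.ofReal_ne_top
  have hτ : ∀ᵐ s ∂τ, s ∈ Ioo 0 δ := by
    refine Measure.ae_smul_measure ?_ _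
    exact ae_restrict_mem measurableSet_Ioo
  set A := {x | 1 ≤ |f x|} with hA
  set E := {x | η ^ D ≤ |f x|} with hE
  have hfa : Measurable fun x => |f x| := by simpa using hf.norm
  have hAm : MeasurableSet A := measurableSet_le measurable_const hfa
  have hEm : MeasurableSet E := measurableSet_le measurable_const hfa
  have hD0 : (D : ℝ) ≠ 0 := by positivity
  have hiA : ∫⁻ z, A.indicator 1 z ∂(cube n) = cube n A := lintegral_indicator_one hAm
  have hmain := transport_cube (τ := τ) (hτ.mono fun s hs => ⟨hs.1.le, hs.2.trans_le hδ1⟩) n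
    (b := A.indicator 1) (W := fun x => 1 - w x) (h := fun q => E.indicator 1 q.2)
    (measurable_one.indicator hAm) (fun z => indicator_le_self' (fun _ _ => zero_le) z)
    (by rwa [hiA]) (measurable_const.sub hwm)
    ((measurable_one.indicator hEm).comp measurable_snd) ?_
  · rw [hiA] at hmain
    simp only [lintegral_indicator_one hEm] at hmain
    have h1 : ∫⁻ s, (cube n A) ^ (-s) * cube n E ∂τ ≤ (cube n A) ^ (-δ) * cube n E := by
      calc ∫⁻ s, (cube n A) ^ (-s) * cube n E ∂τ ≤ ∫⁻ s, (cube n A) ^ (-δ) * cube n E ∂τ := by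
            refine lintegral_mono_ae ?_
            filter_upwards [hτ] with s hs
            gcongr ?_ * _
            exact ENNReal.rpow_le_rpow_of_exponent_ge prob_le_one (by linarith [hs.2])
        _ = _ := by simp
    calc (1 : ℝ≥0∞) = ∫⁻ _, 1 ∂(cube n) := by simp
      _ ≤ ∫⁻ x, (w x + (1 - w x)) ∂(cube n) := lintegral_mono fun x => le_add_tsub
      _ = ∫⁻ x, w x ∂(cube n) + ∫⁻ x, (1 - w x) ∂(cube n) := lintegral_add_left hwm _
      _ ≤ _ := by gcongr; exact hmain.trans h1
  · intro x z hz
    have hzA : z ∈ A := by by_contra h; simp [h] at hz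
    obtain ⟨q, hq, hqs⟩ := hpl x z
    simp only [indicator_of_mem hzA, Pi.one_apply, ENNReal.one_rpow, one_mul]
    set S := {s : ℝ | |q.eval s| < η ^ D} with hS
    have hSm : MeasurableSet S := measurableSet_lt (by fun_prop) measurable_const
    have hind : ∀ s : ℝ, E.indicator (1 : (Fin n → ℝ) → ℝ≥0∞) ((1 - s) • x + s • z) =
        Sᶜ.indicator 1 s := by
      intro s
      have hiff : (1 - s) • x + s • z ∈ E ↔ s ∈ Sᶜ := by
        simp only [hE, hS, mem_compl_iff, mem_ofPred_eq, hqs s, not_lt]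
      by_cases h : s ∈ Sᶜ
      · rw [indicator_of_mem h, indicator_of_mem (hiff.2 h)]; rfl
      · rw [indicator_of_notMem h, indicator_of_notMem (hiff.not.2 h)]
    simp only [hind]
    rw [lintegral_indicator_one hSm.compl, prob_compl_eq_one_sub hSm]
    refine tsub_le_tsub_left ?_ _
    have hτS : τ S = (ENNReal.ofReal δ)⁻¹ * volume (S ∩ Ioo 0 δ) := by
      simp [hτdef, Measure.restrict_apply hSm]
    have h4 : (0 : ℝ) ≤ 4 * D * η := by positivity
    refine le_min ?_ ?_
    · by_cases hx : f x = 0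
      · have : invRoot D f x = ∞ := by
          simp only [invRoot, hx, abs_zero, ENNReal.ofReal_zero]
          rw [ENNReal.zero_rpow_of_neg]
          have : (0 : ℝ) < D := by positivity
          simp; omega
        rw [this, ENNReal.mul_top (ENNReal.ofReal_pos.2 (by positivity)).ne']
        exact le_top
      have hax : 0 < |f x| := abs_pos.2 hx
      set r := |f x| ^ (-(1 / D : ℝ)) with hr
      have hr0 : 0 ≤ r := by positivity
      have hrD : r ^ D * |f x| = 1 := by
        rw [hr, ← Real.rpow_natCast, ← Real.rpow_mul hax.le]
        have : -(1 / (D : ℝ)) * D = -1 := by field_simp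
        rw [this, Real.rpow_neg_one, inv_mul_cancel₀ hax.ne']
      have hq0 : q.eval 0 = f x := by rw [← hqs 0]; simp
      have hv := volume_sublevel_le hD hq (L := δ) (s0 := 0) (η := η * r) hδ0.le ⟨le_rfl, hδ0.le⟩
        (by positivity)
      rw [hq0, mul_pow, mul_assoc, hrD, mul_one] at hv
      have hinv : invRoot D f x = ENNReal.ofReal r := by
        rw [invRoot, ENNReal.ofReal_rpow_of_pos hax]
      rw [hτS, hinv, ← ENNReal.ofReal_mul h4]
      calc _ ≤ (ENNReal.ofReal δ)⁻¹ * ENNReal.ofReal (4 * D * (η * r) * δ) := by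
            gcongr
            refine (measure_mono ?_).trans hv
            exact fun s hs => ⟨⟨hs.2.1.le, hs.2.2.le⟩, hs.1⟩
        _ = _ := by
          rw [mul_comm, ENNReal.ofReal_mul (by positivity), mul_assoc, ENNReal.mul_inv_cancel hδne
            ENNReal.ofReal_ne_top, mul_one]
          congr 1; ring
    · have hq1 : q.eval 1 = f z := by rw [← hqs 1]; simp
      have hv := volume_sublevel_le hD hq (L := 1) (s0 := 1) (η := η) zero_le_one
          ⟨zero_le_one, le_rfl⟩ hη.le
      rw [hτS, ENNReal.ofReal_div_of_pos hδ0, mul_comm, ENNReal.div_eq_inv_mul, mul_comm]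
      gcongr
      rw [mul_one] at hv
      refine (measure_mono ?_).trans hv
      intro s hs
      refine ⟨⟨hs.2.1.le, hs.2.2.le.trans hδ1⟩, lt_of_lt_of_le hs.1 ?_⟩
      rw [hq1]
      have : 1 ≤ |f z| := hzA
      have : 0 < η ^ D := by positivity
      nlinarith

/-- Dyadic layer cake bound. -/
lemma lintegral_rpow_le_of_tail {α : Type*} [MeasurableSpace α] {μ : Measure α}
    [IsProbabilityMeasure μ]
    {v : α → ℝ≥0∞} (hv : Measurable v) {C : ℝ≥0∞} {θ g : ℝ} (hθ : 0 ≤ θ)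
    (hC : ∀ k : ℕ, μ {x | 2 ^ k < v x} ≤ C * (2 ^ (-g)) ^ k) :
    ∫⁻ x, v x ^ θ ∂μ ≤ 1 + C * (2 ^ θ * (1 - 2 ^ (θ - g))⁻¹) := by
  have hm : ∀ k : ℕ, MeasurableSet {x | 2 ^ k < v x} :=
      fun k => measurableSet_lt measurable_const hv
  have hpt : ∀ x, v x ^ θ ≤
      1 + ∑' k : ℕ, ((2 : ℝ≥0∞) ^ (k + 1)) ^ θ * {x | 2 ^ k < v x}.indicator 1 x := by
    intro x
    rcases le_or_gt (v x) 1 with h1 | h1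
    · exact (ENNReal.rpow_le_one h1 hθ).trans le_self_add
    by_cases ht : v x = ∞
    · have : ∑' k : ℕ, ((2 : ℝ≥0∞) ^ (k + 1)) ^ θ * {x | 2 ^ k < v x}.indicator 1 x = ∞ := by
        refine top_unique ?_
        calc ∞ = ∑' k : ℕ, (1 : ℝ≥0∞) := (ENNReal.tsum_const_eq_top_of_ne_zero one_ne_zero).symm
          _ ≤ _ := by
            refine ENNReal.tsum_le_tsum fun k => ?_
            rw [indicator_of_mem, Pi.one_apply, mul_one]
            · simpa using ENNReal.rpow_le_rpow (one_le_pow₀ (by norm_num) : (1 : ℝ≥0∞) ≤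
                  2 ^ (k + 1)) hθ
            · simp [ht]
      rw [this]; simp
    have hr : 1 < (v x).toReal := by
      rw [← ENNReal.toReal_one]; exact (ENNReal.toReal_lt_toReal ENNReal.one_ne_top ht).2 h1
    obtain ⟨k, hk1, hk2⟩ : ∃ k : ℕ, (2 : ℝ) ^ k < (v x).toReal ∧ (v x).toReal ≤ 2 ^ (k + 1) := by
      obtain ⟨m, hm1, hm2⟩ := exists_mem_Ioc_zpow (zero_lt_one.trans hr) (by norm_num : (1 : ℝ) < 2)
      have hm0 : 0 < m + 1 :=
          (one_lt_zpow_iff_right₀ (by norm_num : (1 : ℝ) < 2)).1 (hr.trans_le hm2)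
      lift m to ℕ using by omega
      exact ⟨m, by exact_mod_cast hm1, by exact_mod_cast hm2⟩
    have hk1' : (2 : ℝ≥0∞) ^ k < v x := by
      rw [← ENNReal.toReal_lt_toReal (by finiteness) ht]; simpa using hk1
    have hk2' : v x ≤ (2 : ℝ≥0∞) ^ (k + 1) := by
      rw [← ENNReal.toReal_le_toReal ht (by finiteness)]; simpa using hk2
    calc v x ^ θ ≤ ((2 : ℝ≥0∞) ^ (k + 1)) ^ θ := ENNReal.rpow_le_rpow hk2' hθ
      _ = ((2 : ℝ≥0∞) ^ (k + 1)) ^ θ * {x | 2 ^ k < v x}.indicator 1 x := by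
          rw [indicator_of_mem (by exact hk1'), Pi.one_apply, mul_one]
      _ ≤ _ := ENNReal.le_tsum
            (f := fun k : ℕ => ((2 : ℝ≥0∞) ^ (k + 1)) ^ θ * {x | 2 ^ k < v x}.indicator 1 x) k
      _ ≤ _ := le_add_self
  calc ∫⁻ x, v x ^ θ ∂μ
      ≤ ∫⁻ x, (1 + ∑' k : ℕ, ((2 : ℝ≥0∞) ^ (k + 1)) ^ θ * {x | 2 ^ k < v x}.indicator 1 x) ∂μ :=
        lintegral_mono hpt
    _ = 1 + ∑' k : ℕ, ((2 : ℝ≥0∞) ^ (k + 1)) ^ θ * μ {x | 2 ^ k < v x} := by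
        rw [lintegral_add_left measurable_const, lintegral_tsum]
        · simp only [lintegral_const, measure_univ, mul_one]
          congr 2; ext k
          rw [lintegral_const_mul _ (measurable_one.indicator (hm k)),
              lintegral_indicator_one (hm k)]
        · exact fun k => ((measurable_one.indicator (hm k)).const_mul _).aemeasurable
    _ ≤ 1 + ∑' k : ℕ, C * (2 ^ θ * ((2 : ℝ≥0∞) ^ (θ - g)) ^ k) := by
        refine add_le_add le_rfl (ENNReal.tsum_le_tsum fun k => ?_)
        calc ((2 : ℝ≥0∞) ^ (k + 1)) ^ θ * μ {x | 2 ^ k < v x}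
            ≤ ((2 : ℝ≥0∞) ^ (k + 1)) ^ θ * (C * (2 ^ (-g)) ^ k) := by gcongr; exact hC k
          _ = _ := by
            rw [sub_eq_add_neg, ENNReal.rpow_add _ _ (by norm_num) (by norm_num), mul_pow,
              ← ENNReal.rpow_natCast, ← ENNReal.rpow_mul, mul_comm _ θ, ENNReal.rpow_mul,
              ENNReal.rpow_natCast, pow_succ]
            ring
    _ = _ := by rw [ENNReal.tsum_mul_left, ENNReal.tsum_mul_left, ENNReal.tsum_geometric]

lemma tail_const_ne_top {C : ℝ≥0∞} (hC : C ≠ ∞) {θ g : ℝ} (hθ : 0 ≤ θ) (hg : θ < g) :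
    1 + C * (2 ^ θ * (1 - (2 : ℝ≥0∞) ^ (θ - g))⁻¹) ≠ ∞ := by
  have h1 : (2 : ℝ≥0∞) ^ (θ - g) < 1 :=
      ENNReal.rpow_lt_one_of_one_lt_of_neg (by norm_num) (by linarith)
  have h2 : (1 - (2 : ℝ≥0∞) ^ (θ - g))⁻¹ ≠ ∞ := by
    simpa [ENNReal.inv_eq_top, tsub_eq_zero_iff_le] using h1
  have h3 : (2 : ℝ≥0∞) ^ θ ≠ ∞ := ENNReal.rpow_ne_top_of_nonneg hθ (by norm_num)
  finiteness

lemma min_le_rpow_mul_rpow {a b : ℝ≥0∞} {θ : ℝ} (h0 : 0 ≤ θ) (h1 : θ ≤ 1) :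
    min a b ≤ a ^ θ * b ^ (1 - θ) := by
  have h : min a b = (min a b) ^ θ * (min a b) ^ (1 - θ) := by
    rw [← ENNReal.rpow_add_of_nonneg _ _ h0 (by linarith)]; simp
  calc min a b = (min a b) ^ θ * (min a b) ^ (1 - θ) := h
    _ ≤ _ := mul_le_mul' (ENNReal.rpow_le_rpow (min_le_left _ _) h0)
      (ENNReal.rpow_le_rpow (min_le_right _ _) (by linarith))

/-- Uniform bound for `∫ |f|^{-θ/D}` over normalised functions. -/
def SmallBall (D : ℕ) (θ : ℝ) : Prop :=
  ∃ C : ℝ≥0∞, C ≠ ∞ ∧ ∀ (n : ℕ) (f : (Fin n → ℝ) → ℝ), Measurable f → PolyOnLines D f →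
    8⁻¹ ≤ cube n {x | 1 ≤ |f x|} → ∫⁻ x, invRoot D f x ^ θ ∂(cube n) ≤ C

lemma smallBall_zero (D : ℕ) : SmallBall D 0 := ⟨1, by simp, fun n f _ _ _ => by simp⟩

lemma rpow_neg_le_of_inv_eight_le {β : ℝ≥0∞} (hβ : 8⁻¹ ≤ β) {δ : ℝ} (h0 : 0 ≤ δ) (h1 : δ ≤ 1) :
    β ^ (-δ) ≤ 1 + ENNReal.ofReal (7 * δ) := by
  have h8 : (8 : ℝ) ^ δ ≤ 1 + 7 * δ := by
    have := Real.geom_mean_le_arith_mean2_weighted (w₁ := 1 - δ) (w₂ := δ) (p₁ := 1) (p₂ := 8)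
      (by linarith) h0 (by norm_num) (by norm_num) (by ring)
    simp only [Real.one_rpow, one_mul] at this
    linarith
  calc β ^ (-δ) = (β⁻¹) ^ δ := by rw [ENNReal.rpow_neg, ENNReal.inv_rpow]
    _ ≤ 8 ^ δ := ENNReal.rpow_le_rpow (by rw [ENNReal.inv_le_iff_inv_le]; exact hβ) h0
    _ = ENNReal.ofReal (8 ^ δ) := by
        rw [← ENNReal.ofReal_rpow_of_pos (by norm_num)]; simp
    _ ≤ ENNReal.ofReal (1 + 7 * δ) := ENNReal.ofReal_le_ofReal h8
    _ = _ := by rw [ENNReal.ofReal_add (by norm_num) (by positivity)]; simp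

lemma SmallBall.step {D : ℕ} (hD : 1 ≤ D) {θ θ' : ℝ} (h0 : 0 ≤ θ) (h1 : θ < 1) (h0' : 0 ≤ θ')
    (h' : θ' < 1 / (2 - θ)) (h : SmallBall D θ) : SmallBall D θ' := by
  obtain ⟨C, hC, hb⟩ := h
  set g := 1 / (2 - θ) with hg
  have hg0 : 0 < g := by rw [hg]; exact one_div_pos.2 (by linarith)
  have hD0 : (0 : ℝ) < D := by positivity
  refine ⟨_, tail_const_ne_top (C := ENNReal.ofReal (4 * D) * C + 7) (by finiteness) h0' h', ?_⟩
  intro n f hf hpl h8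
  refine lintegral_rpow_le_of_tail (measurable_invRoot hf) h0' fun k => ?_
  set η : ℝ := (1 / 2) ^ k with hη
  have hη0 : 0 < η := by positivity
  have hη1 : η ≤ 1 := pow_le_one₀ (by norm_num) (by norm_num)
  set δ : ℝ := η ^ g with hδ
  have hδ0 : 0 < δ := by positivity
  have hδ1 : δ ≤ 1 := Real.rpow_le_one hη0.le hη1 hg0.le
  have hβ : cube n {x | 1 ≤ |f x|} ≠ 0 := fun h => by simp [h] at h8
  have hkey := one_le_sublevel_add_superlevel hD hf hpl hδ0 hδ1 hη0 hβ
  set E := {x | η ^ D ≤ |f x|} with hE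
  have hEm : MeasurableSet E := measurableSet_le measurable_const (by simpa using hf.norm)
  have hsub : {x | 2 ^ k < invRoot D f x} ⊆ Eᶜ := by
    intro x hx hxE
    simp only [mem_ofPred_eq] at hx
    refine absurd hx (not_lt.2 ?_)
    have : (2 : ℝ≥0∞) ^ k = (ENNReal.ofReal (η ^ D)) ^ (-(1 / D : ℝ)) := by
      rw [ENNReal.ofReal_rpow_of_pos (by positivity), ← Real.rpow_natCast, ← Real.rpow_mul hη0.le]
      have : (D : ℝ) * -(1 / D) = -1 := by field_simp
      rw [this, Real.rpow_neg_one, hη, ← inv_pow, ENNReal.ofReal_pow (by norm_num)]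
      norm_num
    rw [this, invRoot, ENNReal.rpow_neg, ENNReal.rpow_neg]
    gcongr
    exact hxE
  have hδη : η * δ ^ (θ - 1) = δ := by
    rw [hδ, ← Real.rpow_mul hη0.le]
    nth_rewrite 1 [← Real.rpow_one η]
    rw [← Real.rpow_add hη0]
    congr 1
    rw [hg]
    have : 2 - θ ≠ 0 := by linarith
    field_simp; ring
  have hw : ∫⁻ x, min (ENNReal.ofReal (4 * D * η) * invRoot D f x)
      (ENNReal.ofReal (4 * D * η / δ)) ∂(cube n)
      ≤ ENNReal.ofReal (4 * D) * C * ENNReal.ofReal δ := by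
    calc _ ≤ ∫⁻ x, ENNReal.ofReal (4 * D * δ) * invRoot D f x ^ θ ∂(cube n) := by
          refine lintegral_mono fun x => (min_le_rpow_mul_rpow h0 h1.le).trans (le_of_eq ?_)
          rw [ENNReal.mul_rpow_of_nonneg _ _ h0, ENNReal.ofReal_rpow_of_pos (by positivity),
            ENNReal.ofReal_rpow_of_pos (by positivity), mul_right_comm,
            ← ENNReal.ofReal_mul (by positivity)]
          congr 2
          rw [Real.div_rpow (by positivity) hδ0.le, mul_div_assoc', ← Real.rpow_add (by positivity)]
          rw [show θ + (1 - θ) = 1 by ring, Real.rpow_one]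
          conv_rhs => rw [← hδη]
          rw [show θ - 1 = -(1 - θ) by ring, Real.rpow_neg hδ0.le]
          field_simp
      _ = ENNReal.ofReal (4 * D * δ) * ∫⁻ x, invRoot D f x ^ θ ∂(cube n) :=
          lintegral_const_mul _ ((measurable_invRoot hf).pow_const _)
      _ ≤ ENNReal.ofReal (4 * D * δ) * C := by gcongr; exact hb n f hf hpl h8
      _ = _ := by rw [ENNReal.ofReal_mul (by positivity)]; ring
  calc cube n {x | 2 ^ k < invRoot D f x} ≤ cube n Eᶜ := measure_mono hsub
    _ = 1 - cube n E := prob_compl_eq_one_sub hEm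
    _ ≤ ENNReal.ofReal (4 * D) * C * ENNReal.ofReal δ + ENNReal.ofReal (7 * δ) := by
        rw [tsub_le_iff_right]
        calc (1 : ℝ≥0∞) ≤ _ := hkey
          _ ≤ ENNReal.ofReal (4 * D) * C * ENNReal.ofReal δ + (1 + ENNReal.ofReal (7 * δ)) *
                cube n E := by
              gcongr
              exact rpow_neg_le_of_inv_eight_le h8 hδ0.le hδ1
          _ ≤ ENNReal.ofReal (4 * D) * C * ENNReal.ofReal δ +
                (cube n E + ENNReal.ofReal (7 * δ) * 1) := by
              rw [add_mul, one_mul]; gcongr; exact prob_le_one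
          _ = _ := by ring
    _ = (ENNReal.ofReal (4 * D) * C + 7) * ENNReal.ofReal δ := by
        rw [ENNReal.ofReal_mul (by norm_num : (0 : ℝ) ≤ 7)]
        norm_num; ring
    _ = _ := by
        congr 1
        rw [hδ, hη, ← ENNReal.ofReal_rpow_of_pos hη0, ENNReal.ofReal_pow (by norm_num),
          ← ENNReal.rpow_natCast, ← ENNReal.rpow_mul, ← ENNReal.rpow_natCast, ← ENNReal.rpow_mul,
          mul_comm, neg_mul, ENNReal.rpow_neg, ← ENNReal.inv_rpow, one_div,
          ENNReal.ofReal_inv_of_pos (by norm_num), ENNReal.ofReal_ofNat]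

lemma smallBall_of_lt_one {D : ℕ} (hD : 1 ≤ D) {θ : ℝ} (h0 : 0 ≤ θ)
    (h1 : θ < 1) : SmallBall D θ := by
  have hk : ∀ k : ℕ, SmallBall D (k / (k + 3)) := by
    intro k
    induction k with
    | zero => simpa using smallBall_zero D
    | succ k ih =>
      have hk3 : (0 : ℝ) < k + 3 := by positivity
      refine ih.step hD (by positivity) ?_ (by positivity) ?_
      · rw [div_lt_one hk3]; linarith
      · have h2 : 2 - (k : ℝ) / (k + 3) = (k + 6) / (k + 3) := by field_simp; ring
        rw [h2, one_div_div]
        push_cast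
        rw [div_lt_div_iff₀ (by positivity) (by positivity)]
        nlinarith
  obtain ⟨k, hk'⟩ := exists_nat_gt (3 / (1 - θ))
  have h1' : 0 < 1 - θ := by linarith
  rw [div_lt_iff₀ h1'] at hk'
  refine (hk k).step hD (by positivity) ?_ h0 ?_
  · rw [div_lt_one (by positivity)]; linarith
  · have h2 : 2 - (k : ℝ) / (k + 3) = (k + 6) / (k + 3) := by field_simp; ring
    rw [h2, one_div_div, lt_div_iff₀ (by positivity)]
    nlinarith

lemma four_rpow_neg_inv_le {δ : ℝ} (hδ : 0 < δ) (j : ℕ) : (4 : ℝ) ^ (-(1 / δ)) ≤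
    j.factorial * δ ^ j := by
  have h1 := Real.pow_div_factorial_le_exp (1 / δ) (by positivity) j
  have h2 : (4 : ℝ) ^ (-(1 / δ)) ≤ Real.exp (-(1 / δ)) := by
    rw [Real.rpow_def_of_pos (by norm_num)]
    apply Real.exp_le_exp.2
    have hl : 1 ≤ Real.log 4 := by
      rw [Real.le_log_iff_exp_le (by norm_num)]
      linarith [Real.exp_one_lt_d9]
    have : 0 < 1 / δ := by positivity
    nlinarith
  refine h2.trans ?_
  rw [Real.exp_neg, inv_le_comm₀ (Real.exp_pos _) (by positivity)]
  refine le_trans (le_of_eq ?_) h1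
  rw [one_div, inv_pow, mul_inv, mul_comm, div_eq_mul_inv]

lemma tail_bound {n D : ℕ} (hD : 1 ≤ D) {f : (Fin n → ℝ) → ℝ} (hf : Measurable f)
    (hpl : PolyOnLines D f) (h8 : cube n {x | 1 ≤ |f x|} ≤ 8⁻¹) {η : ℝ} (hη : 0 < η) :
    cube n {x | 1 / η ^ D ≤ |f x|} ≤
        ENNReal.ofReal ((3 * D).factorial * (8 * D * η) ^ (3 * D)) := by
  have hD0 : (0 : ℝ) < D := by positivity
  set δ := 8 * D * η with hδ
  have hδ0 : 0 < δ := by positivity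
  rcases lt_or_ge 1 δ with h1 | h1
  · refine prob_le_one.trans ?_
    rw [ENNReal.one_le_ofReal]
    have hfac : (1 : ℝ) ≤ (3 * D).factorial := by exact_mod_cast Nat.factorial_pos _
    have : (1 : ℝ) ≤ δ ^ (3 * D) := one_le_pow₀ h1.le
    nlinarith
  set β := cube n {x | 1 / η ^ D ≤ |f x|} with hβ
  by_cases hβ0 : β = 0
  · simp [hβ0]
  have hηD : 0 < η ^ D := by positivity
  have e1 : {x | 1 ≤ |η ^ D * f x|} = {x | 1 / η ^ D ≤ |f x|} := by
    ext x
    simp only [mem_ofPred_eq, abs_mul, abs_of_pos hηD]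
    rw [div_le_iff₀' hηD]
  have e2 : {x | η ^ D ≤ |η ^ D * f x|} = {x | 1 ≤ |f x|} := by
    ext x
    simp only [mem_ofPred_eq, abs_mul, abs_of_pos hηD]
    exact ⟨fun h => by nlinarith, fun h => by nlinarith⟩
  have hkey := one_le_sublevel_add_superlevel hD (hf.const_mul (η ^ D)) (hpl.const_mul _) hδ0 h1 hη
    (by rw [e1]; exact hβ0)
  rw [e1, e2, ← hβ] at hkey
  have hw : ∫⁻ x, min (ENNReal.ofReal (4 * D * η) * invRoot D (fun x => η ^ D * f x) x)
      (ENNReal.ofReal (4 * D * η / δ)) ∂(cube n) ≤ 2⁻¹ := by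
    calc _ ≤ ∫⁻ x, ENNReal.ofReal (4 * D * η / δ) ∂(cube n) :=
        lintegral_mono fun x => min_le_right _ _
      _ = ENNReal.ofReal 2⁻¹ := by
        simp only [lintegral_const, measure_univ, mul_one]
        congr 1; rw [hδ]; field_simp; norm_num
      _ = 2⁻¹ := by rw [ENNReal.ofReal_inv_of_pos (by norm_num), ENNReal.ofReal_ofNat]
  have h4 : 4 ≤ β ^ (-δ) := by
    have h2 : (1 : ℝ≥0∞) ≤ 2⁻¹ + β ^ (-δ) * 8⁻¹ := hkey.trans (by gcongr)
    have h3 : (2⁻¹ : ℝ≥0∞) ≤ β ^ (-δ) * 8⁻¹ := by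
      rw [← ENNReal.inv_two_add_inv_two] at h2
      exact (ENNReal.add_le_add_iff_left (by norm_num)).1 h2
    rw [← div_eq_mul_inv, ENNReal.le_div_iff_mul_le (by norm_num) (by norm_num)] at h3
    refine le_trans (le_of_eq ?_) h3
    rw [show (8 : ℝ≥0∞) = 2 * 4 by norm_num, ← mul_assoc,
        ENNReal.inv_mul_cancel (by norm_num) (by norm_num), one_mul]
  calc β = (β ^ (-δ)) ^ (-(1 / δ)) := by
        rw [← ENNReal.rpow_mul, show -δ * -(1 / δ) = 1 by field_simp, ENNReal.rpow_one]
    _ ≤ 4 ^ (-(1 / δ)) := by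
        rw [ENNReal.rpow_neg _ (1 / δ), ENNReal.rpow_neg _ (1 / δ)]; gcongr
    _ = ENNReal.ofReal (4 ^ (-(1 / δ))) := by
        rw [← ENNReal.ofReal_rpow_of_pos (by norm_num)]; simp
    _ ≤ _ := ENNReal.ofReal_le_ofReal (four_rpow_neg_inv_le hδ0 _)

lemma exists_lintegral_sq_le {D : ℕ} (hD : 1 ≤ D) : ∃ C : ℝ≥0∞, C ≠ ∞ ∧
    ∀ (n : ℕ) (f : (Fin n → ℝ) → ℝ), Measurable f → PolyOnLines D f →
    cube n {x | 1 ≤ |f x|} ≤ 8⁻¹ → ∫⁻ x, ENNReal.ofReal (f x ^ 2) ∂(cube n) ≤ C := by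
  set C₀ := ENNReal.ofReal ((3 * D).factorial * (8 * D) ^ (3 * D)) with hC₀
  refine ⟨_, tail_const_ne_top (C := C₀) (θ := 2) (g := 3) ENNReal.ofReal_ne_top (by norm_num)
      (by norm_num), ?_⟩
  intro n f hf hpl h8
  have hfa : Measurable fun x => |f x| := by simpa using hf.norm
  have h := lintegral_rpow_le_of_tail (μ := cube n) (v := fun x => ENNReal.ofReal |f x|) (C := C₀)
    (θ := 2) (g := 3) (by fun_prop) (by norm_num) ?_
  · refine le_trans (le_of_eq (lintegral_congr fun x => ?_)) h
    rw [← sq_abs, ENNReal.ofReal_pow (abs_nonneg _)]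
    exact (ENNReal.rpow_natCast _ 2).symm
  · intro k
    set η : ℝ := (2 : ℝ) ^ (-(k / D : ℝ)) with hη
    have hη0 : 0 < η := by positivity
    have hηD : η ^ D = (2 ^ k)⁻¹ := by
      rw [hη, ← Real.rpow_natCast, ← Real.rpow_mul (by norm_num)]
      have : -((k : ℝ) / D) * D = -k := by field_simp
      rw [this, Real.rpow_neg (by norm_num), Real.rpow_natCast]
    have ht := tail_bound hD hf hpl h8 hη0
    rw [hηD, one_div, inv_inv] at ht
    calc _ ≤ cube n {x | 2 ^ k ≤ |f x|} := by
          refine measure_mono fun x hx => ?_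
          simp only [mem_ofPred_eq] at hx ⊢
          have h2 : (2 : ℝ≥0∞) ^ k = ENNReal.ofReal (2 ^ k) := by
            rw [ENNReal.ofReal_pow (by norm_num), ENNReal.ofReal_ofNat]
          rw [h2] at hx
          exact (ENNReal.ofReal_le_ofReal_iff (abs_nonneg _)).1 hx.le
      _ ≤ _ := ht
      _ = _ := by
          rw [mul_pow, mul_comm 3 D, pow_mul η, hηD, ← mul_assoc,
              ENNReal.ofReal_mul (by positivity), hC₀,
            mul_comm 3 D]
          congr 1
          rw [ENNReal.ofReal_pow (by positivity), ENNReal.ofReal_inv_of_pos (by positivity),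
            ENNReal.ofReal_pow (by norm_num), ENNReal.ofReal_ofNat, ENNReal.rpow_neg,
            show (2 : ℝ≥0∞) ^ (3 : ℝ) = 2 ^ 3 from ENNReal.rpow_natCast 2 3, ← ENNReal.inv_pow,
            ← ENNReal.inv_pow, ← pow_mul, ← pow_mul, mul_comm]

/-- Negative moments of a polynomial on the cube are controlled by its second moment. -/
lemma exists_lintegral_invRoot_rpow_le {D : ℕ} (hD : 1 ≤ D) {θ : ℝ} (h0 : 0 ≤ θ) (h1 : θ < 1) :
    ∃ C : ℝ≥0∞, C ≠ ∞ ∧ ∀ (n : ℕ) (f : (Fin n → ℝ) → ℝ), Measurable f → PolyOnLines D f →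
      ∫⁻ x, ENNReal.ofReal (f x ^ 2) ∂(cube n) ≠ ∞ →
      ∫⁻ x, invRoot D f x ^ θ ∂(cube n)
        ≤ C * (∫⁻ x, ENNReal.ofReal (f x ^ 2) ∂(cube n)) ^ (-(θ / (2 * D))) := by
  obtain ⟨C₁, hC₁, hsq⟩ := exists_lintegral_sq_le hD
  obtain ⟨C₂, hC₂, hsb⟩ := smallBall_of_lt_one hD h0 h1
  have hD0 : (0 : ℝ) < D := by positivity
  set κ : ℝ := C₁.toReal + 1 with hκ
  have hκ0 : 0 < κ := by positivity
  refine ⟨ENNReal.ofReal (κ ^ (θ / (2 * D))) * (C₂ + 1), by finiteness, ?_⟩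
  intro n f hf hpl hV
  set V := ∫⁻ x, ENNReal.ofReal (f x ^ 2) ∂(cube n) with hVdef
  by_cases hV0 : V = 0
  · rcases h0.eq_or_lt with h | h
    · subst h; simp
    · rw [hV0, ENNReal.zero_rpow_of_neg (by simp; positivity), ENNReal.mul_top]
      · exact le_top
      · have : 0 < ENNReal.ofReal (κ ^ (θ / (2 * D))) := ENNReal.ofReal_pos.2 (by positivity)
        exact mul_ne_zero this.ne' (by simp)
  have hVr : 0 < V.toReal := ENNReal.toReal_pos hV0 hV
  set ε := Real.sqrt (V.toReal / κ) with hε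
  have hε0 : 0 < ε := Real.sqrt_pos.2 (by positivity)
  have hε2 : ε ^ 2 = V.toReal / κ := Real.sq_sqrt (by positivity)
  have hg : 8⁻¹ ≤ cube n {x | 1 ≤ |ε⁻¹ * f x|} := by
    by_contra! hlt
    have hle := hsq n _ (hf.const_mul ε⁻¹) (hpl.const_mul _) hlt.le
    have e : ∫⁻ x, ENNReal.ofReal ((ε⁻¹ * f x) ^ 2) ∂(cube n) = ENNReal.ofReal κ := by
      have : ∀ x, ENNReal.ofReal ((ε⁻¹ * f x) ^ 2) =
          ENNReal.ofReal (ε⁻¹ ^ 2) * ENNReal.ofReal (f x ^ 2) :=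
        fun x => by rw [mul_pow, ENNReal.ofReal_mul (by positivity)]
      simp only [this]
      rw [lintegral_const_mul _ (by fun_prop), ← hVdef, ← ENNReal.ofReal_toReal hV,
          ← ENNReal.ofReal_mul (by positivity)]
      congr 1
      rw [inv_pow, hε2]; field_simp
    rw [e, ENNReal.ofReal_le_iff_le_toReal hC₁] at hle
    linarith
  have hinv : ∀ x, invRoot D f x =
      ENNReal.ofReal (ε ^ (-(1 / D : ℝ))) * invRoot D (fun x => ε⁻¹ * f x) x := by
    intro x
    have : |f x| = ε * |ε⁻¹ * f x| := by
      rw [abs_mul, abs_of_pos (inv_pos.2 hε0)]; field_simp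
    rw [invRoot, invRoot, this, ENNReal.ofReal_mul hε0.le,
        ENNReal.mul_rpow_of_ne_top ENNReal.ofReal_ne_top ENNReal.ofReal_ne_top,
      ENNReal.ofReal_rpow_of_pos hε0]
  calc ∫⁻ x, invRoot D f x ^ θ ∂(cube n)
      = ENNReal.ofReal (ε ^ (-(1 / D : ℝ))) ^ θ *
          ∫⁻ x, invRoot D (fun x => ε⁻¹ * f x) x ^ θ ∂(cube n) := by
        rw [← lintegral_const_mul _ ((measurable_invRoot (hf.const_mul _)).pow_const _)]
        refine lintegral_congr fun x => ?_
        rw [hinv, ENNReal.mul_rpow_of_nonneg _ _ h0]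
    _ ≤ ENNReal.ofReal (ε ^ (-(1 / D : ℝ))) ^ θ * (C₂ + 1) := by
        gcongr
        exact (hsb n _ (hf.const_mul _) (hpl.const_mul _) hg).trans le_self_add
    _ = _ := by
        rw [ENNReal.ofReal_rpow_of_pos (by positivity), ← ENNReal.ofReal_toReal hV,
          ENNReal.ofReal_rpow_of_pos hVr, mul_right_comm, ← ENNReal.ofReal_mul (by positivity)]
        congr 2
        rw [← Real.rpow_mul hε0.le, hε, Real.sqrt_eq_rpow, ← Real.rpow_mul (by positivity),
          show 1 / 2 * (-(1 / (D : ℝ)) * θ) = -(θ / (2 * D)) by field_simp,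
          Real.div_rpow hVr.le hκ0.le, Real.rpow_neg hκ0.le]
        field_simp

lemma cube_eq_restrict (n : ℕ) : cube n = volume.restrict (univ.pi fun _ => Icc (0 : ℝ) 1) := by
  rw [cube, volume_pi, Measure.restrict_pi_pi]; rfl

lemma integrable_cube_of_continuous {n : ℕ} {f : (Fin n → ℝ) → ℝ} (hf : Continuous f) :
    Integrable f (cube n) := by
  rw [cube_eq_restrict]
  exact hf.continuousOn.integrableOn_compact (isCompact_univ_pi fun _ => isCompact_Icc)

lemma integrable_unif_of_continuous {f : ℝ → ℝ} (hf : Continuous f) : Integrable f unif :=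
  hf.continuousOn.integrableOn_compact isCompact_Icc

/-- The coefficient functional is represented by a polynomial in `L²[0,1]`. -/
lemma exists_coeff_representer (k : ℕ) : ∃ l : Polynomial ℝ, l.natDegree ≤ k ∧
    ∀ q : Polynomial ℝ, q.natDegree ≤ k → ∫ x, q.eval x * l.eval x ∂unif = q.coeff k := by
  have hinteg : ∀ p q : Polynomial ℝ, Integrable (fun x => p.eval x * q.eval x) unif :=
    fun p q => integrable_unif_of_continuous (by fun_prop)
  let V := Polynomial.degreeLT ℝ (k + 1)
  let B : V →ₗ[ℝ] Module.Dual ℝ V := LinearMap.mk₂ ℝ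
    (fun p q => ∫ x, (q : Polynomial ℝ).eval x * (p : Polynomial ℝ).eval x ∂unif)
    (fun a b c => by
      simp only [Submodule.coe_add, Polynomial.eval_add, mul_add]
      exact integral_add (hinteg _ _) (hinteg _ _))
    (fun a b c => by
      simp only [Submodule.coe_smul, Polynomial.eval_smul, smul_eq_mul]
      rw [← integral_const_mul]; congr 1; ext x; ring)
    (fun a b c => by
      simp only [Submodule.coe_add, Polynomial.eval_add, add_mul]
      exact integral_add (hinteg _ _) (hinteg _ _))
    (fun a b c => by
      simp only [Submodule.coe_smul, Polynomial.eval_smul, smul_eq_mul]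
      rw [← integral_const_mul]; congr 1; ext x; ring)
  have hinj : Function.Injective B := by
    rw [injective_iff_map_eq_zero]
    intro p hp
    have h0 : ∫ x, (p : Polynomial ℝ).eval x * (p : Polynomial ℝ).eval x ∂unif = 0 := by
      have := LinearMap.congr_fun hp p
      simpa [B] using this
    rw [integral_eq_zero_iff_of_nonneg (fun x => mul_self_nonneg _) (hinteg _ _)] at h0
    have h1 : ∀ᵐ x ∂unif, (p : Polynomial ℝ).eval x = 0 := by
      filter_upwards [h0] with x hx
      exact mul_self_eq_zero.1 hx
    have h2 : (p : Polynomial ℝ) = 0 := by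
      refine Polynomial.eq_zero_of_infinite_isRoot _ fun hfin => ?_
      have h3 : unif {x | (p : Polynomial ℝ).IsRoot x} = 1 := by
        rw [prob_compl_eq_zero_iff hfin.measurableSet |>.symm]
        exact h1
      rw [hfin.measure_zero] at h3
      exact zero_ne_one h3
    exact Subtype.ext h2
  have hfd : FiniteDimensional ℝ V := by
    change FiniteDimensional ℝ (Polynomial.degreeLT ℝ (k + 1))
    exact Module.Finite.equiv (Polynomial.degreeLTEquiv ℝ (k + 1)).symm
  have hsurj : Function.Surjective B :=
    (LinearMap.injective_iff_surjective_of_finrank_eq_finrank Subspace.dual_finrank_eq.symm).1 hinj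
  obtain ⟨l, hl⟩ := hsurj ((Polynomial.lcoeff ℝ k).comp V.subtype)
  have hmem : ∀ q : Polynomial ℝ, q ∈ V ↔ q.natDegree ≤ k := by
    intro q
    rw [Polynomial.mem_degreeLT, Polynomial.natDegree_le_iff_degree_le,
      Polynomial.degree_lt_iff_coeff_zero, Polynomial.degree_le_iff_coeff_zero]
    exact ⟨fun h m hm => h m (by exact_mod_cast hm), fun h m hm => h m (by exact_mod_cast hm)⟩
  refine ⟨l, (hmem _).1 l.2, fun q hq => ?_⟩
  have := LinearMap.congr_fun hl ⟨q, (hmem q).2 hq⟩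
  simpa [B] using this

/-- A choice of polynomials dual to the monomials in `L²[0,1]`. -/
def dualPoly (k : ℕ) : Polynomial ℝ := (exists_coeff_representer k).choose

lemma dualPoly_natDegree_le (k : ℕ) : (dualPoly k).natDegree ≤ k :=
  (exists_coeff_representer k).choose_spec.1

lemma integral_mul_dualPoly {k : ℕ} {q : Polynomial ℝ} (hq : q.natDegree ≤ k) :
    ∫ x, q.eval x * (dualPoly k).eval x ∂unif = q.coeff k :=
  (exists_coeff_representer k).choose_spec.2 q hq

lemma dualPoly_zero : dualPoly 0 = 1 := by
  have h1 := Polynomial.eq_C_of_natDegree_le_zero (dualPoly_natDegree_le 0)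
  have h2 := integral_mul_dualPoly (k := 0) (q := 1) (by simp)
  rw [h1] at h2 ⊢
  simp at h2
  simp [h2]

/-- Squared norm of the dual polynomial. -/
def dualNorm (k : ℕ) : ℝ := ∫ x, (dualPoly k).eval x * (dualPoly k).eval x ∂unif

lemma dualNorm_nonneg (k : ℕ) : 0 ≤ dualNorm k := integral_nonneg fun _ => mul_self_nonneg _

lemma exists_dualNorm_le (D : ℕ) : ∃ Λ : ℝ, 1 ≤ Λ ∧ ∀ k ≤ D, dualNorm k ≤ Λ ^ k := by
  refine ⟨1 + ∑ k ∈ Finset.range (D + 1), dualNorm k, ?_, fun k hk => ?_⟩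
  · linarith [Finset.sum_nonneg fun k (_ : k ∈ Finset.range (D + 1)) => dualNorm_nonneg k]
  · rcases Nat.eq_zero_or_pos k with rfl | h
    · simp [dualNorm, dualPoly_zero]
    · have h1 : dualNorm k ≤ ∑ k ∈ Finset.range (D + 1), dualNorm k :=
        Finset.single_le_sum (fun k _ => dualNorm_nonneg k) (Finset.mem_range.2 (by omega))
      have h0 : 0 ≤ ∑ k ∈ Finset.range (D + 1), dualNorm k :=
        Finset.sum_nonneg fun k _ => dualNorm_nonneg k
      calc dualNorm k ≤ 1 + ∑ k ∈ Finset.range (D + 1), dualNorm k := by linarith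
        _ ≤ _ := le_self_pow₀ (by linarith) h.ne'

/-- Product of dual polynomials. -/
def dualProd {n : ℕ} (I : Fin n →₀ ℕ) (z : Fin n → ℝ) : ℝ :=
  ∏ i, (dualPoly (I i)).eval (z i)

lemma continuous_dualProd {n : ℕ} (I : Fin n →₀ ℕ) : Continuous (dualProd I) := by
  unfold dualProd; fun_prop

lemma exists_lt_of_sum_le {n : ℕ} {I J : Fin n →₀ ℕ} (h : ∑ i, J i ≤ ∑ i, I i) (hne : J ≠ I) :
    ∃ i, J i < I i := by
  by_contra! hcon
  apply hne
  ext i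
  have := (Finset.sum_eq_sum_iff_of_le (fun i (_ : i ∈ Finset.univ) => hcon i)).1
    (le_antisymm (Finset.sum_le_sum fun i _ => hcon i) h) i (Finset.mem_univ i)
  exact this.symm

lemma integral_cube_prod {n : ℕ} (u : Fin n → ℝ → ℝ) :
    ∫ z, ∏ i, u i (z i) ∂(cube n) = ∏ i, ∫ x, u i x ∂unif := by
  unfold cube; exact integral_fintype_prod_eq_prod u

lemma integral_dualProd_mul {n : ℕ} {I J : Fin n →₀ ℕ} (h : ∑ i, J i = ∑ i, I i) (hne : J ≠ I) :
    ∫ z, dualProd J z * dualProd I z ∂(cube n) = 0 := by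
  obtain ⟨i, hi⟩ := exists_lt_of_sum_le h.le hne
  simp only [dualProd, ← Finset.prod_mul_distrib]
  rw [integral_cube_prod fun i x => (dualPoly (J i)).eval x * (dualPoly (I i)).eval x]
  refine Finset.prod_eq_zero (Finset.mem_univ i) ?_
  have hd := dualPoly_natDegree_le (J i)
  rw [integral_mul_dualPoly (hd.trans hi.le)]
  exact Polynomial.coeff_eq_zero_of_natDegree_lt (by omega)

lemma integral_dualProd_sq {n : ℕ} (I : Fin n →₀ ℕ) :
    ∫ z, dualProd I z * dualProd I z ∂(cube n) = ∏ i, dualNorm (I i) := by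
  simp only [dualProd, ← Finset.prod_mul_distrib]
  rw [integral_cube_prod fun i x => (dualPoly (I i)).eval x * (dualPoly (I i)).eval x]
  rfl

lemma integral_affine_pow_mul_dualPoly {c b : ℝ} {j k : ℕ} (h : j ≤ k) :
    ∫ x, (c + b * x) ^ j * (dualPoly k).eval x ∂unif = if j = k then b ^ k else 0 := by
  set q : Polynomial ℝ := (Polynomial.C b * Polynomial.X + Polynomial.C c) with hq
  have hqd : q.natDegree ≤ 1 := Polynomial.natDegree_linear_le
  have he : ∀ x, (c + b * x) ^ j = (q ^ j).eval x := fun x => by simp [hq]; ring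
  have hd : (q ^ j).natDegree ≤ j := by
    calc _ ≤ j * q.natDegree := Polynomial.natDegree_pow_le
      _ ≤ j * 1 := by gcongr
      _ = j := mul_one j
  simp only [he]
  rw [integral_mul_dualPoly (hd.trans h)]
  split_ifs with hjk
  · subst hjk
    have := Polynomial.coeff_pow_of_natDegree_le (m := j) hqd
    rw [mul_one] at this
    rw [this]; simp [hq]
  · exact Polynomial.coeff_eq_zero_of_natDegree_lt (by omega)

lemma integral_affine_mul_dualProd {n D : ℕ} {g : MvPolynomial (Fin n) ℝ}
    (hg : ∀ J ∈ g.support, ∑ i, J i ≤ D) {I : Fin n →₀ ℕ} (hI : ∑ i, I i = D) (c b : Fin n → ℝ) :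
    ∫ z, MvPolynomial.eval (fun i => c i + b i * z i) g * dualProd I z ∂(cube n)
      = g.coeff I * ∏ i, b i ^ I i := by
  have hterm : ∀ J : Fin n →₀ ℕ, ∑ i, J i ≤ D →
      ∫ z, (∏ i, (c i + b i * z i) ^ J i) * dualProd I z ∂(cube n)
        = if J = I then ∏ i, b i ^ I i else 0 := by
    intro J hJ
    simp only [dualProd, ← Finset.prod_mul_distrib]
    rw [integral_cube_prod fun i x => (c i + b i * x) ^ J i * (dualPoly (I i)).eval x]
    split_ifs with h
    · subst h
      exact Finset.prod_congr rfl fun i _ => by rw [integral_affine_pow_mul_dualPoly le_rfl]; simp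
    · obtain ⟨i, hi⟩ := exists_lt_of_sum_le (hJ.trans hI.ge) h
      refine Finset.prod_eq_zero (Finset.mem_univ i) ?_
      rw [integral_affine_pow_mul_dualPoly hi.le, if_neg hi.ne]
  simp only [MvPolynomial.eval_eq', Finset.sum_mul, mul_assoc]
  rw [integral_finsetSum]
  · simp only [integral_const_mul]
    rw [Finset.sum_congr rfl fun J hJ => by rw [hterm J (hg J hJ)]]
    simp only [mul_ite, mul_zero]
    rw [Finset.sum_ite_eq']
    split_ifs with h
    · rfl
    · rw [MvPolynomial.notMem_support_iff.1 h, zero_mul]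
  · intro J _
    refine integrable_cube_of_continuous ?_
    have := continuous_dualProd I
    fun_prop

/-- Second moments over boxes dominate the weighted top-degree coefficients. -/
lemma exists_integral_sq_ge (D : ℕ) : ∃ κ : ℝ, 0 < κ ∧ ∀ (n : ℕ) (g : MvPolynomial (Fin n) ℝ),
    (∀ J ∈ g.support, ∑ i, J i ≤ D) → ∀ (T : Finset (Fin n →₀ ℕ)), (∀ I ∈ T, ∑ i, I i = D) →
    ∀ c b : Fin n → ℝ, κ * ∑ I ∈ T, (g.coeff I * ∏ i, b i ^ I i) ^ 2
      ≤ ∫ z, MvPolynomial.eval (fun i => c i + b i * z i) g ^ 2 ∂(cube n) := by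
  obtain ⟨Λ, hΛ, hN⟩ := exists_dualNorm_le D
  have hΛ0 : 0 < Λ ^ D := by positivity
  refine ⟨(Λ ^ D)⁻¹, by positivity, ?_⟩
  intro n g hg T hT c b
  set G : (Fin n → ℝ) → ℝ := fun z => MvPolynomial.eval (fun i => c i + b i * z i) g with hG
  have hGc : Continuous G := by
    simp only [hG, MvPolynomial.eval_eq']; fun_prop
  set a : (Fin n →₀ ℕ) → ℝ := fun I => g.coeff I * ∏ i, b i ^ I i with ha
  set θ := (Λ ^ D)⁻¹ with hθ
  set H : (Fin n → ℝ) → ℝ := fun z => ∑ I ∈ T, a I * dualProd I z with hH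
  have hHc : Continuous H := by
    have := fun I : Fin n →₀ ℕ => continuous_dualProd I
    simp only [hH]; fun_prop
  have hGI : ∀ I ∈ T, ∫ z, G z * dualProd I z ∂(cube n) = a I := fun I hI =>
    integral_affine_mul_dualProd hg (hT I hI) c b
  have hinteg : ∀ I, Integrable (fun z => G z * dualProd I z) (cube n) := fun I =>
    integrable_cube_of_continuous (hGc.mul (continuous_dualProd I))
  have hint2 : ∀ I J : Fin n →₀ ℕ, Integrable (fun z => dualProd I z * dualProd J z) (cube n) :=
      fun I J =>
    integrable_cube_of_continuous ((continuous_dualProd I).mul (continuous_dualProd J))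
  have hGH : ∫ z, G z * H z ∂(cube n) = ∑ I ∈ T, a I ^ 2 := by
    have : ∀ z, G z * H z = ∑ I ∈ T, a I * (G z * dualProd I z) := fun z => by
      simp only [hH, Finset.mul_sum]; exact Finset.sum_congr rfl fun _ _ => by ring
    simp only [this]
    rw [integral_finsetSum _ fun I _ => (hinteg I).const_mul _]
    refine Finset.sum_congr rfl fun I hI => ?_
    rw [integral_const_mul, hGI I hI, sq]
  have hHH : ∫ z, H z * H z ∂(cube n) ≤ Λ ^ D * ∑ I ∈ T, a I ^ 2 := by
    have : ∀ z, H z * H z = ∑ I ∈ T, ∑ J ∈ T, a I * a J * (dualProd I z * dualProd J z) :=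
        fun z => by
      simp only [hH, Finset.sum_mul_sum]
      exact Finset.sum_congr rfl fun _ _ => Finset.sum_congr rfl fun _ _ => by ring
    simp only [this]
    rw [integral_finsetSum _ fun I _ => integrable_finsetSum _ fun J _ => (hint2 I J).const_mul _,
      Finset.mul_sum]
    refine Finset.sum_le_sum fun I hI => ?_
    rw [integral_finsetSum _ fun J _ => (hint2 I J).const_mul _, Finset.sum_eq_single I]
    · rw [integral_const_mul, integral_dualProd_sq, mul_comm, ← sq]
      gcongr
      calc ∏ i, dualNorm (I i) ≤ ∏ i, Λ ^ I i := Finset.prod_le_prod (fun i _ => dualNorm_nonneg _)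
            fun i _ => hN _ ((Finset.single_le_sum (fun _ _ => Nat.zero_le _)
                (Finset.mem_univ i)).trans_eq (hT I hI))
        _ = Λ ^ D := by rw [Finset.prod_pow_eq_pow_sum, hT I hI]
    · intro J hJ hne
      rw [integral_const_mul, integral_dualProd_mul ((hT I hI).trans (hT J hJ).symm) hne.symm,
          mul_zero]
    · exact fun h => absurd hI h
  have hGGi : Integrable (fun z => G z ^ 2) (cube n) := integrable_cube_of_continuous (by fun_prop)
  have hGHi : Integrable (fun z => G z * H z) (cube n) :=
      integrable_cube_of_continuous (by fun_prop)
  have hHHi : Integrable (fun z => H z * H z) (cube n) :=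
      integrable_cube_of_continuous (by fun_prop)
  have hexp : ∫ z, (G z - θ * H z) ^ 2 ∂(cube n)
      = ∫ z, G z ^ 2 ∂(cube n) - 2 * θ * ∫ z, G z * H z ∂(cube n) +
          θ ^ 2 * ∫ z, H z * H z ∂(cube n) := by
    have : ∀ z, (G z - θ * H z) ^ 2 = G z ^ 2 - 2 * θ * (G z * H z) + θ ^ 2 * (H z * H z) :=
        fun z => by ring
    simp only [this]
    have hs : Integrable (fun z => G z ^ 2 - 2 * θ * (G z * H z)) (cube n) :=
      hGGi.sub (hGHi.const_mul _)
    rw [integral_add hs (hHHi.const_mul _), integral_sub hGGi (hGHi.const_mul _),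
      integral_const_mul, integral_const_mul]
  have h0 : 0 ≤ ∫ z, (G z - θ * H z) ^ 2 ∂(cube n) := integral_nonneg fun z => sq_nonneg _
  rw [hexp, hGH] at h0
  have h1 : θ ^ 2 * ∫ z, H z * H z ∂(cube n) ≤ θ * ∑ I ∈ T, a I ^ 2 := by
    calc θ ^ 2 * ∫ z, H z * H z ∂(cube n) ≤ θ ^ 2 * (Λ ^ D * ∑ I ∈ T, a I ^ 2) := by gcongr
      _ = _ := by rw [hθ]; field_simp
  linarith

/-- Integration by parts for an oscillatory integral whose phase has increasing derivative
bounded below by `k`. -/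
lemma norm_integral_exp_le_of_deriv_ge {F F' F'' : ℝ → ℝ} {a b k : ℝ} (hab : a ≤ b) (hk : 0 < k)
    (hF : ∀ s ∈ Icc a b, HasDerivAt F (F' s) s) (hF' : ∀ s ∈ Icc a b, HasDerivAt F' (F'' s) s)
    (hc : ContinuousOn F'' (Icc a b)) (h1 : ∀ s ∈ Icc a b, k ≤ F' s)
    (h2 : ∀ s ∈ Icc a b, 0 ≤ F'' s) :
    ‖∫ s in a..b, Complex.exp (Complex.I * F s)‖ ≤ 2 / k := by
  have hu : uIcc a b = Icc a b := uIcc_of_le hab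
  have hpos : ∀ s ∈ Icc a b, 0 < F' s := fun s hs => hk.trans_le (h1 s hs)
  have hne : ∀ s ∈ Icc a b, (F' s : ℂ) ≠ 0 := fun s hs => by exact_mod_cast (hpos s hs).ne'
  have hF'c : ContinuousOn F' (Icc a b) := fun s hs => (hF' s hs).continuousAt.continuousWithinAt
  have hFc : ContinuousOn F (Icc a b) := fun s hs => (hF s hs).continuousAt.continuousWithinAt
  have hU : ∀ s ∈ uIcc a b, HasDerivAt (fun s => ((F' s)⁻¹ : ℝ) * (-Complex.I : ℂ))
      (((-F'' s / F' s ^ 2 : ℝ)) * (-Complex.I : ℂ)) s := fun s hs => by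
    rw [hu] at hs
    exact (((hF' s hs).inv (hpos s hs).ne').ofReal_comp).mul_const _
  have hV : ∀ s ∈ uIcc a b, HasDerivAt (fun s => Complex.exp (Complex.I * F s))
      (Complex.exp (Complex.I * F s) * (Complex.I * (F' s : ℂ))) s := fun s hs => by
    rw [hu] at hs
    exact ((hF s hs).ofReal_comp.const_mul Complex.I).cexp
  have hE : ContinuousOn (fun s => Complex.exp (Complex.I * F s)) (Icc a b) := by fun_prop
  have hq : ContinuousOn (fun s => -F'' s / F' s ^ 2) (Icc a b) :=
    hc.neg.div (hF'c.pow 2) fun s hs => (pow_pos (hpos s hs) 2).ne'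
  have hU' : IntervalIntegrable
      (fun s => (((-F'' s / F' s ^ 2 : ℝ)) * (-Complex.I : ℂ))) volume a b := by
    apply ContinuousOn.intervalIntegrable
    rw [hu]
    fun_prop
  have hV' : IntervalIntegrable
      (fun s => Complex.exp (Complex.I * F s) * (Complex.I * (F' s : ℂ))) volume a b := by
    apply ContinuousOn.intervalIntegrable
    rw [hu]
    fun_prop
  have hparts := intervalIntegral.integral_mul_deriv_eq_deriv_mul hU hV hU' hV'
  have hLHS : ∫ s in a..b, Complex.exp (Complex.I * F s)
      = ∫ s in a..b, (((F' s)⁻¹ : ℝ) * (-Complex.I : ℂ)) *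
        (Complex.exp (Complex.I * F s) * (Complex.I * (F' s : ℂ))) := by
    refine intervalIntegral.integral_congr fun s hs => ?_
    rw [hu] at hs
    have := hne s hs
    push_cast
    field_simp
    rw [Complex.I_sq]
    ring
  have hexp : ∀ s, ‖Complex.exp (Complex.I * F s)‖ = 1 := fun s => by
    rw [mul_comm]; exact Complex.norm_exp_ofReal_mul_I _
  have hinv : ∀ s ∈ Icc a b, ‖(((F' s)⁻¹ : ℝ) * (-Complex.I : ℂ)) * Complex.exp (Complex.I * F s)‖
      = (F' s)⁻¹ := fun s hs => by
    rw [norm_mul, hexp, norm_mul, Complex.norm_real, norm_neg, Complex.norm_I, mul_one, mul_one,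
      Real.norm_of_nonneg (inv_nonneg.2 (hpos s hs).le)]
  have hinteg : ‖∫ s in a..b, (((-F'' s / F' s ^ 2 : ℝ)) * (-Complex.I : ℂ)) *
      Complex.exp (Complex.I * F s)‖ ≤ (F' a)⁻¹ - (F' b)⁻¹ := by
    have hder : ∀ s ∈ uIcc a b, HasDerivAt (fun s => -(F' s)⁻¹) (-(-F'' s / F' s ^ 2)) s :=
      fun s hs => by
        rw [hu] at hs
        exact ((hF' s hs).inv (hpos s hs).ne').neg
    have hi : IntervalIntegrable (fun s => -(-F'' s / F' s ^ 2)) volume a b := by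
      apply ContinuousOn.intervalIntegrable
      rw [hu]
      exact hq.neg
    have hft := intervalIntegral.integral_eq_sub_of_hasDerivAt hder hi
    refine (intervalIntegral.norm_integral_le_of_norm_le hab ?_ hi).trans_eq (by rw [hft]; ring)
    refine ae_of_all _ fun s hs => ?_
    have hs' : s ∈ Icc a b := Ioc_subset_Icc_self hs
    rw [norm_mul, hexp, norm_mul, Complex.norm_real, norm_neg, Complex.norm_I, mul_one, mul_one,
      neg_div, neg_neg, norm_neg,
      Real.norm_of_nonneg (div_nonneg (h2 s hs') (sq_nonneg _))]
  have ha : a ∈ Icc a b := ⟨le_rfl, hab⟩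
  have hb : b ∈ Icc a b := ⟨hab, le_rfl⟩
  rw [hLHS, hparts]
  refine (norm_sub_le _ _).trans ?_
  have h3 := norm_sub_le ((((F' b)⁻¹ : ℝ) * (-Complex.I : ℂ)) * Complex.exp (Complex.I * F b))
    ((((F' a)⁻¹ : ℝ) * (-Complex.I : ℂ)) * Complex.exp (Complex.I * F a))
  rw [hinv b hb, hinv a ha] at h3
  have h4 : (F' a)⁻¹ ≤ k⁻¹ := inv_anti₀ hk (h1 a ha)
  rw [show 2 / k = 2 * k⁻¹ from rfl]
  linarith

lemma norm_integral_exp_le_of_convex {F F' F'' : ℝ → ℝ} {a b ω : ℝ} (hab : a ≤ b) (hω0 : 0 < ω)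
    (hF : ∀ s ∈ Icc a b, HasDerivAt F (F' s) s) (hF' : ∀ s ∈ Icc a b, HasDerivAt F' (F'' s) s)
    (hc : ContinuousOn F'' (Icc a b)) (h1 : ∀ s ∈ Icc a b, 0 ≤ F' s)
    (h2 : ∀ s ∈ Icc a b, 0 ≤ F'' s)
    (hω : ∀ c, volume {s | s ∈ Icc a b ∧ |F s - c| ≤ 1} ≤ ENNReal.ofReal ω) :
    ‖∫ s in a..b, Complex.exp (Complex.I * F s)‖ ≤ 3 * ω := by
  have hexp : ∀ s, ‖Complex.exp (Complex.I * F s)‖ = 1 := fun s => by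
    rw [mul_comm]; exact Complex.norm_exp_ofReal_mul_I _
  have hFc : ContinuousOn F (Icc a b) := fun s hs => (hF s hs).continuousAt.continuousWithinAt
  have ha : a ∈ Icc a b := ⟨le_rfl, hab⟩
  have hmonoF : MonotoneOn F (Icc a b) := by
    refine monotoneOn_of_deriv_nonneg (convex_Icc a b) hFc
      (fun s hs => (hF s (interior_subset hs)).differentiableAt.differentiableWithinAt)
          fun s hs => ?_
    rw [(hF s (interior_subset hs)).deriv]
    exact h1 s (interior_subset hs)
  have hmonoF' : MonotoneOn F' (Icc a b) := by
    refine monotoneOn_of_deriv_nonneg (convex_Icc a b)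
      (fun s hs => (hF' s hs).continuousAt.continuousWithinAt)
      (fun s hs => (hF' s (interior_subset hs)).differentiableAt.differentiableWithinAt)
          fun s hs => ?_
    rw [(hF' s (interior_subset hs)).deriv]
    exact h2 s (interior_subset hs)
  have hlen : ∀ s1 ∈ Icc a b, F s1 ≤ F a + 1 → s1 - a ≤ ω := fun s1 hs1 hle => by
    have hsub : Icc a s1 ⊆ {s | s ∈ Icc a b ∧ |F s - F a| ≤ 1} := fun s hs => by
      have hs' : s ∈ Icc a b := ⟨hs.1, hs.2.trans hs1.2⟩
      have h3 := hmonoF ha hs' hs.1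
      have h4 := hmonoF hs' hs1 hs.2
      exact ⟨hs', by rw [abs_of_nonneg (by linarith)]; linarith⟩
    have := (measure_mono hsub).trans (hω (F a))
    rw [Real.volume_Icc] at this
    exact (ENNReal.ofReal_le_ofReal_iff hω0.le).1 this
  have hshort : ∀ s1 ∈ Icc a b, s1 - a ≤ ω → ‖∫ s in a..s1, Complex.exp (Complex.I * F s)‖ ≤ ω :=
    fun s1 hs1 hle => by
      refine (intervalIntegral.norm_integral_le_of_norm_le_const (C := 1)
          fun s _ => (hexp s).le).trans ?_
      rwa [one_mul, abs_of_nonneg (by linarith [hs1.1])]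
  by_cases hcase : F b ≤ F a + 1
  · have hb : b ∈ Icc a b := ⟨hab, le_rfl⟩
    linarith [hshort b hb (hlen b hb hcase)]
  · obtain ⟨s1, hs1, hs1F⟩ : F a + 1 ∈ F '' Icc a b :=
      intermediate_value_Icc hab hFc ⟨by linarith, (not_le.1 hcase).le⟩
    have hlen1 := hlen s1 hs1 hs1F.le
    have has1 : a < s1 := by
      rcases hs1.1.lt_or_eq with h | h
      · exact h
      · rw [← h] at hs1F; linarith
    have hsub1 : Icc a s1 ⊆ Icc a b := Icc_subset_Icc_right hs1.2
    have hsub2 : Icc s1 b ⊆ Icc a b := Icc_subset_Icc_left hs1.1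
    obtain ⟨ξ, hξ, hξe⟩ := exists_hasDerivAt_eq_slope F F' has1 (hFc.mono hsub1)
      fun s hs => hF s (hsub1 (Ioo_subset_Icc_self hs))
    have hk : ω⁻¹ ≤ F' s1 := by
      have h3 : F' ξ ≤ F' s1 := hmonoF' (hsub1 (Ioo_subset_Icc_self hξ)) hs1 hξ.2.le
      rw [hξe, hs1F, add_sub_cancel_left, one_div] at h3
      exact (inv_anti₀ (by linarith) hlen1).trans h3
    have h4 := norm_integral_exp_le_of_deriv_ge hs1.2 (inv_pos.2 hω0) (fun s hs => hF s (hsub2 hs))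
      (fun s hs => hF' s (hsub2 hs)) (hc.mono hsub2)
      (fun s hs => hk.trans (hmonoF' hs1 (hsub2 hs) hs.1)) (fun s hs => h2 s (hsub2 hs))
    rw [div_inv_eq_mul] at h4
    have hE : ContinuousOn (fun s => Complex.exp (Complex.I * F s)) (Icc a b) := by fun_prop
    rw [← intervalIntegral.integral_add_adjacent_intervals (b := s1)
      ((hE.mono (by rw [uIcc_of_le hs1.1]; exact hsub1)).intervalIntegrable)
      ((hE.mono (by rw [uIcc_of_le hs1.2]; exact hsub2)).intervalIntegrable)]
    refine (norm_add_le _ _).trans ?_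
    linarith [hshort s1 hs1 hlen1]

lemma norm_integral_exp_neg (F : ℝ → ℝ) (a b : ℝ) :
    ‖∫ s in a..b, Complex.exp (Complex.I * (-F s : ℝ))‖
      = ‖∫ s in a..b, Complex.exp (Complex.I * F s)‖ := by
  have : ∀ s, Complex.exp (Complex.I * (-F s : ℝ))
      = (starRingEnd ℂ) (Complex.exp (Complex.I * F s)) := fun s => by
    rw [← Complex.exp_conj]
    simp
  simp only [this, intervalIntegral.intervalIntegral_eq_integral_uIoc, norm_smul]
  rw [integral_conj, RCLike.norm_conj]

lemma norm_integral_exp_le_of_signs {F F' F'' : ℝ → ℝ} {a b ω : ℝ} (hab : a ≤ b) (hω0 : 0 < ω)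
    (hF : ∀ s ∈ Icc a b, HasDerivAt F (F' s) s) (hF' : ∀ s ∈ Icc a b, HasDerivAt F' (F'' s) s)
    (hc : ContinuousOn F'' (Icc a b))
    (h1 : (∀ s ∈ Icc a b, 0 ≤ F' s) ∨ (∀ s ∈ Icc a b, F' s ≤ 0))
    (h2 : (∀ s ∈ Icc a b, 0 ≤ F'' s) ∨ (∀ s ∈ Icc a b, F'' s ≤ 0))
    (hω : ∀ c, volume {s | s ∈ Icc a b ∧ |F s - c| ≤ 1} ≤ ENNReal.ofReal ω) :
    ‖∫ s in a..b, Complex.exp (Complex.I * F s)‖ ≤ 3 * ω := by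
  wlog h2' : ∀ s ∈ Icc a b, 0 ≤ F'' s generalizing F F' F''
  · rw [← norm_integral_exp_neg]
    have h2n := h2.resolve_left h2'
    refine this (F := fun s => -F s) (F' := fun s => -F' s) (F'' := fun s => -F'' s)
      (fun s hs => (hF s hs).neg) (fun s hs => (hF' s hs).neg) hc.neg ?_
      (Or.inl fun s hs => neg_nonneg.2 (h2n s hs)) (fun c => ?_)
      (fun s hs => neg_nonneg.2 (h2n s hs))
    · rcases h1 with h | h
      · exact Or.inr fun s hs => neg_nonpos.2 (h s hs)
      · exact Or.inl fun s hs => neg_nonneg.2 (h s hs)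
    · have hset : ∀ s, |(-F s) - c| = |F s - -c| := fun s => by rw [← abs_neg]; ring_nf
      simpa only [hset] using hω (-c)
  rcases h1 with h1 | h1
  · exact norm_integral_exp_le_of_convex hab hω0 hF hF' hc h1 h2' hω
  · have hr : ∀ s ∈ Icc a b, a + b - s ∈ Icc a b :=
        fun s hs => ⟨by linarith [hs.2], by linarith [hs.1]⟩
    have hrd : ∀ s : ℝ, HasDerivAt (fun s => a + b - s) (-1) s := fun s => by
      simpa using (hasDerivAt_id s).const_sub (a + b)
    have hI : ∫ s in a..b, Complex.exp (Complex.I * F (a + b - s))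
        = ∫ s in a..b, Complex.exp (Complex.I * F s) := by
      rw [intervalIntegral.integral_comp_sub_left (fun s => Complex.exp (Complex.I * F s)) (a + b)]
      simp
    rw [← hI]
    refine norm_integral_exp_le_of_convex (F := fun s => F (a + b - s))
      (F' := fun s => -F' (a + b - s)) (F'' := fun s => F'' (a + b - s)) hab hω0 (fun s hs => ?_)
      (fun s hs => ?_) ?_ (fun s hs => neg_nonneg.2 (h1 _ (hr s hs))) (fun s hs => h2' _ (hr s hs))
      fun c => ?_
    · simpa [Function.comp_def] using (hF _ (hr s hs)).comp s (hrd s)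
    · simpa [Function.comp_def, Pi.neg_def] using ((hF' _ (hr s hs)).comp s (hrd s)).neg
    · exact hc.comp (by fun_prop) hr
    · have hmp : MeasurePreserving (fun s : ℝ => a + b - s) volume volume :=
        Measure.measurePreserving_sub_left volume (a + b)
      refine le_trans (le_of_eq ?_) (hω c)
      have hms : MeasurableSet {s | s ∈ Icc a b ∧ |F s - c| ≤ 1} := by
        have hFc : ContinuousOn F (Icc a b) := fun s hs => (hF s hs).continuousAt.continuousWithinAt
        have : {s | s ∈ Icc a b ∧ |F s - c| ≤ 1} = Icc a b ∩ (fun s => |F s - c|) ⁻¹' Iic 1 := rfl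
        rw [this]
        exact ((show ContinuousOn (fun s => |F s - c|)
            (Icc a b) by fun_prop).preimage_isClosed_of_isClosed
          isClosed_Icc isClosed_Iic).measurableSet
      rw [← hmp.measure_preimage hms.nullMeasurableSet]
      congr 1
      ext s
      simp only [Set.mem_ofPred_eq, mem_preimage, mem_Icc]
      constructor
      · rintro ⟨⟨h, h'⟩, h''⟩; exact ⟨⟨by linarith, by linarith⟩, h''⟩
      · rintro ⟨⟨h, h'⟩, h''⟩; exact ⟨⟨by linarith, by linarith⟩, h''⟩

lemma eval_sign_of_no_roots (r : Polynomial ℝ) {a b : ℝ} (h : ∀ x ∈ Ioo a b, x ∉ r.roots) :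
    (∀ s ∈ Icc a b, 0 ≤ r.eval s) ∨ (∀ s ∈ Icc a b, r.eval s ≤ 0) := by
  rcases eq_or_ne r 0 with rfl | hr
  · simp
  rcases le_or_gt b a with hba | hab
  · rcases le_total 0 (r.eval a) with h0 | h0
    · refine Or.inl fun s hs => ?_
      rwa [le_antisymm (hs.2.trans hba) hs.1]
    · refine Or.inr fun s hs => ?_
      rwa [le_antisymm (hs.2.trans hba) hs.1]
  by_contra hcon
  rw [not_or] at hcon
  obtain ⟨h1, h2⟩ := hcon
  have hcl : closure (Ioo a b) = Icc a b := closure_Ioo hab.ne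
  have key : ∀ {f : ℝ → ℝ}, Continuous f → (¬ ∀ s ∈ Icc a b, 0 ≤ f s) → ∃ x ∈ Ioo a b, f x < 0 := by
    intro f hf hn
    by_contra! hall
    refine hn fun s hs => ?_
    rw [← hcl] at hs
    exact closure_minimal (s := Ioo a b) (t := {s | 0 ≤ f s}) hall
        (isClosed_le continuous_const hf) hs
  obtain ⟨x, hx, hxr⟩ := key r.continuous h1
  obtain ⟨y, hy, hyr⟩ := key r.continuous.neg (by simpa using h2)
  have hc : IsPreconnected (Ioo a b) := isPreconnected_Ioo
  obtain ⟨z, hz, hz0⟩ := hc.intermediate_value hx hy r.continuous.continuousOn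
    (show (0 : ℝ) ∈ Icc (r.eval x) (r.eval y) from ⟨hxr.le, by simpa using hyr.le⟩)
  exact h z hz ((Polynomial.mem_roots hr).2 hz0)

lemma norm_intervalIntegral_le_of_pieces {g : ℝ → ℂ} (hg : ∀ a ∈ Icc (0 : ℝ) 1, ∀ b ∈ Icc (0 : ℝ) 1,
    IntervalIntegrable g volume a b) {K : ℝ} (Z : Finset ℝ)
    (hK : ∀ a ∈ Icc (0 : ℝ) 1, ∀ b ∈ Icc (0 : ℝ) 1, a ≤ b → (∀ x ∈ Ioo a b, x ∉ Z) →
      ‖∫ s in a..b, g s‖ ≤ K) :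
    ∀ N : ℕ, ∀ a ∈ Icc (0 : ℝ) 1, ∀ b ∈ Icc (0 : ℝ) 1, a ≤ b →
      (Z.filter (fun x => x ∈ Ioo a b)).card ≤ N → ‖∫ s in a..b, g s‖ ≤ (N + 1) * K := by
  intro N
  induction N with
  | zero =>
    intro a ha b hb hab hN
    have : Z.filter (fun x => x ∈ Ioo a b) = ∅ := Finset.card_eq_zero.1 (by lia)
    simpa using hK a ha b hb hab fun x hx hxZ => by
      exact Finset.eq_empty_iff_forall_notMem.1 this x (Finset.mem_filter.2 ⟨hxZ, hx⟩)
  | succ N ih =>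
    intro a ha b hb hab hN
    have hK0 : 0 ≤ K := (norm_nonneg _).trans
      (hK 0 (by simp) 0 (by simp) le_rfl (by simp))
    rcases (Z.filter (fun x => x ∈ Ioo a b)).eq_empty_or_nonempty with he | hne
    · have := hK a ha b hb hab fun x hx hxZ => by
        exact Finset.eq_empty_iff_forall_notMem.1 he x (Finset.mem_filter.2 ⟨hxZ, hx⟩)
      have h2 : (1 : ℝ) * K ≤ ((N + 1 : ℕ) + 1 : ℝ) * K := by gcongr; norm_cast; lia
      linarith
    · set z := (Z.filter (fun x => x ∈ Ioo a b)).min' hne with hz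
      have hzm := Finset.min'_mem _ hne
      rw [← hz] at hzm
      obtain ⟨hzZ, hzab⟩ := Finset.mem_filter.1 hzm
      have hz01 : z ∈ Icc (0 : ℝ) 1 := ⟨ha.1.trans hzab.1.le, hzab.2.le.trans hb.2⟩
      have h1 : ‖∫ s in a..z, g s‖ ≤ K := hK a ha z hz01 hzab.1.le fun x hx hxZ => by
        have hxm : x ∈ Z.filter (fun x => x ∈ Ioo a b) :=
          Finset.mem_filter.2 ⟨hxZ, hx.1, hx.2.trans hzab.2⟩
        have := Finset.min'_le _ x hxm
        exact absurd hx.2 (not_lt.2 this)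
      have h2 : ‖∫ s in z..b, g s‖ ≤ (N + 1) * K := by
        refine ih z hz01 b hb hzab.2.le ?_
        have hss : Z.filter (fun x => x ∈ Ioo z b) ⊂ Z.filter (fun x => x ∈ Ioo a b) := by
          rw [Finset.ssubset_iff_of_subset]
          · exact ⟨z, hzm, by simp⟩
          · intro x hx
            obtain ⟨hx1, hx2⟩ := Finset.mem_filter.1 hx
            exact Finset.mem_filter.2 ⟨hx1, hzab.1.trans hx2.1, hx2.2⟩
        have := Finset.card_lt_card hss
        lia
      rw [← intervalIntegral.integral_add_adjacent_intervals (hg a ha z hz01) (hg z hz01 b hb)]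
      refine (norm_add_le _ _).trans ?_
      push_cast
      linarith

/-- A van der Corput estimate for rational phases. -/
lemma exists_norm_integral_exp_div_le {d : ℕ} (hd : 1 ≤ d) : ∃ C : ℝ, 0 < C ∧
    ∀ (P Q : Polynomial ℝ) (q m : ℝ), P.natDegree ≤ d → Q.natDegree ≤ d → 0 < m →
      (∀ s ∈ Icc (0 : ℝ) 1, 0 < Q.eval s) → (∀ s ∈ Icc (0 : ℝ) 1, Q.eval s ≤ q) →
      (∀ c : ℝ, ∃ s0 ∈ Icc (0 : ℝ) 1, m ≤ |P.eval s0 - c * Q.eval s0|) →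
      ‖∫ s in (0 : ℝ)..1, Complex.exp (Complex.I * (P.eval s / Q.eval s : ℝ))‖
        ≤ C * (q / m) ^ (1 / d : ℝ) := by
  refine ⟨(5 * d + 1) * (3 * (4 * d * 2)), by positivity, fun P Q q m hP hQ hm hQ0 hQq hmax => ?_⟩
  have hq : 0 < q := (hQ0 0 (by simp)).trans_le (hQq 0 (by simp))
  have hd0 : (0 : ℝ) < d := by exact_mod_cast hd
  set η : ℝ := (2 * q / m) ^ (1 / d : ℝ) with hη
  have hη0 : 0 < η := by positivity
  have hηd : η ^ d = 2 * q / m := by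
    rw [hη, ← Real.rpow_natCast, ← Real.rpow_mul (by positivity), one_div,
      inv_mul_cancel₀ hd0.ne', Real.rpow_one]
  set ω : ℝ := 4 * d * η with hω
  have hω0 : 0 < ω := by positivity
  set F : ℝ → ℝ := fun s => P.eval s / Q.eval s with hF
  have hsub : ∀ c, volume {s | s ∈ Icc (0 : ℝ) 1 ∧ |F s - c| ≤ 1} ≤ ENNReal.ofReal ω := by
    intro c
    obtain ⟨s0, hs0, hs0m⟩ := hmax c
    have hdeg : (P - Polynomial.C c * Q).natDegree ≤ d :=
      (Polynomial.natDegree_sub_le _ _).trans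
          (max_le hP ((Polynomial.natDegree_C_mul_le _ _).trans hQ))
    have h := volume_sublevel_le hd hdeg zero_le_one hs0 hη0.le
    rw [mul_one] at h
    refine le_trans (measure_mono fun s (hs : s ∈ Icc (0 : ℝ) 1 ∧ |F s - c| ≤ 1) =>
      show s ∈ Icc (0 : ℝ) 1 ∧ _ from ⟨hs.1, ?_⟩) h
    have hQs := hQ0 s hs.1
    have h1 : |P.eval s - c * Q.eval s| ≤ q := by
      have : P.eval s - c * Q.eval s = (F s - c) * Q.eval s := by rw [hF]; field_simp
      rw [this, abs_mul, abs_of_pos hQs]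
      calc |F s - c| * Q.eval s ≤ 1 * q := mul_le_mul hs.2 (hQq s hs.1) hQs.le zero_le_one
        _ = q := one_mul q
    simp only [Polynomial.eval_sub, Polynomial.eval_mul, Polynomial.eval_C]
    calc |P.eval s - c * Q.eval s| ≤ q := h1
      _ < 2 * q := by linarith
      _ = η ^ d * m := by rw [hηd]; field_simp
      _ ≤ _ := by gcongr
  set N1 := Polynomial.derivative P * Q - P * Polynomial.derivative Q with hN1
  set N2 := Polynomial.derivative N1 * Q - 2 * N1 * Polynomial.derivative Q with hN2
  have hN1d : N1.natDegree ≤ 2 * d := by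
    have h1 := Polynomial.natDegree_derivative_le P
    have h2 := Polynomial.natDegree_derivative_le Q
    refine (Polynomial.natDegree_sub_le _ _).trans (max_le ?_ ?_)
    · exact Polynomial.natDegree_mul_le.trans (by lia)
    · exact Polynomial.natDegree_mul_le.trans (by lia)
  have hN2d : N2.natDegree ≤ 3 * d := by
    have h1 := Polynomial.natDegree_derivative_le N1
    have h2 := Polynomial.natDegree_derivative_le Q
    refine (Polynomial.natDegree_sub_le _ _).trans (max_le ?_ ?_)
    · exact Polynomial.natDegree_mul_le.trans (by lia)
    · refine Polynomial.natDegree_mul_le.trans ?_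
      have : (2 * N1).natDegree ≤ 2 * d := by
        refine Polynomial.natDegree_mul_le.trans ?_
        have h3 : (2 : Polynomial ℝ).natDegree = 0 := Polynomial.natDegree_ofNat 2
        lia
      lia
  have hder1 : ∀ s ∈ Icc (0 : ℝ) 1, HasDerivAt F (N1.eval s / Q.eval s ^ 2) s := fun s hs => by
    have := (P.hasDerivAt s).div (Q.hasDerivAt s) (hQ0 s hs).ne'
    refine HasDerivAt.congr_deriv (f := F) this ?_
    simp [hN1]
  have hder2 : ∀ s ∈ Icc (0 : ℝ) 1, HasDerivAt (fun s => N1.eval s / Q.eval s ^ 2)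
      (N2.eval s / Q.eval s ^ 3) s := fun s hs => by
    have h0 := (hQ0 s hs).ne'
    have := (N1.hasDerivAt s).div ((Q.hasDerivAt s).pow 2) (pow_ne_zero 2 h0)
    refine HasDerivAt.congr_deriv (f := fun s => N1.eval s / Q.eval s ^ 2) this ?_
    simp only [Pi.pow_apply, hN2, Polynomial.eval_sub, Polynomial.eval_mul, Polynomial.eval_ofNat]
    field_simp
    push_cast
    ring
  have hFc : ContinuousOn F (Icc 0 1) := fun s hs => (hder1 s hs).continuousAt.continuousWithinAt
  have hsubset : ∀ {a b : ℝ}, a ∈ Icc (0 : ℝ) 1 → b ∈ Icc (0 : ℝ) 1 → Icc a b ⊆ Icc 0 1 :=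
    fun ha hb => Icc_subset_Icc ha.1 hb.2
  have hpieces := norm_intervalIntegral_le_of_pieces
    (g := fun s => Complex.exp (Complex.I * F s)) (K := 3 * ω)
    (fun a ha b hb => by
      apply ContinuousOn.intervalIntegrable
      have : uIcc a b ⊆ Icc 0 1 := ordConnected_Icc.uIcc_subset ha hb
      have := hFc.mono this
      fun_prop)
    (N1.roots.toFinset ∪ N2.roots.toFinset)
    (fun a ha b hb hab hno => by
      have hs := hsubset ha hb
      simp only [Finset.mem_union, Multiset.mem_toFinset, not_or] at hno
      refine norm_integral_exp_le_of_signs hab hω0 (fun s h => hder1 s (hs h))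
          (fun s h => hder2 s (hs h))
        ?_ ?_ ?_ fun c => ?_
      · exact (N2.continuous.continuousOn).div (by fun_prop) fun s h => pow_ne_zero _
            (hQ0 s (hs h)).ne'
      · refine (eval_sign_of_no_roots N1 fun x hx => (hno x hx).1).imp (fun h s hh => ?_)
            fun h s hh => ?_
        · exact div_nonneg (h s hh) (by positivity)
        · exact div_nonpos_of_nonpos_of_nonneg (h s hh) (by positivity)
      · have h3 : ∀ s ∈ Icc a b, 0 ≤ Q.eval s ^ 3 := fun s h => pow_nonneg (hQ0 s (hs h)).le _
        refine (eval_sign_of_no_roots N2 fun x hx => (hno x hx).2).imp (fun h s hh => ?_)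
            fun h s hh => ?_
        · exact div_nonneg (h s hh) (h3 s hh)
        · exact div_nonpos_of_nonpos_of_nonneg (h s hh) (h3 s hh)
      · exact (measure_mono fun s (h : s ∈ Icc a b ∧ |F s - c| ≤ 1) =>
          show s ∈ Icc (0 : ℝ) 1 ∧ |F s - c| ≤ 1 from ⟨hs h.1, h.2⟩).trans (hsub c))
    (5 * d) 0 (by simp) 1 (by simp) zero_le_one (by
      refine (Finset.card_filter_le _ _).trans ((Finset.card_union_le _ _).trans ?_)
      have h1 := (Multiset.toFinset_card_le N1.roots).trans (N1.card_roots'.trans hN1d)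
      have h2 := (Multiset.toFinset_card_le N2.roots).trans (N2.card_roots'.trans hN2d)
      lia)
  refine hpieces.trans ?_
  have h2η : η ≤ 2 * (q / m) ^ (1 / d : ℝ) := by
    rw [hη, mul_div_assoc, Real.mul_rpow (by norm_num) (by positivity)]
    gcongr
    calc (2 : ℝ) ^ (1 / d : ℝ) ≤ 2 ^ (1 : ℝ) := by
          apply Real.rpow_le_rpow_of_exponent_le (by norm_num)
          rw [div_le_one hd0]
          exact_mod_cast hd
      _ = 2 := by simp
  rw [hω]
  push_cast
  calc (5 * (d : ℝ) + 1) * (3 * (4 * d * η)) ≤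
      (5 * (d : ℝ) + 1) * (3 * (4 * d * (2 * (q / m) ^ (1 / d : ℝ)))) := by
        gcongr
    _ = _ := by ring

lemma exists_abs_coeff_one_le (d : ℕ) : ∃ C : ℝ, 1 ≤ C ∧ ∀ (r : Polynomial ℝ) (M : ℝ),
    r.natDegree ≤ d → (∀ s ∈ Icc (0 : ℝ) 1, |r.eval s| ≤ M) → |r.coeff 1| ≤ C * M := by
  set v : ℕ → ℝ := fun i => i / (d + 1 : ℝ) with hv
  set S := Finset.range (d + 1) with hS
  refine ⟨1 + ∑ i ∈ S, |(Lagrange.basis S v i).coeff 1|,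
    le_add_of_nonneg_right (Finset.sum_nonneg fun _ _ => abs_nonneg _), fun r M hr hM => ?_⟩
  have hM0 : 0 ≤ M := (abs_nonneg _).trans (hM 0 (by simp))
  have hinj : Set.InjOn v S := by
    intro i _ j _ hij
    have h0 : (d + 1 : ℝ) ≠ 0 := by positivity
    have : (i : ℝ) = j := by
      simp only [hv] at hij
      field_simp at hij
      exact hij
    exact_mod_cast this
  have hdeg : r.degree < S.card := by
    rw [hS, Finset.card_range]
    refine (Polynomial.degree_le_natDegree).trans_lt ?_
    exact_mod_cast Nat.lt_succ_of_le hr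
  have hI := Lagrange.eq_interpolate hinj hdeg
  rw [hI, Lagrange.interpolate_apply, Polynomial.finsetSum_coeff]
  calc |∑ i ∈ S, (Polynomial.C (r.eval (v i)) * Lagrange.basis S v i).coeff 1|
      ≤ ∑ i ∈ S, |(Polynomial.C (r.eval (v i)) * Lagrange.basis S v i).coeff 1| :=
        Finset.abs_sum_le_sum_abs _ _
    _ ≤ ∑ i ∈ S, |(Lagrange.basis S v i).coeff 1| * M := by
        refine Finset.sum_le_sum fun i hi => ?_
        rw [Polynomial.coeff_C_mul, abs_mul, mul_comm]
        gcongr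
        refine hM _ ⟨by positivity, ?_⟩
        rw [hv, div_le_one (by positivity)]
        have := Finset.mem_range.1 hi
        exact_mod_cast this.le
    _ ≤ _ := by
        rw [← Finset.sum_mul]
        gcongr
        linarith

lemma exists_norm_integral_exp_div_le_of_jet {d : ℕ} (hd : 1 ≤ d) : ∃ C : ℝ, 0 < C ∧
    ∀ (P Q : Polynomial ℝ) (q m : ℝ), P.natDegree ≤ d → Q.natDegree ≤ d → 0 < m →
      (∀ s ∈ Icc (0 : ℝ) 1, 0 < Q.eval s) → (∀ s ∈ Icc (0 : ℝ) 1, Q.eval s ≤ q) →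
      (m ≤ |Q.coeff 0 * P.coeff 1 - Q.coeff 1 * P.coeff 0| ∨
        m ≤ |Q.coeff 0 * P.eval 1 - Q.eval 1 * P.coeff 0|) →
      ‖∫ s in (0 : ℝ)..1, Complex.exp (Complex.I * (P.eval s / Q.eval s : ℝ))‖
        ≤ C * (q ^ 2 / m) ^ (1 / d : ℝ) := by
  obtain ⟨C₁, hC₁, h₁⟩ := exists_norm_integral_exp_div_le hd
  obtain ⟨C₂, hC₂, h₂⟩ := exists_abs_coeff_one_le d
  refine ⟨C₁ * (2 * C₂) ^ (1 / d : ℝ), by positivity, fun P Q q m hP hQ hm hQ0 hQq hmax => ?_⟩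
  have hq : 0 < q := (hQ0 0 (by simp)).trans_le (hQq 0 (by simp))
  have hQabs : ∀ s ∈ Icc (0 : ℝ) 1, |Q.eval s| ≤ q := fun s hs => by
    rw [abs_of_pos (hQ0 s hs)]; exact hQq s hs
  refine (h₁ P Q q (m / (2 * C₂ * q)) hP hQ (by positivity) hQ0 hQq fun c => ?_).trans_eq ?_
  · set r := P - Polynomial.C c * Q with hr
    have hrd : r.natDegree ≤ d :=
      (Polynomial.natDegree_sub_le _ _).trans
          (max_le hP ((Polynomial.natDegree_C_mul_le _ _).trans hQ))
    obtain ⟨s0, hs0, hmx⟩ := isCompact_Icc.exists_isMaxOn (nonempty_Icc.2 (zero_le_one (α := ℝ)))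
      (show ContinuousOn (fun s => |r.eval s|) (Icc 0 1) by fun_prop)
    have hM : ∀ s ∈ Icc (0 : ℝ) 1, |r.eval s| ≤ |r.eval s0| := fun s hs => hmx hs
    refine ⟨s0, hs0, ?_⟩
    have hre : P.eval s0 - c * Q.eval s0 = r.eval s0 := by simp [hr]
    rw [hre, div_le_iff₀ (by positivity)]
    set M := |r.eval s0|
    have hM0 : 0 ≤ M := abs_nonneg _
    have hc0 : |r.coeff 0| ≤ M := by
      rw [Polynomial.coeff_zero_eq_eval_zero]; exact hM 0 (by simp)
    have hq0 : |Q.coeff 0| ≤ q := by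
      rw [Polynomial.coeff_zero_eq_eval_zero]; exact hQabs 0 (by simp)
    rcases hmax with h | h
    · have : Q.coeff 0 * P.coeff 1 - Q.coeff 1 * P.coeff 0
          = Q.coeff 0 * r.coeff 1 - Q.coeff 1 * r.coeff 0 := by
        simp only [hr, Polynomial.coeff_sub, Polynomial.coeff_C_mul]; ring
      rw [this] at h
      refine h.trans ((abs_sub _ _).trans ?_)
      rw [abs_mul, abs_mul]
      have h3 : |Q.coeff 0| * |r.coeff 1| ≤ q * (C₂ * M) := by gcongr; exact h₂ r M hrd hM
      have h4 : |Q.coeff 1| * |r.coeff 0| ≤ (C₂ * q) * M := by gcongr; exact h₂ Q q hQ hQabs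
      linarith
    · have : Q.coeff 0 * P.eval 1 - Q.eval 1 * P.coeff 0
          = Q.coeff 0 * r.eval 1 - Q.eval 1 * r.coeff 0 := by
        simp only [hr, Polynomial.coeff_sub, Polynomial.coeff_C_mul, Polynomial.eval_sub,
          Polynomial.eval_mul, Polynomial.eval_C]; ring
      rw [this] at h
      refine h.trans ((abs_sub _ _).trans ?_)
      rw [abs_mul, abs_mul]
      have h3 : |Q.coeff 0| * |r.eval 1| ≤ q * M := by gcongr; exact hM 1 (by simp)
      have h4 : |Q.eval 1| * |r.coeff 0| ≤ q * M := by gcongr; exact hQabs 1 (by simp)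
      have h5 : q * M ≤ C₂ * (q * M) := le_mul_of_one_le_left (by positivity) hC₂
      linarith
  · rw [mul_assoc C₁ ((2 * C₂) ^ (1 / d : ℝ)), ← Real.mul_rpow (by positivity) (by positivity)]
    congr 2
    field_simp

/-- The radial profile whose three-dimensional extension has one-dimensional marginals
proportional to `exp (-|x| ^ (2 * (m + 1)))`. -/
def bump (m : ℕ) (s : ℝ) : ℝ := s ^ m * Real.exp (-s ^ (m + 1))

lemma bump_nonneg (m : ℕ) {s : ℝ} (hs : 0 ≤ s) : 0 ≤ bump m s := by
  unfold bump; positivity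

@[fun_prop]
lemma continuous_bump (m : ℕ) : Continuous (bump m) := by
  unfold bump; fun_prop

lemma lintegral_Ioi_mul_bump (m : ℕ) {a y : ℝ} (ha : 0 ≤ a) (hy : 0 ≤ y) :
    ∫⁻ b in Ioi y, ENNReal.ofReal (2 * (m + 1) * b * bump m (a + b ^ 2))
      = ENNReal.ofReal (Real.exp (-(a + y ^ 2) ^ (m + 1))) := by
  have hder : ∀ b ∈ Ici y, HasDerivAt (fun b => -Real.exp (-(a + b ^ 2) ^ (m + 1)))
      (2 * (m + 1) * b * bump m (a + b ^ 2)) b := fun b _ => by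
    have h1 : HasDerivAt (fun b : ℝ => a + b ^ 2) (2 * b) b := by
      simpa using (hasDerivAt_pow 2 b).const_add a
    refine ((h1.pow (m + 1)).neg.exp.neg).congr_deriv ?_
    simp only [bump, Pi.pow_apply, Pi.neg_apply, Nat.add_sub_cancel]
    push_cast
    ring
  have hnn : ∀ b ∈ Ioi y, 0 ≤ 2 * (m + 1) * b * bump m (a + b ^ 2) := fun b hb => by
    have : 0 ≤ b := hy.trans (le_of_lt hb)
    have := bump_nonneg m (s := a + b ^ 2) (by positivity)
    positivity
  have htend : Tendsto (fun b => -Real.exp (-(a + b ^ 2) ^ (m + 1))) atTop (𝓝 0) := by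
    rw [← neg_zero]
    refine (Real.tendsto_exp_neg_atTop_nhds_zero.comp ?_).neg
    refine (tendsto_pow_atTop (Nat.succ_ne_zero m)).comp ?_
    exact tendsto_atTop_add_const_left _ _ (tendsto_pow_atTop two_ne_zero)
  have hinteg := integrableOn_Ioi_deriv_of_nonneg' hder hnn htend
  rw [← ofReal_integral_eq_lintegral_ofReal hinteg
      ((ae_restrict_iff' measurableSet_Ioi).2 (ae_of_all _ hnn)),
    integral_Ioi_of_hasDerivAt_of_nonneg' hder hnn htend]
  simp

lemma lintegral_polar (m : ℕ) {a : ℝ} (ha : 0 ≤ a) :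
    ∫⁻ p : ℝ × ℝ, ENNReal.ofReal (bump m (a + p.1 ^ 2 + p.2 ^ 2))
      = ENNReal.ofReal (Real.pi / (m + 1)) * ENNReal.ofReal (Real.exp (-a ^ (m + 1))) := by
  rw [← lintegral_comp_polarCoord_symm]
  have hc : ∀ p : ℝ × ℝ, ENNReal.ofReal p.1 •
      ENNReal.ofReal (bump m (a + (polarCoord.symm p).1 ^ 2 + (polarCoord.symm p).2 ^ 2))
      = ENNReal.ofReal p.1 * ENNReal.ofReal (bump m (a + p.1 ^ 2)) := fun p => by
    have : a + (polarCoord.symm p).1 ^ 2 + (polarCoord.symm p).2 ^ 2 = a + p.1 ^ 2 := by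
      simp only [polarCoord_symm_apply]
      linear_combination p.1 ^ 2 * Real.sin_sq_add_cos_sq p.2
    rw [this, smul_eq_mul]
  simp only [hc]
  rw [show polarCoord.target = Ioi (0 : ℝ) ×ˢ Ioo (-Real.pi) Real.pi from rfl,
    Measure.volume_eq_prod, ← Measure.prod_restrict]
  rw [lintegral_prod _ (by fun_prop)]
  simp only [lintegral_const, Measure.restrict_apply MeasurableSet.univ, univ_inter,
      Real.volume_Ioo]
  rw [lintegral_mul_const _ (by fun_prop)]
  have h2 : ∫⁻ b in Ioi (0 : ℝ), ENNReal.ofReal b * ENNReal.ofReal (bump m (a + b ^ 2))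
      = ENNReal.ofReal (1 / (2 * (m + 1))) * ENNReal.ofReal (Real.exp (-a ^ (m + 1))) := by
    have h3 := lintegral_Ioi_mul_bump m ha le_rfl
    rw [show a + (0 : ℝ) ^ 2 = a by ring] at h3
    rw [← h3, ← lintegral_const_mul _ (by fun_prop)]
    refine setLIntegral_congr_fun measurableSet_Ioi fun b hb => ?_
    have : 0 ≤ b := le_of_lt hb
    rw [← ENNReal.ofReal_mul this, ← ENNReal.ofReal_mul (by positivity)]
    congr 1
    field_simp
  rw [h2, mul_comm, ← mul_assoc, ← ENNReal.ofReal_mul (by linarith [Real.pi_pos])]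
  congr 2
  field_simp
  ring

lemma lintegral_rotate {F : ℝ × ℝ → ℝ≥0∞} (hF : Measurable F) {c s : ℝ} (h : c ^ 2 + s ^ 2 = 1) :
    ∫⁻ p : ℝ × ℝ, F (c * p.1 + s * p.2, -s * p.1 + c * p.2) = ∫⁻ p, F p := by
  have hn : ‖(⟨c, -s⟩ : ℂ)‖ = 1 := by
    rw [Complex.norm_def, Complex.normSq_mk, Real.sqrt_eq_one]
    linarith
  set a : Circle := ⟨⟨c, -s⟩, mem_sphere_zero_iff_norm.2 hn⟩ with ha
  have hmp := (rotation a).measurePreserving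
  have hV := Complex.volume_preserving_equiv_real_prod
  have hM : Measurable fun z : ℂ => F (Complex.measurableEquivRealProd z) :=
    hF.comp Complex.measurableEquivRealProd.measurable
  have hL : Measurable fun p : ℝ × ℝ => F (c * p.1 + s * p.2, -s * p.1 + c * p.2) :=
    hF.comp (by fun_prop)
  rw [← hV.lintegral_comp hF, ← hmp.lintegral_comp hM, ← hV.lintegral_comp hL]
  refine lintegral_congr fun z => ?_
  have hz : rotation a z = (⟨c, -s⟩ : ℂ) * z := rotation_apply a z
  rw [hz]
  simp only [Complex.measurableEquivRealProd_apply, Complex.mul_re, Complex.mul_im]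
  congr 2 <;> ring

lemma lintegral_rotated_marginal (m : ℕ) {g : ℝ → ℝ≥0∞} (hg : Measurable g) (s : ℝ) :
    ∫⁻ q : ℝ × ℝ × ℝ, g ((q.1 + s * q.2.1) / √(1 + s ^ 2)) *
        ENNReal.ofReal (bump m (q.1 ^ 2 + q.2.1 ^ 2 + q.2.2 ^ 2))
      = ENNReal.ofReal (Real.pi / (m + 1)) *
        ∫⁻ x, g x * ENNReal.ofReal (Real.exp (-x ^ (2 * (m + 1)))) := by
  have key : ∀ s : ℝ, ∫⁻ q : ℝ × ℝ × ℝ, g ((q.1 + s * q.2.1) / √(1 + s ^ 2)) *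
        ENNReal.ofReal (bump m (q.1 ^ 2 + q.2.1 ^ 2 + q.2.2 ^ 2))
      = ∫⁻ u : ℝ, ∫⁻ p : ℝ × ℝ, g ((p.1 + s * p.2) / √(1 + s ^ 2)) *
        ENNReal.ofReal (bump m (p.1 ^ 2 + p.2 ^ 2 + u ^ 2)) := by
    intro s
    have hm := (volume_preserving_prodAssoc (α₁ := ℝ) (β₁ := ℝ) (γ₁ := ℝ))
    rw [← hm.lintegral_comp (by fun_prop)]
    rw [Measure.volume_eq_prod]
    exact lintegral_prod_symm _ (by fun_prop)
  have hrot : ∀ u : ℝ, ∫⁻ p : ℝ × ℝ, g ((p.1 + s * p.2) / √(1 + s ^ 2)) *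
        ENNReal.ofReal (bump m (p.1 ^ 2 + p.2 ^ 2 + u ^ 2))
      = ∫⁻ p : ℝ × ℝ, g ((p.1 + 0 * p.2) / √(1 + 0 ^ 2)) *
        ENNReal.ofReal (bump m (p.1 ^ 2 + p.2 ^ 2 + u ^ 2)) := by
    intro u
    have hr : 0 < √(1 + s ^ 2) := by positivity
    have hr2 : √(1 + s ^ 2) ^ 2 = 1 + s ^ 2 := Real.sq_sqrt (by positivity)
    have hcs : (1 / √(1 + s ^ 2)) ^ 2 + (s / √(1 + s ^ 2)) ^ 2 = 1 := by
      rw [div_pow, div_pow, hr2]; field_simp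
    rw [← lintegral_rotate (F := fun p : ℝ × ℝ => g ((p.1 + 0 * p.2) / √(1 + 0 ^ 2)) *
        ENNReal.ofReal (bump m (p.1 ^ 2 + p.2 ^ 2 + u ^ 2))) (by fun_prop) hcs]
    refine lintegral_congr fun p => ?_
    congr 2
    · simp; ring
    · congr 1
      linear_combination -(p.1 ^ 2 + p.2 ^ 2) * hcs
  rw [key s]
  simp only [hrot]
  rw [← key 0, Measure.volume_eq_prod, lintegral_prod _ (by fun_prop)]
  simp only [zero_mul, add_zero, ne_eq, OfNat.ofNat_ne_zero, not_false_eq_true, zero_pow,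
    Real.sqrt_one, div_one]
  rw [← lintegral_const_mul _ (by fun_prop)]
  refine lintegral_congr fun x => ?_
  rw [lintegral_const_mul _ (by fun_prop), lintegral_polar m (sq_nonneg x), ← pow_mul]
  ring

lemma lintegral_image_affine (G : ℝ → ℝ≥0∞) {c β : ℝ} (hβ : β ≠ 0) {s : Set ℝ}
    (hs : MeasurableSet s) :
    ∫⁻ x in (fun z => c + β * z) '' s, G x = ENNReal.ofReal |β| * ∫⁻ z in s, G (c + β * z) := by
  rw [lintegral_image_eq_lintegral_abs_deriv_mul (f' := fun _ => β) hs ?_ ?_,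
    lintegral_const_mul' _ _ ENNReal.ofReal_ne_top]
  · intro z _
    simpa using (((hasDerivAt_id z).const_mul β).const_add c).hasDerivWithinAt
  · intro x _ y _ h
    simpa [hβ] using h

lemma lintegral_Icc_eq_unif (G : ℝ → ℝ≥0∞) {t : ℝ} (ht : t ≤ 1) :
    ∫⁻ x in Icc t 1, G x = ENNReal.ofReal (1 - t) * ∫⁻ z, G (t + (1 - t) * z) ∂unif := by
  rcases ht.lt_or_eq with h | rfl
  · have hne : 0 < 1 - t := by linarith
    have := lintegral_image_affine G (c := t) hne.ne' (measurableSet_Icc (a := (0 : ℝ)) (b := 1))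
    rw [abs_of_pos hne] at this
    rw [unif, ← this]
    congr 2
    rw [show (fun z : ℝ => t + (1 - t) * z) = (fun z => (1 - t) * z + t) by funext z; ring]
    rw [image_affine_Icc' hne]
    simp
  · simp

/-- On `[0,1]` the weight `ζ ^ k` is a mixture of the uniform laws on `[t, 1]`. -/
lemma exists_pow_mixture (k : ℕ) : ∃ T : Measure ℝ, IsFiniteMeasure T ∧
    (∀ᵐ t ∂T, t ∈ Icc (0 : ℝ) 1) ∧
    ∫⁻ t, ENNReal.ofReal (1 - t) ^ (-(7 / 4) : ℝ) ∂T ≠ ∞ ∧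
    ∀ G : ℝ → ℝ≥0∞, Measurable G →
      ∫⁻ x in Icc (0 : ℝ) 1, G x * ENNReal.ofReal (x ^ k)
        = ∫⁻ t, ∫⁻ z, G (t + (1 - t) * z) ∂unif ∂T := by
  rcases k with _ | k
  · refine ⟨Measure.dirac 0, inferInstance, ?_, ?_, fun G hG => ?_⟩
    · rw [ae_dirac_eq]; simp
    · rw [lintegral_dirac' _ (by fun_prop)]; simp
    · rw [lintegral_dirac]
      simp [unif]
  · set ρ : ℝ → ℝ≥0∞ := fun t => ENNReal.ofReal ((1 - t) * ((k + 1) * t ^ k)) with hρ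
    have hρm : Measurable ρ := by fun_prop
    have hac : unif.withDensity ρ ≪ unif := withDensity_absolutelyContinuous _ _
    refine ⟨unif.withDensity ρ, ?_, hac.ae_le ae_unif_mem, ?_, fun G hG => ?_⟩
    · refine isFiniteMeasure_withDensity
          (ne_top_of_le_ne_top (b := ENNReal.ofReal (k + 1)) (by simp) ?_)
      calc ∫⁻ t, ρ t ∂unif ≤ ∫⁻ _, ENNReal.ofReal (k + 1) ∂unif := by
            refine lintegral_mono_ae (ae_unif_mem.mono fun t ht => ENNReal.ofReal_le_ofReal ?_)
            have h1 : (1 - t) * t ^ k ≤ 1 :=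
              mul_le_one₀ (by linarith [ht.1]) (pow_nonneg ht.1 _) (pow_le_one₀ ht.1 ht.2)
            nlinarith [show (0 : ℝ) ≤ k by positivity]
        _ = _ := by simp
    · rw [lintegral_withDensity_eq_lintegral_mul _ hρm (by fun_prop)]
      have h1 : ∫⁻ t, ENNReal.ofReal (1 - t) ^ (-(3 / 4) : ℝ) ∂unif ≠ ∞ := by
        have h2 : IntegrableOn (fun x : ℝ => x ^ (-(3 / 4) : ℝ)) (Ioo 0 1) := by
          rw [intervalIntegral.integrableOn_Ioo_rpow_iff one_pos]; norm_num
        have h3 := h2.lintegral_lt_top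
        have h4 : ∫⁻ t, ENNReal.ofReal (1 - t) ^ (-(3 / 4) : ℝ) ∂unif
            = ∫⁻ t in Icc (0 : ℝ) 1, ENNReal.ofReal t ^ (-(3 / 4) : ℝ) := by
          have := lintegral_image_affine (fun t => ENNReal.ofReal t ^ (-(3 / 4) : ℝ)) (c := 1)
            (β := -1) (by norm_num) (measurableSet_Icc (a := (0 : ℝ)) (b := 1))
          have himg : (fun z : ℝ => 1 + -1 * z) '' Icc 0 1 = Icc 0 1 := by
            rw [show (fun z : ℝ => 1 + -1 * z) = (fun z => 1 - z) by funext z; ring]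
            simp
          rw [himg] at this
          rw [this]
          simp [unif, sub_eq_add_neg]
        rw [h4, ← restrict_Ioo_eq_restrict_Icc]
        refine ne_top_of_le_ne_top h3.ne
            (le_of_eq (setLIntegral_congr_fun measurableSet_Ioo fun t ht => ?_))
        rw [ENNReal.ofReal_rpow_of_pos ht.1]
      refine ne_top_of_le_ne_top (ENNReal.mul_ne_top (ENNReal.ofReal_ne_top (r := k + 1)) h1) ?_
      rw [← lintegral_const_mul _ (by fun_prop)]
      refine lintegral_mono_ae ?_
      have hne : ∀ᵐ t ∂unif, t ≠ 1 := by
        have : unif {(1 : ℝ)} = 0 := measure_singleton 1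
        exact measure_eq_zero_iff_ae_notMem.1 this |>.mono fun t ht => by simpa using ht
      filter_upwards [ae_unif_mem, hne] with t ht ht1
      have hpos : 0 < 1 - t := sub_pos.2 (lt_of_le_of_ne ht.2 ht1)
      have hpos' := ENNReal.ofReal_pos.2 hpos
      simp only [Pi.mul_apply, hρ]
      rw [ENNReal.ofReal_mul hpos.le, mul_comm (ENNReal.ofReal (1 - t)), mul_assoc]
      refine mul_le_mul' (ENNReal.ofReal_le_ofReal ?_) (le_of_eq ?_)
      · exact mul_le_of_le_one_right (by positivity) (pow_le_one₀ ht.1 ht.2)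
      · nth_rewrite 1 [← ENNReal.rpow_one (ENNReal.ofReal (1 - t))]
        rw [← ENNReal.rpow_add _ _ hpos'.ne' ENNReal.ofReal_ne_top]
        norm_num
    · have hGm : Measurable fun t => ∫⁻ z, G (t + (1 - t) * z) ∂unif :=
        Measurable.lintegral_prod_right' (f := fun q : ℝ × ℝ => G (q.1 + (1 - q.1) * q.2))
          (hG.comp (by fun_prop))
      rw [lintegral_withDensity_eq_lintegral_mul _ hρm hGm]
      have hpow : ∀ x ∈ Icc (0 : ℝ) 1, ENNReal.ofReal (x ^ (k + 1))
          = ∫⁻ t in Icc (0 : ℝ) 1,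
              (Iic x).indicator (fun t => ENNReal.ofReal ((k + 1) * t ^ k)) t := by
        intro x hx
        rw [lintegral_indicator measurableSet_Iic, Measure.restrict_restrict measurableSet_Iic,
          show Iic x ∩ Icc 0 1 = Icc 0 x by
            ext t; simp only [mem_inter_iff, mem_Iic, mem_Icc]; constructor
            · rintro ⟨h1, h2, -⟩; exact ⟨h2, h1⟩
            · rintro ⟨h1, h2⟩; exact ⟨h2, h1, h2.trans hx.2⟩,
          ← ofReal_integral_eq_lintegral_ofReal
            ((by fun_prop : Continuous fun t : ℝ => (k + 1) * t ^ k).continuousOn.integrableOn_Icc)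
            ((ae_restrict_iff' measurableSet_Icc).2 (ae_of_all _ fun t ht => by
              have := ht.1; positivity)),
          integral_Icc_eq_integral_Ioc, ← intervalIntegral.integral_of_le hx.1,
          intervalIntegral.integral_const_mul, integral_pow]
        congr 1
        field_simp
        simp
      calc ∫⁻ x in Icc (0 : ℝ) 1, G x * ENNReal.ofReal (x ^ (k + 1))
          = ∫⁻ x in Icc (0 : ℝ) 1, ∫⁻ t in Icc (0 : ℝ) 1,
            G x * (Iic x).indicator (fun t => ENNReal.ofReal ((k + 1) * t ^ k)) t := by
            refine setLIntegral_congr_fun measurableSet_Icc fun x hx => ?_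
            rw [hpow x hx, lintegral_const_mul _ ((by fun_prop : Measurable fun t : ℝ =>
              ENNReal.ofReal ((k + 1) * t ^ k)).indicator measurableSet_Iic)]
        _ = ∫⁻ t in Icc (0 : ℝ) 1, ∫⁻ x in Icc (0 : ℝ) 1,
            G x * (Iic x).indicator (fun t => ENNReal.ofReal ((k + 1) * t ^ k)) t := by
            refine lintegral_lintegral_swap (Measurable.aemeasurable ?_)
            refine (hG.comp measurable_fst).mul ?_
            have : (fun q : ℝ × ℝ => (Iic q.1).indicator
                (fun t => ENNReal.ofReal ((k + 1) * t ^ k)) q.2)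
                = {q : ℝ × ℝ | q.2 ≤ q.1}.indicator
                    (fun q => ENNReal.ofReal ((k + 1) * q.2 ^ k)) := by
              funext q; simp [indicator]
            change Measurable (fun q : ℝ × ℝ => (Iic q.1).indicator
                (fun t => ENNReal.ofReal ((k + 1) * t ^ k)) q.2)
            rw [this]
            exact Measurable.indicator (by fun_prop)
                (measurableSet_le measurable_snd measurable_fst)
        _ = ∫⁻ t in Icc (0 : ℝ) 1, (ρ * fun t => ∫⁻ z, G (t + (1 - t) * z) ∂unif) t := by
            refine setLIntegral_congr_fun measurableSet_Icc fun t ht => ?_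
            have h1 : ∀ x, G x * (Iic x).indicator (fun t => ENNReal.ofReal ((k + 1) * t ^ k)) t
                = (Ici t).indicator (fun x => ENNReal.ofReal ((k + 1) * t ^ k) * G x) x :=
                    fun x => by
              simp only [indicator, mem_Iic, mem_Ici]
              split_ifs
              · rw [mul_comm]
              · simp
            simp only [h1]
            rw [lintegral_indicator measurableSet_Ici, Measure.restrict_restrict measurableSet_Ici,
              show Ici t ∩ Icc 0 1 = Icc t 1 by
                ext x; simp only [mem_inter_iff, mem_Ici, mem_Icc]; constructor
                · rintro ⟨h1, -, h2⟩; exact ⟨h1, h2⟩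
                · rintro ⟨h1, h2⟩; exact ⟨h1, ht.1.trans h1, h2⟩,
              lintegral_const_mul _ hG, lintegral_Icc_eq_unif G ht.2]
            simp only [Pi.mul_apply, hρ]
            rw [ENNReal.ofReal_mul (p := 1 - t) (by linarith [ht.2]), ← mul_assoc,
              mul_comm (ENNReal.ofReal (1 - t))]

/-- The even weight `h ^ (2 * i)` on `(-b, b)` is a mixture of uniform laws on intervals,
whose endpoints scale with `b`. -/
lemma exists_even_pow_mixture (i : ℕ) : ∃ N : Measure (ℝ × ℝ), IsFiniteMeasure N ∧
    (∀ᵐ p ∂N, |p.1| ≤ 1 ∧ |p.2| ≤ 1) ∧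
    ∫⁻ p, ENNReal.ofReal |p.2| ^ (-(7 / 4) : ℝ) ∂N ≠ ∞ ∧
    ∀ G : ℝ → ℝ≥0∞, Measurable G → ∀ b : ℝ, 0 < b →
      ∫⁻ x in Ioo (-b) b, G x * ENNReal.ofReal (x ^ (2 * i))
        = ENNReal.ofReal (b ^ (2 * i + 1)) * ∫⁻ p, ∫⁻ z, G (b * (p.1 + p.2 * z)) ∂unif ∂N := by
  obtain ⟨T, hT, hmem, hsing, hmix⟩ := exists_pow_mixture (2 * i)
  have hm1 : Measurable fun t : ℝ => (t, 1 - t) := by fun_prop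
  have hm2 : Measurable fun t : ℝ => (-t, -(1 - t)) := by fun_prop
  have hG' : ∀ (G : ℝ → ℝ≥0∞), Measurable G → ∀ b : ℝ,
      Measurable fun p : ℝ × ℝ => ∫⁻ z, G (b * (p.1 + p.2 * z)) ∂unif := fun G hG b =>
    Measurable.lintegral_prod_right' (f := fun q : (ℝ × ℝ) × ℝ => G (b * (q.1.1 + q.1.2 * q.2)))
      (hG.comp (by fun_prop))
  have hs : Measurable fun p : ℝ × ℝ => ENNReal.ofReal |p.2| ^ (-(7 / 4) : ℝ) := by fun_prop
  have hset : MeasurableSet {p : ℝ × ℝ | |p.1| ≤ 1 ∧ |p.2| ≤ 1} := by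
    rw [ofPred_and]
    exact (measurableSet_le (by fun_prop) measurable_const).inter
      (measurableSet_le (by fun_prop) measurable_const)
  have hone : ∀ t ∈ Icc (0 : ℝ) 1, |t| ≤ 1 ∧ |1 - t| ≤ 1 := fun t ht => by
    constructor <;> rw [abs_le] <;> constructor <;> linarith [ht.1, ht.2]
  have habs : ∀ᵐ t ∂T, ENNReal.ofReal |1 - t| ^ (-(7 / 4) : ℝ)
      = ENNReal.ofReal (1 - t) ^ (-(7 / 4) : ℝ) := hmem.mono fun t ht => by
    rw [abs_of_nonneg (by linarith [ht.2])]
  refine ⟨T.map (fun t => (t, 1 - t)) + T.map (fun t => (-t, -(1 - t))), inferInstance, ?_, ?_, ?_⟩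
  · rw [ae_add_measure_iff, ae_map_iff hm1.aemeasurable hset, ae_map_iff hm2.aemeasurable hset]
    refine ⟨hmem.mono hone, hmem.mono fun t ht => ?_⟩
    simpa only [abs_neg] using hone t ht
  · rw [lintegral_add_measure, lintegral_map hs hm1, lintegral_map hs hm2]
    simp only [abs_neg]
    rw [lintegral_congr_ae habs]
    exact ENNReal.add_ne_top.2 ⟨hsing, hsing⟩
  · intro G hG b hb
    rw [lintegral_add_measure, lintegral_map (hG' G hG b) hm1, lintegral_map (hG' G hG b) hm2]
    have hhalf : ∀ σ : ℝ, |σ| = 1 →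
        ∫⁻ x in (fun z => 0 + (σ * b) * z) '' Icc 0 1, G x * ENNReal.ofReal (x ^ (2 * i))
        = ENNReal.ofReal (b ^ (2 * i + 1)) *
          ∫⁻ t, ∫⁻ z, G (b * (σ * t + σ * (1 - t) * z)) ∂unif ∂T := by
      intro σ hσ
      have hσ0 : σ ≠ 0 := by rintro rfl; simp at hσ
      rw [lintegral_image_affine _ (mul_ne_zero hσ0 hb.ne') measurableSet_Icc, abs_mul, hσ, one_mul,
        abs_of_pos hb, pow_succ', ENNReal.ofReal_mul hb.le, mul_assoc]
      congr 1
      have h2 : σ ^ 2 = 1 := by rw [← sq_abs, hσ, one_pow]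
      have hpow : ∀ z : ℝ, ENNReal.ofReal ((σ * b * z) ^ (2 * i))
          = ENNReal.ofReal (b ^ (2 * i)) * ENNReal.ofReal (z ^ (2 * i)) := fun z => by
        rw [← ENNReal.ofReal_mul (by positivity), mul_pow, mul_pow, pow_mul σ, h2, one_pow,
          one_mul]
      have := hmix (fun z => G (σ * b * z)) (hG.comp (by fun_prop))
      simp only [zero_add, hpow]
      simp_rw [mul_left_comm _ (ENNReal.ofReal (b ^ (2 * i)))]
      rw [lintegral_const_mul' _ _ ENNReal.ofReal_ne_top, this]
      congr 1
      refine lintegral_congr fun t => lintegral_congr fun z => ?_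
      congr 1; ring
    have hu : Ioo (-b) b =ᵐ[volume] (((fun z => 0 + ((-1) * b) * z) '' Icc 0 1) ∪
        ((fun z => 0 + (1 * b) * z) '' Icc 0 1) : Set ℝ) := by
      have e1 : (fun z : ℝ => 0 + ((-1) * b) * z) '' Icc 0 1 = Icc (-b) 0 := by
        have := image_affine_Icc' (a := b) hb 0 (0 : ℝ) 1
        ext y
        simp only [mem_image, mem_Icc]
        constructor
        · rintro ⟨z, ⟨h0, h1⟩, rfl⟩
          constructor <;> nlinarith
        · rintro ⟨h0, h1⟩
          refine ⟨-y / b, ⟨by apply div_nonneg <;> linarith, by rw [div_le_one hb]; linarith⟩, ?_⟩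
          field_simp; ring
      have e2 : (fun z : ℝ => 0 + (1 * b) * z) '' Icc 0 1 = Icc 0 b := by
        ext y
        simp only [mem_image, mem_Icc]
        constructor
        · rintro ⟨z, ⟨h0, h1⟩, rfl⟩
          constructor <;> nlinarith
        · rintro ⟨h0, h1⟩
          refine ⟨y / b, ⟨by positivity, by rw [div_le_one hb]; linarith⟩, ?_⟩
          field_simp; ring
      rw [e1, e2, Icc_union_Icc_eq_Icc (by linarith) hb.le]
      exact Ioo_ae_eq_Icc
    have e1 : AEDisjoint volume ((fun z : ℝ => 0 + ((-1) * b) * z) '' Icc 0 1)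
        ((fun z : ℝ => 0 + (1 * b) * z) '' Icc 0 1) := by
      refine measure_mono_null (t := {0}) ?_ (measure_singleton _)
      rintro y ⟨⟨z, ⟨h0, h1⟩, rfl⟩, ⟨w, ⟨h2, h3⟩, h⟩⟩
      simp only at h
      have : 0 ≤ b * z := by positivity
      have : 0 ≤ b * w := by positivity
      rw [mem_singleton_iff]; linarith
    have hms : ∀ σ : ℝ, MeasurableSet ((fun z : ℝ => 0 + (σ * b) * z) '' Icc 0 1) := fun σ =>
      (isCompact_Icc.image (by fun_prop)).isClosed.measurableSet
    rw [setLIntegral_congr hu, Measure.restrict_union₀ e1 (hms 1).nullMeasurableSet,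
      lintegral_add_measure, hhalf 1 (by simp), hhalf (-1) (by simp), ← mul_add]
    congr 1
    rw [add_comm]
    simp

/-- Two-dimensional version of `exists_even_pow_mixture`. -/
lemma exists_even_pow_mixture_prod (i j : ℕ) : ∃ N : Measure ((ℝ × ℝ) × ℝ × ℝ),
    IsFiniteMeasure N ∧
    (∀ᵐ p ∂N, (|p.1.1| ≤ 1 ∧ |p.1.2| ≤ 1) ∧ |p.2.1| ≤ 1 ∧ |p.2.2| ≤ 1) ∧
    ∫⁻ p, ENNReal.ofReal |p.1.2| ^ (-(7 / 4) : ℝ) ∂N ≠ ∞ ∧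
    ∫⁻ p, ENNReal.ofReal |p.2.2| ^ (-(7 / 4) : ℝ) ∂N ≠ ∞ ∧
    ∀ G : ℝ × ℝ → ℝ≥0∞, Measurable G → ∀ a b : ℝ, 0 < a → 0 < b →
      ∫⁻ x in Ioo (-a) a, ∫⁻ h in Ioo (-b) b,
          G (x, h) * ENNReal.ofReal (x ^ (2 * i) * h ^ (2 * j))
        = ENNReal.ofReal (a ^ (2 * i + 1) * b ^ (2 * j + 1)) * ∫⁻ p, ∫⁻ z, ∫⁻ z',
          G (a * (p.1.1 + p.1.2 * z), b * (p.2.1 + p.2.2 * z')) ∂unif ∂unif ∂N := by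
  obtain ⟨N, hN, hmem, hsing, hmix⟩ := exists_even_pow_mixture i
  obtain ⟨N', hN', hmem', hsing', hmix'⟩ := exists_even_pow_mixture j
  refine ⟨N.prod N', inferInstance, ?_, ?_, ?_, ?_⟩
  · have h1 := (Measure.quasiMeasurePreserving_fst (μ := N) (ν := N')).ae hmem
    have h2 := (Measure.quasiMeasurePreserving_snd (μ := N) (ν := N')).ae hmem'
    filter_upwards [h1, h2] with p hp hp'
    exact ⟨hp, hp'⟩
  · rw [lintegral_prod _ (by fun_prop)]
    simp only [lintegral_const]
    rw [lintegral_mul_const _ (by fun_prop)]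
    exact ENNReal.mul_ne_top hsing (by simp)
  · rw [lintegral_prod _ (by fun_prop)]
    simp only [lintegral_const]
    exact ENNReal.mul_ne_top hsing' (by simp)
  · intro G hG a b ha hb
    have hm1 : ∀ x, Measurable fun h => G (x, h) := fun x => hG.comp (by fun_prop)
    have hmz : ∀ x, Measurable fun q : (ℝ × ℝ) × ℝ => G (x, b * (q.1.1 + q.1.2 * q.2)) := fun x =>
      hG.comp (by fun_prop)
    have hinner : ∀ x, ∫⁻ h in Ioo (-b) b, G (x, h) * ENNReal.ofReal (x ^ (2 * i) * h ^ (2 * j))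
        = (ENNReal.ofReal (b ^ (2 * j + 1)) * ∫⁻ p, ∫⁻ z, G (x, b * (p.1 + p.2 * z)) ∂unif ∂N')
          * ENNReal.ofReal (x ^ (2 * i)) := fun x => by
      rw [← hmix' _ (hm1 x) b hb, ← lintegral_mul_const' _ _ ENNReal.ofReal_ne_top]
      refine lintegral_congr fun h => ?_
      rw [ENNReal.ofReal_mul ((even_two_mul i).pow_nonneg x)]; ring
    have hM : Measurable fun x => ∫⁻ p, ∫⁻ z, G (x, b * (p.1 + p.2 * z)) ∂unif ∂N' := by
      refine Measurable.lintegral_prod_right' (f := fun q : ℝ × ℝ × ℝ =>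
        ∫⁻ z, G (q.1, b * (q.2.1 + q.2.2 * z)) ∂unif) ?_
      exact Measurable.lintegral_prod_right' (f := fun q : (ℝ × ℝ × ℝ) × ℝ =>
        G (q.1.1, b * (q.1.2.1 + q.1.2.2 * q.2))) (hG.comp (by fun_prop))
    simp only [hinner]
    rw [hmix _ (hM.const_mul _) a ha, ENNReal.ofReal_mul (by positivity), mul_assoc]
    congr 1
    simp_rw [lintegral_const_mul' _ _ (ENNReal.ofReal_ne_top (r := b ^ (2 * j + 1)))]
    congr 1
    have hM2 : Measurable fun p : (ℝ × ℝ) × ℝ × ℝ => ∫⁻ z, ∫⁻ z',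
        G (a * (p.1.1 + p.1.2 * z), b * (p.2.1 + p.2.2 * z')) ∂unif ∂unif := by
      refine Measurable.lintegral_prod_right' (f := fun q : ((ℝ × ℝ) × ℝ × ℝ) × ℝ =>
        ∫⁻ z', G (a * (q.1.1.1 + q.1.1.2 * q.2), b * (q.1.2.1 + q.1.2.2 * z')) ∂unif) ?_
      exact Measurable.lintegral_prod_right' (f := fun q : (((ℝ × ℝ) × ℝ × ℝ) × ℝ) × ℝ =>
        G (a * (q.1.1.1.1 + q.1.1.1.2 * q.1.2), b * (q.1.1.2.1 + q.1.1.2.2 * q.2)))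
          (hG.comp (by fun_prop))
    rw [lintegral_prod _ hM2.aemeasurable]
    refine lintegral_congr fun p => ?_
    refine lintegral_lintegral_swap (f := fun z (p' : ℝ × ℝ) => ∫⁻ z',
      G (a * (p.1 + p.2 * z), b * (p'.1 + p'.2 * z')) ∂unif) (Measurable.aemeasurable ?_)
    exact Measurable.lintegral_prod_right' (f := fun q : (ℝ × ℝ × ℝ) × ℝ =>
        G (a * (p.1 + p.2 * q.1.1), b * (q.1.2.1 + q.1.2.2 * q.2))) (hG.comp (by fun_prop))

/-- The linear functional `L` is a mixture of uniform laws on rectangles, the law of whose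
positions and side lengths has all moments and moderately integrable small sides. -/
def IsBoxMixture (L : (ℝ × ℝ → ℝ≥0∞) → ℝ≥0∞) : Prop :=
  ∃ Q : Measure ((ℝ × ℝ) × ℝ × ℝ), IsFiniteMeasure Q ∧
    (∀ k : ℕ, ∫⁻ p, ENNReal.ofReal ((|p.1.1| + |p.1.2| + |p.2.1| + |p.2.2|) ^ k) ∂Q ≠ ∞) ∧
    ∫⁻ p, ENNReal.ofReal |p.1.2| ^ (-(7 / 4) : ℝ) ∂Q ≠ ∞ ∧
    ∫⁻ p, ENNReal.ofReal |p.2.2| ^ (-(7 / 4) : ℝ) ∂Q ≠ ∞ ∧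
    ∀ G : ℝ × ℝ → ℝ≥0∞, Measurable G → L G = ∫⁻ p, ∫⁻ z, ∫⁻ z',
      G (p.1.1 + p.1.2 * z, p.2.1 + p.2.2 * z') ∂unif ∂unif ∂Q

lemma IsBoxMixture.zero : IsBoxMixture fun _ => 0 :=
  ⟨0, inferInstance, by simp, by simp, by simp, by simp⟩

lemma IsBoxMixture.add {L L' : (ℝ × ℝ → ℝ≥0∞) → ℝ≥0∞} (h : IsBoxMixture L)
    (h' : IsBoxMixture L') : IsBoxMixture fun G => L G + L' G := by
  obtain ⟨Q, h0, h1, h2, h3, h4⟩ := h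
  obtain ⟨Q', h0', h1', h2', h3', h4'⟩ := h'
  refine ⟨Q + Q', inferInstance, fun k => ?_, ?_, ?_, fun G hG => ?_⟩
  · rw [lintegral_add_measure]; exact ENNReal.add_ne_top.2 ⟨h1 k, h1' k⟩
  · rw [lintegral_add_measure]; exact ENNReal.add_ne_top.2 ⟨h2, h2'⟩
  · rw [lintegral_add_measure]; exact ENNReal.add_ne_top.2 ⟨h3, h3'⟩
  · simp only [lintegral_add_measure, h4 G hG, h4' G hG]

lemma IsBoxMixture.congr {L L' : (ℝ × ℝ → ℝ≥0∞) → ℝ≥0∞} (h : IsBoxMixture L)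
    (h' : ∀ G, Measurable G → L' G = L G) : IsBoxMixture L' := by
  obtain ⟨Q, h0, h1, h2, h3, h4⟩ := h
  exact ⟨Q, h0, h1, h2, h3, fun G hG => (h' G hG).trans (h4 G hG)⟩

lemma measurable_box_lintegral {G : ℝ × ℝ → ℝ≥0∞} (hG : Measurable G) :
    Measurable fun p : (ℝ × ℝ) × ℝ × ℝ => ∫⁻ z, ∫⁻ z',
      G (p.1.1 + p.1.2 * z, p.2.1 + p.2.2 * z') ∂unif ∂unif := by
  refine Measurable.lintegral_prod_right' (f := fun q : ((ℝ × ℝ) × ℝ × ℝ) × ℝ =>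
    ∫⁻ z', G (q.1.1.1 + q.1.1.2 * q.2, q.1.2.1 + q.1.2.2 * z') ∂unif) ?_
  exact Measurable.lintegral_prod_right' (f := fun q : (((ℝ × ℝ) × ℝ × ℝ) × ℝ) × ℝ =>
    G (q.1.1.1.1 + q.1.1.1.2 * q.1.2, q.1.1.2.1 + q.1.1.2.2 * q.2)) (hG.comp (by fun_prop))

/-- The squared Euclidean norm on `ℝ³`. -/
def normSq3 (V : ℝ × ℝ × ℝ) : ℝ := V.1 ^ 2 + V.2.1 ^ 2 + V.2.2 ^ 2

@[fun_prop] lemma continuous_normSq3 : Continuous normSq3 := by unfold normSq3; fun_prop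

@[fun_prop] lemma measurable_normSq3 : Measurable normSq3 := continuous_normSq3.measurable

lemma normSq3_nonneg (V : ℝ × ℝ × ℝ) : 0 ≤ normSq3 V := by unfold normSq3; positivity

lemma lintegral_pow_mul_exp_normSq3_ne_top (m k : ℕ) (C : ℝ) :
    ∫⁻ V, ENNReal.ofReal (C * (1 + normSq3 V) ^ k * Real.exp (-normSq3 V ^ (m + 1))) ≠ ∞ := by
  have hg : Integrable fun x : ℝ => Real.exp (-(1 / 2) * x ^ 2) :=
    integrable_exp_neg_mul_sq (by norm_num)
  have hI := (hg.mul_prod (hg.mul_prod hg)).const_mul (|C| * (k.factorial * 2 ^ k) * Real.exp 2)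
  refine ne_top_of_le_ne_top hI.lintegral_lt_top.ne (lintegral_mono fun V => ?_)
  refine ENNReal.ofReal_le_ofReal ?_
  set s := normSq3 V with hs
  have hs0 : 0 ≤ s := normSq3_nonneg V
  have hexp : Real.exp (-(1 / 2) * V.1 ^ 2) * (Real.exp (-(1 / 2) * V.2.1 ^ 2) *
      Real.exp (-(1 / 2) * V.2.2 ^ 2)) = Real.exp (-s / 2) := by
    rw [← Real.exp_add, ← Real.exp_add, hs, normSq3]; congr 1; ring
  rw [hexp]
  have h1 : (1 + s) ^ k ≤ k.factorial * 2 ^ k * Real.exp ((1 + s) / 2) := by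
    have := Real.pow_div_factorial_le_exp ((1 + s) / 2) (by positivity) k
    rw [div_pow, div_div, div_le_iff₀ (by positivity)] at this
    linarith
  have h2 : s - 1 ≤ s ^ (m + 1) := by
    rcases le_total s 1 with h | h
    · have : 0 ≤ s ^ (m + 1) := by positivity
      linarith
    · have : s ≤ s ^ (m + 1) := le_self_pow₀ h (Nat.succ_ne_zero m)
      linarith
  calc C * (1 + s) ^ k * Real.exp (-s ^ (m + 1))
      ≤ |C| * (k.factorial * 2 ^ k * Real.exp ((1 + s) / 2)) * Real.exp (1 - s) := by
        gcongr
        · exact le_abs_self C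
        · linarith
    _ = |C| * (k.factorial * 2 ^ k) * (Real.exp ((1 + s) / 2) * Real.exp (1 - s)) := by ring
    _ = |C| * (k.factorial * 2 ^ k) * Real.exp (3 / 2 + -s / 2) := by
        rw [← Real.exp_add]; congr 2; ring
    _ ≤ |C| * (k.factorial * 2 ^ k) * Real.exp (2 + -s / 2) := by gcongr; norm_num
    _ = _ := by rw [Real.exp_add]; ring

lemma isBoxMixture_of_density (m K : ℕ) {C : ℝ} (hC : 0 ≤ C) {ρ : ℝ × ℝ × ℝ → ℝ≥0∞}
    (hρ : Measurable ρ)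
    (hbound : ∀ V : ℝ × ℝ × ℝ, 0 < V.2.1 → 0 < V.2.2 → ρ V ≤ ENNReal.ofReal
      (C * V.2.1 ^ 2 * V.2.2 ^ 2 * (1 + normSq3 V) ^ K * Real.exp (-normSq3 V ^ (m + 1))))
    (N : Measure ((ℝ × ℝ) × ℝ × ℝ)) [IsFiniteMeasure N]
    (hmem : ∀ᵐ p ∂N, (|p.1.1| ≤ 1 ∧ |p.1.2| ≤ 1) ∧ |p.2.1| ≤ 1 ∧ |p.2.2| ≤ 1)
    (hs1 : ∫⁻ p, ENNReal.ofReal |p.1.2| ^ (-(7 / 4) : ℝ) ∂N ≠ ∞)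
    (hs2 : ∫⁻ p, ENNReal.ofReal |p.2.2| ^ (-(7 / 4) : ℝ) ∂N ≠ ∞) :
    IsBoxMixture fun G => ∫⁻ V in {V : ℝ × ℝ × ℝ | 0 < V.2.1 ∧ 0 < V.2.2}, ρ V *
      ∫⁻ p, ∫⁻ z, ∫⁻ z', G (V.2.2 * (p.1.1 + p.1.2 * z), V.2.1 * (p.2.1 + p.2.2 * z'))
        ∂unif ∂unif ∂N := by
  set R : Set (ℝ × ℝ × ℝ) := {V : ℝ × ℝ × ℝ | 0 < V.2.1 ∧ 0 < V.2.2} with hR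
  have hRm : MeasurableSet R := by
    rw [hR, ofPred_and]
    exact (measurableSet_lt measurable_const (by fun_prop)).inter
      (measurableSet_lt measurable_const (by fun_prop))
  set M : Measure (ℝ × ℝ × ℝ) := (volume.restrict R).withDensity ρ with hM
  have hsq : ∀ V : ℝ × ℝ × ℝ, V.2.1 ^ 2 ≤ 1 + normSq3 V ∧ V.2.2 ^ 2 ≤ 1 + normSq3 V := fun V => by
    constructor <;> unfold normSq3 <;> nlinarith [sq_nonneg V.1, sq_nonneg V.2.1, sq_nonneg V.2.2]
  have hone : ∀ V, 1 ≤ 1 + normSq3 V := fun V => by linarith [normSq3_nonneg V]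
  have hMint : ∀ (F : ℝ × ℝ × ℝ → ℝ≥0∞), Measurable F → (∃ (k : ℕ) (C' : ℝ), 0 ≤ C' ∧
      ∀ V ∈ R, F V * ENNReal.ofReal (V.2.1 ^ 2 * V.2.2 ^ 2) ≤
          ENNReal.ofReal (C' * (1 + normSq3 V) ^ k)) →
      ∫⁻ V, F V ∂M ≠ ∞ := by
    rintro F hF ⟨k, C', hC', hb⟩
    rw [hM, lintegral_withDensity_eq_lintegral_mul _ hρ hF]
    refine ne_top_of_le_ne_top (lintegral_pow_mul_exp_normSq3_ne_top m (k + K) (C * C'))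
      ((setLIntegral_mono' hRm fun V hV => ?_).trans (setLIntegral_le_lintegral R _))
    have hexp := (Real.exp_pos (-normSq3 V ^ (m + 1))).le
    have hN := normSq3_nonneg V
    calc (ρ * F) V ≤ ENNReal.ofReal
          (C * V.2.1 ^ 2 * V.2.2 ^ 2 * (1 + normSq3 V) ^ K * Real.exp (-normSq3 V ^ (m + 1))) *
              F V :=
          mul_le_mul_left (hbound V hV.1 hV.2) _
      _ = ENNReal.ofReal (C * (1 + normSq3 V) ^ K * Real.exp (-normSq3 V ^ (m + 1))) *
          (F V * ENNReal.ofReal (V.2.1 ^ 2 * V.2.2 ^ 2)) := by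
          rw [mul_left_comm, ← ENNReal.ofReal_mul (by positivity), mul_comm]; congr 2; ring
      _ ≤ _ := mul_le_mul_right (hb V hV) _
      _ = _ := by
          rw [← ENNReal.ofReal_mul (by positivity)]; congr 1; ring
  have hMfin : IsFiniteMeasure M := by
    refine ⟨lt_top_iff_ne_top.2 ?_⟩
    have := hMint (fun _ => 1) measurable_const ⟨2, 1, zero_le_one, fun V _ => by
      rw [one_mul, one_mul, sq (1 + _)]
      exact ENNReal.ofReal_le_ofReal (mul_le_mul (hsq V).1 (hsq V).2 (by positivity)
        (by linarith [hone V]))⟩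
    simpa using this
  have hMR : ∀ᵐ V ∂M, V ∈ R :=
    (withDensity_absolutelyContinuous _ _).ae_le (ae_restrict_mem hRm)
  have hquarter : ∀ x : ℝ, 0 < x → ∀ V : ℝ × ℝ × ℝ, x ^ 2 ≤ 1 + normSq3 V →
      ENNReal.ofReal x ^ (-(7 / 4) : ℝ) * ENNReal.ofReal (x ^ 2) ≤
          ENNReal.ofReal (1 + normSq3 V) := by
    intro x hx V hV
    rw [ENNReal.ofReal_rpow_of_pos hx, ← ENNReal.ofReal_mul (by positivity)]
    refine ENNReal.ofReal_le_ofReal ?_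
    rw [← Real.rpow_natCast x 2, ← Real.rpow_add hx]
    rcases le_total x 1 with h | h
    · exact (Real.rpow_le_one hx.le h (by norm_num)).trans (hone V)
    · refine (Real.rpow_le_rpow_of_exponent_le h (y := _) (z := ((2 : ℕ) : ℝ))
          (by norm_num)).trans ?_
      rwa [Real.rpow_natCast]
  let Φ : (ℝ × ℝ × ℝ) × ((ℝ × ℝ) × ℝ × ℝ) → (ℝ × ℝ) × ℝ × ℝ := fun q =>
      ((q.1.2.2 * q.2.1.1, q.1.2.2 * q.2.1.2), (q.1.2.1 * q.2.2.1, q.1.2.1 * q.2.2.2))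
  have hΦ : Measurable Φ := by fun_prop
  refine ⟨(M.prod N).map Φ, Measure.isFiniteMeasure_map _ _, fun k => ?_, ?_, ?_, fun G hG => ?_⟩
  · rw [lintegral_map (by fun_prop) hΦ]
    have hF := hMint (fun V => ENNReal.ofReal ((4 * (1 + normSq3 V)) ^ k)) (by fun_prop)
      ⟨k + 2, 4 ^ k, by positivity, fun V _ => by
        have hN := normSq3_nonneg V
        rw [← ENNReal.ofReal_mul (by positivity)]
        refine ENNReal.ofReal_le_ofReal ?_
        have h := mul_le_mul (hsq V).1 (hsq V).2 (by positivity) (by linarith)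
        calc _ ≤ (4 * (1 + normSq3 V)) ^ k * ((1 + normSq3 V) * (1 + normSq3 V)) := by gcongr
          _ = _ := by rw [mul_pow]; ring⟩
    refine ne_top_of_le_ne_top (ENNReal.mul_ne_top hF (measure_ne_top N univ)) ?_
    rw [← lintegral_mul_const _ (by fun_prop), lintegral_prod _ (by fun_prop)]
    refine lintegral_mono_ae (hMR.mono fun V hV => ?_)
    rw [← lintegral_const]
    refine lintegral_mono_ae (hmem.mono fun p hp => ?_)
    refine ENNReal.ofReal_le_ofReal (pow_le_pow_left₀ (by positivity) ?_ k)
    have ha : V.2.1 ≤ 1 + normSq3 V := by nlinarith [(hsq V).1, hone V, sq_nonneg (V.2.1 - 1)]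
    have hb : V.2.2 ≤ 1 + normSq3 V := by nlinarith [(hsq V).2, hone V, sq_nonneg (V.2.2 - 1)]
    simp only [Φ, abs_mul, abs_of_pos hV.1, abs_of_pos hV.2]
    have hV1 := hV.1.le
    have hV2 := hV.2.le
    have e1 := mul_le_mul_of_nonneg_left hp.1.1 hV2
    have e2 := mul_le_mul_of_nonneg_left hp.1.2 hV2
    have e3 := mul_le_mul_of_nonneg_left hp.2.1 hV1
    have e4 := mul_le_mul_of_nonneg_left hp.2.2 hV1
    linarith
  · rw [lintegral_map (by fun_prop) hΦ]
    have hF := hMint (fun V => ENNReal.ofReal |V.2.2| ^ (-(7 / 4) : ℝ)) (by fun_prop)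
      ⟨2, 1, by positivity, fun V hV => by
        rw [abs_of_pos hV.2, mul_comm (V.2.1 ^ 2), ENNReal.ofReal_mul (by positivity), ← mul_assoc,
          one_mul, sq (1 + _), ENNReal.ofReal_mul (by linarith [hone V])]
        exact mul_le_mul' (hquarter _ hV.2 V (hsq V).2) (ENNReal.ofReal_le_ofReal (hsq V).1)⟩
    refine ne_top_of_le_ne_top (ENNReal.mul_ne_top hF hs1) (le_of_eq ?_)
    rw [← lintegral_mul_const _ (by fun_prop), lintegral_prod _ (by fun_prop)]
    refine lintegral_congr_ae (hMR.mono fun V hV => ?_)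
    simp only
    rw [← lintegral_const_mul _ (by fun_prop)]
    refine lintegral_congr fun p => ?_
    rw [abs_mul, ENNReal.ofReal_mul (by positivity), ENNReal.mul_rpow_of_ne_top] <;> simp
  · rw [lintegral_map (by fun_prop) hΦ]
    have hF := hMint (fun V => ENNReal.ofReal |V.2.1| ^ (-(7 / 4) : ℝ)) (by fun_prop)
      ⟨2, 1, by positivity, fun V hV => by
        rw [abs_of_pos hV.1, ENNReal.ofReal_mul (by positivity), ← mul_assoc,
          one_mul, sq (1 + _), ENNReal.ofReal_mul (by linarith [hone V])]
        exact mul_le_mul' (hquarter _ hV.1 V (hsq V).1) (ENNReal.ofReal_le_ofReal (hsq V).2)⟩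
    refine ne_top_of_le_ne_top (ENNReal.mul_ne_top hF hs2) (le_of_eq ?_)
    rw [← lintegral_mul_const _ (by fun_prop), lintegral_prod _ (by fun_prop)]
    refine lintegral_congr_ae (hMR.mono fun V hV => ?_)
    simp only
    rw [← lintegral_const_mul _ (by fun_prop)]
    refine lintegral_congr fun p => ?_
    rw [abs_mul, ENNReal.ofReal_mul (by positivity), ENNReal.mul_rpow_of_ne_top] <;> simp
  · have hcomp := (measurable_box_lintegral hG).comp hΦ
    rw [lintegral_map (measurable_box_lintegral hG) hΦ]
    refine Eq.trans ?_ (lintegral_prod _ hcomp.aemeasurable).symm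
    rw [hM, lintegral_withDensity_eq_lintegral_mul _ hρ hcomp.lintegral_prod_right']
    refine lintegral_congr fun V => ?_
    simp only [Pi.mul_apply]
    congr 1
    refine lintegral_congr fun p => lintegral_congr fun z => lintegral_congr fun z' => ?_
    simp only [Φ]
    congr 2 <;> ring

/-- The weight attached to the auxiliary variables `(u, b, a)`. -/
def auxWeight (m : ℕ) (V : ℝ × ℝ × ℝ) : ℝ :=
  4 * (m + 1) ^ 2 * (V.2.1 * V.2.2) * bump m (normSq3 V)

@[fun_prop] lemma measurable_auxWeight (m : ℕ) : Measurable (auxWeight m) := by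
  have := (continuous_bump m).measurable
  unfold auxWeight
  fun_prop

/-- The region `|x| < a`, `|h| < b` in the variables `((u, b, a), (x, h))`. -/
def auxRegion : Set ((ℝ × ℝ × ℝ) × ℝ × ℝ) := {q | |q.2.1| < q.1.2.2 ∧ |q.2.2| < q.1.2.1}

lemma measurableSet_auxRegion : MeasurableSet auxRegion := by
  rw [auxRegion, ofPred_and]
  exact (measurableSet_lt (by fun_prop) (by fun_prop)).inter
    (measurableSet_lt (by fun_prop) (by fun_prop))

/-- The functional on functions of `(x, h)` with weight `ω`. -/
def auxFunctional (m : ℕ) (ω : (ℝ × ℝ × ℝ) × ℝ × ℝ → ℝ) (G : ℝ × ℝ → ℝ≥0∞) : ℝ≥0∞ :=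
  ∫⁻ q in auxRegion, ENNReal.ofReal (ω q) * ENNReal.ofReal (auxWeight m q.1) * G q.2

/-- Nonnegative weights whose functional is a mixture of uniform laws on rectangles. -/
def IsBoxWeight (m : ℕ) (ω : (ℝ × ℝ × ℝ) × ℝ × ℝ → ℝ) : Prop :=
  Measurable ω ∧ (∀ q, 0 ≤ ω q) ∧ IsBoxMixture (auxFunctional m ω)

lemma IsBoxWeight.sum (m : ℕ) {ι : Type*} (s : Finset ι) (ω : ι → (ℝ × ℝ × ℝ) × ℝ × ℝ → ℝ)
    (h : ∀ i ∈ s, IsBoxWeight m (ω i)) : IsBoxWeight m (fun q => ∑ i ∈ s, ω i q) := by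
  classical
  induction s using Finset.induction_on with
  | empty =>
    refine ⟨by simp, by simp, IsBoxMixture.zero.congr fun G hG => ?_⟩
    simp [auxFunctional]
  | insert i s his ih =>
    have h1 := h i (Finset.mem_insert_self _ _)
    have h2 := ih fun j hj => h j (Finset.mem_insert_of_mem hj)
    simp only [Finset.sum_insert his]
    refine ⟨h1.1.add h2.1, fun q => add_nonneg (h1.2.1 q) (h2.2.1 q),
      (h1.2.2.add h2.2.2).congr fun G hG => ?_⟩
    have m1 := h1.1
    simp only [auxFunctional]
    rw [← lintegral_add_left (by fun_prop)]
    refine lintegral_congr fun q => ?_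
    rw [ENNReal.ofReal_add (h1.2.1 q) (h2.2.1 q)]
    ring

lemma isBoxWeight_monomial (m α β i j : ℕ) {c : ℝ} (hc : 0 ≤ c) :
    IsBoxWeight m fun q => c * q.1.1 ^ (2 * α) * (q.1.1 ^ 2 + q.1.2.1 ^ 2) ^ β *
      (q.2.1 ^ (2 * i) * q.2.2 ^ (2 * j)) := by
  have heven : ∀ (k : ℕ) (x : ℝ), 0 ≤ x ^ (2 * k) := fun k x => (even_two_mul k).pow_nonneg x
  refine ⟨by fun_prop, fun q => mul_nonneg (mul_nonneg (mul_nonneg hc (heven _ _)) (by positivity))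
    (mul_nonneg (heven _ _) (heven _ _)), ?_⟩
  obtain ⟨N, hN, hmem, hs1, hs2, hmix⟩ := exists_even_pow_mixture_prod i j
  set κ : ℝ × ℝ × ℝ → ℝ := fun V => c * V.1 ^ (2 * α) * (V.1 ^ 2 + V.2.1 ^ 2) ^ β with hκ
  have hκ0 : ∀ V, 0 ≤ κ V := fun V => mul_nonneg (mul_nonneg hc (heven _ _)) (by positivity)
  set ρ : ℝ × ℝ × ℝ → ℝ≥0∞ := fun V => ENNReal.ofReal (κ V * auxWeight m V *
    (V.2.2 ^ (2 * i + 1) * V.2.1 ^ (2 * j + 1))) with hρ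
  have hκm : Measurable κ := by fun_prop
  have hρm : Measurable ρ := by fun_prop
  have hw : ∀ V : ℝ × ℝ × ℝ, 0 < V.2.1 → 0 < V.2.2 → 0 ≤ auxWeight m V := fun V h1 h2 => by
    have := bump_nonneg m (normSq3_nonneg V)
    unfold auxWeight; positivity
  refine (isBoxMixture_of_density m (α + β + m + i + j) (C := c * (4 * (m + 1) ^ 2)) (by positivity)
    hρm (fun V h1 h2 => ENNReal.ofReal_le_ofReal ?_) N hmem hs1 hs2).congr fun G hG => ?_
  · have hN0 := normSq3_nonneg V
    have hle : ∀ x : ℝ, x ^ 2 ≤ 1 + normSq3 V → ∀ k : ℕ, x ^ (2 * k) ≤ (1 + normSq3 V) ^ k :=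
      fun x hx k => by rw [pow_mul]; exact pow_le_pow_left₀ (by positivity) hx k
    have b1 : V.1 ^ (2 * α) ≤ (1 + normSq3 V) ^ α :=
      hle _ (by unfold normSq3; nlinarith [sq_nonneg V.2.1, sq_nonneg V.2.2]) _
    have b2 : V.2.1 ^ (2 * j) ≤ (1 + normSq3 V) ^ j :=
      hle _ (by unfold normSq3; nlinarith [sq_nonneg V.1, sq_nonneg V.2.2]) _
    have b3 : V.2.2 ^ (2 * i) ≤ (1 + normSq3 V) ^ i :=
      hle _ (by unfold normSq3; nlinarith [sq_nonneg V.2.1, sq_nonneg V.1]) _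
    have b4 : (V.1 ^ 2 + V.2.1 ^ 2) ^ β ≤ (1 + normSq3 V) ^ β :=
      pow_le_pow_left₀ (by positivity) (by unfold normSq3; nlinarith [sq_nonneg V.2.2]) _
    have b5 : normSq3 V ^ m ≤ (1 + normSq3 V) ^ m := pow_le_pow_left₀ hN0 (by linarith) _
    have hE := (Real.exp_pos (-normSq3 V ^ (m + 1))).le
    have := heven α V.1
    calc κ V * auxWeight m V * (V.2.2 ^ (2 * i + 1) * V.2.1 ^ (2 * j + 1))
        = c * (4 * (m + 1) ^ 2) * V.2.1 ^ 2 * V.2.2 ^ 2 * (V.1 ^ (2 * α) *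
          (V.1 ^ 2 + V.2.1 ^ 2) ^ β * normSq3 V ^ m * V.2.2 ^ (2 * i) * V.2.1 ^ (2 * j)) *
          Real.exp (-normSq3 V ^ (m + 1)) := by
          simp only [hκ, auxWeight, bump]; ring
      _ ≤ c * (4 * (m + 1) ^ 2) * V.2.1 ^ 2 * V.2.2 ^ 2 * ((1 + normSq3 V) ^ α *
          (1 + normSq3 V) ^ β * (1 + normSq3 V) ^ m * (1 + normSq3 V) ^ i * (1 + normSq3 V) ^ j) *
          Real.exp (-normSq3 V ^ (m + 1)) := by gcongr
      _ = _ := by rw [← pow_add, ← pow_add, ← pow_add, ← pow_add]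
  · have hRm : MeasurableSet {V : ℝ × ℝ × ℝ | 0 < V.2.1 ∧ 0 < V.2.2} := by
      rw [ofPred_and]
      exact (measurableSet_lt measurable_const (by fun_prop)).inter
        (measurableSet_lt measurable_const (by fun_prop))
    set F : (ℝ × ℝ × ℝ) × ℝ × ℝ → ℝ≥0∞ := fun q =>
      ENNReal.ofReal (κ q.1 * (q.2.1 ^ (2 * i) * q.2.2 ^ (2 * j))) *
        ENNReal.ofReal (auxWeight m q.1) * G q.2 with hF
    have hFm : Measurable F := by fun_prop
    rw [auxFunctional, ← lintegral_indicator measurableSet_auxRegion,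
      ← lintegral_indicator hRm]
    change ∫⁻ q, auxRegion.indicator F q = _
    refine (lintegral_prod _ (hFm.indicator measurableSet_auxRegion).aemeasurable).trans ?_
    refine lintegral_congr fun V => ?_
    by_cases hV : 0 < V.2.1 ∧ 0 < V.2.2
    · rw [indicator_of_mem (show V ∈ {V : ℝ × ℝ × ℝ | 0 < V.2.1 ∧ 0 < V.2.2} from hV)]
      have hset : ∀ y, auxRegion.indicator F (V, y)
          = (Ioo (-V.2.2) V.2.2 ×ˢ Ioo (-V.2.1) V.2.1).indicator (fun y => F (V, y)) y :=
              fun y => by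
        simp only [indicator, auxRegion, mem_prod, mem_Ioo, ← abs_lt, mem_ofPred_eq]
        congr
      simp only [hset]
      rw [lintegral_indicator (measurableSet_Ioo.prod measurableSet_Ioo)]
      refine (setLIntegral_prod (μ := volume) (ν := volume) (s := Ioo (-V.2.2) V.2.2)
        (t := Ioo (-V.2.1) V.2.1) (fun y => F (V, y)) (by fun_prop)).trans ?_
      have hpt : ∀ x h, F (V, x, h) = ENNReal.ofReal (κ V * auxWeight m V) *
          (G (x, h) * ENNReal.ofReal (x ^ (2 * i) * h ^ (2 * j))) := fun x h => by
        simp only [hF]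
        rw [ENNReal.ofReal_mul (hκ0 V), ENNReal.ofReal_mul (hκ0 V)]
        ring
      simp only [hpt]
      simp_rw [lintegral_const_mul' _ _ (ENNReal.ofReal_ne_top (r := κ V * auxWeight m V))]
      rw [hmix G hG _ _ hV.2 hV.1, ← mul_assoc, ← ENNReal.ofReal_mul
        (mul_nonneg (hκ0 V) (hw V hV.1 hV.2))]
    · rw [indicator_of_notMem (show V ∉ {V : ℝ × ℝ × ℝ | 0 < V.2.1 ∧ 0 < V.2.2} from hV)]
      refine (lintegral_congr fun y => indicator_of_notMem (fun hy => hV ?_) F).trans lintegral_zero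
      exact ⟨(abs_nonneg _).trans_lt hy.2, (abs_nonneg _).trans_lt hy.1⟩

/-- The rotation invariant law with density proportional to `bump m (x² + h² + u²)` has an
`(x, h)`-marginal that is a mixture of uniform laws on rectangles. -/
lemma isBoxMixture_bump (m : ℕ) : IsBoxMixture fun G =>
    ∫⁻ q : ℝ × ℝ × ℝ, G (q.1, q.2.1) *
        ENNReal.ofReal (bump m (q.1 ^ 2 + q.2.1 ^ 2 + q.2.2 ^ 2)) := by
  set ω : (ℝ × ℝ × ℝ) × ℝ × ℝ → ℝ := fun q => (q.1.1 ^ 2 + q.2.1 ^ 2 + q.2.2 ^ 2) ^ m *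
    (q.1.1 ^ 2 + q.1.2.1 ^ 2 + q.2.1 ^ 2) ^ m with hω
  have hωw : IsBoxWeight m ω := by
    have : ω = fun q => ∑ j ∈ Finset.range (m + 1), ∑ k ∈ Finset.range (j + 1),
        ∑ l ∈ Finset.range (m + 1), ((m.choose j * j.choose k * m.choose l : ℕ) : ℝ) *
          q.1.1 ^ (2 * k) * (q.1.1 ^ 2 + q.1.2.1 ^ 2) ^ l *
          (q.2.1 ^ (2 * (j - k + (m - l))) * q.2.2 ^ (2 * (m - j))) := by
      funext q
      simp only [hω]
      rw [add_pow, add_pow (q.1.1 ^ 2 + q.1.2.1 ^ 2), Finset.sum_mul]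
      refine Finset.sum_congr rfl fun j _ => ?_
      rw [add_pow, Finset.sum_mul, Finset.sum_mul, Finset.sum_mul]
      refine Finset.sum_congr rfl fun k _ => ?_
      rw [Finset.mul_sum]
      refine Finset.sum_congr rfl fun l _ => ?_
      push_cast
      rw [mul_add, pow_add, pow_mul q.1.1, pow_mul q.2.1, pow_mul q.2.1, pow_mul q.2.2]
      ring
    rw [this]
    exact IsBoxWeight.sum m _ _ fun j _ => IsBoxWeight.sum m _ _ fun k _ =>
      IsBoxWeight.sum m _ _ fun l _ => isBoxWeight_monomial m k l _ _ (by positivity)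
  refine hωw.2.2.congr fun G hG => ?_
  have hωm : Measurable ω := hωw.1
  have hbm : Measurable (bump m) := (continuous_bump m).measurable
  set F : (ℝ × ℝ × ℝ) × ℝ × ℝ → ℝ≥0∞ := fun q =>
    ENNReal.ofReal (ω q) * ENNReal.ofReal (auxWeight m q.1) * G q.2 with hF
  have hFm : Measurable F := by fun_prop
  have hFi := hFm.indicator measurableSet_auxRegion
  have hR : auxFunctional m ω G
      = ∫⁻ y : ℝ × ℝ, ∫⁻ V : ℝ × ℝ × ℝ, auxRegion.indicator F (V, y) := by
    rw [auxFunctional, ← lintegral_indicator measurableSet_auxRegion]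
    exact lintegral_prod_symm' _ hFi
  have hL : ∫⁻ q : ℝ × ℝ × ℝ, G (q.1, q.2.1) *
        ENNReal.ofReal (bump m (q.1 ^ 2 + q.2.1 ^ 2 + q.2.2 ^ 2))
      = ∫⁻ y : ℝ × ℝ, ∫⁻ u, G y * ENNReal.ofReal (bump m (y.1 ^ 2 + y.2 ^ 2 + u ^ 2)) := by
    have hm3 : Measurable fun q : ℝ × ℝ × ℝ => G (q.1, q.2.1) *
        ENNReal.ofReal (bump m (q.1 ^ 2 + q.2.1 ^ 2 + q.2.2 ^ 2)) := by fun_prop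
    have hm3' : Measurable fun q : (ℝ × ℝ) × ℝ => G q.1 *
        ENNReal.ofReal (bump m (q.1.1 ^ 2 + q.1.2 ^ 2 + q.2 ^ 2)) := by fun_prop
    refine (lintegral_prod _ hm3.aemeasurable).trans ?_
    refine Eq.trans ?_ (lintegral_prod (μ := volume) (ν := volume) _
      hm3'.lintegral_prod_right'.aemeasurable).symm
    exact lintegral_congr fun x => lintegral_prod _ (by fun_prop)
  rw [hR, hL]
  refine lintegral_congr fun y => ?_
  have hFy : Measurable fun V => auxRegion.indicator F (V, y) := hFi.comp (by fun_prop)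
  refine Eq.trans ?_ (lintegral_prod _ hFy.aemeasurable).symm
  refine lintegral_congr fun u => ?_
  have hFu : Measurable fun B : ℝ × ℝ => auxRegion.indicator F ((u, B), y) :=
    hFi.comp (by fun_prop)
  refine Eq.trans ?_ (lintegral_prod _ hFu.aemeasurable).symm
  obtain ⟨x, h⟩ := y
  have hin : ∀ b, ∫⁻ a, auxRegion.indicator F ((u, b, a), (x, h))
      = (Ioi |h|).indicator (fun b => (G (x, h) * ENNReal.ofReal ((u ^ 2 + x ^ 2 + h ^ 2) ^ m)) *
        ENNReal.ofReal (2 * (m + 1) * b * bump m (u ^ 2 + x ^ 2 + b ^ 2))) b := by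
    intro b
    by_cases hb : b ∈ Ioi |h|
    · have hb0 : 0 < b := (abs_nonneg h).trans_lt hb
      rw [indicator_of_mem hb]
      have hset : ∀ a, auxRegion.indicator F ((u, b, a), (x, h)) = (Ioi |x|).indicator
          (fun a => (G (x, h) * ENNReal.ofReal ((u ^ 2 + x ^ 2 + h ^ 2) ^ m) *
            ENNReal.ofReal (2 * (m + 1) * b * (u ^ 2 + b ^ 2 + x ^ 2) ^ m)) *
            ENNReal.ofReal (2 * (m + 1) * a * bump m (u ^ 2 + b ^ 2 + a ^ 2))) a := by
        intro a
        by_cases ha : a ∈ Ioi |x|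
        · rw [indicator_of_mem ha, indicator_of_mem (show ((u, b, a), (x, h)) ∈ auxRegion from
            ⟨ha, hb⟩)]
          simp only [hF, hω]
          rw [mul_comm _ (G (x, h)), mul_assoc, mul_assoc]
          congr 1
          rw [← ENNReal.ofReal_mul (by positivity), ← ENNReal.ofReal_mul (by positivity),
            ← ENNReal.ofReal_mul (by positivity)]
          simp only [auxWeight, normSq3]
          congr 1; ring
        · rw [indicator_of_notMem ha, indicator_of_notMem (fun hmem => ha hmem.1)]
      simp only [hset]
      rw [lintegral_indicator measurableSet_Ioi, lintegral_const_mul _ (by fun_prop)]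
      have := lintegral_Ioi_mul_bump m (a := u ^ 2 + b ^ 2) (by positivity) (abs_nonneg x)
      rw [sq_abs] at this
      rw [this, mul_assoc, ← ENNReal.ofReal_mul (by positivity)]
      congr 2
      simp only [bump]
      rw [show u ^ 2 + b ^ 2 + x ^ 2 = u ^ 2 + x ^ 2 + b ^ 2 by ring]
      ring
    · rw [indicator_of_notMem hb]
      refine (lintegral_congr fun a => indicator_of_notMem (fun hmem => hb hmem.2) F).trans
        lintegral_zero
  simp only [hin]
  rw [lintegral_indicator measurableSet_Ioi, lintegral_const_mul _ (by fun_prop)]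
  have := lintegral_Ioi_mul_bump m (a := u ^ 2 + x ^ 2) (by positivity) (abs_nonneg h)
  rw [sq_abs] at this
  rw [this, mul_assoc, ← ENNReal.ofReal_mul (by positivity)]
  congr 2
  simp only [bump]
  rw [show x ^ 2 + h ^ 2 + u ^ 2 = u ^ 2 + x ^ 2 + h ^ 2 by ring]

/-- The total mass of the density `exp (-x ^ (2 (m + 1)))`. -/
def gibbsMass (m : ℕ) : ℝ≥0∞ :=
  ∫⁻ x : ℝ, ENNReal.ofReal (Real.exp (-x ^ (2 * (m + 1))))

/-- The probability measure with density proportional to `exp (-x ^ (2 (m + 1)))`. -/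
def gibbs (m : ℕ) : Measure ℝ :=
  (gibbsMass m)⁻¹ • volume.withDensity fun x => ENNReal.ofReal (Real.exp (-x ^ (2 * (m + 1))))

lemma gibbsMass_ne_zero (m : ℕ) : gibbsMass m ≠ 0 := by
  rw [gibbsMass, Ne, lintegral_eq_zero_iff (by fun_prop)]
  intro h
  have : ∀ᵐ x : ℝ, False := by
    filter_upwards [h] with x hx
    simp only [Pi.zero_apply, ENNReal.ofReal_eq_zero] at hx
    exact absurd (Real.exp_pos _) (not_lt.mpr hx)
  exact (inferInstance : NeZero (volume : Measure ℝ)).out (by simpa using this)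

/-- Parameters `((c₁, β₁), (c₂, β₂))` of the rectangle
`{(c₁ + β₁ z, c₂ + β₂ z') : z, z' ∈ [0, 1]}`. -/
abbrev BoxParam := (ℝ × ℝ) × ℝ × ℝ

/-- An upper bound for the coordinates of points of the rectangle. -/
def BoxParam.reach (ω : BoxParam) : ℝ := |ω.1.1| + |ω.1.2| + |ω.2.1| + |ω.2.2|

/-- The smaller side length of the rectangle, capped at one. -/
def BoxParam.width (ω : BoxParam) : ℝ := min 1 (min |ω.1.2| |ω.2.2|)

@[fun_prop] lemma BoxParam.measurable_reach : Measurable BoxParam.reach := by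
  unfold BoxParam.reach; fun_prop

@[fun_prop] lemma BoxParam.measurable_width : Measurable BoxParam.width := by
  unfold BoxParam.width; fun_prop

lemma BoxParam.reach_nonneg (ω : BoxParam) : 0 ≤ ω.reach := by unfold BoxParam.reach; positivity

lemma BoxParam.width_nonneg (ω : BoxParam) : 0 ≤ ω.width := by unfold BoxParam.width; positivity

/-- The point of the line through `(c₁ + β₁ z, c₂ + β₂ z')` with parameter `s`, normalised. -/
def slide (s : ℝ) (q : BoxParam × ℝ × ℝ) : ℝ :=
  (q.1.1.1 + q.1.1.2 * q.2.1 + s * (q.1.2.1 + q.1.2.2 * q.2.2)) / √(1 + s ^ 2)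

@[fun_prop] lemma measurable_slide (s : ℝ) : Measurable (slide s) := by
  unfold slide; fun_prop

/-- Along a uniformly random line inside a random rectangle, every point has law `gibbs m`. -/
lemma exists_box_representation (m : ℕ) : gibbsMass m ≠ ∞ ∧ ∃ P : Measure BoxParam,
    IsProbabilityMeasure P ∧ (∀ k : ℕ, ∫⁻ ω, ENNReal.ofReal (ω.reach ^ k) ∂P ≠ ∞) ∧
    ∫⁻ ω, ENNReal.ofReal ω.width ^ (-(7 / 4) : ℝ) ∂P ≠ ∞ ∧
    ∀ s, (P.prod (unif.prod unif)).map (slide s) = gibbs m := by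
  obtain ⟨Q, hQ, hk, h1, h2, hG⟩ := isBoxMixture_bump m
  have hrot : ∀ (s : ℝ) (g : ℝ → ℝ≥0∞), Measurable g →
      ∫⁻ p, ∫⁻ z, ∫⁻ z', g (slide s (p, z, z')) ∂unif ∂unif ∂Q =
        ENNReal.ofReal (Real.pi / (m + 1)) *
          ∫⁻ x, g x * ENNReal.ofReal (Real.exp (-x ^ (2 * (m + 1)))) := fun s g hg => by
    rw [← lintegral_rotated_marginal m hg s]
    exact (hG (fun y => g ((y.1 + s * y.2) / √(1 + s ^ 2))) (by fun_prop)).symm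
  have hpi : ENNReal.ofReal (Real.pi / (m + 1)) ≠ 0 := by
    have := Real.pi_pos
    simp only [ne_eq, ENNReal.ofReal_eq_zero, not_le]
    positivity
  have hmass : Q univ = ENNReal.ofReal (Real.pi / (m + 1)) * gibbsMass m := by
    have := hrot 0 (fun _ => 1) measurable_const
    simpa [gibbsMass] using this
  have hfin : gibbsMass m ≠ ∞ := fun h => by
    rw [h, ENNReal.mul_top hpi] at hmass
    exact measure_ne_top Q univ hmass
  have hQ0 : Q univ ≠ 0 := by
    rw [hmass]; exact mul_ne_zero hpi (gibbsMass_ne_zero m)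
  have hinv : (Q univ)⁻¹ ≠ ∞ := ENNReal.inv_ne_top.mpr hQ0
  have hP : IsProbabilityMeasure ((Q univ)⁻¹ • Q) := ⟨by
    simp [ENNReal.inv_mul_cancel hQ0 (measure_ne_top Q univ)]⟩
  refine ⟨hfin, (Q univ)⁻¹ • Q, hP, fun k => ?_, ?_, fun s => ?_⟩
  · rw [lintegral_smul_measure]
    exact ENNReal.mul_ne_top hinv (hk k)
  · rw [lintegral_smul_measure]
    refine ENNReal.mul_ne_top hinv (ne_top_of_le_ne_top (b := Q univ +
      (∫⁻ p, ENNReal.ofReal |p.1.2| ^ (-(7 / 4) : ℝ) ∂Q +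
        ∫⁻ p, ENNReal.ofReal |p.2.2| ^ (-(7 / 4) : ℝ) ∂Q)) (by simp [h1, h2]) ?_)
    rw [← lintegral_add_left (by fun_prop), ← lintegral_one, ← lintegral_add_left (by fun_prop)]
    refine lintegral_mono fun ω => ?_
    simp only [BoxParam.width]
    rcases min_choice (1 : ℝ) (min |ω.1.2| |ω.2.2|) with h | h <;> rw [h]
    · simp
    rcases min_choice |ω.1.2| |ω.2.2| with h' | h' <;> rw [h']
    · exact le_add_left le_self_add
    · exact le_add_left le_add_self
  · ext A hA
    have hg : Measurable (A.indicator (1 : ℝ → ℝ≥0∞)) := measurable_one.indicator hA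
    have hmeas : Measurable fun q : BoxParam × ℝ × ℝ => A.indicator (1 : ℝ → ℝ≥0∞) (slide s q) :=
      hg.comp (measurable_slide s)
    rw [← lintegral_indicator_one hA, lintegral_map hg (measurable_slide s)]
    refine (lintegral_prod _ hmeas.aemeasurable).trans ?_
    have hin : ∀ p : BoxParam, ∫⁻ y, A.indicator (1 : ℝ → ℝ≥0∞) (slide s (p, y)) ∂(unif.prod unif)
        = ∫⁻ z, ∫⁻ z', A.indicator (1 : ℝ → ℝ≥0∞) (slide s (p, z, z')) ∂unif ∂unif := fun p =>
      lintegral_prod _ (hmeas.comp (by fun_prop)).aemeasurable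
    simp only [hin]
    rw [lintegral_smul_measure, hrot s _ hg, hmass, gibbs]
    rw [← lintegral_indicator_one hA, lintegral_smul_measure,
      lintegral_withDensity_eq_lintegral_mul _ (by fun_prop) hg, smul_eq_mul, smul_eq_mul,
      ENNReal.mul_inv (Or.inl hpi) (Or.inl ENNReal.ofReal_ne_top), mul_mul_mul_comm,
      ENNReal.inv_mul_cancel hpi ENNReal.ofReal_ne_top, one_mul]
    simp only [Pi.mul_apply, mul_comm]

lemma isProbabilityMeasure_gibbs {m : ℕ} (h : gibbsMass m ≠ ∞) :
    IsProbabilityMeasure (gibbs m) := ⟨by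
  rw [gibbs, Measure.smul_apply, withDensity_apply _ MeasurableSet.univ, Measure.restrict_univ,
    smul_eq_mul]
  exact ENNReal.inv_mul_cancel (gibbsMass_ne_zero m) h⟩

/-- The coordinatewise version of `slide`. -/
def slideAll {n : ℕ} (s : ℝ) (q : (Fin n → BoxParam) × (Fin n → ℝ) × (Fin n → ℝ)) :
    Fin n → ℝ := fun i => slide s (q.1 i, q.2.1 i, q.2.2 i)

lemma measurable_slideAll_uncurry {n : ℕ} : Measurable fun q : ℝ ×
    ((Fin n → BoxParam) × (Fin n → ℝ) × (Fin n → ℝ)) => slideAll q.1 q.2 := by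
  refine measurable_pi_lambda _ fun i => ?_
  simp only [slideAll, slide]
  have h0 : Measurable fun q : ℝ × ((Fin n → BoxParam) × (Fin n → ℝ) × (Fin n → ℝ)) => q.2.1 i :=
    (measurable_pi_apply i).comp (by fun_prop)
  fun_prop

lemma map_slideAll {P : Measure BoxParam} [IsProbabilityMeasure P] {ν : Measure ℝ}
    [IsProbabilityMeasure ν] {s : ℝ} (h : (P.prod (unif.prod unif)).map (slide s) = ν) (n : ℕ) :
    ((Measure.pi fun _ => P).prod ((cube n).prod (cube n))).map (slideAll s)
      = Measure.pi fun _ => ν := by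
  have e1 := measurePreserving_arrowProdEquivProdArrow BoxParam (ℝ × ℝ) (Fin n) (fun _ => P)
    (fun _ => unif.prod unif)
  have e2 := measurePreserving_arrowProdEquivProdArrow ℝ ℝ (Fin n) (fun _ => unif) (fun _ => unif)
  have e3 := ((MeasurePreserving.id (Measure.pi fun _ : Fin n => P)).prod e2).comp e1
  have hm : Measurable (slideAll s (n := n)) :=
    measurable_slideAll_uncurry.comp (measurable_const.prodMk measurable_id)
  change (Measure.prod _ ((Measure.pi fun _ => unif).prod (Measure.pi fun _ => unif))).map _ = _
  rw [← e3.map_eq, Measure.map_map hm e3.measurable]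
  have hν : ∀ i : Fin n, SigmaFinite ((P.prod (unif.prod unif)).map (slide s)) := fun _ => by
    rw [h]; infer_instance
  have := Measure.pi_map_pi (μ := fun _ : Fin n => P.prod (unif.prod unif))
    (f := fun _ => slide s) (hμ := hν) fun _ => (measurable_slide s).aemeasurable
  rw [h] at this
  exact this

/-- The gauge `∑ xᵢ ^ (2 (m + 1))`. -/
def powSum {n : ℕ} (m : ℕ) (x : Fin n → ℝ) : ℝ := ∑ i, x i ^ (2 * (m + 1))

@[fun_prop] lemma measurable_powSum {n : ℕ} (m : ℕ) : Measurable (powSum (n := n) m) := by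
  unfold powSum; fun_prop

lemma powSum_nonneg {n : ℕ} (m : ℕ) (x : Fin n → ℝ) : 0 ≤ powSum m x :=
  Finset.sum_nonneg fun _ _ => (even_two_mul _).pow_nonneg _

lemma powSum_smul {n : ℕ} (m : ℕ) (r : ℝ) (x : Fin n → ℝ) :
    powSum m (r • x) = r ^ (2 * (m + 1)) * powSum m x := by
  simp [powSum, mul_pow, Finset.mul_sum]

lemma lintegral_pi_gibbs {m : ℕ} (hm : gibbsMass m ≠ ∞) {n : ℕ} {F : (Fin n → ℝ) → ℝ≥0∞}
    (hF : Measurable F) :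
    ∫⁻ x, F x ∂(Measure.pi fun _ => gibbs m) =
      (gibbsMass m)⁻¹ ^ n * ∫⁻ x, F x * ENNReal.ofReal (Real.exp (-powSum m x)) := by
  have := isProbabilityMeasure_gibbs hm
  rw [volume_pi]
  induction n with
  | zero => simp [lintegral_pi_fin_zero, powSum]
  | succ n ih =>
    have hinv : (gibbsMass m)⁻¹ ≠ ∞ := ENNReal.inv_ne_top.mpr (gibbsMass_ne_zero m)
    have hc : ∀ a, Measurable fun x : Fin n → ℝ => F (Fin.cons a x) := fun a =>
      hF.comp (measurable_fin_cons.comp (measurable_const.prodMk measurable_id))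
    have hF2 : Measurable fun q : ℝ × (Fin n → ℝ) => F (Fin.cons q.1 q.2) :=
      hF.comp measurable_fin_cons
    rw [lintegral_pi_fin_succ _ hF, lintegral_pi_fin_succ _ (by fun_prop)]
    simp_rw [ih (hc _)]
    rw [lintegral_const_mul' _ _ (ENNReal.pow_ne_top hinv), gibbs, lintegral_smul_measure,
      lintegral_withDensity_eq_lintegral_mul _ (by fun_prop)
        (Measurable.lintegral_prod_right' (f := fun q : ℝ × (Fin n → ℝ) => F (Fin.cons q.1 q.2) *
          ENNReal.ofReal (Real.exp (-powSum m q.2))) (by fun_prop)), smul_eq_mul, ← mul_assoc,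
        pow_succ]
    congr 1
    refine lintegral_congr fun a => ?_
    rw [Pi.mul_apply, ← lintegral_const_mul' _ _ ENNReal.ofReal_ne_top]
    refine lintegral_congr fun x => ?_
    rw [mul_left_comm, ← ENNReal.ofReal_mul (Real.exp_pos _).le, ← Real.exp_add]
    simp [powSum, Fin.sum_univ_succ, add_comm]

lemma lintegral_smul_comp {n : ℕ} {G : (Fin n → ℝ) → ℝ≥0∞} (hG : Measurable G) {r : ℝ}
    (hr : 0 < r) : ∫⁻ x, G (r • x) = ENNReal.ofReal (r ^ n)⁻¹ * ∫⁻ x, G x := by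
  have := Measure.map_addHaar_smul (volume : Measure (Fin n → ℝ)) hr.ne'
  rw [← lintegral_map hG (measurable_const_smul r), this, lintegral_smul_measure]
  simp [abs_of_pos hr]

lemma lintegral_Ioi_exp_mul_rpow {a : ℝ} (ha : 0 < a) :
    ∫⁻ w in Ioi (0 : ℝ), ENNReal.ofReal (Real.exp (-w) * w ^ (a - 1))
      = ENNReal.ofReal (Real.Gamma a) := by
  rw [Real.Gamma_eq_integral ha, ofReal_integral_eq_lintegral_ofReal
    (Real.GammaIntegral_convergent ha)]
  filter_upwards [ae_restrict_mem measurableSet_Ioi] with w hw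
  exact mul_nonneg (Real.exp_pos _).le (Real.rpow_nonneg (le_of_lt hw) _)

/-- Integration in polar coordinates adapted to the gauge `powSum m`. -/
lemma lintegral_gauge_polar (m : ℕ) {n : ℕ} {R : ℝ} (hR : 0 < R) {g : (Fin n → ℝ) → ℝ≥0∞}
    (hg : Measurable g) {η : ℝ → ℝ≥0∞} (hη : Measurable η) :
    ∫⁻ x : Fin n → ℝ, ∫⁻ e in Ici (0 : ℝ),
        g ((R * (powSum m x + e) ^ (-(1 / (2 * (m + 1) : ℝ)))) • x)
        * η (powSum m x + e) * ENNReal.ofReal (Real.exp (-(powSum m x + e)))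
      = (∫⁻ w in Ioi (0 : ℝ), η w * ENNReal.ofReal (Real.exp (-w) * w ^ (n / (2 * (m + 1) : ℝ)))) *
        (ENNReal.ofReal (R ^ n)⁻¹ * ∫⁻ y in {y | powSum m y ≤ R ^ (2 * (m + 1))}, g y) := by
  set H : (Fin n → ℝ) × ℝ → ℝ≥0∞ := fun q => g ((R * q.2 ^ (-(1 / (2 * (m + 1) : ℝ)))) • q.1) *
    η q.2 * ENNReal.ofReal (Real.exp (-q.2)) with hH
  have hHm : Measurable H := by fun_prop
  set A : Set ((Fin n → ℝ) × ℝ) := {q | powSum m q.1 ≤ q.2} with hA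
  have hAm : MeasurableSet A := measurableSet_le (by fun_prop) (by fun_prop)
  set Bl : Set (Fin n → ℝ) := {y | powSum m y ≤ R ^ (2 * (m + 1))} with hB
  have hBm : MeasurableSet Bl := measurableSet_le (by fun_prop) measurable_const
  have h1 : ∀ x : Fin n → ℝ, ∫⁻ e in Ici (0 : ℝ), H (x, powSum m x + e)
      = ∫⁻ w, A.indicator H (x, w) := fun x => by
    rw [← lintegral_indicator measurableSet_Ici,
      ← lintegral_add_left_eq_self (fun w => A.indicator H (x, w)) (powSum m x)]
    refine lintegral_congr fun e => ?_
    by_cases he : 0 ≤ e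
    · rw [indicator_of_mem (show e ∈ Ici (0 : ℝ) from he),
        indicator_of_mem (show (x, powSum m x + e) ∈ A by simpa [hA] using he)]
    · rw [indicator_of_notMem (show e ∉ Ici (0 : ℝ) from he),
        indicator_of_notMem (show (x, powSum m x + e) ∉ A by simpa [hA] using he)]
  change ∫⁻ x : Fin n → ℝ, ∫⁻ e in Ici (0 : ℝ), H (x, powSum m x + e) = _
  simp only [h1]
  rw [lintegral_lintegral_swap (f := fun x w => A.indicator H (x, w))
    (hHm.indicator hAm).aemeasurable]
  have h2 : ∀ᵐ w : ℝ, ∫⁻ x, A.indicator H (x, w) = (Ioi (0 : ℝ)).indicator (fun w =>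
      (η w * ENNReal.ofReal (Real.exp (-w) * w ^ (n / (2 * (m + 1) : ℝ))))) w *
        (ENNReal.ofReal (R ^ n)⁻¹ * ∫⁻ y in Bl, g y) := by
    filter_upwards [compl_mem_ae_iff.mpr (measure_singleton (0 : ℝ))] with w hw0
    rcases lt_or_gt_of_ne (show w ≠ 0 from hw0) with hw | hw
    · rw [indicator_of_notMem (show w ∉ Ioi (0 : ℝ) from not_lt.mpr hw.le), zero_mul]
      refine (lintegral_congr fun x => indicator_of_notMem (fun hx => ?_) H).trans lintegral_zero
      exact absurd ((powSum_nonneg m x).trans hx) (not_le.mpr hw)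
    · rw [indicator_of_mem (show w ∈ Ioi (0 : ℝ) from hw)]
      set r := R * w ^ (-(1 / (2 * (m + 1) : ℝ))) with hr
      have hr0 : 0 < r := by positivity
      have hp : (2 * (m + 1) : ℝ) ≠ 0 := by positivity
      have hrp : r ^ (2 * (m + 1)) = R ^ (2 * (m + 1)) * w⁻¹ := by
        rw [hr, mul_pow, ← Real.rpow_natCast (w ^ _), ← Real.rpow_mul hw.le,
          show -(1 / (2 * (m + 1) : ℝ)) * ((2 * (m + 1) : ℕ) : ℝ) = -1 by
            push_cast; field_simp, Real.rpow_neg_one]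
      have hpt : ∀ x, A.indicator H (x, w) =
          (η w * ENNReal.ofReal (Real.exp (-w))) * Bl.indicator g (r • x) := fun x => by
        have hiff : (x, w) ∈ A ↔ r • x ∈ Bl := by
          change powSum m x ≤ w ↔ powSum m (r • x) ≤ R ^ (2 * (m + 1))
          rw [powSum_smul, hrp, mul_assoc, mul_le_iff_le_one_right (by positivity),
            inv_mul_le_iff₀ hw, mul_one]
        by_cases hx : (x, w) ∈ A
        · rw [indicator_of_mem hx, indicator_of_mem (hiff.mp hx)]
          simp only [hH]; ring
        · rw [indicator_of_notMem hx, indicator_of_notMem (fun h => hx (hiff.mpr h)), mul_zero]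
      simp only [hpt]
      have hcomp : Measurable fun x => Bl.indicator g (r • x) :=
        (hg.indicator hBm).comp (measurable_const_smul r)
      rw [lintegral_const_mul _ hcomp, lintegral_smul_comp (hg.indicator hBm) hr0,
        lintegral_indicator hBm, ENNReal.ofReal_mul (Real.exp_pos _).le]
      have hrn : (r ^ n)⁻¹ = w ^ (n / (2 * (m + 1) : ℝ)) * (R ^ n)⁻¹ := by
        rw [hr, mul_pow, ← Real.rpow_natCast (w ^ _), ← Real.rpow_mul hw.le, mul_inv,
          ← Real.rpow_neg hw.le, mul_comm]
        congr 2; ring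
      rw [hrn, ENNReal.ofReal_mul (by positivity)]
      ring
  rw [lintegral_congr_ae h2, lintegral_mul_const _ (Measurable.indicator (by fun_prop)
    measurableSet_Ioi), lintegral_indicator measurableSet_Ioi]

/-- The standard exponential law. -/
def expLaw : Measure ℝ :=
  (volume.restrict (Ici 0)).withDensity fun e => ENNReal.ofReal (Real.exp (-e))

instance : IsProbabilityMeasure expLaw := ⟨by
  rw [expLaw, withDensity_apply _ MeasurableSet.univ, Measure.restrict_univ,
    setLIntegral_congr (Ioi_ae_eq_Ici.symm)]
  simpa using lintegral_Ioi_exp_mul_rpow one_pos⟩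

lemma ae_expLaw_pos : ∀ᵐ e ∂expLaw, 0 < e := by
  refine (withDensity_absolutelyContinuous _ _).ae_le ?_
  rw [← restrict_Ioi_eq_restrict_Ici]
  exact ae_restrict_mem measurableSet_Ioi

lemma lintegral_expLaw {F : ℝ → ℝ≥0∞} (hF : Measurable F) :
    ∫⁻ e, F e ∂expLaw = ∫⁻ e in Ici 0, F e * ENNReal.ofReal (Real.exp (-e)) := by
  rw [expLaw, lintegral_withDensity_eq_lintegral_mul _ (by fun_prop) hF]
  simp [mul_comm]

lemma Rnp_pos {n : ℕ} (hn : 1 ≤ n) {p : ℝ} (hp : 0 < p) : 0 < Rnp n p := by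
  have hn' : (0 : ℝ) < n := by exact_mod_cast hn
  have h1 : 0 < Real.Gamma ((n + 2 : ℝ) / p) := Real.Gamma_pos_of_pos (by positivity)
  have h2 : 0 < Real.Gamma (n / p) := Real.Gamma_pos_of_pos (by positivity)
  have h3 : 0 < Real.Gamma (1 / p) := Real.Gamma_pos_of_pos (by positivity)
  have h4 : 0 < Real.Gamma (3 / p) := Real.Gamma_pos_of_pos (by positivity)
  unfold Rnp
  positivity

lemma lpBall_eq_powSum_le (n m : ℕ) : lpBall n ((2 * (m + 1) : ℕ) : ℝ) =
    {y | powSum m y ≤ Rnp n ((2 * (m + 1) : ℕ) : ℝ) ^ (2 * (m + 1))} := by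
  ext x
  simp only [lpBall, powSum, mem_ofPred_eq, Real.rpow_natCast, (even_two_mul (m + 1)).pow_abs]

lemma lintegral_gibbs_expLaw {m n : ℕ} (hm : gibbsMass m ≠ ∞) {R : ℝ} (hR : 0 < R)
    {g : (Fin n → ℝ) → ℝ≥0∞} (hg : Measurable g) {η : ℝ → ℝ≥0∞} (hη : Measurable η) :
    ∫⁻ q : (Fin n → ℝ) × ℝ, g ((R * (powSum m q.1 + q.2) ^ (-(1 / (2 * (m + 1) : ℝ)))) • q.1)
        * η (powSum m q.1 + q.2) ∂((Measure.pi fun _ => gibbs m).prod expLaw)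
      = (gibbsMass m)⁻¹ ^ n *
        ((∫⁻ w in Ioi (0 : ℝ), η w * ENNReal.ofReal (Real.exp (-w) * w ^ (n / (2 * (m + 1) : ℝ)))) *
        (ENNReal.ofReal (R ^ n)⁻¹ * ∫⁻ y in {y | powSum m y ≤ R ^ (2 * (m + 1))}, g y)) := by
  have := isProbabilityMeasure_gibbs hm
  have hm1 : Measurable fun q : (Fin n → ℝ) × ℝ =>
      g ((R * (powSum m q.1 + q.2) ^ (-(1 / (2 * (m + 1) : ℝ)))) • q.1)
        * η (powSum m q.1 + q.2) := by fun_prop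
  refine (lintegral_prod _ hm1.aemeasurable).trans ?_
  rw [lintegral_pi_gibbs hm hm1.lintegral_prod_right', ← lintegral_gauge_polar m hR hg hη]
  congr 1
  refine lintegral_congr fun x => ?_
  rw [lintegral_expLaw (F := fun e => g ((R * (powSum m x + e) ^ (-(1 / (2 * (m + 1) : ℝ)))) • x)
    * η (powSum m x + e)) (by fun_prop), mul_comm, ← lintegral_const_mul' _ _ ENNReal.ofReal_ne_top]
  refine lintegral_congr fun e => ?_
  rw [neg_add, Real.exp_add, ENNReal.ofReal_mul (Real.exp_pos _).le]
  ring

lemma gauge_constant_eq {m n : ℕ} (hm : gibbsMass m ≠ ∞) {R : ℝ} (hR : 0 < R) :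
    (gibbsMass m)⁻¹ ^ n * (ENNReal.ofReal (Real.Gamma (n / (2 * (m + 1) : ℝ) + 1)) *
      (ENNReal.ofReal (R ^ n)⁻¹ *
        volume {y : Fin n → ℝ | powSum m y ≤ R ^ (2 * (m + 1))})) = 1 := by
  have := isProbabilityMeasure_gibbs hm
  have h := lintegral_gibbs_expLaw (n := n) hm hR (g := fun _ => 1) measurable_const
    (η := fun _ => 1) measurable_const
  have hΓ := lintegral_Ioi_exp_mul_rpow (a := n / (2 * (m + 1) : ℝ) + 1) (by positivity)
  rw [add_sub_cancel_right] at hΓ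
  simpa [hΓ] using h.symm

/-- The uniform law on the ball as the image of a product law. -/
lemma muNP_eq_map {m n : ℕ} (hm : gibbsMass m ≠ ∞) (hn : 1 ≤ n) :
    muNP n ((2 * (m + 1) : ℕ) : ℝ) = ((Measure.pi fun _ => gibbs m).prod expLaw).map
      fun q : (Fin n → ℝ) × ℝ => (Rnp n ((2 * (m + 1) : ℕ) : ℝ) *
        (powSum m q.1 + q.2) ^ (-(1 / (2 * (m + 1) : ℝ)))) • q.1 := by
  set R := Rnp n ((2 * (m + 1) : ℕ) : ℝ) with hRdef
  have hR : 0 < R := Rnp_pos hn (by positivity)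
  rw [muNP, lpBall_eq_powSum_le, ← hRdef]
  ext A hA
  have hg : Measurable (A.indicator (1 : (Fin n → ℝ) → ℝ≥0∞)) := measurable_one.indicator hA
  rw [← lintegral_indicator_one hA, lintegral_smul_measure, ← lintegral_indicator_one hA,
    lintegral_map hg (by fun_prop)]
  have h := lintegral_gibbs_expLaw (n := n) hm hR hg (η := fun _ => 1) measurable_const
  have hΓ := lintegral_Ioi_exp_mul_rpow (a := n / (2 * (m + 1) : ℝ) + 1) (by positivity)
  rw [add_sub_cancel_right] at hΓ
  simp only [mul_one, one_mul, hΓ] at h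
  rw [h, smul_eq_mul]
  have hc := gauge_constant_eq (n := n) hm hR
  rw [← mul_assoc, ← mul_assoc] at hc
  rw [← ENNReal.eq_inv_of_mul_eq_one_left hc]
  ring

/-- The law of the gauge variable. -/
lemma lintegral_gauge {m n : ℕ} (hm : gibbsMass m ≠ ∞) {η : ℝ → ℝ≥0∞} (hη : Measurable η) :
    ∫⁻ q : (Fin n → ℝ) × ℝ, η (powSum m q.1 + q.2) ∂((Measure.pi fun _ => gibbs m).prod expLaw)
      = (ENNReal.ofReal (Real.Gamma (n / (2 * (m + 1) : ℝ) + 1)))⁻¹ *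
        ∫⁻ w in Ioi (0 : ℝ),
            η w * ENNReal.ofReal (Real.exp (-w) * w ^ (n / (2 * (m + 1) : ℝ))) := by
  have h := lintegral_gibbs_expLaw (n := n) hm one_pos (g := fun _ => 1) measurable_const hη
  have hc := gauge_constant_eq (n := n) hm one_pos
  simp only [one_mul, lintegral_const, Measure.restrict_apply MeasurableSet.univ, univ_inter] at h
  rw [h]
  rw [mul_left_comm, mul_comm] at hc
  rw [← ENNReal.eq_inv_of_mul_eq_one_left hc]
  ring

lemma Gamma_add_one_le {u σ : ℝ} (hu : 0 < u) (h0 : 0 < σ) (h1 : σ < 1) :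
    Real.Gamma (u + 1) ≤ Real.Gamma (u + σ) * (u + σ) ^ (1 - σ) := by
  have h := Real.Gamma_mul_add_mul_le_rpow_Gamma_mul_rpow_Gamma (s := u + σ) (t := u + σ + 1)
    (a := σ) (b := 1 - σ) (by positivity) (by positivity) h0 (by linarith) (by ring)
  have hg : 0 < Real.Gamma (u + σ) := Real.Gamma_pos_of_pos (by positivity)
  rw [show σ * (u + σ) + (1 - σ) * (u + σ + 1) = u + 1 by ring,
    Real.Gamma_add_one (s := u + σ) (by positivity), Real.mul_rpow (by positivity) hg.le,
        mul_left_comm, ← Real.rpow_add hg] at h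
  simpa [mul_comm] using h

lemma Gamma_sub_le {y σ : ℝ} (h0 : 0 < σ) (h1 : σ < 1) (hy : 2 * σ ≤ y) :
    Real.Gamma (y - σ) ≤ 2 * y ^ (-σ) * Real.Gamma y := by
  have hy0 : 0 < y := by linarith
  have hu : 0 < y - σ := by linarith
  have h := Gamma_add_one_le hu h0 h1
  rw [sub_add_cancel, Real.Gamma_add_one hu.ne', Real.rpow_sub hy0, Real.rpow_one] at h
  have hg : 0 < Real.Gamma y := Real.Gamma_pos_of_pos hy0
  rw [Real.rpow_neg hy0.le]
  have hp : 0 < (y ^ σ)⁻¹ := by positivity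
  have h2 : (y - σ) * Real.Gamma (y - σ) ≤ (y - σ) * (2 * (y ^ σ)⁻¹ * Real.Gamma y) := by
    refine h.trans ?_
    rw [div_eq_mul_inv]
    nlinarith [mul_pos hp hg]
  exact le_of_mul_le_mul_left h2 hu

lemma Gamma_add_ge {y σ : ℝ} (hy : 0 < y) (h0 : 0 < σ) (h1 : σ ≤ 1) (hσ : σ ≤ 2 * y) :
    y ^ σ / 3 * Real.Gamma y ≤ Real.Gamma (y + σ) := by
  have hg : 0 < Real.Gamma y := Real.Gamma_pos_of_pos hy
  rcases h1.lt_or_eq with h1 | rfl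
  · have h := Gamma_add_one_le hy h0 h1
    have hG : 0 < Real.Gamma (y + σ) := Real.Gamma_pos_of_pos (by positivity)
    have h3 : (y + σ) ^ (1 - σ) ≤ 3 * y ^ (1 - σ) := by
      calc (y + σ) ^ (1 - σ) ≤ (3 * y) ^ (1 - σ) :=
            Real.rpow_le_rpow (by positivity) (by linarith) (by linarith)
        _ = 3 ^ (1 - σ) * y ^ (1 - σ) := Real.mul_rpow (by norm_num) hy.le
        _ ≤ 3 ^ (1 : ℝ) * y ^ (1 - σ) := by
            gcongr
            · norm_num
            · linarith
        _ = 3 * y ^ (1 - σ) := by rw [Real.rpow_one]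
    rw [Real.Gamma_add_one hy.ne'] at h
    have hyy : y = y ^ σ * y ^ (1 - σ) := by
      rw [← Real.rpow_add hy]; simp
    have hp : 0 < y ^ (1 - σ) := by positivity
    have h4 : y ^ σ * Real.Gamma y * y ^ (1 - σ) ≤ (3 * Real.Gamma (y + σ)) * y ^ (1 - σ) := by
      calc y ^ σ * Real.Gamma y * y ^ (1 - σ) = y * Real.Gamma y := by
            rw [mul_right_comm, ← hyy]
        _ ≤ Real.Gamma (y + σ) * (y + σ) ^ (1 - σ) := h
        _ ≤ Real.Gamma (y + σ) * (3 * y ^ (1 - σ)) := by gcongr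
        _ = _ := by ring
    have := le_of_mul_le_mul_right h4 hp
    linarith
  · rw [Real.Gamma_add_one hy.ne', Real.rpow_one]
    nlinarith [mul_pos hy hg]

/-- The radius satisfies `R ^ p ≥ c n`. -/
lemma exists_le_Rnp_pow (m : ℕ) : ∃ c : ℝ, 0 < c ∧ ∀ n : ℕ, 1 ≤ n →
    c * n ≤ Rnp n ((2 * (m + 1) : ℕ) : ℝ) ^ (2 * (m + 1)) := by
  set p : ℝ := ((2 * (m + 1) : ℕ) : ℝ) with hp
  have hp2 : 2 ≤ p := by rw [hp]; push_cast; linarith [(Nat.cast_nonneg m : (0 : ℝ) ≤ m)]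
  have hp0 : 0 < p := by linarith
  set κ : ℝ := Real.Gamma (1 / p) / Real.Gamma (3 / p) with hκ
  have hκ0 : 0 < κ := div_pos (Real.Gamma_pos_of_pos (by positivity))
    (Real.Gamma_pos_of_pos (by positivity))
  refine ⟨(κ / 3) ^ (m + 1) / p, by positivity, fun n hn => ?_⟩
  have hn1 : (1 : ℝ) ≤ n := by exact_mod_cast hn
  have hn0 : (0 : ℝ) < n := by linarith
  have hy : 0 < n / p := by positivity
  have hg := Gamma_add_ge hy (σ := 2 / p) (by positivity) (by rw [div_le_one hp0]; exact hp2)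
    (by rw [← mul_div_assoc]; gcongr; linarith)
  rw [← add_div] at hg
  have hgy : 0 < Real.Gamma (n / p) := Real.Gamma_pos_of_pos hy
  have h2 : (n / p) ^ (2 / p) / 3 * κ ≤ ((n + 2 : ℝ) / n) *
      (Real.Gamma ((n + 2 : ℝ) / p) / Real.Gamma (n / p)) * κ := by
    gcongr
    calc (n / p) ^ (2 / p) / 3 ≤ 1 * (Real.Gamma ((n + 2 : ℝ) / p) / Real.Gamma (n / p)) := by
          rw [one_mul, le_div_iff₀ hgy]; exact hg
      _ ≤ _ := by
          have := Real.Gamma_pos_of_pos (s := (n + 2 : ℝ) / p) (by positivity)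
          gcongr
          rw [le_div_iff₀ hn0]; linarith
  rw [pow_mul, Rnp, Real.sq_sqrt ((by positivity : (0 : ℝ) ≤ _).trans h2)]
  refine le_trans (le_of_eq ?_) (pow_le_pow_left₀ (by positivity) h2 (m + 1))
  rw [div_mul_eq_mul_div, div_mul_eq_mul_div, mul_div_assoc, mul_div_assoc, mul_pow,
    ← Real.rpow_natCast ((n / p) ^ _), ← Real.rpow_mul hy.le,
    show 2 / p * ((m + 1 : ℕ) : ℝ) = 1 by rw [hp]; push_cast; field_simp, Real.rpow_one]
  ring

lemma exists_lintegral_gauge_rpow_le {m : ℕ} (hm : gibbsMass m ≠ ∞) : ∃ C : ℝ≥0∞, C ≠ ∞ ∧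
    ∀ n : ℕ, 1 ≤ n → ∫⁻ q : (Fin n → ℝ) × ℝ,
      ENNReal.ofReal (n / (powSum m q.1 + q.2)) ^ (1 + 1 / (2 * (2 * (m + 1))) : ℝ)
        ∂((Measure.pi fun _ => gibbs m).prod expLaw) ≤ C := by
  set p : ℝ := 2 * (m + 1) with hp
  have hp2 : 2 ≤ p := by linarith [(Nat.cast_nonneg m : (0 : ℝ) ≤ m)]
  have hp0 : 0 < p := by linarith
  set σ : ℝ := 1 / (2 * p) with hσ
  have hσ0 : 0 < σ := by positivity
  have hσ1 : σ < 1 := by rw [hσ, div_lt_one (by positivity)]; linarith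
  refine ⟨ENNReal.ofReal (2 * p * p ^ σ), ENNReal.ofReal_ne_top, fun n hn => ?_⟩
  have hn1 : (1 : ℝ) ≤ n := by exact_mod_cast hn
  have hn0 : (0 : ℝ) < n := by linarith
  have hy : 0 < n / p := by positivity
  have hyσ : 2 * σ ≤ n / p := by
    rw [hσ, show 2 * (1 / (2 * p)) = 1 / p by field_simp]; gcongr
  have hl := lintegral_gauge (n := n) hm (η := fun w => ENNReal.ofReal (n / w) ^ (1 + σ))
    (by fun_prop)
  rw [← hp] at hl
  rw [hl]
  have hinteg : ∫⁻ w in Ioi (0 : ℝ), ENNReal.ofReal (n / w) ^ (1 + σ) *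
      ENNReal.ofReal (Real.exp (-w) * w ^ (n / p))
      = ENNReal.ofReal ((n : ℝ) ^ (1 + σ)) * ENNReal.ofReal (Real.Gamma (n / p - σ)) := by
    rw [← lintegral_Ioi_exp_mul_rpow (by linarith),
        ← lintegral_const_mul' _ _ ENNReal.ofReal_ne_top]
    refine setLIntegral_congr_fun measurableSet_Ioi fun w hw => ?_
    have hw : 0 < w := hw
    rw [ENNReal.ofReal_rpow_of_pos (by positivity), ← ENNReal.ofReal_mul (by positivity),
      ← ENNReal.ofReal_mul (by positivity), Real.div_rpow hn0.le hw.le,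
      show n / p - σ - 1 = n / p - (1 + σ) by ring, Real.rpow_sub hw]
    congr 1
    ring
  rw [hinteg]
  have hΓ : 0 < Real.Gamma (n / p + 1) := Real.Gamma_pos_of_pos (by positivity)
  rw [← ENNReal.ofReal_inv_of_pos hΓ, ← ENNReal.ofReal_mul (by positivity),
    ← ENNReal.ofReal_mul (by positivity)]
  refine ENNReal.ofReal_le_ofReal ?_
  rw [inv_mul_le_iff₀ hΓ, Real.Gamma_add_one hy.ne']
  have h := Gamma_sub_le hσ0 hσ1 hyσ
  calc (n : ℝ) ^ (1 + σ) * Real.Gamma (n / p - σ)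
      ≤ (n : ℝ) ^ (1 + σ) * (2 * (n / p) ^ (-σ) * Real.Gamma (n / p)) := by gcongr
    _ = _ := by
      rw [Real.rpow_add hn0, Real.rpow_one, Real.rpow_neg hy.le, Real.div_rpow hn0.le hp0.le]
      field_simp

/-- The parameters of a random line: rectangles, base points and directions. -/
abbrev LineParam (n : ℕ) := (Fin n → BoxParam) × (Fin n → ℝ) × (Fin n → ℝ)

/-- The base point of the line. -/
def LineParam.base {n : ℕ} (q : LineParam n) : Fin n → ℝ :=
  fun i => (q.1 i).1.1 + (q.1 i).1.2 * q.2.1 i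

/-- The direction of the line. -/
def LineParam.dir {n : ℕ} (q : LineParam n) : Fin n → ℝ :=
  fun i => (q.1 i).2.1 + (q.1 i).2.2 * q.2.2 i

@[fun_prop] lemma LineParam.measurable_base {n : ℕ} : Measurable (LineParam.base (n := n)) := by
  refine measurable_pi_lambda _ fun i => ?_
  have h0 : Measurable fun q : LineParam n => q.1 i := (measurable_pi_apply i).comp (by fun_prop)
  unfold LineParam.base
  fun_prop

@[fun_prop] lemma LineParam.measurable_dir {n : ℕ} : Measurable (LineParam.dir (n := n)) := by
  refine measurable_pi_lambda _ fun i => ?_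
  have h0 : Measurable fun q : LineParam n => q.1 i := (measurable_pi_apply i).comp (by fun_prop)
  unfold LineParam.dir
  fun_prop

lemma slideAll_eq {n : ℕ} (s : ℝ) (q : LineParam n) :
    slideAll s q = (√(1 + s ^ 2))⁻¹ • (q.base + s • q.dir) := by
  ext i
  simp [slideAll, slide, LineParam.base, LineParam.dir, div_eq_inv_mul]

/-- The law of the line parameters together with an exponential variable. -/
def lineLaw (P : Measure BoxParam) (n : ℕ) : Measure (LineParam n × ℝ) :=
  ((Measure.pi fun _ => P).prod ((cube n).prod (cube n))).prod expLaw

instance (P : Measure BoxParam) [IsProbabilityMeasure P] (n : ℕ) :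
    IsProbabilityMeasure (lineLaw P n) := by
  unfold lineLaw; infer_instance

lemma map_lineLaw {m : ℕ} (hm : gibbsMass m ≠ ∞) {P : Measure BoxParam} [IsProbabilityMeasure P]
    {s : ℝ} (h : (P.prod (unif.prod unif)).map (slide s) = gibbs m) (n : ℕ) :
    (lineLaw P n).map (Prod.map (slideAll s) id) = (Measure.pi fun _ => gibbs m).prod expLaw := by
  have := isProbabilityMeasure_gibbs hm
  have hms : Measurable (slideAll s (n := n)) :=
    measurable_slideAll_uncurry.comp (measurable_const.prodMk measurable_id)
  rw [lineLaw, ← Measure.map_prod_map _ _ hms measurable_id, map_slideAll h, Measure.map_id]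

lemma eval_smul_of_isHomogeneous {n d : ℕ} {f : MvPolynomial (Fin n) ℝ} (hf : f.IsHomogeneous d)
    (r : ℝ) (x : Fin n → ℝ) :
    MvPolynomial.eval (r • x) f = r ^ d * MvPolynomial.eval x f := by
  rw [MvPolynomial.eval_eq', MvPolynomial.eval_eq', Finset.mul_sum]
  refine Finset.sum_congr rfl fun I hI => ?_
  have hd : ∑ i, I i = d := by
    have := hf (MvPolynomial.mem_support_iff.mp hI)
    rw [Finsupp.weight_apply] at this
    simpa [Finsupp.sum_fintype] using this
  simp only [Pi.smul_apply, smul_eq_mul, mul_pow, Finset.prod_mul_distrib]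
  rw [Finset.prod_pow_eq_pow_sum, hd]
  ring

/-- The oscillating phase along the line with the given parameters. -/
def linePhase {n : ℕ} (m : ℕ) (f : MvPolynomial (Fin n) ℝ) (τ : ℝ)
    (u : LineParam n × ℝ) (s : ℝ) : ℝ :=
  τ * MvPolynomial.eval (u.1.base + s • u.1.dir) f /
    (powSum m (u.1.base + s • u.1.dir) + u.2 * (1 + s ^ 2) ^ (m + 1))

lemma measurable_linePhase {n : ℕ} (m : ℕ) (f : MvPolynomial (Fin n) ℝ) (τ : ℝ) :
    Measurable fun v : ℝ × (LineParam n × ℝ) => linePhase m f τ v.2 v.1 := by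
  have h1 : Measurable fun x : Fin n → ℝ => MvPolynomial.eval x f :=
    (MvPolynomial.continuous_eval f).measurable
  unfold linePhase
  fun_prop

lemma phase_eq_linePhase {n m : ℕ} {f : MvPolynomial (Fin n) ℝ}
    (hf : f.IsHomogeneous (2 * (m + 1))) (R t s : ℝ) (u : LineParam n × ℝ) (hu : 0 < u.2) :
    t * MvPolynomial.eval ((R * (powSum m (slideAll s u.1) + u.2) ^ (-(1 / (2 * (m + 1) : ℝ)))) •
      slideAll s u.1) f = linePhase m f (t * R ^ (2 * (m + 1))) u s := by
  have hW : 0 < powSum m (slideAll s u.1) + u.2 := add_pos_of_nonneg_of_pos (powSum_nonneg _ _) hu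
  have hs : 0 < 1 + s ^ 2 := by positivity
  have hsq : (√(1 + s ^ 2))⁻¹ ^ (2 * (m + 1)) = ((1 + s ^ 2) ^ (m + 1))⁻¹ := by
    rw [inv_pow, pow_mul, Real.sq_sqrt hs.le]
  have hrp : ((powSum m (slideAll s u.1) + u.2) ^ (-(1 / (2 * (m + 1) : ℝ)))) ^ (2 * (m + 1))
      = (powSum m (slideAll s u.1) + u.2)⁻¹ := by
    have hp : (2 * (m + 1) : ℝ) ≠ 0 := by positivity
    rw [← Real.rpow_natCast, ← Real.rpow_mul hW.le,
      show -(1 / (2 * (m + 1) : ℝ)) * ((2 * (m + 1) : ℕ) : ℝ) = -1 by push_cast; field_simp,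
      Real.rpow_neg_one]
  rw [eval_smul_of_isHomogeneous hf, mul_pow, hrp, slideAll_eq, eval_smul_of_isHomogeneous hf,
    powSum_smul, hsq, linePhase]
  rw [slideAll_eq, powSum_smul, hsq] at hW
  have hV : 0 < powSum m (u.1.base + s • u.1.dir) + u.2 * (1 + s ^ 2) ^ (m + 1) :=
    add_pos_of_nonneg_of_pos (powSum_nonneg _ _) (by positivity)
  have hc : 0 < (1 + s ^ 2) ^ (m + 1) := by positivity
  rw [show (((1 + s ^ 2) ^ (m + 1))⁻¹ * powSum m (u.1.base + s • u.1.dir) + u.2)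
    = ((1 + s ^ 2) ^ (m + 1))⁻¹ * (powSum m (u.1.base + s • u.1.dir) +
      u.2 * (1 + s ^ 2) ^ (m + 1)) by field_simp]
  field_simp

/-- The characteristic function is controlled by oscillatory integrals along random lines. -/
lemma enorm_charFun_le {m n : ℕ} (hm : gibbsMass m ≠ ∞) (hn : 1 ≤ n) {P : Measure BoxParam}
    [IsProbabilityMeasure P] (hP : ∀ s, (P.prod (unif.prod unif)).map (slide s) = gibbs m)
    {f : MvPolynomial (Fin n) ℝ} (hf : f.IsHomogeneous (2 * (m + 1))) (t : ℝ) :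
    ‖∫ x, Complex.exp (Complex.I * (t : ℂ) * (MvPolynomial.eval x f : ℂ))
        ∂(muNP n ((2 * (m + 1) : ℕ) : ℝ))‖ₑ ≤
      ∫⁻ u, ‖∫ s in (0 : ℝ)..1, Complex.exp (Complex.I *
        (linePhase m f (t * Rnp n ((2 * (m + 1) : ℕ) : ℝ) ^ (2 * (m + 1))) u s : ℝ))‖ₑ
          ∂(lineLaw P n) := by
  set R := Rnp n ((2 * (m + 1) : ℕ) : ℝ) with hR
  set K : ℝ → LineParam n × ℝ → ℂ := fun s u =>
    Complex.exp (Complex.I * (linePhase m f (t * R ^ (2 * (m + 1))) u s : ℝ)) with hK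
  have hKm : Measurable (Function.uncurry K) := by
    have := measurable_linePhase m f (t * R ^ (2 * (m + 1)))
    simp only [hK, Function.uncurry_def]
    fun_prop
  have hfm : Measurable fun x : Fin n → ℝ => MvPolynomial.eval x f :=
    (MvPolynomial.continuous_eval f).measurable
  have hs : ∀ s, ∫ x, Complex.exp (Complex.I * (t : ℂ) * (MvPolynomial.eval x f : ℂ))
        ∂(muNP n ((2 * (m + 1) : ℕ) : ℝ)) = ∫ u, K s u ∂(lineLaw P n) := fun s => by
    have hms : Measurable (slideAll s (n := n)) :=
      measurable_slideAll_uncurry.comp (measurable_const.prodMk measurable_id)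
    rw [muNP_eq_map hm hn, integral_map (by fun_prop)
      (Measurable.aestronglyMeasurable (by fun_prop)), ← map_lineLaw hm (hP s),
      integral_map (by fun_prop) (Measurable.aestronglyMeasurable (by fun_prop))]
    refine integral_congr_ae ?_
    have he : ∀ᵐ u ∂(lineLaw P n), 0 < u.2 :=
      Measure.quasiMeasurePreserving_snd.ae ae_expLaw_pos
    filter_upwards [he] with u hu
    simp only [hK, Prod.map_fst, Prod.map_snd, id]
    rw [← phase_eq_linePhase hf R t s u hu, Complex.ofReal_mul, mul_assoc]
  have hinteg : Integrable (Function.uncurry K) ((volume.restrict (Ioc (0 : ℝ) 1)).prod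
      (lineLaw P n)) := by
    refine (integrable_const (1 : ℝ)).mono' hKm.aestronglyMeasurable (Eventually.of_forall ?_)
    rintro ⟨s, u⟩
    simp only [hK, Function.uncurry]
    rw [mul_comm, Complex.norm_exp_ofReal_mul_I]
  have hmain : ∫ x, Complex.exp (Complex.I * (t : ℂ) * (MvPolynomial.eval x f : ℂ))
        ∂(muNP n ((2 * (m + 1) : ℕ) : ℝ)) = ∫ u, (∫ s in (0 : ℝ)..1, K s u) ∂(lineLaw P n) := by
    simp_rw [intervalIntegral.integral_of_le (zero_le_one (α := ℝ))]
    rw [← integral_integral_swap hinteg]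
    simp_rw [← hs]
    simp
  rw [hmain]
  exact enorm_integral_le_lintegral_enorm _

/-- The restriction of a polynomial to the line `s ↦ x + s h`, as a univariate polynomial. -/
def linePoly {n : ℕ} (x h : Fin n → ℝ) (f : MvPolynomial (Fin n) ℝ) : Polynomial ℝ :=
  MvPolynomial.aeval (fun i => Polynomial.C (x i) + Polynomial.X * Polynomial.C (h i)) f

lemma natDegree_linePoly_le {n D : ℕ} (x h : Fin n → ℝ) {f : MvPolynomial (Fin n) ℝ}
    (hf : f.totalDegree ≤ D) : (linePoly x h f).natDegree ≤ D := by
  refine (MvPolynomial.aeval_natDegree_le (n := 1) f hf _ fun i => ?_).trans (by simp)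
  compute_degree

lemma eval_linePoly {n : ℕ} (x h : Fin n → ℝ) (f : MvPolynomial (Fin n) ℝ) (s : ℝ) :
    (linePoly x h f).eval s = MvPolynomial.eval (x + s • h) f := by
  induction f using MvPolynomial.induction_on with
  | C a => simp [linePoly]
  | add p q hp hq => simp_all [linePoly]
  | mul_X p i hp => simp_all [linePoly, mul_comm s]

lemma coeff_zero_linePoly {n : ℕ} (x h : Fin n → ℝ) (f : MvPolynomial (Fin n) ℝ) :
    (linePoly x h f).coeff 0 = MvPolynomial.eval x f := by
  rw [Polynomial.coeff_zero_eq_eval_zero, eval_linePoly]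
  simp

lemma coeff_one_linePoly {n : ℕ} (x h : Fin n → ℝ) (f : MvPolynomial (Fin n) ℝ) :
    (linePoly x h f).coeff 1 = ∑ i, MvPolynomial.eval x (MvPolynomial.pderiv i f) * h i := by
  induction f using MvPolynomial.induction_on with
  | C a => simp [linePoly]
  | add p q hp hq =>
    rw [linePoly, map_add, Polynomial.coeff_add, ← linePoly, ← linePoly, hp, hq,
      ← Finset.sum_add_distrib]
    exact Finset.sum_congr rfl fun i _ => by simp [add_mul]
  | mul_X p j hp =>
    have h1 : linePoly x h (p * MvPolynomial.X j)
        = linePoly x h p * (Polynomial.C (x j) + Polynomial.X * Polynomial.C (h j)) := by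
      simp [linePoly]
    rw [h1, Polynomial.mul_coeff_one, hp, coeff_zero_linePoly]
    simp only [MvPolynomial.pderiv_mul, MvPolynomial.pderiv_X, map_add, map_mul,
      MvPolynomial.eval_X, add_mul, Finset.sum_add_distrib]
    have h2 : ∑ i, MvPolynomial.eval x p *
        MvPolynomial.eval x (Pi.single (M := fun _ => MvPolynomial (Fin n) ℝ) i 1 j) * h i
        = MvPolynomial.eval x p * h j := by
      rw [Finset.sum_eq_single j]
      · simp
      · intro i _ hi; simp [Pi.single_eq_of_ne hi.symm]
      · simp
    rw [h2]
    simp [Polynomial.coeff_C, Finset.sum_mul, mul_right_comm, add_comm]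

lemma polyOnLines_eval_affine {n D : ℕ} {f : MvPolynomial (Fin n) ℝ} (hf : f.totalDegree ≤ D)
    (c b : Fin n → ℝ) : PolyOnLines D fun z => MvPolynomial.eval (fun i => c i + b i * z i) f := by
  intro x z
  refine ⟨linePoly (fun i => c i + b i * x i) (fun i => b i * (z i - x i)) f,
    natDegree_linePoly_le _ _ hf, fun s => ?_⟩
  have h : (fun i => c i + b i * x i) + s • (fun i => b i * (z i - x i))
      = fun i => c i + b i * ((1 - s) • x + s • z) i := by
    ext i
    simp only [Pi.add_apply, Pi.smul_apply, smul_eq_mul]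
    ring
  rw [eval_linePoly, h]

/-- The polynomial `∑ i, x i ^ (2 * (m + 1))`. -/
def powPoly (n m : ℕ) : MvPolynomial (Fin n) ℝ :=
  ∑ i, MvPolynomial.X i ^ (2 * (m + 1))

lemma eval_powPoly {n : ℕ} (m : ℕ) (x : Fin n → ℝ) :
    MvPolynomial.eval x (powPoly n m) = powSum m x := by
  simp [powPoly, powSum]

lemma totalDegree_powPoly_le (n m : ℕ) : (powPoly n m).totalDegree ≤ 2 * (m + 1) := by
  refine MvPolynomial.totalDegree_finsetSum_le fun i _ => ?_
  exact (MvPolynomial.totalDegree_X_pow _ _).le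

/-- The gradient at `x` of the numerator of the derivative of `f / (powSum m + e)`. -/
def tangentCoeff {n : ℕ} (m : ℕ) (f : MvPolynomial (Fin n) ℝ) (x : Fin n → ℝ) (e : ℝ)
    (i : Fin n) : ℝ :=
  (powSum m x + e) * MvPolynomial.eval x (MvPolynomial.pderiv i f) -
    MvPolynomial.eval x f * MvPolynomial.eval x (MvPolynomial.pderiv i (powPoly n m))

/-- The linear form with the coefficients `tangentCoeff`. -/
def tangentPoly {n : ℕ} (m : ℕ) (f : MvPolynomial (Fin n) ℝ) (x : Fin n → ℝ)
    (e : ℝ) : MvPolynomial (Fin n) ℝ :=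
  ∑ i, MvPolynomial.C (tangentCoeff m f x e i) * MvPolynomial.X i

/-- The numerator of the increment from `x` of `f / (powSum m + e)` along a line. -/
def chordPoly {n : ℕ} (m : ℕ) (f : MvPolynomial (Fin n) ℝ) (x : Fin n → ℝ)
    (e : ℝ) : MvPolynomial (Fin n) ℝ :=
  MvPolynomial.C (powSum m x + e) * f -
    MvPolynomial.C (MvPolynomial.eval x f) * (powPoly n m + MvPolynomial.C (e * 2 ^ (m + 1)))

lemma exists_norm_integral_exp_line_le (m : ℕ) : ∃ C, 0 < C ∧
    ∀ (n : ℕ) (f : MvPolynomial (Fin n) ℝ), f.totalDegree ≤ 2 * (m + 1) →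
    ∀ (x h : Fin n → ℝ) (e τ q μ : ℝ), 0 < e → τ ≠ 0 → 0 < μ →
    (∀ s ∈ Icc (0 : ℝ) 1, powSum m (x + s • h) + e * (1 + s ^ 2) ^ (m + 1) ≤ q) →
    (μ ≤ |MvPolynomial.eval h (tangentPoly m f x e)| ∨
      μ ≤ |MvPolynomial.eval (x + h) (chordPoly m f x e)|) →
    ‖∫ s in (0 : ℝ)..1, Complex.exp (Complex.I * (τ * MvPolynomial.eval (x + s • h) f /
      (powSum m (x + s • h) + e * (1 + s ^ 2) ^ (m + 1)) : ℝ))‖ ≤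
        C * (q ^ 2 / (|τ| * μ)) ^ (1 / (2 * (m + 1) : ℕ) : ℝ) := by
  obtain ⟨C, hC, hjet⟩ := exists_norm_integral_exp_div_le_of_jet (d := 2 * (m + 1)) (by omega)
  refine ⟨C, hC, fun n f hf x h e τ q μ he hτ hμ hq hor => ?_⟩
  set P : Polynomial ℝ := Polynomial.C τ * linePoly x h f with hP
  set Q : Polynomial ℝ := linePoly x h (powPoly n m) +
    Polynomial.C e * (1 + Polynomial.X ^ 2) ^ (m + 1) with hQ
  have hPe : ∀ s, P.eval s = τ * MvPolynomial.eval (x + s • h) f := fun s => by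
    simp [hP, eval_linePoly]
  have hQe : ∀ s, Q.eval s = powSum m (x + s • h) + e * (1 + s ^ 2) ^ (m + 1) := fun s => by
    simp [hQ, eval_linePoly, eval_powPoly]
  have hQ0 : Q.coeff 0 = powSum m x + e := by
    rw [Polynomial.coeff_zero_eq_eval_zero, hQe]; simp
  have hP0 : P.coeff 0 = τ * MvPolynomial.eval x f := by
    rw [Polynomial.coeff_zero_eq_eval_zero, hPe]; simp
  have hP1 : P.coeff 1 = τ * ∑ i, MvPolynomial.eval x (MvPolynomial.pderiv i f) * h i := by
    rw [hP, Polynomial.coeff_C_mul, coeff_one_linePoly]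
  have hQ1 : Q.coeff 1 = ∑ i, MvPolynomial.eval x (MvPolynomial.pderiv i (powPoly n m)) * h i := by
    have : (Polynomial.C e * (1 + Polynomial.X ^ 2) ^ (m + 1) : Polynomial ℝ).coeff 1 = 0 := by
      have h1 := Polynomial.coeff_derivative
        (Polynomial.C e * (1 + Polynomial.X ^ 2) ^ (m + 1) : Polynomial ℝ) 0
      rw [Polynomial.coeff_zero_eq_eval_zero] at h1
      simpa [Polynomial.derivative_pow] using h1.symm
    rw [hQ, Polynomial.coeff_add, coeff_one_linePoly, this, add_zero]
  have hd : ∀ k : ℝ, |τ| * μ ≤ |τ * k| ↔ μ ≤ |k| := fun k => by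
    rw [abs_mul]; exact mul_le_mul_iff_right₀ (abs_pos.mpr hτ)
  have hA : Q.coeff 0 * P.coeff 1 - Q.coeff 1 * P.coeff 0
      = τ * MvPolynomial.eval h (tangentPoly m f x e) := by
    rw [hQ0, hP0, hP1, hQ1]
    simp only [tangentPoly, tangentCoeff, map_sum, map_mul, MvPolynomial.eval_C,
      MvPolynomial.eval_X, sub_mul, Finset.sum_sub_distrib, Finset.mul_sum, Finset.sum_mul, mul_sub]
    congr 1 <;> exact Finset.sum_congr rfl fun i _ => by ring
  have hB : Q.coeff 0 * P.eval 1 - Q.eval 1 * P.coeff 0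
      = τ * MvPolynomial.eval (x + h) (chordPoly m f x e) := by
    rw [hQ0, hP0, hPe, hQe]
    simp only [chordPoly, map_sub, map_mul, map_add, MvPolynomial.eval_C, eval_powPoly, one_smul]
    norm_num
    ring
  have := hjet P Q q (|τ| * μ) ?_ ?_ (mul_pos (abs_pos.mpr hτ) hμ) ?_ ?_ ?_
  · simpa only [hPe, hQe] using this
  · rw [hP]
    exact (Polynomial.natDegree_C_mul_le _ _).trans (natDegree_linePoly_le _ _ hf)
  · rw [hQ]
    refine (Polynomial.natDegree_add_le _ _).trans (max_le
      (natDegree_linePoly_le _ _ (totalDegree_powPoly_le n m)) ?_)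
    refine (Polynomial.natDegree_C_mul_le _ _).trans (Polynomial.natDegree_pow_le.trans ?_)
    rw [mul_comm]
    refine Nat.mul_le_mul_right _ ?_
    compute_degree
  · intro s _
    rw [hQe]
    exact add_pos_of_nonneg_of_pos (powSum_nonneg _ _) (by positivity)
  · intro s hs
    rw [hQe]
    exact hq s hs
  · rw [hA, hB, hd, hd]
    exact hor

lemma sum_le_of_mem_support {n D : ℕ} {g : MvPolynomial (Fin n) ℝ} (hg : g.totalDegree ≤ D)
    {J : Fin n →₀ ℕ} (hJ : J ∈ g.support) : ∑ i, J i ≤ D := by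
  have := (MvPolynomial.le_totalDegree hJ).trans hg
  rwa [Finsupp.sum_fintype _ _ (fun _ => rfl)] at this

lemma continuous_eval_affine {n : ℕ} (g : MvPolynomial (Fin n) ℝ) (c b : Fin n → ℝ) :
    Continuous fun z : Fin n → ℝ => MvPolynomial.eval (fun i => c i + b i * z i) g :=
  (MvPolynomial.continuous_eval g).comp (by fun_prop)

lemma lintegral_sq_eval_affine_eq {n : ℕ} (g : MvPolynomial (Fin n) ℝ) (c b : Fin n → ℝ) :
    ∫⁻ z, ENNReal.ofReal (MvPolynomial.eval (fun i => c i + b i * z i) g ^ 2) ∂(cube n) =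
      ENNReal.ofReal (∫ z, MvPolynomial.eval (fun i => c i + b i * z i) g ^ 2 ∂(cube n)) :=
  (ofReal_integral_eq_lintegral_ofReal
    (integrable_cube_of_continuous ((continuous_eval_affine g c b).pow 2))
    (Eventually.of_forall fun _ => sq_nonneg _)).symm

/-- Negative moments of a polynomial on a box in terms of its top coefficients. -/
lemma exists_lintegral_invRoot_eval_le {D : ℕ} (hD : 1 ≤ D) {θ : ℝ} (h0 : 0 ≤ θ) (h1 : θ < 1) :
    ∃ C : ℝ≥0∞, C ≠ ∞ ∧ ∀ (n : ℕ) (g : MvPolynomial (Fin n) ℝ), g.totalDegree ≤ D →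
      ∀ T : Finset (Fin n →₀ ℕ), (∀ I ∈ T, ∑ i, I i = D) → ∀ c b : Fin n → ℝ,
      ∫⁻ z, invRoot D (fun z => MvPolynomial.eval (fun i => c i + b i * z i) g) z ^ θ ∂(cube n) ≤
        C * ENNReal.ofReal (∑ I ∈ T, (g.coeff I * ∏ i, b i ^ I i) ^ 2) ^ (-(θ / (2 * D))) := by
  obtain ⟨C, hC, hA⟩ := exists_lintegral_invRoot_rpow_le hD h0 h1
  obtain ⟨κ, hκ, hB⟩ := exists_integral_sq_ge D
  refine ⟨C * ENNReal.ofReal κ ^ (-(θ / (2 * D))), ENNReal.mul_ne_top hC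
    (by rw [ENNReal.ofReal_rpow_of_pos hκ]; exact ENNReal.ofReal_ne_top), fun n g hg T hT c b => ?_⟩
  refine (hA n _ (continuous_eval_affine g c b).measurable
    (polyOnLines_eval_affine hg c b) ?_).trans ?_
  · rw [lintegral_sq_eval_affine_eq]
    exact ENNReal.ofReal_ne_top
  · rw [mul_assoc, ← ENNReal.mul_rpow_of_ne_top ENNReal.ofReal_ne_top ENNReal.ofReal_ne_top,
      ← ENNReal.ofReal_mul hκ.le, lintegral_sq_eval_affine_eq, ENNReal.rpow_neg, ENNReal.rpow_neg]
    gcongr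
    exact hB n g (fun J hJ => sum_le_of_mem_support hg hJ) T hT c b

lemma totalDegree_tangentPoly_le {n : ℕ} (m : ℕ) (f : MvPolynomial (Fin n) ℝ) (x : Fin n → ℝ)
    (e : ℝ) : (tangentPoly m f x e).totalDegree ≤ 1 := by
  refine MvPolynomial.totalDegree_finsetSum_le fun i _ => ?_
  refine (MvPolynomial.totalDegree_mul _ _).trans ?_
  simp

lemma coeff_tangentPoly {n : ℕ} (m : ℕ) (f : MvPolynomial (Fin n) ℝ) (x : Fin n → ℝ)
    (e : ℝ) (i : Fin n) :
    (tangentPoly m f x e).coeff (Finsupp.single i 1) = tangentCoeff m f x e i := by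
  rw [tangentPoly, MvPolynomial.coeff_sum, Finset.sum_eq_single i]
  · simp [MvPolynomial.coeff_C_mul]
  · intro j _ hj
    rw [MvPolynomial.coeff_C_mul, MvPolynomial.coeff_X, if_neg, mul_zero]
    exact fun h => hj (Finsupp.single_left_injective one_ne_zero h)
  · simp

lemma totalDegree_chordPoly_le {n m : ℕ} {f : MvPolynomial (Fin n) ℝ}
    (hf : f.totalDegree ≤ 2 * (m + 1)) (x : Fin n → ℝ) (e : ℝ) :
    (chordPoly m f x e).totalDegree ≤ 2 * (m + 1) := by
  refine (MvPolynomial.totalDegree_sub _ _).trans (max_le ?_ ?_)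
  · exact (MvPolynomial.totalDegree_mul _ _).trans
        (by rw [MvPolynomial.totalDegree_C, zero_add]; exact hf)
  · refine (MvPolynomial.totalDegree_mul _ _).trans ?_
    rw [MvPolynomial.totalDegree_C, zero_add]
    exact (MvPolynomial.totalDegree_add _ _).trans (max_le (totalDegree_powPoly_le n m)
      (by rw [MvPolynomial.totalDegree_C]; exact Nat.zero_le _))

/-- The exponents of total degree `d`. -/
def exponents (n d : ℕ) : Finset (Fin n →₀ ℕ) := Finset.finsuppAntidiag Finset.univ d

lemma mem_exponents {n d : ℕ} {I : Fin n →₀ ℕ} : I ∈ exponents n d ↔ ∑ i, I i = d := by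
  simp [exponents, Finset.mem_finsuppAntidiag]

lemma enorm_le_invRoot {d : ℕ} {A B C r α β : ℝ} {v : ℂ} (hC : 0 < C) (hr : 0 < r)
    (hd : 1 ≤ d) (hα : 0 < α) (hβ : 0 < β) (hαβ : α + β = 1 / d)
    (h : ∀ μ, 0 < μ → (μ ≤ |A| ∨ μ ≤ |B|) → ‖v‖ ≤ C * (r / μ) ^ (1 / d : ℝ)) :
    ‖v‖ₑ ≤ ENNReal.ofReal C * ENNReal.ofReal r ^ (1 / d : ℝ) *
      ((ENNReal.ofReal |A| ^ (-(1 / (1 : ℕ) : ℝ))) ^ α *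
        (ENNReal.ofReal |B| ^ (-(1 / d : ℝ))) ^ (d * β)) := by
  have hd' : (d : ℝ) ≠ 0 := by positivity
  have e1 : (ENNReal.ofReal |A| ^ (-(1 / (1 : ℕ) : ℝ))) ^ α = ENNReal.ofReal |A| ^ (-α) := by
    rw [← ENNReal.rpow_mul]; congr 1; push_cast; ring
  have e2 : (ENNReal.ofReal |B| ^ (-(1 / d : ℝ))) ^ (d * β) = ENNReal.ofReal |B| ^ (-β) := by
    rw [← ENNReal.rpow_mul]; congr 1; field_simp
  rw [e1, e2]
  have hcr : ENNReal.ofReal C * ENNReal.ofReal r ^ (1 / d : ℝ) ≠ 0 := by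
    rw [ENNReal.ofReal_rpow_of_pos hr, ← ENNReal.ofReal_mul hC.le]
    simp only [ne_eq, ENNReal.ofReal_eq_zero, not_le]
    positivity
  have hne : ∀ (k a : ℝ), 0 < a → ENNReal.ofReal |k| ^ (-a) ≠ 0 := fun k a ha => by
    rw [ENNReal.rpow_neg]
    simp [ENNReal.rpow_eq_top_iff, not_lt.mpr ha.le]
  rcases eq_or_ne A 0 with rfl | hA
  · rw [abs_zero, ENNReal.ofReal_zero, ENNReal.zero_rpow_of_neg (by linarith),
      ENNReal.top_mul (hne B β hβ), ENNReal.mul_top hcr]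
    exact le_top
  rcases eq_or_ne B 0 with rfl | hB
  · rw [abs_zero, ENNReal.ofReal_zero, ENNReal.zero_rpow_of_neg (by linarith),
      ENNReal.mul_top (hne A α hα), ENNReal.mul_top hcr]
    exact le_top
  have hA' := abs_pos.mpr hA
  have hB' := abs_pos.mpr hB
  set μ := max |A| |B| with hμ
  have hμ0 : 0 < μ := lt_max_of_lt_left hA'
  have hv := h μ hμ0 (by rcases max_choice |A| |B| with h | h <;> simp [hμ, h])
  rw [ENNReal.ofReal_rpow_of_pos hr, ENNReal.ofReal_rpow_of_pos hA',
    ENNReal.ofReal_rpow_of_pos hB', ← ENNReal.ofReal_mul hC.le,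
        ← ENNReal.ofReal_mul (by positivity),
    ← ENNReal.ofReal_mul (by positivity), ← ofReal_norm]
  refine ENNReal.ofReal_le_ofReal (hv.trans ?_)
  rw [Real.div_rpow hr.le hμ0.le, div_eq_mul_inv, ← Real.rpow_neg hμ0.le, ← hαβ, neg_add,
    Real.rpow_add hμ0, ← mul_assoc]
  refine mul_le_mul_of_nonneg_left ?_ (by positivity)
  refine mul_le_mul ?_ ?_ (by positivity) (by positivity)
  · exact Real.rpow_le_rpow_of_nonpos hA' (le_max_left _ _) (by linarith)
  · exact Real.rpow_le_rpow_of_nonpos hB' (le_max_right _ _) (by linarith)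

/-- Averaging the oscillatory integral over a box of directions. -/
lemma exists_lintegral_enorm_line_le (m : ℕ) {α β : ℝ} (hα : 0 < α) (hβ : 0 < β)
    (hαβ : α + β = 1 / (2 * (m + 1) : ℕ)) : ∃ C : ℝ≥0∞, C ≠ ∞ ∧
    ∀ (n : ℕ) (f : MvPolynomial (Fin n) ℝ), f.totalDegree ≤ 2 * (m + 1) →
    ∀ (x c b : Fin n → ℝ) (e τ q : ℝ), 0 < e → τ ≠ 0 → 0 < q →
    (∀ᵐ z ∂(cube n), ∀ s ∈ Icc (0 : ℝ) 1,
      powSum m (x + s • fun i => c i + b i * z i) + e * (1 + s ^ 2) ^ (m + 1) ≤ q) →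
    ∫⁻ z, ‖∫ s in (0 : ℝ)..1, Complex.exp (Complex.I *
      (τ * MvPolynomial.eval (x + s • fun i => c i + b i * z i) f /
      (powSum m (x + s • fun i => c i + b i * z i) + e * (1 + s ^ 2) ^ (m + 1)) : ℝ))‖ₑ ∂(cube n) ≤
      C * ENNReal.ofReal (q ^ 2 / |τ|) ^ (1 / (2 * (m + 1) : ℕ) : ℝ) *
        (ENNReal.ofReal (∑ i, (tangentCoeff m f x e i * b i) ^ 2) ^ (-(α / 2)) *
        ENNReal.ofReal (∑ I ∈ exponents n (2 * (m + 1)),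
          ((chordPoly m f x e).coeff I * ∏ i, b i ^ I i) ^ 2) ^ (-(β / 2))) := by
  set d := 2 * (m + 1) with hd
  have hd2 : (2 : ℝ) ≤ d := by rw [hd]; push_cast; linarith [(Nat.cast_nonneg m : (0 : ℝ) ≤ m)]
  have hdpos : (0 : ℝ) < d := by linarith
  set γ := α + d * β with hγ
  have hγ0 : 0 < γ := by positivity
  have hγ1 : γ < 1 := by
    have h1 : d * (α + β) = 1 := by rw [hαβ]; field_simp
    nlinarith
  obtain ⟨C₀, hC₀, hline⟩ := exists_norm_integral_exp_line_le m
  obtain ⟨C₁, hC₁, hT⟩ := exists_lintegral_invRoot_eval_le (D := 1) le_rfl hγ0.le hγ1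
  obtain ⟨C₂, hC₂, hch⟩ := exists_lintegral_invRoot_eval_le (D := d) (by omega) hγ0.le hγ1
  refine ⟨ENNReal.ofReal C₀ * (C₁ ^ (α / γ) * C₂ ^ (d * β / γ)), ?_,
    fun n f hf x c b e τ q he hτ hq hae => ?_⟩
  · exact ENNReal.mul_ne_top ENNReal.ofReal_ne_top (ENNReal.mul_ne_top
      (ENNReal.rpow_ne_top_of_nonneg (by positivity) hC₁)
      (ENNReal.rpow_ne_top_of_nonneg (by positivity) hC₂))
  set F := invRoot 1 fun z : Fin n → ℝ => MvPolynomial.eval (fun i => c i + b i * z i)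
      (tangentPoly m f x e)
    with hF
  set G := invRoot d fun z : Fin n → ℝ => MvPolynomial.eval (fun i => (x i + c i) + b i * z i)
    (chordPoly m f x e) with hG
  have hFm : Measurable F := measurable_invRoot (continuous_eval_affine _ _ _).measurable
  have hGm : Measurable G := measurable_invRoot (continuous_eval_affine _ _ _).measurable
  have hr : 0 < q ^ 2 / |τ| := div_pos (by positivity) (abs_pos.mpr hτ)
  have hFi := hT n _ (totalDegree_tangentPoly_le m f x e)
    (Finset.univ.map ⟨fun i => Finsupp.single i 1, Finsupp.single_left_injective one_ne_zero⟩)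
    (by simp [Finsupp.single_apply]) c b
  have hGi := hch n _ (totalDegree_chordPoly_le hf x e) (exponents n d)
    (fun I hI => mem_exponents.mp hI) (fun i => x i + c i) b
  rw [Finset.sum_map] at hFi
  simp only [Function.Embedding.coeFn_mk, coeff_tangentPoly] at hFi
  have hprod : ∀ i : Fin n, ∏ j, b j ^ (Finsupp.single i 1 : Fin n →₀ ℕ) j = b i := fun i => by
    rw [Finset.prod_eq_single i]
    · simp
    · intro j _ hj; simp [hj.symm]
    · simp
  simp only [hprod] at hFi
  calc _ ≤ ∫⁻ z, ENNReal.ofReal C₀ * ENNReal.ofReal (q ^ 2 / |τ|) ^ (1 / d : ℝ) *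
        (F z ^ α * G z ^ (d * β)) ∂(cube n) := by
        refine lintegral_mono_ae ?_
        filter_upwards [hae] with z hz
        refine enorm_le_invRoot hC₀ hr (by omega) hα hβ hαβ fun μ hμ hor => ?_
        rw [div_div]
        refine hline n f hf x (fun i => c i + b i * z i) e τ q μ he hτ hμ hz ?_
        have hx : (x + fun i => c i + b i * z i) = fun i => x i + c i + b i * z i := by
          ext i; simp [add_assoc]
        rw [hx]
        exact hor
    _ = ENNReal.ofReal C₀ * ENNReal.ofReal (q ^ 2 / |τ|) ^ (1 / d : ℝ) *
        ∫⁻ z, F z ^ α * G z ^ (d * β) ∂(cube n) := by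
        rw [lintegral_const_mul _ (by fun_prop)]
    _ ≤ ENNReal.ofReal C₀ * ENNReal.ofReal (q ^ 2 / |τ|) ^ (1 / d : ℝ) *
        ((∫⁻ z, F z ^ γ ∂(cube n)) ^ (α / γ) * (∫⁻ z, G z ^ γ ∂(cube n)) ^ (d * β / γ)) := by
        gcongr
        have := ENNReal.lintegral_mul_norm_pow_le (μ := cube n) (f := fun z => F z ^ γ)
          (g := fun z => G z ^ γ) (p := α / γ) (q := d * β / γ) (by fun_prop) (by fun_prop)
          (by positivity) (by positivity) (by rw [← add_div]; exact div_self hγ0.ne')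
        simp_rw [← ENNReal.rpow_mul, mul_div_cancel₀ _ hγ0.ne'] at this
        exact this
    _ ≤ ENNReal.ofReal C₀ * ENNReal.ofReal (q ^ 2 / |τ|) ^ (1 / d : ℝ) *
        ((C₁ * ENNReal.ofReal (∑ i, (tangentCoeff m f x e i * b i) ^ 2) ^
            (-(γ / (2 * (1 : ℕ))))) ^ (α / γ) *
        (C₂ * ENNReal.ofReal (∑ I ∈ exponents n d,
          ((chordPoly m f x e).coeff I * ∏ i, b i ^ I i) ^ 2) ^ (-(γ / (2 * d)))) ^
            (d * β / γ)) := by gcongr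
    _ = _ := by
        rw [ENNReal.mul_rpow_of_nonneg _ _ (by positivity),
          ENNReal.mul_rpow_of_nonneg _ _ (by positivity), ← ENNReal.rpow_mul, ← ENNReal.rpow_mul]
        have e1 : -(γ / (2 * (1 : ℕ))) * (α / γ) = -(α / 2) := by push_cast; field_simp
        have e2 : -(γ / (2 * d)) * (d * β / γ) = -(β / 2) := by field_simp
        rw [e1, e2]
        ring

/-- The polynomial `∂ᵢf xⱼ ^ (2 * m + 1) - ∂ⱼf xᵢ ^ (2 * m + 1)`. -/
def crossPoly {n : ℕ} (m : ℕ) (f : MvPolynomial (Fin n) ℝ) (i j : Fin n) :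
    MvPolynomial (Fin n) ℝ :=
  MvPolynomial.pderiv i f * MvPolynomial.X j ^ (2 * m + 1) -
    MvPolynomial.pderiv j f * MvPolynomial.X i ^ (2 * m + 1)

/-- The weighted mean square of the polynomials `crossPoly`. -/
def crossForm {n : ℕ} (m : ℕ) (f : MvPolynomial (Fin n) ℝ) (w : Fin n → ℝ) :
    MvPolynomial (Fin n) ℝ :=
  MvPolynomial.C (n : ℝ)⁻¹ *
    ∑ i, ∑ j, MvPolynomial.C ((w i * w j) ^ 2) * crossPoly m f i j ^ 2

lemma eval_crossForm {n : ℕ} (m : ℕ) (f : MvPolynomial (Fin n) ℝ) (w x : Fin n → ℝ) :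
    MvPolynomial.eval x (crossForm m f w) =
      (n : ℝ)⁻¹ * ∑ i, ∑ j, (w i * w j) ^ 2 * MvPolynomial.eval x (crossPoly m f i j) ^ 2 := by
  simp [crossForm]

lemma eval_crossForm_nonneg {n : ℕ} (m : ℕ) (f : MvPolynomial (Fin n) ℝ) (w x : Fin n → ℝ) :
    0 ≤ MvPolynomial.eval x (crossForm m f w) := by
  rw [eval_crossForm]
  positivity

lemma totalDegree_crossPoly_le {n m : ℕ} {f : MvPolynomial (Fin n) ℝ}
    (hf : f.IsHomogeneous (2 * (m + 1))) (i j : Fin n) :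
    (crossPoly m f i j).totalDegree ≤ 2 * (2 * m + 1) := by
  have h : ∀ i j : Fin n, (MvPolynomial.pderiv i f * MvPolynomial.X j ^ (2 * m + 1)).totalDegree
      ≤ 2 * (2 * m + 1) := fun i j => by
    refine (MvPolynomial.totalDegree_mul _ _).trans ?_
    have h1 : (MvPolynomial.pderiv i f).totalDegree ≤ 2 * m + 1 := hf.pderiv.totalDegree_le
    have h2 : (MvPolynomial.X j ^ (2 * m + 1) : MvPolynomial (Fin n) ℝ).totalDegree ≤ 2 * m + 1 :=
      (MvPolynomial.totalDegree_X_pow _ _).le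
    omega
  exact (MvPolynomial.totalDegree_sub _ _).trans (max_le (h i j) (h j i))

lemma totalDegree_crossForm_le {n m : ℕ} {f : MvPolynomial (Fin n) ℝ}
    (hf : f.IsHomogeneous (2 * (m + 1))) (w : Fin n → ℝ) :
    (crossForm m f w).totalDegree ≤ 4 * (2 * (m + 1)) := by
  refine (MvPolynomial.totalDegree_mul _ _).trans ?_
  rw [MvPolynomial.totalDegree_C, zero_add]
  refine MvPolynomial.totalDegree_finsetSum_le fun i _ =>
    MvPolynomial.totalDegree_finsetSum_le fun j _ => ?_
  refine (MvPolynomial.totalDegree_mul _ _).trans ?_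
  rw [MvPolynomial.totalDegree_C, zero_add]
  refine (MvPolynomial.totalDegree_pow _ _).trans ?_
  have := totalDegree_crossPoly_le hf i j
  omega

lemma eval_pderiv_powPoly {n : ℕ} (m : ℕ) (x : Fin n → ℝ) (i : Fin n) :
    MvPolynomial.eval x (MvPolynomial.pderiv i (powPoly n m)) =
      (2 * (m + 1) : ℕ) * x i ^ (2 * m + 1) := by
  rw [powPoly, map_sum, map_sum, Finset.sum_eq_single i]
  · rw [MvPolynomial.pderiv_pow, MvPolynomial.pderiv_X_self]
    simp [show 2 * (m + 1) - 1 = 2 * m + 1 by omega]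
  · intro j _ hj
    rw [MvPolynomial.pderiv_pow, MvPolynomial.pderiv_X_of_ne hj]
    simp
  · simp

lemma sum_sq_tangentCoeff_ge {n m : ℕ} (hn : 1 ≤ n) (f : MvPolynomial (Fin n) ℝ)
    {x w b r : Fin n → ℝ} {e : ℝ} (hw0 : ∀ i, 0 ≤ w i) (hw1 : ∀ i, w i ≤ 1)
    (hwb : ∀ i, w i ≤ |b i|) (hxr : ∀ i, |x i| ≤ r i) :
    (powSum m x + e) ^ 2 * MvPolynomial.eval x (crossForm m f w) ≤
      4 * (1 + (n : ℝ)⁻¹ * ∑ i, r i ^ (2 * (2 * (m + 1)))) *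
        ∑ i, (tangentCoeff m f x e i * b i) ^ 2 := by
  have hn' : (0 : ℝ) < n := by exact_mod_cast hn
  set v := tangentCoeff m f x e with hv
  set W := powSum m x + e with hW
  have hvQ : ∀ i j, v i * x j ^ (2 * m + 1) - v j * x i ^ (2 * m + 1) =
      W * MvPolynomial.eval x (crossPoly m f i j) := fun i j => by
    simp only [hv, tangentCoeff, crossPoly, eval_pderiv_powPoly, map_sub, map_mul, map_pow,
      MvPolynomial.eval_X]
    ring
  have hpow : ∀ i, (x i ^ (2 * m + 1)) ^ 2 ≤ 1 + r i ^ (2 * (2 * (m + 1))) := fun i => by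
    have h0 : 0 ≤ r i := (abs_nonneg _).trans (hxr i)
    calc (x i ^ (2 * m + 1)) ^ 2 = |x i| ^ (2 * (2 * m + 1)) := by
          rw [← pow_mul, mul_comm, (even_two_mul _).pow_abs]
      _ ≤ r i ^ (2 * (2 * m + 1)) := pow_le_pow_left₀ (abs_nonneg _) (hxr i) _
      _ ≤ 1 + r i ^ (2 * (2 * (m + 1))) := by
          rcases le_total (r i) 1 with h | h
          · exact (pow_le_one₀ h0 h).trans (le_add_of_nonneg_right (by positivity))
          · exact (pow_le_pow_right₀ h (show 2 * (2 * m + 1) ≤ 2 * (2 * (m + 1)) by omega)).trans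
              (by linarith)
  have hpos : ∀ i, 0 ≤ 1 + r i ^ (2 * (2 * (m + 1))) := fun i => by
    have : 0 ≤ r i := (abs_nonneg _).trans (hxr i)
    positivity
  have hterm : ∀ i j, W ^ 2 * ((w i * w j) ^ 2 * MvPolynomial.eval x (crossPoly m f i j) ^ 2) ≤
      2 * ((v i * w i) ^ 2 * (1 + r j ^ (2 * (2 * (m + 1)))) +
        (v j * w j) ^ 2 * (1 + r i ^ (2 * (2 * (m + 1))))) := fun i j => by
    have hwsq : ∀ i, w i ^ 2 ≤ 1 := fun i => pow_le_one₀ (hw0 i) (hw1 i)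
    have key : ∀ i j, (v i * w i) ^ 2 * ((x j ^ (2 * m + 1)) ^ 2 * w j ^ 2) ≤
        (v i * w i) ^ 2 * (1 + r j ^ (2 * (2 * (m + 1)))) := fun i j => by
      refine mul_le_mul_of_nonneg_left ?_ (sq_nonneg _)
      exact (mul_le_of_le_one_right (sq_nonneg _) (hwsq j)).trans (hpow j)
    have h1 : W ^ 2 * ((w i * w j) ^ 2 * MvPolynomial.eval x (crossPoly m f i j) ^ 2) =
        (w i * w j) ^ 2 * (v i * x j ^ (2 * m + 1) - v j * x i ^ (2 * m + 1)) ^ 2 := by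
      rw [hvQ]; ring
    rw [h1]
    nlinarith [key i j, key j i,
      sq_nonneg ((w i * w j) * (v i * x j ^ (2 * m + 1) + v j * x i ^ (2 * m + 1)))]
  have hvb : ∑ i, (v i * w i) ^ 2 ≤ ∑ i, (v i * b i) ^ 2 := by
    refine Finset.sum_le_sum fun i _ => ?_
    rw [mul_pow, mul_pow, ← sq_abs (b i)]
    gcongr
    · exact hw0 i
    · exact hwb i
  have hsum : ∀ F G : Fin n → ℝ, ∑ i, ∑ j, 2 * (F i * G j + F j * G i) =
      4 * (∑ i, F i) * ∑ j, G j := fun F G => by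
    simp_rw [← Finset.mul_sum, Finset.sum_add_distrib, ← Finset.mul_sum, ← Finset.sum_mul,
      ← Finset.mul_sum]
    ring
  rw [eval_crossForm]
  calc W ^ 2 * ((n : ℝ)⁻¹ * ∑ i, ∑ j,
        (w i * w j) ^ 2 * MvPolynomial.eval x (crossPoly m f i j) ^ 2)
      = (n : ℝ)⁻¹ * ∑ i, ∑ j,
        W ^ 2 * ((w i * w j) ^ 2 * MvPolynomial.eval x (crossPoly m f i j) ^ 2) := by
        simp_rw [← Finset.mul_sum]; ring
    _ ≤ (n : ℝ)⁻¹ * (4 * (∑ i, (v i * w i) ^ 2) * ∑ j, (1 + r j ^ (2 * (2 * (m + 1))))) := by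
        rw [← hsum]
        exact mul_le_mul_of_nonneg_left
          (Finset.sum_le_sum fun i _ => Finset.sum_le_sum fun j _ => hterm i j) (by positivity)
    _ ≤ (n : ℝ)⁻¹ * (4 * (∑ i, (v i * b i) ^ 2) * ∑ j, (1 + r j ^ (2 * (2 * (m + 1))))) := by
        have := Finset.sum_nonneg fun j (_ : j ∈ Finset.univ) => hpos j
        gcongr
    _ = _ := by
        rw [Finset.sum_add_distrib, Finset.sum_const, Finset.card_univ, Fintype.card_fin,
          nsmul_eq_mul]
        field_simp

/-- The exponents of degree `d` which are not pure powers. -/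
def mixedExponents (n d : ℕ) : Finset (Fin n →₀ ℕ) :=
  open Classical in (exponents n d).filter fun I => ∀ i, I ≠ Finsupp.single i d

lemma sum_exponents_eq {n d : ℕ} (hd : 1 ≤ d) (F : (Fin n →₀ ℕ) → ℝ) :
    ∑ I ∈ exponents n d, F I = ∑ I ∈ mixedExponents n d, F I + ∑ i, F (Finsupp.single i d) := by
  classical
  rw [mixedExponents, ← Finset.sum_filter_add_sum_filter_not (exponents n d)
    (fun I => ∀ i, I ≠ Finsupp.single i d)]
  congr 1
  · have h : (exponents n d).filter (fun I => ¬ ∀ i, I ≠ Finsupp.single i d) = Finset.univ.map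
        ⟨fun i => Finsupp.single i d, Finsupp.single_left_injective (by omega)⟩ := by
      ext I
      simp only [Finset.mem_filter, mem_exponents, not_forall, not_not, Finset.mem_map,
        Finset.mem_univ, true_and, Function.Embedding.coeFn_mk]
      constructor
      · rintro ⟨-, i, rfl⟩; exact ⟨i, rfl⟩
      · rintro ⟨i, rfl⟩; exact ⟨by simp [Finsupp.single_apply], i, rfl⟩
    rw [h, Finset.sum_map]
    rfl

lemma prod_pow_single {n : ℕ} (w : Fin n → ℝ) (i : Fin n) (d : ℕ) :
    ∏ j, w j ^ (Finsupp.single i d : Fin n →₀ ℕ) j = w i ^ d := by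
  rw [Finset.prod_eq_single i]
  · simp
  · intro j _ hj; simp [hj.symm]
  · simp

/-- A weighted version of the squared distance of the coefficients of `f` to the multiples of the
power sum. -/
def topForm {n : ℕ} (d : ℕ) (f : MvPolynomial (Fin n) ℝ) (w : Fin n → ℝ) : ℝ :=
  ∑ I ∈ mixedExponents n d, (f.coeff I * ∏ i, w i ^ I i) ^ 2 +
    (4 * n : ℝ)⁻¹ * ∑ i, ∑ j,
      ((f.coeff (Finsupp.single i d) - f.coeff (Finsupp.single j d)) * (w i * w j) ^ d) ^ 2

lemma coeff_powPoly {n m : ℕ} (I : Fin n →₀ ℕ) :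
    (powPoly n m).coeff I = ∑ i, if Finsupp.single i (2 * (m + 1)) = I then 1 else 0 := by
  classical
  rw [powPoly, MvPolynomial.coeff_sum]
  exact Finset.sum_congr rfl fun i _ => by rw [MvPolynomial.coeff_X_pow]

lemma sum_sq_chordPoly_ge {n m : ℕ} (hn : 1 ≤ n) (f : MvPolynomial (Fin n) ℝ)
    {x w b : Fin n → ℝ} {e : ℝ} (hw0 : ∀ i, 0 ≤ w i) (hw1 : ∀ i, w i ≤ 1)
    (hwb : ∀ i, w i ≤ |b i|) :
    (powSum m x + e) ^ 2 * topForm (2 * (m + 1)) f w ≤ ∑ I ∈ exponents n (2 * (m + 1)),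
      ((chordPoly m f x e).coeff I * ∏ i, b i ^ I i) ^ 2 := by
  have hn' : (0 : ℝ) < n := by exact_mod_cast hn
  set d := 2 * (m + 1) with hd
  set W := powSum m x + e with hW
  have hwb' : ∀ I : Fin n →₀ ℕ, (∏ i, w i ^ I i) ^ 2 ≤ (∏ i, b i ^ I i) ^ 2 := fun I => by
    rw [← sq_abs (∏ i, b i ^ I i), Finset.abs_prod]
    refine pow_le_pow_left₀ (Finset.prod_nonneg fun i _ => pow_nonneg (hw0 i) _) ?_ _
    refine Finset.prod_le_prod (fun i _ => pow_nonneg (hw0 i) _) fun i _ => ?_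
    rw [abs_pow]
    exact pow_le_pow_left₀ (hw0 i) (hwb i) _
  have hle : ∑ I ∈ exponents n d, ((chordPoly m f x e).coeff I * ∏ i, w i ^ I i) ^ 2 ≤
      ∑ I ∈ exponents n d, ((chordPoly m f x e).coeff I * ∏ i, b i ^ I i) ^ 2 := by
    refine Finset.sum_le_sum fun I _ => ?_
    rw [mul_pow, mul_pow]
    exact mul_le_mul_of_nonneg_left (hwb' I) (sq_nonneg _)
  refine le_trans ?_ hle
  have hcoeff : ∀ I ∈ exponents n d, (chordPoly m f x e).coeff I =
      W * f.coeff I - MvPolynomial.eval x f * (powPoly n m).coeff I := fun I hI => by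
    have hI0 : (0 : Fin n →₀ ℕ) ≠ I := by
      rintro rfl
      have := mem_exponents.mp hI
      simp [hd] at this
    rw [chordPoly, MvPolynomial.coeff_sub, MvPolynomial.coeff_C_mul, MvPolynomial.coeff_C_mul,
      MvPolynomial.coeff_add, MvPolynomial.coeff_C, if_neg hI0, add_zero]
  rw [sum_exponents_eq (by omega), topForm, mul_add]
  refine add_le_add ?_ ?_
  · rw [Finset.mul_sum]
    refine (Finset.sum_congr rfl fun I hI => ?_).le
    obtain ⟨hI, hI'⟩ := Finset.mem_filter.mp hI
    rw [hcoeff I hI, coeff_powPoly, Finset.sum_eq_zero fun i _ => if_neg (hI' i).symm]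
    ring
  · set y : Fin n → ℝ := fun i => (W * f.coeff (Finsupp.single i d) - MvPolynomial.eval x f) *
      w i ^ d with hy
    have hyi : ∀ i, (chordPoly m f x e).coeff (Finsupp.single i d) *
        ∏ j, w j ^ (Finsupp.single i d : Fin n →₀ ℕ) j = y i := fun i => by
      rw [hcoeff _ (by simp [mem_exponents, Finsupp.single_apply]), prod_pow_single,
        coeff_powPoly, Finset.sum_eq_single i]
      · simp [hy, hd]
      · intro j _ hj
        exact if_neg fun h => hj (Finsupp.single_left_injective (by omega) h)
      · simp
    simp_rw [hyi]
    have hwd : ∀ i, (w i ^ d) ^ 2 ≤ 1 := fun i =>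
      pow_le_one₀ (pow_nonneg (hw0 i) _) (pow_le_one₀ (hw0 i) (hw1 i))
    have hterm : ∀ i j, W ^ 2 * ((f.coeff (Finsupp.single i d) - f.coeff (Finsupp.single j d)) *
        (w i * w j) ^ d) ^ 2 ≤ 2 * (y i ^ 2 + y j ^ 2) := fun i j => by
      have h1 : W ^ 2 * ((f.coeff (Finsupp.single i d) - f.coeff (Finsupp.single j d)) *
        (w i * w j) ^ d) ^ 2 = (y i * w j ^ d - y j * w i ^ d) ^ 2 := by
        simp only [hy]; ring
      have h2 : ∀ i j, (y i * w j ^ d) ^ 2 ≤ y i ^ 2 := fun i j => by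
        rw [mul_pow]
        exact mul_le_of_le_one_right (sq_nonneg _) (hwd j)
      rw [h1]
      nlinarith [h2 i j, h2 j i, sq_nonneg (y i * w j ^ d + y j * w i ^ d)]
    calc _ = (4 * n : ℝ)⁻¹ * ∑ i, ∑ j, W ^ 2 *
          ((f.coeff (Finsupp.single i d) - f.coeff (Finsupp.single j d)) * (w i * w j) ^ d)
              ^ 2 := by
          simp_rw [← Finset.mul_sum]; ring
      _ ≤ (4 * n : ℝ)⁻¹ * ∑ i, ∑ j, 2 * (y i ^ 2 + y j ^ 2) := by
          exact mul_le_mul_of_nonneg_left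
            (Finset.sum_le_sum fun i _ => Finset.sum_le_sum fun j _ => hterm i j) (by positivity)
      _ = ∑ i, y i ^ 2 := by
          simp_rw [← Finset.mul_sum, Finset.sum_add_distrib, Finset.sum_const, Finset.card_univ,
            Fintype.card_fin, nsmul_eq_mul, ← Finset.mul_sum]
          field_simp
          ring

lemma sum_mul_rpow_neg_le {ι : Type*} (s : Finset ι) {w y : ι → ℝ} (hw : ∀ k ∈ s, 0 ≤ w k)
    (hw1 : ∑ k ∈ s, w k = 1) (hy : ∀ k ∈ s, 0 < y k) {η : ℝ} (hη : 0 ≤ η) :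
    (∑ k ∈ s, w k * y k) ^ (-η) ≤ ∑ k ∈ s, w k * y k ^ (-η) := by
  have hG : 0 < ∏ k ∈ s, y k ^ w k := Finset.prod_pos fun k hk => Real.rpow_pos_of_pos (hy k hk) _
  calc (∑ k ∈ s, w k * y k) ^ (-η) ≤ (∏ k ∈ s, y k ^ w k) ^ (-η) :=
        Real.rpow_le_rpow_of_nonpos hG
          (Real.geom_mean_le_arith_mean_weighted s w y hw hw1 fun k hk => (hy k hk).le)
          (by linarith)
    _ = ∏ k ∈ s, (y k ^ (-η)) ^ w k := by
        rw [← Real.finsetProd_rpow _ _ fun k hk => (Real.rpow_pos_of_pos (hy k hk) _).le]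
        refine Finset.prod_congr rfl fun k hk => ?_
        rw [← Real.rpow_mul (hy k hk).le, ← Real.rpow_mul (hy k hk).le, mul_comm]
    _ ≤ ∑ k ∈ s, w k * y k ^ (-η) :=
        Real.geom_mean_le_arith_mean_weighted s w _ hw hw1 fun k hk =>
          (Real.rpow_pos_of_pos (hy k hk) _).le

lemma ofReal_sum_rpow_neg_le {ι : Type*} (s : Finset ι) {q y : ι → ℝ} (hq : ∀ k ∈ s, 0 ≤ q k)
    (hQ : 0 < ∑ k ∈ s, q k) (hy : ∀ k ∈ s, 0 ≤ y k) {η : ℝ} (hη : 0 < η) :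
    ENNReal.ofReal (∑ k ∈ s, q k * y k) ^ (-η) ≤ ENNReal.ofReal (∑ k ∈ s, q k) ^ (-η) *
      ∑ k ∈ s, ENNReal.ofReal (q k / ∑ k ∈ s, q k) * ENNReal.ofReal (y k) ^ (-η) := by
  classical
  set Q := ∑ k ∈ s, q k with hQdef
  set s' := s.filter fun k => 0 < q k with hs'
  have hsub : ∀ {M : Type} [AddCommMonoid M] (g : ι → M), (∀ k ∈ s, q k = 0 → g k = 0) →
      ∑ k ∈ s', g k = ∑ k ∈ s, g k := fun g hg => by
    refine Finset.sum_subset (Finset.filter_subset _ _) fun k hk hk' => hg k hk ?_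
    rw [hs', Finset.mem_filter, not_and, not_lt] at hk'
    exact le_antisymm (hk' hk) (hq k hk)
  by_cases hpos : ∀ k ∈ s', 0 < y k
  · have hmem : ∀ k ∈ s', 0 < q k := fun k hk => (Finset.mem_filter.mp hk).2
    have hne : s'.Nonempty := by
      rw [← hsub q fun k _ h => h] at hQdef
      refine Finset.nonempty_of_sum_ne_zero (f := q) ?_
      rw [← hQdef]; exact hQ.ne'
    have hS : 0 < ∑ k ∈ s', q k / Q * y k :=
      Finset.sum_pos (fun k hk => mul_pos (div_pos (hmem k hk) hQ) (hpos k hk)) hne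
    have h1 := sum_mul_rpow_neg_le s' (w := fun k => q k / Q) (y := y)
      (fun k hk => (div_pos (hmem k hk) hQ).le)
      (by rw [← Finset.sum_div, hsub q fun k _ h => h]; exact div_self hQ.ne') hpos hη.le
    rw [← hsub (fun k => q k * y k) fun k _ h => by simp [h],
      ← hsub _ fun k _ h => by simp [h]]
    have h2 : ∑ k ∈ s', q k * y k = Q * ∑ k ∈ s', q k / Q * y k := by
      rw [Finset.mul_sum]
      exact Finset.sum_congr rfl fun k _ => by field_simp
    rw [h2, ENNReal.ofReal_mul hQ.le,
      ENNReal.mul_rpow_of_ne_top ENNReal.ofReal_ne_top ENNReal.ofReal_ne_top]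
    gcongr
    rw [ENNReal.ofReal_rpow_of_pos hS]
    refine (ENNReal.ofReal_le_ofReal h1).trans_eq ?_
    rw [ENNReal.ofReal_sum_of_nonneg fun k hk => mul_nonneg (div_pos (hmem k hk) hQ).le
      (Real.rpow_pos_of_pos (hpos k hk) _).le]
    refine Finset.sum_congr rfl fun k hk => ?_
    rw [ENNReal.ofReal_mul (div_pos (hmem k hk) hQ).le, ENNReal.ofReal_rpow_of_pos (hpos k hk)]
  · push Not at hpos
    obtain ⟨k, hk', hyk⟩ := hpos
    obtain ⟨hk, hqk⟩ := Finset.mem_filter.mp hk'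
    have hyk0 : y k = 0 := le_antisymm hyk (hy k hk)
    have htop : ∑ k ∈ s, ENNReal.ofReal (q k / Q) * ENNReal.ofReal (y k) ^ (-η) = ∞ := by
      refine ENNReal.sum_eq_top.mpr ⟨k, hk, ?_⟩
      rw [hyk0, ENNReal.ofReal_zero, ENNReal.zero_rpow_of_neg (by linarith), ENNReal.mul_top]
      simpa using div_pos hqk hQ
    rw [htop, ENNReal.mul_top]
    · exact le_top
    · rw [ENNReal.ofReal_rpow_of_pos hQ]
      simpa using Real.rpow_pos_of_pos hQ _

lemma lintegral_sum_rpow_neg_le {Ω ι : Type*} [MeasurableSpace Ω] {μ : Measure Ω} (s : Finset ι)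
    {q : ι → ℝ} {y : ι → Ω → ℝ} (hq : ∀ k ∈ s, 0 ≤ q k) (hQ : 0 < ∑ k ∈ s, q k)
    (hy : ∀ k ∈ s, ∀ ω, 0 ≤ y k ω) (hym : ∀ k ∈ s, Measurable (y k)) {η : ℝ} (hη : 0 < η)
    {K : ℝ≥0∞} (hK : ∀ k ∈ s, ∫⁻ ω, ENNReal.ofReal (y k ω) ^ (-η) ∂μ ≤ K) :
    ∫⁻ ω, ENNReal.ofReal (∑ k ∈ s, q k * y k ω) ^ (-η) ∂μ ≤
      ENNReal.ofReal (∑ k ∈ s, q k) ^ (-η) * K := by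
  set Q := ∑ k ∈ s, q k with hQdef
  have hm : ∀ k ∈ s, Measurable fun ω => ENNReal.ofReal (y k ω) ^ (-η) := fun k hk => by
    have := hym k hk
    fun_prop
  calc _ ≤ ∫⁻ ω, ENNReal.ofReal Q ^ (-η) *
        ∑ k ∈ s, ENNReal.ofReal (q k / Q) * ENNReal.ofReal (y k ω) ^ (-η) ∂μ :=
        lintegral_mono fun ω => ofReal_sum_rpow_neg_le s hq hQ (fun k hk => hy k hk ω) hη
    _ = ENNReal.ofReal Q ^ (-η) *
        ∑ k ∈ s, ENNReal.ofReal (q k / Q) * ∫⁻ ω, ENNReal.ofReal (y k ω) ^ (-η) ∂μ := by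
        rw [lintegral_const_mul _ (Finset.measurable_fun_sum s fun k hk => (hm k hk).const_mul _),
          lintegral_finsetSum' _ fun k hk => ((hm k hk).const_mul _).aemeasurable]
        congr 1
        exact Finset.sum_congr rfl fun k hk => lintegral_const_mul _ (hm k hk)
    _ ≤ ENNReal.ofReal Q ^ (-η) * ∑ k ∈ s, ENNReal.ofReal (q k / Q) * K := by
        gcongr with k hk
        exact hK k hk
    _ = _ := by
        rw [← Finset.sum_mul, ← ENNReal.ofReal_sum_of_nonneg fun k hk => div_nonneg (hq k hk) hQ.le,
          ← Finset.sum_div, div_self hQ.ne', ENNReal.ofReal_one, one_mul]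

lemma lintegral_pi_prod {Ω : Type*} [MeasurableSpace Ω] (μ : Measure Ω) [IsProbabilityMeasure μ] :
    ∀ {n : ℕ} (g : Fin n → Ω → ℝ≥0∞), (∀ i, Measurable (g i)) →
      ∫⁻ x, ∏ i, g i (x i) ∂(Measure.pi fun _ => μ) = ∏ i, ∫⁻ ω, g i ω ∂μ
  | 0, g, _ => by simp
  | n + 1, g, hg => by
    have hm : ∀ (k : ℕ) (g : Fin k → Ω → ℝ≥0∞), (∀ i, Measurable (g i)) →
        Measurable fun x : Fin k → Ω => ∏ i, g i (x i) := fun k g hg =>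
      Finset.measurable_fun_prod _ fun i _ => (hg i).comp (measurable_pi_apply i)
    rw [lintegral_pi_fin_succ _ (hm _ g hg)]
    simp_rw [Fin.prod_univ_succ, Fin.cons_zero, Fin.cons_succ]
    simp_rw [lintegral_const_mul _ (hm n (fun i => g i.succ) fun i => hg _),
      lintegral_pi_prod μ (fun i => g i.succ) fun i => hg _]
    rw [lintegral_mul_const _ (hg 0)]

lemma lintegral_prod_width_rpow_le {P : Measure BoxParam} [IsProbabilityMeasure P] {n L : ℕ}
    (k : Fin n → ℕ) {η : ℝ} (hk : ∀ i, η * k i ≤ 7 / 4)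
    (hL : (Finset.univ.filter fun i => k i ≠ 0).card ≤ L) :
    ∫⁻ ω, ENNReal.ofReal (∏ i, (ω i).width ^ k i) ^ (-η) ∂(Measure.pi fun _ : Fin n => P) ≤
      (∫⁻ ω, ENNReal.ofReal ω.width ^ (-(7/4) : ℝ) ∂P) ^ L := by
  set C := ∫⁻ ω, ENNReal.ofReal ω.width ^ (-(7/4) : ℝ) ∂P with hC
  have hw1 : ∀ ω : BoxParam, ENNReal.ofReal ω.width ≤ 1 := fun ω => by
    rw [← ENNReal.ofReal_one]
    exact ENNReal.ofReal_le_ofReal (min_le_left _ _)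
  have hmono : ∀ (ω : BoxParam) (a : ℝ), a ≤ 7 / 4 →
      ENNReal.ofReal ω.width ^ (-a) ≤ ENNReal.ofReal ω.width ^ (-(7/4) : ℝ) := fun ω a ha =>
    ENNReal.rpow_le_rpow_of_exponent_ge (hw1 ω) (by linarith)
  have hC1 : 1 ≤ C := by
    calc (1 : ℝ≥0∞) = ∫⁻ _, 1 ∂P := by simp
      _ ≤ C := lintegral_mono fun ω => by
        simpa using hmono ω 0 (by norm_num)
  have hpt : ∀ ω : Fin n → BoxParam, ENNReal.ofReal (∏ i, (ω i).width ^ k i) ^ (-η) =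
      ∏ i, ENNReal.ofReal (ω i).width ^ (-(η * k i)) := fun ω => by
    rw [ENNReal.ofReal_prod_of_nonneg fun i _ => pow_nonneg (BoxParam.width_nonneg _) _,
      ← ENNReal.prod_rpow_of_ne_top fun i _ => ENNReal.ofReal_ne_top]
    refine Finset.prod_congr rfl fun i _ => ?_
    rw [ENNReal.ofReal_pow (BoxParam.width_nonneg _), ← ENNReal.rpow_natCast, ← ENNReal.rpow_mul]
    congr 1
    ring
  simp_rw [hpt]
  rw [lintegral_pi_prod P (fun i ω => ENNReal.ofReal ω.width ^ (-(η * k i))) fun i => by fun_prop]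
  calc _ ≤ ∏ i, if k i ≠ 0 then C else 1 := by
        refine Finset.prod_le_prod' fun i _ => ?_
        split_ifs with h
        · exact lintegral_mono fun ω => hmono ω _ (hk i)
        · push Not at h
          simp [h]
    _ = C ^ (Finset.univ.filter fun i => k i ≠ 0).card := by
        rw [Finset.prod_ite, Finset.prod_const, Finset.prod_const_one, mul_one]
    _ ≤ C ^ L := pow_le_pow_right₀ hC1 hL

lemma sum_sq_sub_eq {n : ℕ} (a : Fin n → ℝ) :
    ∑ i, ∑ j, (a i - a j) ^ 2 = 2 * (n * ∑ i, a i ^ 2 - (∑ i, a i) ^ 2) := by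
  simp_rw [sub_sq, Finset.sum_add_distrib, Finset.sum_sub_distrib, Finset.sum_const,
    Finset.card_univ, Fintype.card_fin, nsmul_eq_mul, ← Finset.mul_sum, ← Finset.sum_mul,
    ← Finset.mul_sum]
  ring

lemma quarter_le_topForm_one {n d : ℕ} (hn : 1 ≤ n) (hd : 1 ≤ d) {f : MvPolynomial (Fin n) ℝ}
    (hA : ∑ I ∈ exponents n d, f.coeff I ^ 2 = 1)
    (hS : (∑ i, f.coeff (Finsupp.single i d)) ^ 2 ≤ n / 16) :
    1 / 4 ≤ ∑ I ∈ mixedExponents n d, f.coeff I ^ 2 + ∑ i, ∑ j,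
      (4 * n : ℝ)⁻¹ * (f.coeff (Finsupp.single i d) - f.coeff (Finsupp.single j d)) ^ 2 := by
  have hn' : (0 : ℝ) < n := by exact_mod_cast hn
  rw [sum_exponents_eq hd] at hA
  have h0 : 0 ≤ ∑ I ∈ mixedExponents n d, f.coeff I ^ 2 :=
    Finset.sum_nonneg fun _ _ => sq_nonneg _
  simp_rw [← Finset.mul_sum]
  rw [sum_sq_sub_eq]
  have h1 : (4 * n : ℝ)⁻¹ * (2 * (n * ∑ i, f.coeff (Finsupp.single i d) ^ 2 -
      (∑ i, f.coeff (Finsupp.single i d)) ^ 2)) = (∑ i, f.coeff (Finsupp.single i d) ^ 2) / 2 -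
      (∑ i, f.coeff (Finsupp.single i d)) ^ 2 / n / 2 := by
    field_simp
    ring
  have h2 : (∑ i, f.coeff (Finsupp.single i d)) ^ 2 / n ≤ 1 / 16 := by
    rw [div_le_iff₀ hn']; linarith
  rw [h1]
  linarith

lemma coeff_crossPoly {n m : ℕ} {f : MvPolynomial (Fin n) ℝ} {i j : Fin n} (hij : i ≠ j)
    {I : Fin n →₀ ℕ} (hI : ∑ l, I l = 2 * m + 1) :
    (crossPoly m f i j).coeff (I + Finsupp.single j (2 * m + 1)) =
      (I i + 1) * f.coeff (I + Finsupp.single i 1) -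
        if I = Finsupp.single i (2 * m + 1) then
          (2 * m + 2) * f.coeff (Finsupp.single j (2 * (m + 1))) else 0 := by
  classical
  rw [crossPoly, MvPolynomial.coeff_sub, MvPolynomial.X_pow_eq_monomial,
    MvPolynomial.coeff_mul_monomial, MvPolynomial.X_pow_eq_monomial,
    MvPolynomial.coeff_mul_monomial', MvPolynomial.coeff_pderiv, mul_one, mul_comm]
  congr 1
  have hiff : Finsupp.single i (2 * m + 1) ≤ I + Finsupp.single j (2 * m + 1) ↔
      I = Finsupp.single i (2 * m + 1) := by
    constructor
    · intro h
      have h1 := h i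
      simp only [Finsupp.single_eq_same, Finsupp.add_apply, Finsupp.single_apply, hij.symm,
        if_false, add_zero] at h1
      have h2 := Finset.add_sum_erase Finset.univ I (Finset.mem_univ i)
      have h3 : ∑ l ∈ Finset.univ.erase i, I l = 0 := by omega
      rw [Finset.sum_eq_zero_iff] at h3
      ext l
      rcases eq_or_ne l i with rfl | hl
      · simp; omega
      · rw [h3 l (by simp [hl]), Finsupp.single_apply, if_neg hl.symm]
    · rintro rfl
      exact le_self_add
  simp only [hiff]
  split_ifs with h
  · rw [h, add_tsub_cancel_left, MvPolynomial.coeff_pderiv, ← Finsupp.single_add]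
    simp only [Finsupp.single_eq_same]
    push_cast
    rw [show 2 * m + 1 + 1 = 2 * (m + 1) by ring]
    ring
  · rfl

lemma sum_sq_coeff_crossPoly_ge {n m : ℕ} (f : MvPolynomial (Fin n) ℝ) {i j : Fin n}
    (hij : i ≠ j) :
    ∑ I ∈ (mixedExponents n (2 * (m + 1))).filter (fun I => I i ≠ 0), f.coeff I ^ 2 +
      (f.coeff (Finsupp.single i (2 * (m + 1))) - f.coeff (Finsupp.single j (2 * (m + 1)))) ^ 2 ≤
    ∑ J ∈ exponents n (2 * (2 * m + 1)), (crossPoly m f i j).coeff J ^ 2 := by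
  classical
  set M := (mixedExponents n (2 * (m + 1))).filter (fun I => I i ≠ 0) with hM
  set S := insert (Finsupp.single i (2 * (m + 1))) M with hS
  set φ : (Fin n →₀ ℕ) → (Fin n →₀ ℕ) := fun I =>
    (I - Finsupp.single i 1) + Finsupp.single j (2 * m + 1) with hφ
  have hMm : ∀ I ∈ M, ∑ l, I l = 2 * (m + 1) ∧ (∀ l, I ≠ Finsupp.single l (2 * (m + 1))) ∧
      I i ≠ 0 := fun I hI => by
    obtain ⟨h1, h2⟩ := Finset.mem_filter.mp hI
    obtain ⟨h3, h4⟩ := Finset.mem_filter.mp h1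
    exact ⟨mem_exponents.mp h3, h4, h2⟩
  have hnot : Finsupp.single i (2 * (m + 1)) ∉ M := fun h => (hMm _ h).2.1 i rfl
  have hSm : ∀ I ∈ S, ∑ l, I l = 2 * (m + 1) ∧ I i ≠ 0 := fun I hI => by
    rcases Finset.mem_insert.mp hI with rfl | h
    · exact ⟨by simp [Finsupp.single_apply], by simp⟩
    · exact ⟨(hMm I h).1, (hMm I h).2.2⟩
  have hdec : ∀ I ∈ S, (I - Finsupp.single i 1) + Finsupp.single i 1 = I := fun I hI => by
    refine tsub_add_cancel_of_le ?_
    rw [Finsupp.single_le_iff]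
    have := (hSm I hI).2
    omega
  have hdeg : ∀ I ∈ S, ∑ l, (I - Finsupp.single i 1 : Fin n →₀ ℕ) l = 2 * m + 1 := fun I hI => by
    have h1 := (hSm I hI).1
    rw [← hdec I hI] at h1
    simp only [Finsupp.add_apply, Finset.sum_add_distrib] at h1
    have h2 : ∑ l, (Finsupp.single i 1 : Fin n →₀ ℕ) l = 1 := by simp [Finsupp.single_apply]
    omega
  have hinj : Set.InjOn φ S := fun I hI I' hI' h => by
    have h1 := add_right_cancel h
    rw [← hdec I hI, ← hdec I' hI', h1]
  have himg : S.image φ ⊆ exponents n (2 * (2 * m + 1)) := by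
    intro J hJ
    obtain ⟨I, hI, rfl⟩ := Finset.mem_image.mp hJ
    rw [mem_exponents]
    simp only [hφ, Finsupp.add_apply, Finset.sum_add_distrib]
    have h3 : ∀ k, ∑ l, (Finsupp.single j k : Fin n →₀ ℕ) l = k := fun k => by
      simp [Finsupp.single_apply]
    rw [hdeg I hI, h3]
    omega
  refine le_trans ?_ (Finset.sum_le_sum_of_subset_of_nonneg himg fun _ _ _ => sq_nonneg _)
  rw [Finset.sum_image hinj, hS, Finset.sum_insert hnot, add_comm]
  refine add_le_add ?_ (Finset.sum_le_sum fun I hI => ?_)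
  · have h1 : Finsupp.single i (2 * (m + 1)) - Finsupp.single i 1 =
        Finsupp.single i (2 * m + 1) := by
      rw [← Finsupp.single_tsub]; congr 1
    have h2 := hdeg _ (Finset.mem_insert_self _ M)
    rw [h1] at h2
    simp only [hφ]
    rw [h1, coeff_crossPoly hij h2, if_pos rfl, ← Finsupp.single_add, Finsupp.single_eq_same,
      show 2 * m + 1 + 1 = 2 * (m + 1) by ring]
    push_cast
    rw [show (2 * m + 1 + 1 : ℝ) = 2 * m + 2 by ring, ← mul_sub, mul_pow]
    refine le_mul_of_one_le_left (sq_nonneg _) (one_le_pow₀ ?_)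
    linarith [(Nat.cast_nonneg m : (0 : ℝ) ≤ m)]
  · have hIS : I ∈ S := Finset.mem_insert_of_mem hI
    have h2 := hdeg _ hIS
    simp only [hφ]
    rw [coeff_crossPoly hij h2, if_neg, sub_zero, hdec I hIS, mul_pow]
    · refine le_mul_of_one_le_left (sq_nonneg _) (one_le_pow₀ ?_)
      linarith [(Nat.cast_nonneg ((I - Finsupp.single i 1 : Fin n →₀ ℕ) i) :
        (0 : ℝ) ≤ ((I - Finsupp.single i 1 : Fin n →₀ ℕ) i : ℝ))]
    · intro h
      refine (hMm I hI).2.1 i ?_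
      rw [← hdec I hIS, h, ← Finsupp.single_add]
      rfl

lemma quarter_le_crossForm_one {n m : ℕ} (hn : 2 ≤ n) {f : MvPolynomial (Fin n) ℝ}
    (hA : ∑ I ∈ exponents n (2 * (m + 1)), f.coeff I ^ 2 = 1)
    (hS : (∑ i, f.coeff (Finsupp.single i (2 * (m + 1)))) ^ 2 ≤ n / 16) :
    1 / 4 ≤ ∑ i, ∑ j, ∑ J ∈ exponents n (2 * (2 * m + 1)),
      (n : ℝ)⁻¹ * (crossPoly m f i j).coeff J ^ 2 := by
  classical
  have hn2 : (2 : ℝ) ≤ n := by exact_mod_cast hn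
  have hn' : (0 : ℝ) < n := by linarith
  set d := 2 * (m + 1) with hd
  set A : Fin n → ℝ := fun i => ∑ I ∈ (mixedExponents n d).filter (fun I => I i ≠ 0), f.coeff I ^ 2
    with hAdef
  set a : Fin n → ℝ := fun i => f.coeff (Finsupp.single i d) with ha
  set B : Fin n → Fin n → ℝ := fun i j => ∑ J ∈ exponents n (2 * (2 * m + 1)),
    (crossPoly m f i j).coeff J ^ 2 with hB
  have hA0 : ∀ i, 0 ≤ A i := fun i => Finset.sum_nonneg fun _ _ => sq_nonneg _
  have hterm : ∀ i j, (if i = j then 0 else A i) + (a i - a j) ^ 2 ≤ B i j := fun i j => by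
    split_ifs with h
    · subst h
      simpa using Finset.sum_nonneg fun J (_ : J ∈ exponents n (2 * (2 * m + 1))) =>
        sq_nonneg ((crossPoly m f i i).coeff J)
    · exact sum_sq_coeff_crossPoly_ge f h
  have hsum : ∑ i, ∑ j, (if i = j then 0 else A i) = (n - 1) * ∑ i, A i := by
    rw [Finset.mul_sum]
    refine Finset.sum_congr rfl fun i _ => ?_
    have : ∀ j, (if i = j then 0 else A i) = A i - if i = j then A i else 0 := fun j => by
      split_ifs <;> simp
    simp_rw [this, Finset.sum_sub_distrib]
    simp
    ring
  have hmix : ∑ I ∈ mixedExponents n d, f.coeff I ^ 2 ≤ ∑ i, A i := by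
    simp only [hAdef, Finset.sum_filter]
    rw [Finset.sum_comm]
    refine Finset.sum_le_sum fun I hI => ?_
    have h1 : ∑ l, I l = d := mem_exponents.mp (Finset.mem_filter.mp hI).1
    obtain ⟨i, -, hi⟩ : ∃ i ∈ Finset.univ, I i ≠ 0 :=
      Finset.exists_ne_zero_of_sum_ne_zero (by omega)
    calc f.coeff I ^ 2 = if I i ≠ 0 then f.coeff I ^ 2 else 0 := by rw [if_pos hi]
      _ ≤ _ := Finset.single_le_sum (f := fun i => if I i ≠ 0 then f.coeff I ^ 2 else 0)
        (fun i _ => by split_ifs <;> positivity) (Finset.mem_univ i)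
  have htot : (n - 1) * ∑ i, A i + ∑ i, ∑ j, (a i - a j) ^ 2 ≤ ∑ i, ∑ j, B i j := by
    rw [← hsum, ← Finset.sum_add_distrib]
    simp_rw [← Finset.sum_add_distrib]
    exact Finset.sum_le_sum fun i _ => Finset.sum_le_sum fun j _ => hterm i j
  rw [sum_sq_sub_eq] at htot
  rw [sum_exponents_eq (by omega)] at hA
  have hX0 : 0 ≤ ∑ I ∈ mixedExponents n d, f.coeff I ^ 2 :=
    Finset.sum_nonneg fun _ _ => sq_nonneg _
  have hD0 : 0 ≤ ∑ i, a i ^ 2 := Finset.sum_nonneg fun _ _ => sq_nonneg _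
  simp_rw [← Finset.mul_sum]
  rw [inv_mul_eq_div, le_div_iff₀ hn']
  nlinarith

lemma lintegral_sum_prod_width_rpow_le {P : Measure BoxParam} [IsProbabilityMeasure P] {ι : Type*}
    {n L : ℕ} (s : Finset ι) {q : ι → ℝ} {k : ι → Fin n → ℕ} (hq : ∀ t, 0 ≤ q t) {c : ℝ}
    (hc : 0 < c) (hQ : c ≤ ∑ t ∈ s, q t) {η : ℝ} (hη : 0 < η)
    (hk : ∀ t ∈ s, ∀ l, η * k t l ≤ 7 / 4)
    (hL : ∀ t ∈ s, (Finset.univ.filter fun l => k t l ≠ 0).card ≤ L) :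
    ∫⁻ ω, ENNReal.ofReal (∑ t ∈ s, q t * ∏ l, (ω l).width ^ k t l) ^ (-η)
        ∂(Measure.pi fun _ : Fin n => P) ≤
      ENNReal.ofReal c ^ (-η) * (∫⁻ ω, ENNReal.ofReal ω.width ^ (-(7/4) : ℝ) ∂P) ^ L := by
  have hm : ∀ t, Measurable fun ω : Fin n → BoxParam => ∏ l, (ω l).width ^ k t l := fun t =>
    Finset.measurable_fun_prod _ fun i _ => (BoxParam.measurable_width.comp
      (measurable_pi_apply i)).pow_const _
  have h := lintegral_sum_rpow_neg_le (μ := Measure.pi fun _ : Fin n => P) s (q := q)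
    (y := fun t ω => ∏ l, (ω l).width ^ k t l) (fun t _ => hq t) (hc.trans_le hQ)
    (fun t _ ω => Finset.prod_nonneg fun i _ => pow_nonneg (BoxParam.width_nonneg _) _)
    (fun t _ => hm t) hη fun t ht => lintegral_prod_width_rpow_le (k t) (hk t ht) (hL t ht)
  refine h.trans (mul_le_mul_left ?_ _)
  rw [ENNReal.rpow_neg, ENNReal.rpow_neg, ENNReal.inv_le_inv]
  exact ENNReal.rpow_le_rpow (ENNReal.ofReal_le_ofReal hQ) hη.le

lemma lintegral_topForm_le {P : Measure BoxParam} [IsProbabilityMeasure P] {n d : ℕ} (hn : 1 ≤ n)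
    (hd : 1 ≤ d) {f : MvPolynomial (Fin n) ℝ} (hA : ∑ I ∈ exponents n d, f.coeff I ^ 2 = 1)
    (hS : (∑ i, f.coeff (Finsupp.single i d)) ^ 2 ≤ n / 16) {η : ℝ} (hη : 0 < η)
    (hηd : η * (2 * d) ≤ 7 / 4) :
    ∫⁻ ω, ENNReal.ofReal (topForm d f fun i => (ω i).width) ^ (-η)
        ∂(Measure.pi fun _ : Fin n => P) ≤
      ENNReal.ofReal (1 / 4) ^ (-η) *
        (∫⁻ ω, ENNReal.ofReal ω.width ^ (-(7/4) : ℝ) ∂P) ^ (d + 2) := by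
  classical
  set a : Fin n → ℝ := fun i => f.coeff (Finsupp.single i d) with ha
  set q : (Fin n →₀ ℕ) ⊕ (Fin n × Fin n) → ℝ :=
    Sum.elim (fun I => f.coeff I ^ 2) fun p => (4 * n : ℝ)⁻¹ * (a p.1 - a p.2) ^ 2 with hq
  set k : (Fin n →₀ ℕ) ⊕ (Fin n × Fin n) → Fin n → ℕ :=
    Sum.elim (fun I l => 2 * I l) fun p l => if l = p.1 ∨ l = p.2 then 2 * d else 0 with hk
  set s : Finset ((Fin n →₀ ℕ) ⊕ (Fin n × Fin n)) := (mixedExponents n d).disjSum Finset.univ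
    with hs
  have hQ : 1 / 4 ≤ ∑ t ∈ s, q t := by
    rw [hs, Finset.sum_disjSum, Fintype.sum_prod_type]
    exact quarter_le_topForm_one hn hd hA hS
  have htop : ∀ ω : Fin n → BoxParam, topForm d f (fun i => (ω i).width) =
      ∑ t ∈ s, q t * ∏ l, (ω l).width ^ k t l := fun ω => by
    rw [hs, Finset.sum_disjSum, Fintype.sum_prod_type, topForm]
    simp_rw [Finset.mul_sum]
    congr 1
    · refine Finset.sum_congr rfl fun I _ => ?_
      simp only [hq, hk, Sum.elim_inl]
      rw [mul_pow, ← Finset.prod_pow]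
      simp_rw [← pow_mul, mul_comm]
    · refine Finset.sum_congr rfl fun i _ => Finset.sum_congr rfl fun j _ => ?_
      simp only [hq, hk, Sum.elim_inr]
      rcases eq_or_ne i j with rfl | hij
      · simp
      · have h1 : ∏ l, (ω l).width ^ (if l = i ∨ l = j then 2 * d else 0) =
            ((ω i).width * (ω j).width) ^ (2 * d) := by
          simp_rw [pow_ite, pow_zero]
          rw [Finset.prod_ite, Finset.prod_const_one, mul_one, mul_pow,
            ← Finset.prod_pair (f := fun l => (ω l).width ^ (2 * d)) hij]
          congr 1
          ext l
          simp
        rw [h1, mul_pow, ← pow_mul, mul_comm d 2, mul_assoc]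
  have hkle : ∀ t ∈ s, ∀ l, k t l ≤ 2 * d := fun t ht l => by
    rw [hs, Finset.mem_disjSum] at ht
    rcases ht with ⟨I, hI, rfl⟩ | ⟨p, -, rfl⟩
    · have h1 : ∑ l, I l = d := mem_exponents.mp (Finset.mem_filter.mp hI).1
      have h2 := Finset.single_le_sum (f := I) (fun _ _ => Nat.zero_le _) (Finset.mem_univ l)
      simp only [hk, Sum.elim_inl]
      omega
    · simp only [hk, Sum.elim_inr]
      split_ifs <;> omega
  have hkcard : ∀ t ∈ s, (Finset.univ.filter fun l => k t l ≠ 0).card ≤ d + 2 := fun t ht => by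
    rw [hs, Finset.mem_disjSum] at ht
    rcases ht with ⟨I, hI, rfl⟩ | ⟨p, -, rfl⟩
    · have h1 : ∑ l, I l = d := mem_exponents.mp (Finset.mem_filter.mp hI).1
      have h2 : (Finset.univ.filter fun l => k (Sum.inl I) l ≠ 0).card ≤ ∑ l, I l := by
        rw [Finset.card_eq_sum_ones, Finset.sum_filter]
        refine Finset.sum_le_sum fun l _ => ?_
        simp only [hk, Sum.elim_inl]
        split_ifs <;> omega
      omega
    · have h2 : (Finset.univ.filter fun l => k (Sum.inr p) l ≠ 0) ⊆ {p.1, p.2} := fun l hl => by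
        simp only [hk, Sum.elim_inr, Finset.mem_filter, Finset.mem_univ, true_and, ne_eq,
          ite_eq_right_iff, not_forall] at hl
        simpa using hl.1
      have := (Finset.card_le_card h2).trans Finset.card_le_two
      omega
  simp_rw [htop]
  refine lintegral_sum_prod_width_rpow_le s (fun t => ?_) (by norm_num) hQ hη
      (fun t ht i => ?_) hkcard
  · rcases t with I | p
    · exact sq_nonneg _
    · simp only [hq, Sum.elim_inr]; positivity
  · refine le_trans (mul_le_mul_of_nonneg_left ?_ hη.le) hηd
    exact_mod_cast hkle t ht i

lemma sq_integral_cube_le {n : ℕ} {g : (Fin n → ℝ) → ℝ} (hg : Continuous g) :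
    (∫ z, g z ∂(cube n)) ^ 2 ≤ ∫ z, g z ^ 2 ∂(cube n) := by
  set c := ∫ z, g z ∂(cube n) with hc
  have hgi := integrable_cube_of_continuous hg
  have hg2 := integrable_cube_of_continuous (hg.pow 2)
  have h : 0 ≤ ∫ z, (g z - c) ^ 2 ∂(cube n) := integral_nonneg fun _ => sq_nonneg _
  have h1 : ∫ z, (g z - c) ^ 2 ∂(cube n) = ∫ z, g z ^ 2 ∂(cube n) - c ^ 2 := by
    have h2 : ∀ z, (g z - c) ^ 2 = g z ^ 2 - (2 * c) * g z + c ^ 2 := fun z => by ring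
    simp_rw [h2]
    have h3 : Integrable (fun z => g z ^ 2) (cube n) := hg2
    have h4 : Integrable (fun z => g z ^ 2 - 2 * c * g z) (cube n) := h3.sub (hgi.const_mul _)
    rw [integral_add h4 (integrable_const _),
      integral_sub h3 (hgi.const_mul _), integral_const_mul, integral_const, ← hc]
    simp
    ring
  linarith

/-- The mean of `crossForm` over a box is controlled below by its coefficients. -/
def crossWeight {n : ℕ} (m : ℕ) (f : MvPolynomial (Fin n) ℝ) (w : Fin n → ℝ) : ℝ :=
  ∑ i, ∑ j, ∑ J ∈ exponents n (2 * (2 * m + 1)),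
    (n : ℝ)⁻¹ * (crossPoly m f i j).coeff J ^ 2 * ((∏ l, w l ^ J l) * (w i * w j)) ^ 2

lemma exists_lintegral_crossForm_box_le (m : ℕ) : ∃ C : ℝ≥0∞, C ≠ ∞ ∧
    ∀ (n : ℕ) (f : MvPolynomial (Fin n) ℝ), f.IsHomogeneous (2 * (m + 1)) →
    ∀ c b w : Fin n → ℝ, (∀ i, 0 ≤ w i) → (∀ i, w i ≤ |b i|) →
    ∫⁻ z, ENNReal.ofReal (MvPolynomial.eval (fun i => c i + b i * z i) (crossForm m f w)) ^
      (-(1 / (8 * (2 * (m + 1) : ℕ)) : ℝ)) ∂(cube n) ≤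
      C * ENNReal.ofReal (crossWeight m f w) ^ (-(1 / (8 * (2 * (m + 1) : ℕ)) : ℝ)) := by
  set d := 2 * (m + 1) with hd
  have hd0 : (0 : ℝ) < d := by rw [hd]; positivity
  obtain ⟨C, hC, hneg⟩ := exists_lintegral_invRoot_rpow_le (D := 4 * d) (by omega)
    (θ := 1 / 2) (by norm_num) (by norm_num)
  obtain ⟨κ, hκ, hlow⟩ := exists_integral_sq_ge (2 * (2 * m + 1))
  set η : ℝ := 1 / (8 * d) with hη
  have hη0 : 0 < η := by positivity
  refine ⟨C * ENNReal.ofReal κ ^ (-η), ENNReal.mul_ne_top hC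
    (by rw [ENNReal.ofReal_rpow_of_pos hκ]; exact ENNReal.ofReal_ne_top),
    fun n f hf c b w hw0 hwb => ?_⟩
  set g : (Fin n → ℝ) → ℝ := fun z =>
    MvPolynomial.eval (fun i => c i + b i * z i) (crossForm m f w) with hg
  have hgc : Continuous g := continuous_eval_affine _ _ _
  have hg0 : ∀ z, 0 ≤ g z := fun z => eval_crossForm_nonneg _ _ _ _
  have hmean : κ * crossWeight m f w ≤ ∫ z, g z ∂(cube n) := by
    have hi : ∀ i j, Integrable (fun z : Fin n → ℝ => (w i * w j) ^ 2 *
        MvPolynomial.eval (fun i => c i + b i * z i) (crossPoly m f i j) ^ 2) (cube n) :=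
      fun i j => integrable_cube_of_continuous
        (continuous_const.mul ((continuous_eval_affine _ _ _).pow 2))
    simp only [hg, eval_crossForm]
    rw [integral_const_mul,
        integral_finsetSum _ fun i _ => integrable_finsetSum _ fun j _ => hi i j]
    simp_rw [integral_finsetSum _ fun j _ => hi _ j, integral_const_mul]
    rw [crossWeight, Finset.mul_sum, Finset.mul_sum]
    refine Finset.sum_le_sum fun i _ => ?_
    rw [Finset.mul_sum, Finset.mul_sum]
    refine Finset.sum_le_sum fun j _ => ?_
    have h1 := hlow n (crossPoly m f i j)
      (fun J hJ => sum_le_of_mem_support (totalDegree_crossPoly_le hf i j) hJ)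
      (exponents n (2 * (2 * m + 1))) (fun I hI => mem_exponents.mp hI) c b
    refine le_trans ?_ (mul_le_mul_of_nonneg_left (mul_le_mul_of_nonneg_left h1 (sq_nonneg _))
      (by positivity))
    simp_rw [Finset.mul_sum]
    refine Finset.sum_le_sum fun J _ => ?_
    have h2 : (∏ l, w l ^ J l) ^ 2 ≤ (∏ l, b l ^ J l) ^ 2 := by
      rw [← sq_abs (∏ i, b i ^ J i), Finset.abs_prod]
      refine pow_le_pow_left₀ (Finset.prod_nonneg fun i _ => pow_nonneg (hw0 i) _) ?_ _
      refine Finset.prod_le_prod (fun i _ => pow_nonneg (hw0 i) _) fun i _ => ?_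
      rw [abs_pow]
      exact pow_le_pow_left₀ (hw0 i) (hwb i) _
    calc _ = (n : ℝ)⁻¹ * (w i * w j) ^ 2 * κ * (crossPoly m f i j).coeff J ^ 2 *
          (∏ l, w l ^ J l) ^ 2 := by ring
      _ ≤ (n : ℝ)⁻¹ * (w i * w j) ^ 2 * κ * (crossPoly m f i j).coeff J ^ 2 *
          (∏ l, b l ^ J l) ^ 2 := by gcongr
      _ = _ := by ring
  have hsq : ∫⁻ z, ENNReal.ofReal (g z ^ 2) ∂(cube n) =
      ENNReal.ofReal (∫ z, g z ^ 2 ∂(cube n)) := lintegral_sq_eval_affine_eq _ _ _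
  have h3 := hneg n g hgc.measurable
    (polyOnLines_eval_affine (totalDegree_crossForm_le hf w) c b)
    (by rw [hsq]; exact ENNReal.ofReal_ne_top)
  have h4 : ∀ z, invRoot (4 * d) g z ^ (1 / 2 : ℝ) = ENNReal.ofReal (g z) ^ (-η) := fun z => by
    rw [invRoot, abs_of_nonneg (hg0 z), ← ENNReal.rpow_mul]
    congr 1
    rw [hη]; push_cast; field_simp; norm_num
  simp_rw [h4] at h3
  refine h3.trans ?_
  rw [mul_assoc]
  gcongr
  rw [hsq, ← ENNReal.mul_rpow_of_ne_top ENNReal.ofReal_ne_top ENNReal.ofReal_ne_top,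
    ← ENNReal.ofReal_mul hκ.le]
  have hW0 : 0 ≤ ∫ z, g z ∂(cube n) := integral_nonneg hg0
  have h5 : ENNReal.ofReal (∫ z, g z ∂(cube n)) ^ 2 ≤ ENNReal.ofReal (∫ z, g z ^ 2 ∂(cube n)) := by
    rw [← ENNReal.ofReal_pow hW0]
    exact ENNReal.ofReal_le_ofReal (sq_integral_cube_le hgc)
  have h6 : (-(1 / 2 / (2 * (4 * d : ℕ))) : ℝ) = -(η / 2) := by
    rw [hη]; push_cast; field_simp; norm_num
  rw [h6, ENNReal.rpow_neg, ENNReal.rpow_neg, ENNReal.inv_le_inv]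
  calc ENNReal.ofReal (κ * crossWeight m f w) ^ η ≤ ENNReal.ofReal (∫ z, g z ∂(cube n)) ^ η := by
        gcongr
    _ = (ENNReal.ofReal (∫ z, g z ∂(cube n)) ^ 2) ^ (η / 2) := by
        rw [← ENNReal.rpow_natCast, ← ENNReal.rpow_mul]
        congr 1
        push_cast; ring
    _ ≤ _ := by gcongr

lemma lintegral_crossWeight_le {P : Measure BoxParam} [IsProbabilityMeasure P] {n m : ℕ}
    (hn : 2 ≤ n) {f : MvPolynomial (Fin n) ℝ}
    (hA : ∑ I ∈ exponents n (2 * (m + 1)), f.coeff I ^ 2 = 1)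
    (hS : (∑ i, f.coeff (Finsupp.single i (2 * (m + 1)))) ^ 2 ≤ n / 16) {η : ℝ} (hη : 0 < η)
    (hηd : η * (4 * (2 * (m + 1) : ℕ)) ≤ 7 / 4) :
    ∫⁻ ω, ENNReal.ofReal (crossWeight m f fun i => (ω i).width) ^ (-η)
        ∂(Measure.pi fun _ : Fin n => P) ≤
      ENNReal.ofReal (1 / 4) ^ (-η) *
        (∫⁻ ω, ENNReal.ofReal ω.width ^ (-(7/4) : ℝ) ∂P) ^ (2 * (2 * (m + 1))) := by
  classical
  set s : Finset (Fin n × Fin n × (Fin n →₀ ℕ)) :=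
    Finset.univ ×ˢ Finset.univ ×ˢ exponents n (2 * (2 * m + 1)) with hs
  set q : Fin n × Fin n × (Fin n →₀ ℕ) → ℝ := fun t =>
    (n : ℝ)⁻¹ * (crossPoly m f t.1 t.2.1).coeff t.2.2 ^ 2 with hq
  set k : Fin n × Fin n × (Fin n →₀ ℕ) → Fin n → ℕ := fun t l =>
    2 * t.2.2 l + (if l = t.1 then 2 else 0) + (if l = t.2.1 then 2 else 0) with hk
  have hQ : 1 / 4 ≤ ∑ t ∈ s, q t := by
    rw [hs, Finset.sum_product]
    simp_rw [Finset.sum_product]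
    exact quarter_le_crossForm_one hn hA hS
  have htop : ∀ ω : Fin n → BoxParam, crossWeight m f (fun i => (ω i).width) =
      ∑ t ∈ s, q t * ∏ l, (ω l).width ^ k t l := fun ω => by
    rw [hs, Finset.sum_product, crossWeight]
    simp_rw [Finset.sum_product]
    refine Finset.sum_congr rfl fun i _ => Finset.sum_congr rfl fun j _ =>
      Finset.sum_congr rfl fun J _ => ?_
    simp only [hq, hk, pow_add, Finset.prod_mul_distrib, pow_ite, pow_zero, Finset.prod_ite_eq',
      Finset.mem_univ, if_true]
    rw [mul_pow, ← Finset.prod_pow, mul_pow]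
    simp_rw [← pow_mul, mul_comm (J _) 2]
    rw [mul_assoc _ ((ω i).width ^ 2)]
  have hsum : ∀ t ∈ s, ∑ l, t.2.2 l = 2 * (2 * m + 1) := fun t ht => by
    simp only [hs, Finset.mem_product, Finset.mem_univ, true_and] at ht
    exact mem_exponents.mp ht
  have hkle : ∀ t ∈ s, ∀ l, k t l ≤ 4 * (2 * (m + 1)) := fun t ht l => by
    have h2 := Finset.single_le_sum (f := t.2.2) (fun _ _ => Nat.zero_le _) (Finset.mem_univ l)
    have h3 := hsum t ht
    simp only [hk]
    split_ifs <;> omega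
  have hkcard : ∀ t ∈ s, (Finset.univ.filter fun l => k t l ≠ 0).card ≤ 2 * (2 * (m + 1)) :=
    fun t ht => by
    have h2 : (Finset.univ.filter fun l => k t l ≠ 0).card ≤
        ∑ l, (t.2.2 l + (if l = t.1 then 1 else 0) + (if l = t.2.1 then 1 else 0)) := by
      rw [Finset.card_eq_sum_ones, Finset.sum_filter]
      refine Finset.sum_le_sum fun l _ => ?_
      simp only [hk]
      split_ifs <;> omega
    simp only [Finset.sum_add_distrib, hsum t ht, Finset.sum_ite_eq', Finset.mem_univ,
      if_true] at h2
    omega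
  simp_rw [htop]
  refine lintegral_sum_prod_width_rpow_le s (fun t => ?_) (by norm_num) hQ hη
      (fun t ht i => ?_) hkcard
  · simp only [hq]; positivity
  · refine le_trans (mul_le_mul_of_nonneg_left ?_ hη.le) hηd
    exact_mod_cast hkle t ht i

lemma ofReal_rpow_neg_half_le {W K Q V a : ℝ} (hW : 0 < W) (hK : 0 < K)
    (h : W ^ 2 * Q ≤ K * V) (ha : 0 < a) :
    ENNReal.ofReal V ^ (-(a / 2)) ≤ ENNReal.ofReal K ^ (a / 2) *
      (ENNReal.ofReal W ^ (-a) * ENNReal.ofReal Q ^ (-(a / 2))) := by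
  have h1 : K⁻¹ * (W ^ 2 * Q) ≤ V := by
    rw [inv_mul_le_iff₀ hK]; exact h
  have h2 : ENNReal.ofReal V ^ (-(a / 2)) ≤ ENNReal.ofReal (K⁻¹ * (W ^ 2 * Q)) ^ (-(a / 2)) := by
    rw [ENNReal.rpow_neg, ENNReal.rpow_neg, ENNReal.inv_le_inv]
    exact ENNReal.rpow_le_rpow (ENNReal.ofReal_le_ofReal h1) (by positivity)
  refine h2.trans_eq ?_
  rw [ENNReal.ofReal_mul (inv_nonneg.mpr hK.le), ENNReal.ofReal_mul (sq_nonneg W),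
    ENNReal.mul_rpow_of_ne_top ENNReal.ofReal_ne_top
      (ENNReal.mul_ne_top ENNReal.ofReal_ne_top ENNReal.ofReal_ne_top),
    ENNReal.mul_rpow_of_ne_top ENNReal.ofReal_ne_top ENNReal.ofReal_ne_top,
    ENNReal.ofReal_inv_of_pos hK, ENNReal.inv_rpow, ENNReal.rpow_neg, inv_inv,
    ENNReal.ofReal_pow hW.le, ← ENNReal.rpow_natCast, ← ENNReal.rpow_mul]
  congr 3
  push_cast
  ring

/-- A normalised bound for the size of a random line. -/
def growth {n : ℕ} (m : ℕ) (e : ℝ) (r : Fin n → ℝ) : ℝ :=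
  1 + e * 2 ^ (m + 1) + (n : ℝ)⁻¹ * ∑ i, r i ^ (2 * (2 * (m + 1)))

lemma abs_add_smul_le_reach (ω : BoxParam) {z z' s : ℝ} (hz : z ∈ Icc (0 : ℝ) 1)
    (hz' : z' ∈ Icc (0 : ℝ) 1) (hs : s ∈ Icc (0 : ℝ) 1) :
    |ω.1.1 + ω.1.2 * z + s * (ω.2.1 + ω.2.2 * z')| ≤ ω.reach := by
  have hmul : ∀ {a b : ℝ}, b ∈ Icc (0 : ℝ) 1 → |a * b| ≤ |a| := fun {a b} hb => by
    rw [abs_mul, abs_of_nonneg hb.1]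
    exact mul_le_of_le_one_right (abs_nonneg _) hb.2
  calc _ ≤ |ω.1.1 + ω.1.2 * z| + |s * (ω.2.1 + ω.2.2 * z')| := abs_add_le _ _
    _ ≤ (|ω.1.1| + |ω.1.2 * z|) + |ω.2.1 + ω.2.2 * z'| := by
        refine add_le_add (abs_add_le _ _) ?_
        rw [abs_mul, abs_of_nonneg hs.1]
        exact mul_le_of_le_one_left (abs_nonneg _) hs.2
    _ ≤ (|ω.1.1| + |ω.1.2 * z|) + (|ω.2.1| + |ω.2.2 * z'|) := by
        gcongr
        exact abs_add_le _ _
    _ ≤ _ := by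
        have h1 := hmul (a := ω.1.2) hz
        have h2 := hmul (a := ω.2.2) hz'
        rw [BoxParam.reach]
        linarith

lemma powSum_line_le {n m : ℕ} (ω : Fin n → BoxParam) {z z' : Fin n → ℝ} {s e : ℝ}
    (hz : ∀ i, z i ∈ Icc (0 : ℝ) 1) (hz' : ∀ i, z' i ∈ Icc (0 : ℝ) 1) (hs : s ∈ Icc (0 : ℝ) 1)
    (he : 0 ≤ e) :
    powSum m ((fun i => (ω i).1.1 + (ω i).1.2 * z i) +
        s • fun i => (ω i).2.1 + (ω i).2.2 * z' i) + e * (1 + s ^ 2) ^ (m + 1) ≤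
      ∑ i, (ω i).reach ^ (2 * (m + 1)) + e * 2 ^ (m + 1) := by
  have hs2 : 1 + s ^ 2 ≤ 2 := by nlinarith [hs.1, hs.2]
  refine add_le_add (Finset.sum_le_sum fun i _ => ?_) (by gcongr)
  simp only [Pi.add_apply, Pi.smul_apply, smul_eq_mul]
  rw [← (even_two_mul _).pow_abs]
  exact pow_le_pow_left₀ (abs_nonneg _) (abs_add_smul_le_reach _ (hz i) (hz' i) hs) _

lemma sum_reach_le_mul_growth {n m : ℕ} (hn : 1 ≤ n) (r : Fin n → ℝ) {e : ℝ} (he : 0 ≤ e) :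
    ∑ i, r i ^ (2 * (m + 1)) + e * 2 ^ (m + 1) ≤ n * growth m e r := by
  have hn' : (1 : ℝ) ≤ n := by exact_mod_cast hn
  have h1 : ∀ i, r i ^ (2 * (m + 1)) ≤ 1 + r i ^ (2 * (2 * (m + 1))) := fun i => by
    rw [mul_comm 2 (2 * (m + 1)), pow_mul _ (2 * (m + 1)) 2]
    nlinarith [sq_nonneg (r i ^ (2 * (m + 1)) - 1)]
  have h2 := Finset.sum_le_sum fun i (_ : i ∈ Finset.univ) => h1 i
  rw [Finset.sum_add_distrib, Finset.sum_const, Finset.card_univ, Fintype.card_fin,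
    nsmul_eq_mul] at h2
  have h3 : 0 ≤ e * 2 ^ (m + 1) := by positivity
  have h4 : n * growth m e r = n + n * (e * 2 ^ (m + 1)) + ∑ i, r i ^ (2 * (2 * (m + 1))) := by
    rw [growth]; field_simp
  rw [h4]
  nlinarith

lemma ae_cube_mem (n : ℕ) : ∀ᵐ z ∂(cube n), ∀ i, z i ∈ Icc (0 : ℝ) 1 :=
  ae_all_iff.mpr fun i =>
    (Measure.quasiMeasurePreserving_eval (μ := fun _ : Fin n => unif) i).ae ae_unif_mem

lemma exists_lintegral_linePhase_le (m : ℕ) {α β : ℝ} (hα : 0 < α) (hβ : 0 < β)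
    (hαβ : α + β = 1 / (2 * (m + 1) : ℕ)) : ∃ C : ℝ≥0∞, C ≠ ∞ ∧
    ∀ (n : ℕ), 1 ≤ n → ∀ (f : MvPolynomial (Fin n) ℝ), f.IsHomogeneous (2 * (m + 1)) →
    ∀ (ω : Fin n → BoxParam) (z : Fin n → ℝ) (e T : ℝ), (∀ i, z i ∈ Icc (0 : ℝ) 1) → 0 < e →
    T ≠ 0 →
    ∫⁻ z', ‖∫ s in (0 : ℝ)..1, Complex.exp (Complex.I *
        (linePhase m f T ((ω, z, z'), e) s : ℝ))‖ₑ ∂(cube n) ≤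
      C * ENNReal.ofReal (n / |T|) ^ (1 / (2 * (m + 1) : ℕ) : ℝ) *
      (ENNReal.ofReal (growth m e fun i => (ω i).reach) ^ (3 * (1 / (2 * (m + 1) : ℕ)) : ℝ) *
      ENNReal.ofReal (n / (powSum m (LineParam.base (ω, z, (0 : Fin n → ℝ))) + e)) ^
        (1 / (2 * (m + 1) : ℕ) : ℝ) *
      ENNReal.ofReal (MvPolynomial.eval (LineParam.base (ω, z, (0 : Fin n → ℝ)))
        (crossForm m f fun i => (ω i).width)) ^ (-(α / 2)) *
      ENNReal.ofReal (topForm (2 * (m + 1)) f fun i => (ω i).width) ^ (-(β / 2))) := by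
  obtain ⟨C, hC, hline⟩ := exists_lintegral_enorm_line_le m hα hβ hαβ
  set δ : ℝ := 1 / (2 * (m + 1) : ℕ) with hδ
  have hδ0 : 0 < δ := by positivity
  refine ⟨C * 4 ^ δ, ENNReal.mul_ne_top hC (by finiteness),
    fun n hn f hf ω z e T hz he hT => ?_⟩
  have hn' : (0 : ℝ) < n := by exact_mod_cast hn
  set r : Fin n → ℝ := fun i => (ω i).reach with hr
  set w : Fin n → ℝ := fun i => (ω i).width with hw
  set x : Fin n → ℝ := LineParam.base (ω, z, (0 : Fin n → ℝ)) with hx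
  set b : Fin n → ℝ := fun i => (ω i).2.2 with hb
  set q : ℝ := ∑ i, r i ^ (2 * (m + 1)) + e * 2 ^ (m + 1) with hq
  have hr0 : ∀ i, 0 ≤ r i := fun i => BoxParam.reach_nonneg _
  have hq0 : 0 < q := by
    have := Finset.sum_nonneg fun i (_ : i ∈ Finset.univ) => pow_nonneg (hr0 i) (2 * (m + 1))
    positivity
  set U := growth m e r with hU
  have hsum0 : 0 ≤ (n : ℝ)⁻¹ * ∑ i, r i ^ (2 * (2 * (m + 1))) :=
    mul_nonneg (by positivity) (Finset.sum_nonneg fun i _ => pow_nonneg (hr0 i) _)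
  have hU1 : 1 ≤ U := by
    have : 0 ≤ e * 2 ^ (m + 1) := by positivity
    rw [hU, growth]; linarith
  have hqU : q ≤ n * U := sum_reach_le_mul_growth hn r he.le
  set W := powSum m x + e with hW
  have hW0 : 0 < W := add_pos_of_nonneg_of_pos (powSum_nonneg _ _) he
  have hw0 : ∀ i, 0 ≤ w i := fun i => BoxParam.width_nonneg _
  have hw1 : ∀ i, w i ≤ 1 := fun i => min_le_left _ _
  have hwb : ∀ i, w i ≤ |b i| := fun i => (min_le_right _ _).trans (min_le_right _ _)
  have hxr : ∀ i, |x i| ≤ r i := fun i => by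
    have := abs_add_smul_le_reach (ω i) (hz i) (z' := 0) (s := 0) (by simp) (by simp)
    simpa [hx, hr, LineParam.base] using this
  set Q := MvPolynomial.eval x (crossForm m f w) with hQ
  set B := topForm (2 * (m + 1)) f w with hB
  have h1 := hline n f hf.totalDegree_le x (fun i => (ω i).2.1) b e T q he hT hq0 (by
    filter_upwards [ae_cube_mem n] with z' hz' s hs
    exact powSum_line_le ω hz hz' hs he.le)
  refine h1.trans ?_
  have hMU : 4 * (1 + (n : ℝ)⁻¹ * ∑ i, r i ^ (2 * (2 * (m + 1)))) ≤ 4 * U := by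
    have : 0 ≤ e * 2 ^ (m + 1) := by positivity
    rw [hU, growth]; linarith
  have hcross := ofReal_rpow_neg_half_le hW0 (by positivity)
    ((sum_sq_tangentCoeff_ge (e := e) hn f hw0 hw1 hwb hxr).trans
      (mul_le_mul_of_nonneg_right hMU (Finset.sum_nonneg fun i _ => sq_nonneg _))) hα
  have htop := ofReal_rpow_neg_half_le (K := 1) hW0 one_pos
    ((sum_sq_chordPoly_ge (e := e) hn f hw0 hw1 hwb).trans_eq (one_mul _).symm) hβ
  rw [ENNReal.ofReal_one, ENNReal.one_rpow, one_mul] at htop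
  have hK : ENNReal.ofReal (4 * U) ^ (α / 2) ≤ 4 ^ δ * ENNReal.ofReal U ^ δ := by
    have h4U : 1 ≤ ENNReal.ofReal (4 * U) := by
      rw [← ENNReal.ofReal_one]; exact ENNReal.ofReal_le_ofReal (by linarith)
    refine (ENNReal.rpow_le_rpow_of_exponent_le h4U (by linarith : α / 2 ≤ δ)).trans_eq ?_
    rw [ENNReal.ofReal_mul (by norm_num),
        ENNReal.mul_rpow_of_ne_top (by finiteness) (by finiteness)]
    norm_num
  have hqT : ENNReal.ofReal (q ^ 2 / |T|) ^ δ * ENNReal.ofReal W ^ (-δ) ≤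
      ENNReal.ofReal (n / |T|) ^ δ * ENNReal.ofReal (n / W) ^ δ * ENNReal.ofReal U ^ (2 * δ) := by
    have hT0 : 0 < |T| := abs_pos.mpr hT
    have e1 : ENNReal.ofReal W ^ (-δ) = ENNReal.ofReal W⁻¹ ^ δ := by
      rw [ENNReal.ofReal_inv_of_pos hW0, ENNReal.inv_rpow, ENNReal.rpow_neg]
    have e2 : ENNReal.ofReal U ^ (2 * δ) = ENNReal.ofReal (U ^ 2) ^ δ := by
      rw [ENNReal.ofReal_pow (by linarith), ENNReal.rpow_mul]
      norm_num
    rw [e1, e2, ← ENNReal.mul_rpow_of_ne_top (by finiteness) (by finiteness),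
      ← ENNReal.mul_rpow_of_ne_top (by finiteness) (by finiteness),
      ← ENNReal.mul_rpow_of_ne_top (by finiteness) (by finiteness),
      ← ENNReal.ofReal_mul (by positivity), ← ENNReal.ofReal_mul (by positivity),
      ← ENNReal.ofReal_mul (by positivity)]
    refine ENNReal.rpow_le_rpow (ENNReal.ofReal_le_ofReal ?_) hδ0.le
    calc q ^ 2 / |T| * W⁻¹ ≤ (n * U) ^ 2 / |T| * W⁻¹ := by gcongr
      _ = _ := by ring
  have hWδ : ENNReal.ofReal W ^ (-δ) = ENNReal.ofReal W ^ (-α) * ENNReal.ofReal W ^ (-β) := by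
    rw [← ENNReal.rpow_add _ _ (by simpa using hW0) ENNReal.ofReal_ne_top, ← hαβ]
    congr 1; ring
  have hUδ : ENNReal.ofReal U ^ (3 * δ) = ENNReal.ofReal U ^ δ * ENNReal.ofReal U ^ (2 * δ) := by
    rw [← ENNReal.rpow_add_of_nonneg _ _ hδ0.le (by positivity)]
    congr 1; ring
  calc _ ≤ C * ENNReal.ofReal (q ^ 2 / |T|) ^ δ *
        ((4 ^ δ * ENNReal.ofReal U ^ δ * (ENNReal.ofReal W ^ (-α) *
          ENNReal.ofReal Q ^ (-(α / 2)))) *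
        (ENNReal.ofReal W ^ (-β) * ENNReal.ofReal B ^ (-(β / 2)))) :=
        mul_le_mul_right (mul_le_mul' (hcross.trans (mul_le_mul_left hK _)) htop) _
    _ = C * 4 ^ δ * ENNReal.ofReal U ^ δ * (ENNReal.ofReal (q ^ 2 / |T|) ^ δ *
        ENNReal.ofReal W ^ (-δ)) * (ENNReal.ofReal Q ^ (-(α / 2)) *
          ENNReal.ofReal B ^ (-(β / 2))) := by rw [hWδ]; ring
    _ ≤ C * 4 ^ δ * ENNReal.ofReal U ^ δ * (ENNReal.ofReal (n / |T|) ^ δ *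
        ENNReal.ofReal (n / W) ^ δ * ENNReal.ofReal U ^ (2 * δ)) * (ENNReal.ofReal Q ^ (-(α / 2)) *
          ENNReal.ofReal B ^ (-(β / 2))) := by gcongr
    _ = _ := by rw [hUδ]; ring

lemma lintegral_lineLaw (P : Measure BoxParam) [IsProbabilityMeasure P] {n : ℕ}
    {F : LineParam n × ℝ → ℝ≥0∞} (hF : Measurable F) :
    ∫⁻ u, F u ∂(lineLaw P n) = ∫⁻ e, ∫⁻ ω, ∫⁻ z, ∫⁻ z', F ((ω, z, z'), e) ∂(cube n) ∂(cube n)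
      ∂(Measure.pi fun _ => P) ∂expLaw := by
  rw [lineLaw]
  refine (lintegral_prod_symm _ hF.aemeasurable).trans ?_
  refine lintegral_congr fun e => ?_
  have h1 : Measurable fun q : LineParam n => F (q, e) := hF.comp (by fun_prop)
  refine (lintegral_prod _ h1.aemeasurable).trans ?_
  refine lintegral_congr fun ω => ?_
  have h2 : Measurable fun q : (Fin n → ℝ) × (Fin n → ℝ) => F ((ω, q), e) := hF.comp (by fun_prop)
  exact lintegral_prod _ h2.aemeasurable

lemma lintegral_expLaw_pow_ne_top (k : ℕ) : ∫⁻ e, ENNReal.ofReal (e ^ k) ∂expLaw ≠ ∞ := by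
  rw [lintegral_expLaw (by fun_prop), ← restrict_Ioi_eq_restrict_Ici]
  have h := lintegral_Ioi_exp_mul_rpow (a := k + 1) (by positivity)
  have h1 : ∫⁻ e in Ioi (0 : ℝ), ENNReal.ofReal (e ^ k) * ENNReal.ofReal (Real.exp (-e)) =
      ENNReal.ofReal (Real.Gamma (k + 1)) := by
    rw [← h]
    refine setLIntegral_congr_fun measurableSet_Ioi fun e he => ?_
    rw [add_sub_cancel_right, Real.rpow_natCast, mul_comm, ENNReal.ofReal_mul (Real.exp_pos _).le]
  rw [h1]
  exact ENNReal.ofReal_ne_top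

lemma add_pow_le_two_pow_mul {a b : ℝ} (ha : 0 ≤ a) (hb : 0 ≤ b) (k : ℕ) :
    (a + b) ^ k ≤ 2 ^ k * (a ^ k + b ^ k) := by
  refine (add_pow_le ha hb k).trans ?_
  gcongr
  · norm_num
  · omega

lemma measurable_reach_coord {n : ℕ} (i : Fin n) :
    Measurable fun u : LineParam n × ℝ => (u.1.1 i).reach :=
  BoxParam.measurable_reach.comp ((measurable_pi_apply i).comp (by fun_prop))

lemma measurable_width_coord {n : ℕ} (i : Fin n) :
    Measurable fun u : LineParam n × ℝ => (u.1.1 i).width :=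
  BoxParam.measurable_width.comp ((measurable_pi_apply i).comp (by fun_prop))

lemma measurable_growth {n : ℕ} (m : ℕ) :
    Measurable fun u : LineParam n × ℝ => growth m u.2 fun i => (u.1.1 i).reach := by
  have h := fun i : Fin n => measurable_reach_coord i
  unfold growth
  fun_prop

lemma growth_pow_le {n m : ℕ} (hn : 1 ≤ n) {e : ℝ} (he : 0 ≤ e) {r : Fin n → ℝ} (hr : ∀ i, 0 ≤ r i)
    (k : ℕ) : growth m e r ^ k ≤
      4 ^ k * (1 + (2 ^ (m + 1)) ^ k * e ^ k) +
        2 ^ k * ((n : ℝ)⁻¹ * ∑ i, r i ^ (2 * (2 * (m + 1)) * k)) := by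
  have hn' : (0 : ℝ) < n := by exact_mod_cast hn
  have h0 : 0 ≤ e * 2 ^ (m + 1) := by positivity
  have hJ : ((n : ℝ)⁻¹ * ∑ i, r i ^ (2 * (2 * (m + 1)))) ^ k ≤
      (n : ℝ)⁻¹ * ∑ i, r i ^ (2 * (2 * (m + 1)) * k) := by
    have := Real.pow_arith_mean_le_arith_mean_pow Finset.univ (fun _ : Fin n => (n : ℝ)⁻¹)
      (fun i => r i ^ (2 * (2 * (m + 1)))) (fun _ _ => by positivity)
      (by simp [hn'.ne']) (fun i _ => pow_nonneg (hr i) _) k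
    simpa only [← Finset.mul_sum, ← pow_mul] using this
  have hS : 0 ≤ (n : ℝ)⁻¹ * ∑ i, r i ^ (2 * (2 * (m + 1))) :=
    mul_nonneg (by positivity) (Finset.sum_nonneg fun i _ => pow_nonneg (hr i) _)
  have h1 := add_pow_le_two_pow_mul (add_nonneg zero_le_one h0) hS k
  have h2 := add_pow_le_two_pow_mul zero_le_one h0 k
  rw [one_pow, mul_pow] at h2
  rw [growth]
  refine h1.trans ?_
  have h4 : (4 : ℝ) ^ k = 2 ^ k * 2 ^ k := by rw [← mul_pow]; norm_num
  calc _ ≤ 2 ^ k * (2 ^ k * (1 + e ^ k * (2 ^ (m + 1)) ^ k) +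
        (n : ℝ)⁻¹ * ∑ i, r i ^ (2 * (2 * (m + 1)) * k)) := by gcongr
    _ = _ := by rw [h4]; ring

lemma exists_lintegral_growth_rpow_le (m : ℕ) {P : Measure BoxParam} [IsProbabilityMeasure P]
    (hP : ∀ k : ℕ, ∫⁻ ω, ENNReal.ofReal (ω.reach ^ k) ∂P ≠ ∞) {a : ℝ} {k : ℕ} (hak : a ≤ k) :
    ∃ C : ℝ≥0∞, C ≠ ∞ ∧ ∀ n : ℕ, 1 ≤ n →
      ∫⁻ u, ENNReal.ofReal (growth m u.2 fun i => (u.1.1 i).reach) ^ a ∂(lineLaw P n) ≤ C := by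
  set E := ∫⁻ e, ENNReal.ofReal (e ^ k) ∂expLaw with hE
  set K := 2 * (2 * (m + 1)) * k with hK
  set R := ∫⁻ ω, ENNReal.ofReal (ω.reach ^ K) ∂P with hR
  refine ⟨ENNReal.ofReal (4 ^ k) * (1 + ENNReal.ofReal ((2 ^ (m + 1)) ^ k) * E) +
    ENNReal.ofReal (2 ^ k) * R, ?_, fun n hn => ?_⟩
  · have := lintegral_expLaw_pow_ne_top k
    have := hP K
    finiteness
  have hn' : (0 : ℝ) < n := by exact_mod_cast hn
  have hae : ∀ᵐ u ∂(lineLaw P n), 0 < u.2 := Measure.quasiMeasurePreserving_snd.ae ae_expLaw_pos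
  have hr0 : ∀ (u : LineParam n × ℝ) (i : Fin n), 0 ≤ (u.1.1 i).reach :=
    fun u i => BoxParam.reach_nonneg _
  have hmr := fun i : Fin n => measurable_reach_coord i
  have hpt : ∀ᵐ u ∂(lineLaw P n),
      ENNReal.ofReal (growth m u.2 fun i => (u.1.1 i).reach) ^ a ≤
      ENNReal.ofReal (4 ^ k) * (1 + ENNReal.ofReal ((2 ^ (m + 1)) ^ k) * ENNReal.ofReal (u.2 ^ k)) +
      ENNReal.ofReal (2 ^ k) * (ENNReal.ofReal (n : ℝ)⁻¹ *
        ∑ i, ENNReal.ofReal ((u.1.1 i).reach ^ K)) := by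
    filter_upwards [hae] with u hu
    have hS : 0 ≤ (n : ℝ)⁻¹ * ∑ i, (u.1.1 i).reach ^ (2 * (2 * (m + 1))) :=
      mul_nonneg (by positivity) (Finset.sum_nonneg fun i _ => pow_nonneg (hr0 u i) _)
    have hS' : 0 ≤ ∑ i, (u.1.1 i).reach ^ K := Finset.sum_nonneg fun i _ => pow_nonneg (hr0 u i) _
    have hU1 : 1 ≤ growth m u.2 fun i => (u.1.1 i).reach := by
      have : 0 ≤ u.2 * 2 ^ (m + 1) := by positivity
      rw [growth]; linarith
    have hU1' : 1 ≤ ENNReal.ofReal (growth m u.2 fun i => (u.1.1 i).reach) := by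
      rw [← ENNReal.ofReal_one]; exact ENNReal.ofReal_le_ofReal hU1
    refine (ENNReal.rpow_le_rpow_of_exponent_le hU1' hak).trans ?_
    rw [ENNReal.rpow_natCast, ← ENNReal.ofReal_pow (by linarith)]
    refine (ENNReal.ofReal_le_ofReal (growth_pow_le hn hu.le (hr0 u) k)).trans_eq ?_
    rw [ENNReal.ofReal_add (by positivity) (by positivity), ENNReal.ofReal_mul (by positivity),
      ENNReal.ofReal_add (by positivity) (by positivity), ENNReal.ofReal_mul (by positivity),
      ENNReal.ofReal_mul (by positivity), ENNReal.ofReal_mul (by positivity), ENNReal.ofReal_one,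
      ENNReal.ofReal_sum_of_nonneg fun i _ => pow_nonneg (hr0 u i) _]
  refine (lintegral_mono_ae hpt).trans_eq ?_
  have hEi : ∫⁻ u, ENNReal.ofReal (u.2 ^ k) ∂(lineLaw P n) = E := by
    rw [lintegral_lineLaw P (by fun_prop)]
    simp [hE]
  have hRi : ∀ i, ∫⁻ u, ENNReal.ofReal ((u.1.1 i).reach ^ K) ∂(lineLaw P n) = R := fun i => by
    have := hmr i
    rw [lintegral_lineLaw P (by fun_prop)]
    simp only [lintegral_const, measure_univ, mul_one]
    exact (measurePreserving_eval (fun _ : Fin n => P) i).lintegral_comp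
      (f := fun ω => ENNReal.ofReal (ω.reach ^ K)) (by fun_prop)
  rw [lintegral_add_left (by fun_prop), lintegral_const_mul _ (by fun_prop),
    lintegral_add_left (by fun_prop), lintegral_const_mul _ (by fun_prop), hEi,
    lintegral_const_mul _ (by fun_prop), lintegral_const_mul _ (by fun_prop),
    lintegral_finsetSum' _ (fun i _ => by have := hmr i; fun_prop)]
  simp_rw [hRi]
  rw [Finset.sum_const, Finset.card_univ, Fintype.card_fin, nsmul_eq_mul, lintegral_const,
    measure_univ, mul_one, ← mul_assoc (ENNReal.ofReal (n : ℝ)⁻¹), ← ENNReal.ofReal_natCast,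
    ← ENNReal.ofReal_mul (by positivity), inv_mul_cancel₀ hn'.ne', ENNReal.ofReal_one, one_mul]

lemma exists_lintegral_lineLaw_gauge_rpow_le {m : ℕ} (hm : gibbsMass m ≠ ∞) {P : Measure BoxParam}
    [IsProbabilityMeasure P] (hP : ∀ s, (P.prod (unif.prod unif)).map (slide s) = gibbs m) :
    ∃ C : ℝ≥0∞, C ≠ ∞ ∧ ∀ n : ℕ, 1 ≤ n →
      ∫⁻ u, ENNReal.ofReal (n / (powSum m u.1.base + u.2)) ^ (1 + 1 / (2 * (2 * (m + 1))) : ℝ)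
        ∂(lineLaw P n) ≤ C := by
  obtain ⟨C, hC, h⟩ := exists_lintegral_gauge_rpow_le hm
  refine ⟨C, hC, fun n hn => ?_⟩
  have h1 := h n hn
  have hms : Measurable (slideAll 0 (n := n)) :=
    measurable_slideAll_uncurry.comp (measurable_const.prodMk measurable_id)
  rw [← map_lineLaw hm (hP 0), lintegral_map (by fun_prop) (by fun_prop)] at h1
  simpa [slideAll_eq] using h1

lemma measurable_eval_crossForm {n m : ℕ} (f : MvPolynomial (Fin n) ℝ) :
    Measurable fun u : LineParam n × ℝ =>
      MvPolynomial.eval u.1.base (crossForm m f fun i => (u.1.1 i).width) := by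
  have h := fun i : Fin n => measurable_width_coord i
  have h1 : ∀ i j, Measurable fun u : LineParam n × ℝ =>
      MvPolynomial.eval u.1.base (crossPoly m f i j) := fun i j =>
    (MvPolynomial.continuous_eval _).measurable.comp (by fun_prop)
  simp only [eval_crossForm]
  fun_prop

lemma measurable_topForm {n d : ℕ} (f : MvPolynomial (Fin n) ℝ) :
    Measurable fun u : LineParam n × ℝ => topForm d f fun i => (u.1.1 i).width := by
  have h := fun i : Fin n => measurable_width_coord i
  unfold topForm
  fun_prop

lemma lintegral_lineLaw_topForm_le {P : Measure BoxParam} [IsProbabilityMeasure P] {n d : ℕ}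
    (hn : 1 ≤ n) (hd : 1 ≤ d) {f : MvPolynomial (Fin n) ℝ}
    (hA : ∑ I ∈ exponents n d, f.coeff I ^ 2 = 1)
    (hS : (∑ i, f.coeff (Finsupp.single i d)) ^ 2 ≤ n / 16) {η : ℝ} (hη : 0 < η)
    (hηd : η * (2 * d) ≤ 7 / 4) :
    ∫⁻ u, ENNReal.ofReal (topForm d f fun i => (u.1.1 i).width) ^ (-η) ∂(lineLaw P n) ≤
      ENNReal.ofReal (1 / 4) ^ (-η) *
        (∫⁻ ω, ENNReal.ofReal ω.width ^ (-(7/4) : ℝ) ∂P) ^ (d + 2) := by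
  have h := measurable_topForm (d := d) f
  rw [lintegral_lineLaw P (by fun_prop)]
  simp only [lintegral_const, measure_univ, mul_one]
  exact lintegral_topForm_le hn hd hA hS hη hηd

lemma exists_lintegral_lineLaw_crossForm_le (m : ℕ) {P : Measure BoxParam}
    [IsProbabilityMeasure P] (hP : ∫⁻ ω, ENNReal.ofReal ω.width ^ (-(7 / 4) : ℝ) ∂P ≠ ∞) :
    ∃ C : ℝ≥0∞, C ≠ ∞ ∧ ∀ n, 2 ≤ n → ∀ f : MvPolynomial (Fin n) ℝ,
      f.IsHomogeneous (2 * (m + 1)) → ∑ I ∈ exponents n (2 * (m + 1)), f.coeff I ^ 2 = 1 →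
      (∑ i, f.coeff (Finsupp.single i (2 * (m + 1)))) ^ 2 ≤ n / 16 →
      ∫⁻ u, ENNReal.ofReal (MvPolynomial.eval u.1.base (crossForm m f fun i => (u.1.1 i).width)) ^
        (-(1 / (8 * (2 * (m + 1) : ℕ))) : ℝ) ∂(lineLaw P n) ≤ C := by
  obtain ⟨C, hC, h⟩ := exists_lintegral_crossForm_box_le m
  set η : ℝ := 1 / (8 * (2 * (m + 1) : ℕ)) with hη
  have hη0 : 0 < η := by positivity
  refine ⟨C * (ENNReal.ofReal (1 / 4) ^ (-η) *
    (∫⁻ ω, ENNReal.ofReal ω.width ^ (-(7/4) : ℝ) ∂P) ^ (2 * (2 * (m + 1)))),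
    ENNReal.mul_ne_top hC (ENNReal.mul_ne_top ?_ (by finiteness)), fun n hn f hf hA hS => ?_⟩
  · rw [ENNReal.ofReal_rpow_of_pos (by norm_num)]; exact ENNReal.ofReal_ne_top
  have hm := measurable_eval_crossForm (m := m) f
  rw [lintegral_lineLaw P (by fun_prop)]
  have hb : ∀ (ω : Fin n → BoxParam) (z z' : Fin n → ℝ), LineParam.base (ω, z, z') =
      fun i => (ω i).1.1 + (ω i).1.2 * z i := fun _ _ _ => rfl
  simp only [hb, lintegral_const, measure_univ, mul_one]
  have hw : ∀ ω : Fin n → BoxParam, ∀ i, (ω i).width ≤ |(ω i).1.2| := fun ω i =>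
    (min_le_right _ _).trans (min_le_left _ _)
  calc _ ≤ ∫⁻ ω : Fin n → BoxParam, C * ENNReal.ofReal (crossWeight m f fun i => (ω i).width) ^ (-η)
        ∂(Measure.pi fun _ => P) :=
        lintegral_mono fun ω => h n f hf _ (fun i => (ω i).1.2) _
          (fun i => BoxParam.width_nonneg _) (hw ω)
    _ = C * ∫⁻ ω : Fin n → BoxParam, ENNReal.ofReal (crossWeight m f fun i => (ω i).width) ^ (-η)
        ∂(Measure.pi fun _ => P) := lintegral_const_mul' _ _ hC
    _ ≤ _ := by
        refine mul_le_mul_right (lintegral_crossWeight_le hn hA hS hη0 ?_) _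
        rw [hη]
        have : (0 : ℝ) < (2 * (m + 1) : ℕ) := by positivity
        field_simp
        norm_num

lemma rpow_mul_rpow_le_add {x y z w : ℝ≥0∞} {a b c d : ℝ} (ha : 0 ≤ a) (hb : 0 ≤ b) (hc : 0 ≤ c)
    (hd : 0 ≤ d) (h : a + b + c + d = 1) : x ^ a * y ^ b * z ^ c * w ^ d ≤ x + y + z + w := by
  set S := x + y + z + w with hS
  have hx : x ≤ S := by rw [hS, add_assoc, add_assoc]; exact le_self_add
  have hy : y ≤ S := by rw [hS, add_comm x, add_assoc, add_assoc]; exact le_self_add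
  have hz : z ≤ S := by rw [hS, add_comm _ z, add_assoc]; exact le_self_add
  have hw : w ≤ S := le_add_self
  calc _ ≤ S ^ a * S ^ b * S ^ c * S ^ d := by gcongr
    _ = S := by
        rw [← ENNReal.rpow_add_of_nonneg _ _ ha hb,
            ← ENNReal.rpow_add_of_nonneg _ _ (by positivity) hc,
          ← ENNReal.rpow_add_of_nonneg _ _ (by positivity) hd, h, ENNReal.rpow_one]

lemma rpow_product_le_rpow_sum {δ η : ℝ} (hδ0 : 0 < δ) (hδ2 : δ ≤ 1 / 2)
    (hη : η * (34 / 35 - δ / (1 + δ / 2)) = 279 * δ / 280 / 2) (U W Q B : ℝ≥0∞) :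
    U ^ (3 * δ) * W ^ δ * Q ^ (-(δ / 280 / 2)) * B ^ (-(279 * δ / 280 / 2)) ≤
      U ^ (210 * δ) + W ^ (1 + δ / 2) + Q ^ (-(δ / 8)) + B ^ (-η) := by
  have hv2 : δ / (1 + δ / 2) ≤ 2 / 5 := by rw [div_le_iff₀ (by positivity)]; linarith
  have h := rpow_mul_rpow_le_add (x := U ^ (210 * δ)) (y := W ^ (1 + δ / 2)) (z := Q ^ (-(δ / 8)))
    (w := B ^ (-η)) (a := 1 / 70) (b := δ / (1 + δ / 2)) (c := 1 / 70)
    (d := 34 / 35 - δ / (1 + δ / 2)) (by norm_num) (by positivity) (by norm_num) (by linarith)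
    (by ring)
  simp only [← ENNReal.rpow_mul] at h
  have e1 : 210 * δ * (1 / 70) = 3 * δ := by ring
  have e2 : (1 + δ / 2) * (δ / (1 + δ / 2)) = δ := by field_simp
  have e3 : -(δ / 8) * (1 / 70) = -(δ / 280 / 2) := by ring
  have e4 : -η * (34 / 35 - δ / (1 + δ / 2)) = -(279 * δ / 280 / 2) := by rw [neg_mul, hη]
  rwa [e1, e2, e3, e4] at h

lemma measurable_enorm_integral_linePhase {n : ℕ} (m : ℕ) (f : MvPolynomial (Fin n) ℝ) (T : ℝ) :
    Measurable fun u : LineParam n × ℝ =>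
      ‖∫ s in (0 : ℝ)..1, Complex.exp (Complex.I * (linePhase m f T u s : ℝ))‖ₑ := by
  have h1 : Measurable fun x : Fin n → ℝ => MvPolynomial.eval x f :=
    (MvPolynomial.continuous_eval f).measurable
  have h : Measurable fun q : (LineParam n × ℝ) × ℝ => linePhase m f T q.1 q.2 := by
    unfold linePhase
    fun_prop
  have h1 : Measurable (Function.uncurry fun (u : LineParam n × ℝ) (s : ℝ) =>
      Complex.exp (Complex.I * (linePhase m f T u s : ℝ))) := by
    simp only [Function.uncurry_def]
    fun_prop
  simp_rw [intervalIntegral.integral_of_le (zero_le_one (α := ℝ))]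
  exact (h1.stronglyMeasurable.integral_prod_right).measurable.enorm

/-- A function of the position of the line dominating its oscillatory integral. -/
def lineMajorant {n : ℕ} (m : ℕ) (f : MvPolynomial (Fin n) ℝ) (δ η : ℝ)
    (u : LineParam n × ℝ) : ℝ≥0∞ :=
  ENNReal.ofReal (growth m u.2 fun i => (u.1.1 i).reach) ^ (210 * δ) +
    ENNReal.ofReal (n / (powSum m u.1.base + u.2)) ^ (1 + δ / 2) +
    ENNReal.ofReal (MvPolynomial.eval u.1.base (crossForm m f fun i => (u.1.1 i).width)) ^
      (-(δ / 8)) +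
    ENNReal.ofReal (topForm (2 * (m + 1)) f fun i => (u.1.1 i).width) ^ (-η)

@[fun_prop] lemma measurable_lineMajorant {n : ℕ} (m : ℕ) (f : MvPolynomial (Fin n) ℝ) (δ η : ℝ) :
    Measurable (lineMajorant m f δ η) := by
  have hU := measurable_growth (n := n) m
  have hQ := measurable_eval_crossForm (m := m) f
  have hB := measurable_topForm (d := 2 * (m + 1)) f
  unfold lineMajorant
  fun_prop

lemma exists_lintegral_lineMajorant_le {m : ℕ} (hm : gibbsMass m ≠ ∞) {P : Measure BoxParam}
    [IsProbabilityMeasure P] (hreach : ∀ k : ℕ, ∫⁻ ω, ENNReal.ofReal (ω.reach ^ k) ∂P ≠ ∞)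
    (hwidth : ∫⁻ ω, ENNReal.ofReal ω.width ^ (-(7 / 4) : ℝ) ∂P ≠ ∞)
    (hP : ∀ s, (P.prod (unif.prod unif)).map (slide s) = gibbs m) {δ η : ℝ}
    (hδ : δ = 1 / (2 * (m + 1) : ℕ)) (hη0 : 0 < η)
    (hη : η * (2 * (2 * (m + 1) : ℕ)) ≤ 7 / 4) :
    ∃ C : ℝ≥0∞, C ≠ ∞ ∧ ∀ n, 2 ≤ n → ∀ f : MvPolynomial (Fin n) ℝ,
      f.IsHomogeneous (2 * (m + 1)) → ∑ I ∈ exponents n (2 * (m + 1)), f.coeff I ^ 2 = 1 →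
      (∑ i, f.coeff (Finsupp.single i (2 * (m + 1)))) ^ 2 ≤ n / 16 →
      ∫⁻ u, lineMajorant m f δ η u ∂(lineLaw P n) ≤ C := by
  have hd2 : (2 : ℝ) ≤ (2 * (m + 1) : ℕ) := by
    push_cast; linarith [(Nat.cast_nonneg m : (0 : ℝ) ≤ m)]
  have hδ2 : δ ≤ 1 / 2 := hδ ▸ one_div_le_one_div_of_le (by norm_num) hd2
  obtain ⟨C₁, hC₁, hU⟩ := exists_lintegral_growth_rpow_le m hreach (a := 210 * δ) (k := 210)
    (by push_cast; linarith)
  obtain ⟨C₂, hC₂, hW⟩ := exists_lintegral_lineLaw_gauge_rpow_le hm hP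
  obtain ⟨C₃, hC₃, hQ⟩ := exists_lintegral_lineLaw_crossForm_le m hwidth
  have e2 : (1 + 1 / (2 * (2 * (m + 1))) : ℝ) = 1 + δ / 2 := by rw [hδ]; push_cast; field_simp
  have e3 : (-(1 / (8 * (2 * (m + 1) : ℕ))) : ℝ) = -(δ / 8) := by rw [hδ]; push_cast; field_simp
  rw [e2] at hW
  rw [e3] at hQ
  set C₄ : ℝ≥0∞ := ENNReal.ofReal (1 / 4) ^ (-η) *
    (∫⁻ ω, ENNReal.ofReal ω.width ^ (-(7/4) : ℝ) ∂P) ^ (2 * (m + 1) + 2) with hC₄def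
  have hC₄ : C₄ ≠ ∞ := by
    refine ENNReal.mul_ne_top ?_ (by finiteness)
    rw [ENNReal.ofReal_rpow_of_pos (by norm_num)]
    exact ENNReal.ofReal_ne_top
  refine ⟨C₁ + C₂ + C₃ + C₄, by finiteness, fun n hn f hf hA hS => ?_⟩
  have hn1 : 1 ≤ n := by omega
  have hmU := measurable_growth (n := n) m
  have hmQ := measurable_eval_crossForm (m := m) f
  have hmB := measurable_topForm (d := 2 * (m + 1)) f
  unfold lineMajorant
  rw [lintegral_add_left (by fun_prop), lintegral_add_left (by fun_prop),
    lintegral_add_left (by fun_prop)]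
  exact add_le_add (add_le_add (add_le_add (hU n hn1) (hW n hn1)) (hQ n hn f hf hA hS))
    (lintegral_lineLaw_topForm_le hn1 (by omega) hA hS hη0 hη)

lemma lintegral_lineLaw_mono {n : ℕ} (P : Measure BoxParam) [IsProbabilityMeasure P]
    {F G : LineParam n × ℝ → ℝ≥0∞} (hF : Measurable F) (hG : Measurable G)
    (h : ∀ e, 0 < e → ∀ ω z, (∀ i, z i ∈ Icc (0 : ℝ) 1) →
      ∫⁻ z', F ((ω, z, z'), e) ∂(cube n) ≤ ∫⁻ z', G ((ω, z, z'), e) ∂(cube n)) :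
    ∫⁻ u, F u ∂(lineLaw P n) ≤ ∫⁻ u, G u ∂(lineLaw P n) := by
  rw [lintegral_lineLaw P hF, lintegral_lineLaw P hG]
  refine lintegral_mono_ae ?_
  filter_upwards [ae_expLaw_pos] with e he
  refine lintegral_mono fun ω => lintegral_mono_ae ?_
  filter_upwards [ae_cube_mem n] with z hz
  exact h e he ω z hz

lemma exists_lintegral_lineLaw_linePhase_le {m : ℕ} (hm : gibbsMass m ≠ ∞) {P : Measure BoxParam}
    [IsProbabilityMeasure P] (hreach : ∀ k : ℕ, ∫⁻ ω, ENNReal.ofReal (ω.reach ^ k) ∂P ≠ ∞)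
    (hwidth : ∫⁻ ω, ENNReal.ofReal ω.width ^ (-(7 / 4) : ℝ) ∂P ≠ ∞)
    (hP : ∀ s, (P.prod (unif.prod unif)).map (slide s) = gibbs m) :
    ∃ C : ℝ≥0∞, C ≠ ∞ ∧ ∀ n, 2 ≤ n → ∀ f : MvPolynomial (Fin n) ℝ,
      f.IsHomogeneous (2 * (m + 1)) → ∑ I ∈ exponents n (2 * (m + 1)), f.coeff I ^ 2 = 1 →
      (∑ i, f.coeff (Finsupp.single i (2 * (m + 1)))) ^ 2 ≤ n / 16 → ∀ T : ℝ, T ≠ 0 →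
      ∫⁻ u, ‖∫ s in (0 : ℝ)..1, Complex.exp (Complex.I * (linePhase m f T u s : ℝ))‖ₑ
        ∂(lineLaw P n) ≤ C * ENNReal.ofReal (n / |T|) ^ (1 / (2 * (m + 1) : ℕ) : ℝ) := by
  have hd2 : (2 : ℝ) ≤ (2 * (m + 1) : ℕ) := by
    push_cast; linarith [(Nat.cast_nonneg m : (0 : ℝ) ≤ m)]
  set δ : ℝ := 1 / (2 * (m + 1) : ℕ) with hδ
  have hδ0 : 0 < δ := by positivity
  have hδ2 : δ ≤ 1 / 2 := one_div_le_one_div_of_le (by norm_num) hd2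
  have hδd : δ * (2 * (m + 1) : ℕ) = 1 := by rw [hδ]; field_simp
  have hv2 : δ / (1 + δ / 2) ≤ 2 / 5 := by rw [div_le_iff₀ (by positivity)]; linarith
  set k := 34 / 35 - δ / (1 + δ / 2) with hk
  have hk0 : 4 / 7 ≤ k := by rw [hk]; linarith
  have hk1 : k ≠ 0 := by linarith
  obtain ⟨C₀, hC₀, hmain⟩ := exists_lintegral_linePhase_le m (α := δ / 280) (β := 279 * δ / 280)
    (by positivity) (by positivity) (by rw [← hδ]; ring)
  rw [← hδ] at hmain
  obtain ⟨C, hC, hinteg⟩ := exists_lintegral_lineMajorant_le hm hreach hwidth hP hδ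
    (η := 279 * δ / 280 / 2 / k) (by positivity) (by
      rw [show 279 * δ / 280 / 2 / k * (2 * (2 * (m + 1) : ℕ)) =
        (279 / 280) * (δ * (2 * (m + 1) : ℕ)) / k by ring, hδd, div_le_iff₀ (by linarith)]
      linarith)
  refine ⟨C₀ * C, by finiteness, fun n hn f hf hA hS T hT => ?_⟩
  set K := C₀ * ENNReal.ofReal (n / |T|) ^ δ with hK
  have hη : 279 * δ / 280 / 2 / k * k = 279 * δ / 280 / 2 := by field_simp
  have hmaj := measurable_lineMajorant m f δ (279 * δ / 280 / 2 / k)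
  calc _ ≤ ∫⁻ u, K * lineMajorant m f δ (279 * δ / 280 / 2 / k) u ∂(lineLaw P n) := by
        refine lintegral_lineLaw_mono P (measurable_enorm_integral_linePhase m f T)
          (hmaj.const_mul _) fun e he ω z hz => ?_
        have h1 := hmain n (by omega) f hf ω z e T hz he hT
        have h2 := rpow_product_le_rpow_sum hδ0 hδ2 hη
          (ENNReal.ofReal (growth m e fun i => (ω i).reach))
          (ENNReal.ofReal (n / (powSum m (LineParam.base (ω, z, (0 : Fin n → ℝ))) + e)))
          (ENNReal.ofReal (MvPolynomial.eval (LineParam.base (ω, z, (0 : Fin n → ℝ)))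
            (crossForm m f fun i => (ω i).width)))
          (ENNReal.ofReal (topForm (2 * (m + 1)) f fun i => (ω i).width))
        refine (h1.trans (mul_le_mul_right h2 K)).trans (le_of_eq ?_)
        have hb : ∀ z' : Fin n → ℝ, LineParam.base (ω, z, z') =
          LineParam.base (ω, z, (0 : Fin n → ℝ)) := fun _ => rfl
        simp only [lineMajorant, hb, lintegral_const, measure_univ, mul_one]
    _ = K * ∫⁻ u, lineMajorant m f δ (279 * δ / 280 / 2 / k) u ∂(lineLaw P n) :=
        lintegral_const_mul _ hmaj
    _ ≤ K * C := by gcongr; exact hinteg n hn f hf hA hS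
    _ = _ := by rw [hK]; ring

lemma exists_norm_charFun_le (m : ℕ) : ∃ C : ℝ, 0 < C ∧ ∀ n, 2 ≤ n →
    ∀ f : MvPolynomial (Fin n) ℝ, f.IsHomogeneous (2 * (m + 1)) →
      ∑ I ∈ exponents n (2 * (m + 1)), f.coeff I ^ 2 = 1 →
      (∑ i, f.coeff (Finsupp.single i (2 * (m + 1)))) ^ 2 ≤ n / 16 → ∀ t : ℝ, t ≠ 0 →
      ‖∫ x, Complex.exp (Complex.I * (t : ℂ) * (MvPolynomial.eval x f : ℂ))
        ∂(muNP n ((2 * (m + 1) : ℕ) : ℝ))‖ ≤ C * |t| ^ (-(1 / ((2 * (m + 1) : ℕ) : ℝ))) := by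
  obtain ⟨hm, P, hPp, hreach, hwidth, hP⟩ := exists_box_representation m
  obtain ⟨C, hC, hline⟩ := exists_lintegral_lineLaw_linePhase_le hm hreach hwidth hP
  obtain ⟨c, hc, hR⟩ := exists_le_Rnp_pow m
  set δ : ℝ := 1 / ((2 * (m + 1) : ℕ) : ℝ) with hδ
  have hδ0 : 0 < δ := by positivity
  refine ⟨(C.toReal + 1) * (c⁻¹) ^ δ, by positivity, fun n hn f hf hA hS t ht => ?_⟩
  have hn0 : (0 : ℝ) < n := by exact_mod_cast (by omega : 0 < n)
  have hRn := hR n (by omega)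
  set R := Rnp n ((2 * (m + 1) : ℕ) : ℝ) ^ (2 * (m + 1)) with hRdef
  have hR0 : 0 < R := lt_of_lt_of_le (by positivity) hRn
  have ht0 : 0 < |t| := abs_pos.mpr ht
  have h := (enorm_charFun_le hm (by omega) hP hf t).trans
    (hline n hn f hf hA hS (t * R) (mul_ne_zero ht hR0.ne'))
  have hle : (n : ℝ) / |t * R| ≤ c⁻¹ * |t|⁻¹ := by
    rw [abs_mul, abs_of_pos hR0, div_le_iff₀ (by positivity)]
    calc (n : ℝ) = c⁻¹ * (c * n) := by field_simp
      _ ≤ c⁻¹ * R := by gcongr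
      _ = _ := by field_simp
  have h1 : C * ENNReal.ofReal (n / |t * R|) ^ δ ≤
      ENNReal.ofReal (C.toReal * ((c⁻¹) ^ δ * |t| ^ (-δ))) := by
    rw [ENNReal.ofReal_mul ENNReal.toReal_nonneg, ENNReal.ofReal_toReal hC, Real.rpow_neg ht0.le,
      ← Real.inv_rpow ht0.le, ← Real.mul_rpow (by positivity) (by positivity),
      ← ENNReal.ofReal_rpow_of_nonneg (by positivity) hδ0.le]
    gcongr
  have h2 := h.trans h1
  rw [← ofReal_norm, ENNReal.ofReal_le_ofReal_iff (by positivity)] at h2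
  refine h2.trans ?_
  rw [mul_assoc]
  gcongr
  linarith

lemma sum_exponents_coeff_sq {n d : ℕ} {f : MvPolynomial (Fin n) ℝ} (h : coeffNorm d f = 1) :
    ∑ I ∈ exponents n d, f.coeff I ^ 2 = 1 := by
  have h1 : ∑ I ∈ f.support.filter (fun I => (I.sum fun _ e => e) = d), f.coeff I ^ 2 = 1 :=
    Real.sqrt_eq_one.mp h
  rw [← h1]
  symm
  refine Finset.sum_subset (fun I hI => ?_) fun I hI hI' => ?_
  · rw [mem_exponents, ← (Finset.mem_filter.mp hI).2, Finsupp.sum_fintype _ _ (fun _ => rfl)]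
  · have : I ∉ f.support := fun hs => hI' <| Finset.mem_filter.mpr
      ⟨hs, by rw [Finsupp.sum_fintype _ _ (fun _ => rfl)]; exact mem_exponents.mp hI⟩
    rw [MvPolynomial.notMem_support_iff.mp this]
    norm_num

lemma coeffInner_fP {n p : ℕ} (f : MvPolynomial (Fin n) ℝ) :
    coeffInner f (fP n p) = (√n)⁻¹ * ∑ i, f.coeff (Finsupp.single i p) := by
  classical
  have hc : ∀ I, (fP n p).coeff I =
      (√n)⁻¹ * ∑ i, if Finsupp.single i p = I then 1 else 0 := fun I => by
    simp [fP, MvPolynomial.coeff_sum, MvPolynomial.coeff_X_pow]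
  set s := f.support ∪ (fP n p).support with hs
  have h1 : coeffInner f (fP n p) =
      (√n)⁻¹ * ∑ i, ∑ I ∈ s, if Finsupp.single i p = I then f.coeff I else 0 := by
    rw [coeffInner, Finset.sum_comm, Finset.mul_sum]
    refine Finset.sum_congr rfl fun I _ => ?_
    rw [hc, mul_left_comm, Finset.mul_sum]
    simp
  rw [h1]
  congr 1
  refine Finset.sum_congr rfl fun i _ => ?_
  rw [Finset.sum_ite_eq]
  split_ifs with h
  · rfl
  · exact (MvPolynomial.notMem_support_iff.mp fun hf => h (Finset.mem_union_left _ hf)).symm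

lemma sq_sum_coeff_single_le {n p : ℕ} (hn : 1 ≤ n) {f : MvPolynomial (Fin n) ℝ}
    (h : |coeffInner f (fP n p)| ≤ 1 / 4) :
    (∑ i, f.coeff (Finsupp.single i p)) ^ 2 ≤ n / 16 := by
  have hn' : (0 : ℝ) < n := by exact_mod_cast hn
  rw [coeffInner_fP, ← abs_of_nonneg (by norm_num : (0 : ℝ) ≤ 1 / 4), ← sq_le_sq, mul_pow,
    inv_pow, Real.sq_sqrt hn'.le, inv_mul_le_iff₀ hn'] at h
  linarith

lemma two_le_of_coeff_bounds {n p : ℕ} (hn : 1 ≤ n) {f : MvPolynomial (Fin n) ℝ}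
    (hA : ∑ I ∈ exponents n p, f.coeff I ^ 2 = 1)
    (hS : (∑ i, f.coeff (Finsupp.single i p)) ^ 2 ≤ n / 16) : 2 ≤ n := by
  by_contra hlt
  obtain rfl : n = 1 := by omega
  have hE : exponents 1 p = {Finsupp.single 0 p} := by
    ext I
    rw [mem_exponents, Finset.mem_singleton, Fin.sum_univ_one]
    constructor
    · rintro rfl
      exact Finsupp.ext fun i => by rw [Subsingleton.elim i 0, Finsupp.single_eq_same]
    · rintro rfl
      simp
  rw [hE, Finset.sum_singleton] at hA
  rw [Fin.sum_univ_one, hA] at hS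
  norm_num at hS

lemma isProbabilityMeasure_muNP {m n : ℕ} (hm : gibbsMass m ≠ ∞) (hn : 1 ≤ n) :
    IsProbabilityMeasure (muNP n ((2 * (m + 1) : ℕ) : ℝ)) := by
  have := isProbabilityMeasure_gibbs hm
  rw [muNP_eq_map hm hn]
  exact Measure.isProbabilityMeasure_map (by unfold powSum; fun_prop)

lemma isCompact_lpBall {m n : ℕ} : IsCompact (lpBall n ((2 * (m + 1) : ℕ) : ℝ)) := by
  rw [lpBall_eq_powSum_le]
  refine Metric.isCompact_of_isClosed_isBounded ?_ ?_
  · unfold powSum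
    exact isClosed_le (by fun_prop) continuous_const
  · set B := Rnp n ((2 * (m + 1) : ℕ) : ℝ) ^ (2 * (m + 1))
    refine Metric.isBounded_closedBall (x := (0 : Fin n → ℝ)) (r := 1 + |B|) |>.subset
      fun x hx => ?_
    rw [mem_closedBall_zero_iff, pi_norm_le_iff_of_nonneg (by positivity)]
    intro i
    rw [Real.norm_eq_abs]
    rcases le_total |x i| 1 with h | h
    · linarith [abs_nonneg B]
    · have h1 : x i ^ (2 * (m + 1)) ≤ B := (Finset.single_le_sum
        (f := fun i => x i ^ (2 * (m + 1))) (fun j _ => (even_two_mul (m + 1)).pow_nonneg _)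
        (Finset.mem_univ i)).trans hx
      have h2 := le_self_pow₀ h (by omega : 2 * (m + 1) ≠ 0)
      rw [(even_two_mul (m + 1)).pow_abs] at h2
      linarith [le_abs_self B]

lemma integrable_muNP_of_continuous {m n : ℕ} (hm : gibbsMass m ≠ ∞) (hn : 1 ≤ n)
    {g : (Fin n → ℝ) → ℝ} (hg : Continuous g) :
    Integrable g (muNP n ((2 * (m + 1) : ℕ) : ℝ)) := by
  have h := isProbabilityMeasure_muNP hm hn
  have hinteg := hg.continuousOn.integrableOn_compact (isCompact_lpBall (m := m) (n := n))
    (μ := volume)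
  rcases eq_or_ne (volume (lpBall n ((2 * (m + 1) : ℕ) : ℝ))) 0 with h0 | h0
  · have : muNP n ((2 * (m + 1) : ℕ) : ℝ) = 0 := by
      rw [muNP, Measure.restrict_eq_zero.mpr h0, smul_zero]
    rw [this]
    exact integrable_zero_measure
  · exact Integrable.smul_measure hinteg (ENNReal.inv_ne_top.mpr h0)

lemma one_sub_norm_charFun_le {Ω : Type*} [MeasurableSpace Ω] {μ : Measure Ω}
    [IsProbabilityMeasure μ] {g : Ω → ℝ} (hg : Integrable g μ)
        (hg2 : Integrable (fun x => g x ^ 2) μ)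
    (t : ℝ) : 1 - ‖∫ x, Complex.exp (Complex.I * (t : ℂ) * (g x : ℂ)) ∂μ‖ ≤
        t ^ 2 / 2 * mVar μ g := by
  set c := ∫ x, g x ∂μ with hc
  have hinteg : Integrable (fun x => Complex.exp (Complex.I * (t : ℂ) * (g x : ℂ))) μ := by
    refine Integrable.of_bound (C := 1) ?_ (Eventually.of_forall fun x => ?_)
    · have := hg.aestronglyMeasurable.aemeasurable
      exact AEMeasurable.aestronglyMeasurable (by fun_prop)
    · rw [mul_assoc, ← Complex.ofReal_mul, mul_comm, Complex.norm_exp_ofReal_mul_I]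
  set E := ∫ x, Complex.exp (Complex.I * (t : ℂ) * (g x : ℂ)) ∂μ with hE
  set w := Complex.exp (((-(t * c) : ℝ) : ℂ) * Complex.I) with hw
  have hw1 : ‖w‖ = 1 := Complex.norm_exp_ofReal_mul_I _
  have hre : (w * E).re = ∫ x, Real.cos (t * (g x - c)) ∂μ := by
    rw [hE, ← integral_const_mul, ← RCLike.re_eq_complex_re, ← integral_re (hinteg.const_mul w)]
    refine integral_congr_ae (Eventually.of_forall fun x => ?_)
    simp only [RCLike.re_eq_complex_re]
    rw [hw, ← Complex.exp_add, show ((-(t * c) : ℝ) : ℂ) * Complex.I + Complex.I * t * g x =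
      ((t * (g x - c) : ℝ) : ℂ) * Complex.I by push_cast; ring, Complex.exp_ofReal_mul_I_re]
  have hvar : ∫ x, (1 - t ^ 2 / 2 * (g x ^ 2 - 2 * c * g x + c ^ 2)) ∂μ =
      1 - t ^ 2 / 2 * mVar μ g := by
    rw [integral_sub (integrable_const _) (by fun_prop), integral_const_mul,
      integral_add (by fun_prop) (integrable_const _), integral_sub hg2 (by fun_prop),
      integral_const_mul, mVar]
    simp only [integral_const, probReal_univ, one_smul, ← hc]
    ring
  have hcos : ∫ x, (1 - t ^ 2 / 2 * (g x ^ 2 - 2 * c * g x + c ^ 2)) ∂μ ≤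
      ∫ x, Real.cos (t * (g x - c)) ∂μ := by
    refine integral_mono (by fun_prop) ?_ fun x => ?_
    · refine Integrable.of_bound (C := 1) ?_ (Eventually.of_forall fun x => Real.abs_cos_le_one _)
      have := hg.aestronglyMeasurable.aemeasurable
      exact AEMeasurable.aestronglyMeasurable (by fun_prop)
    · refine le_trans (le_of_eq ?_) (Real.one_sub_sq_div_two_le_cos (x := t * (g x - c)))
      ring
  have hle : (w * E).re ≤ ‖E‖ := (Complex.re_le_norm _).trans (by rw [norm_mul, hw1, one_mul])
  linarith

end LpBallDecay

/-- Theorem 1.4, case (2): let `p = d` be an even integer.  There are constants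
`c_p ∈ (0,1)`, `c'_p > 0`, `C_p > 0` such that every degree-`p` homogeneous polynomial `f`
with `coeff_p(f) = 1` and `|⟨f, f_p⟩| ≤ c_p` satisfies a variance lower bound and Fourier
decay `|t|^{-1/p}` under the uniform measure on the isotropic `L^p` ball. -/
theorem lp_ball_variance_and_fourier_decay_even_case (p : ℕ) (hpe : Even p) (hp1 : 1 ≤ p) :
    ∃ c c' C : ℝ, 0 < c ∧ c < 1 ∧ 0 < c' ∧ 0 < C ∧
      ∀ (n : ℕ), 1 ≤ n → ∀ f : MvPolynomial (Fin n) ℝ,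
        f.IsHomogeneous p → coeffNorm p f = 1 →
        |coeffInner f (fP n p)| ≤ c →
        c' ≤ mVar (muNP n (p : ℝ)) (fun x => MvPolynomial.eval x f) ∧
        ∀ t : ℝ, t ≠ 0 →
          ‖∫ x, Complex.exp (Complex.I * (t : ℂ) * (MvPolynomial.eval x f : ℂ))
              ∂(muNP n (p : ℝ))‖
            ≤ C * |t| ^ (-(1 / (p : ℝ))) := by
  obtain ⟨m, rfl⟩ : ∃ m, p = 2 * (m + 1) := by
    obtain ⟨k, hk⟩ := hpe
    exact ⟨k - 1, by omega⟩
  obtain ⟨C, hC, hdecay⟩ := LpBallDecay.exists_norm_charFun_le m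
  obtain ⟨hm, -⟩ := LpBallDecay.exists_box_representation m
  set t₀ : ℝ := (2 * C) ^ ((2 * (m + 1) : ℕ) : ℝ) with ht₀
  have ht₀0 : 0 < t₀ := by positivity
  refine ⟨1 / 4, 1 / t₀ ^ 2, C, by norm_num, by norm_num, by positivity, hC,
    fun n hn f hf hA hS => ?_⟩
  have hA' := LpBallDecay.sum_exponents_coeff_sq hA
  have hS' := LpBallDecay.sq_sum_coeff_single_le hn hS
  have hn2 := LpBallDecay.two_le_of_coeff_bounds hn hA' hS'
  have hd := hdecay n hn2 f hf hA' hS'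
  refine ⟨?_, hd⟩
  have := LpBallDecay.isProbabilityMeasure_muNP hm hn
  have hcont : Continuous fun x : Fin n → ℝ => MvPolynomial.eval x f :=
    MvPolynomial.continuous_eval f
  have hv := LpBallDecay.one_sub_norm_charFun_le
    (LpBallDecay.integrable_muNP_of_continuous hm hn hcont)
    (LpBallDecay.integrable_muNP_of_continuous hm hn (hcont.pow 2)) t₀
  have hhalf := hd t₀ ht₀0.ne'
  have hpow : C * |t₀| ^ (-(1 / ((2 * (m + 1) : ℕ) : ℝ))) = 1 / 2 := by
    rw [abs_of_pos ht₀0, ht₀, ← Real.rpow_mul (by positivity),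
      mul_neg, mul_one_div_cancel (by positivity), Real.rpow_neg_one]
    field_simp
  rw [hpow] at hhalf
  rw [div_le_iff₀ (by positivity)]
  linarith
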